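/- Let n ≥ 2 and 1 ≤ d ≤ n−1, set m = n−d, and identify ℂ^n = ℂ^d × ℂ^m with coordinates (z,w) = (x+iy,w). Let U be an open neighborhood of 0 in ℂ^n, let h be an ℝ^d-valued function of class C⁴ on a neighborhood of 0 in ℝ^d × ℂ^m with h(0) = 0 and Dh(0) = 0, and let M = {(x+iy,w) ∈ U : y = h(x,w)}. Define the Levi form at 0 by L(a) := (1/4)(D²h(0)[(0,a),(0,a)] + D²h(0)[(0,ia),(0,ia)]) ∈ ℝ^d for a ∈ ℂ^m, where D²h(0) is the second real Fréchet derivative of h at 0. Assume the convex hull of {L(a) : a ∈ ℂ^m} has nonempty interior in ℝ^d. Then there exists a wedge 𝒲 = {z + η : z ∈ ω, η ∈ C} of edge M at 0 (ω an open neighborhood of 0 in M, C a truncated open cone in the normal space {(iy,0) : y ∈ ℝ^d}) such that: for every relatively closed subset K ⊆ M whose (2n−d−2)-dimensional Hausdorff measure is zero and every C¹ CR function f : M∖K → ℂ, there exists a holomorphic function F on 𝒲 such that for every p ∈ ω∖K, F(ζ) → f(p) as ζ → p with ζ ∈ 𝒲. -/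

import Mathlib

open MeasureTheory Metric Set Filter
open scoped ComplexConjugate
open Complex (I norm_real re_add_im conj_ofReal ofReal_re ofRealCLM re_ofReal_mul norm_I ofReal_sub)
open AddCircle (haarAddCircle toCircle)
open Finset (sum_congr mul_sum sum_add_distrib)
open Real (exp norm_of_nonneg)
open ContinuousLinearMap (proj fst snd comp_apply opNorm_comp_le inl norm_inl_le_one)
open ContinuousMap (coeFn_toLp)

section Hol
variable {E : Type*} [NormedAddCommGroup E] [NormedSpace ℂ E]
variable {F : Type*} [NormedAddCommGroup F] [NormedSpace ℂ F]

theorem norm_fderiv_le_of_bound {f : E → ℂ} {c : E} {R B : ℝ} (hR : 0 < R)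
    (hd : DifferentiableOn ℂ f (ball c R)) (hB : ∀ w ∈ ball c R, ‖f w‖ ≤ B) :
    ‖fderiv ℂ f c‖ ≤ 2 * B / R := by
  refine Complex.norm_fderiv_le_div_of_mapsTo_ball hd (fun w hw => ?_) hR
  rw [mem_closedBall, dist_eq_norm]
  calc ‖f w - f c‖ ≤ ‖f w‖ + ‖f c‖ := norm_sub_le _ _
    _ ≤ 2 * B := by linarith [hB w hw, hB c (mem_ball_self hR)]

theorem norm_sub_fderiv_le_of_bound {f : E → ℂ} {c : E} {R B : ℝ} (hR : 0 < R)
    (hd : DifferentiableOn ℂ f (ball c R)) (hB : ∀ w ∈ ball c R, ‖f w‖ ≤ B)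
    {w : E} (hw : w ∈ ball c R) :
    ‖f w - f c - fderiv ℂ f c (w - c)‖ ≤ 4 * B * (‖w - c‖ / R) ^ 2 := by
  have hdc : DifferentiableAt ℂ f c := (hd c (mem_ball_self hR)).differentiableAt (ball_mem_nhds c hR)
  set g : E → ℂ := fun w => f w - fderiv ℂ f c (w - c) with hg
  have hgd : DifferentiableOn ℂ g (ball c R) := by
    refine hd.sub ?_
    exact (((fderiv ℂ f c).differentiable).comp (differentiable_id.sub_const c)).differentiableOn
  have hgc : g c = f c := by simp [hg]
  have hB0 : 0 ≤ B := (norm_nonneg _).trans (hB c (mem_ball_self hR))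
  have hmaps : MapsTo g (ball c R) (closedBall (g c) (4 * B)) := by
    intro v hv
    rw [mem_closedBall, dist_eq_norm, hgc]
    have h1 : ‖fderiv ℂ f c (v - c)‖ ≤ 2 * B / R * R := by
      refine ((fderiv ℂ f c).le_opNorm _).trans ?_
      gcongr
      · exact norm_fderiv_le_of_bound hR hd hB
      · rw [mem_ball, dist_eq_norm] at hv; exact hv.le
    have h2 : 2 * B / R * R = 2 * B := by field_simp
    have h3 : ‖f v - fderiv ℂ f c (v - c) - f c‖ ≤ ‖f v‖ + ‖fderiv ℂ f c (v - c)‖ + ‖f c‖ :=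
      (norm_sub_le _ _).trans (by gcongr; exact norm_sub_le _ _)
    have := hB v hv
    have := hB c (mem_ball_self hR)
    simp only [hg]
    linarith
  have hlo : (g · - g c) =o[nhds c] (fun w ↦ ‖w - c‖ ^ 1) := by
    have := hdc.hasFDerivAt.isLittleO
    simp only [pow_one]
    refine (this.norm_right).congr_left (fun w => ?_)
    simp only [hg, sub_self, map_zero, sub_zero]; ring
  have := Complex.dist_le_mul_div_pow_of_mapsTo_ball_of_isLittleO hgd hmaps hlo hw
  rw [dist_eq_norm, dist_eq_norm] at this
  have e : f w - f c - fderiv ℂ f c (w - c) = g w - g c := by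
    simp only [hg, sub_self, map_zero, sub_zero]; ring
  rw [e]
  exact this

theorem hasFDerivAt_of_quadratic {f : E → ℂ} {c : E} {R C : ℝ} (hR : 0 < R) (L : E →L[ℂ] ℂ)
    (h : ∀ w ∈ ball c R, ‖f w - f c - L (w - c)‖ ≤ C * (‖w - c‖ / R) ^ 2) :
    HasFDerivAt f L c := by
  rw [hasFDerivAt_iff_isLittleO]
  have h1 : (fun w => f w - f c - L (w - c)) =O[nhds c] fun w => ‖w - c‖ ^ 2 := by
    refine Asymptotics.IsBigO.of_bound (C / R ^ 2) ?_
    filter_upwards [ball_mem_nhds c hR] with w hw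
    refine (h w hw).trans (le_of_eq ?_)
    simp; field_simp
  refine h1.trans_isLittleO ?_
  have h2 : (fun w : E => ‖w - c‖ ^ 2) =o[nhds c] fun w => ‖w - c‖ ^ 1 := by
    have h3 : Tendsto (fun w : E => ‖w - c‖) (nhds c) (nhds 0) := by
      have : Continuous fun w : E => ‖w - c‖ := by fun_prop
      simpa using this.tendsto c
    exact (Asymptotics.isLittleO_pow_pow (𝕜 := ℝ) (m := 1) (n := 2) (by norm_num)).comp_tendsto h3
  simpa using h2

theorem differentiableOn_of_tendstoUniformlyOn {P : ℕ → E → ℂ} {f : E → ℂ} {W : Set E}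
    (hW : IsOpen W) (hP : ∀ j, DifferentiableOn ℂ (P j) W)
    (hlim : TendstoUniformlyOn P f atTop W) : DifferentiableOn ℂ f W := by
  intro c hc
  have hcont : ContinuousOn f W :=
    hlim.continuousOn (Frequently.of_forall fun j => (hP j).continuousOn)
  obtain ⟨R1, hR1, hR1W⟩ := Metric.isOpen_iff.1 hW c hc
  obtain ⟨R2, hR2, hR2W⟩ := Metric.continuousAt_iff.1 (hcont.continuousAt (hW.mem_nhds hc)) 1 one_pos
  set R := min R1 R2
  have hR : 0 < R := lt_min hR1 hR2
  have hsub : ball c R ⊆ W := (ball_subset_ball (min_le_left _ _)).trans hR1W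
  have hfB : ∀ w ∈ ball c R, ‖f w‖ ≤ ‖f c‖ + 1 := by
    intro w hw
    have h1 := hR2W (lt_of_lt_of_le hw (min_le_right _ _))
    rw [dist_eq_norm] at h1
    calc ‖f w‖ = ‖f c + (f w - f c)‖ := by congr 1; ring
      _ ≤ _ := (norm_add_le _ _).trans (by linarith)
  have hPB : ∀ᶠ j in atTop, ∀ w ∈ ball c R, ‖P j w‖ ≤ ‖f c‖ + 2 := by
    filter_upwards [Metric.tendstoUniformlyOn_iff.1 hlim 1 one_pos] with j hj w hw
    have h1 := hj w (hsub hw)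
    rw [dist_eq_norm] at h1
    calc ‖P j w‖ = ‖f w - (f w - P j w)‖ := by congr 1; ring
      _ ≤ ‖f w‖ + ‖f w - P j w‖ := norm_sub_le _ _
      _ ≤ _ := by linarith [hfB w hw]
  have hcau : CauchySeq fun j => fderiv ℂ (P j) c := by
    rw [Metric.cauchySeq_iff]
    intro ε hε
    have hu := hlim.uniformCauchySeqOn
    rw [Metric.uniformCauchySeqOn_iff] at hu
    obtain ⟨N, hN⟩ := hu (ε * R / 4) (by positivity)
    refine ⟨N, fun m hm n hn => ?_⟩
    rw [dist_eq_norm]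
    have hda : ∀ j, DifferentiableAt ℂ (P j) c := fun j => (hP j c hc).differentiableAt (hW.mem_nhds hc)
    have e : fderiv ℂ (fun w => P m w - P n w) c = fderiv ℂ (P m) c - fderiv ℂ (P n) c :=
      fderiv_fun_sub (hda m) (hda n)
    rw [← e]
    refine (norm_fderiv_le_of_bound (B := ε * R / 4) hR
      (((hP m).sub (hP n)).mono hsub) (fun w hw => ?_)).trans_lt ?_
    · have := hN m hm n hn w (hsub hw)
      rw [dist_eq_norm] at this
      exact this.le
    · have : 2 * (ε * R / 4) / R = ε / 2 := by field_simp; ring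
      rw [this]; linarith
  obtain ⟨L, hL⟩ := cauchySeq_tendsto_of_complete hcau
  refine (hasFDerivAt_of_quadratic (C := 4 * (‖f c‖ + 2)) hR L fun w hw => ?_).differentiableAt.differentiableWithinAt
  have ht : Tendsto (fun j => ‖P j w - P j c - fderiv ℂ (P j) c (w - c)‖) atTop
      (nhds ‖f w - f c - L (w - c)‖) := by
    refine (((hlim.tendsto_at (hsub hw)).sub (hlim.tendsto_at hc)).sub ?_).norm
    exact ((ContinuousLinearMap.apply ℂ ℂ (w - c)).continuous.tendsto L).comp hL
  refine le_of_tendsto ht ?_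
  filter_upwards [hPB] with j hj
  exact norm_sub_fderiv_le_of_bound hR ((hP j).mono hsub) hj hw

/-- mean over the unit circle -/
noncomputable def avg {G : Type*} [NormedAddCommGroup G] [NormedSpace ℝ G] (f : ℂ → G) : G :=
  Real.circleAverage f 0 1

theorem ContinuousOn.circleIntegrable_sphere {G : Type*} [NormedAddCommGroup G]
    {f : ℂ → G} (hf : ContinuousOn f (sphere 0 1)) : CircleIntegrable f 0 1 :=
  hf.circleIntegrable zero_le_one

theorem norm_avg_le {G : Type*} [NormedAddCommGroup G] [NormedSpace ℝ G] {f : ℂ → G} {C : ℝ}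
    (h : ∀ σ ∈ sphere (0 : ℂ) 1, ‖f σ‖ ≤ C) : ‖avg f‖ ≤ C := by
  rw [avg, Real.circleAverage_def, norm_smul]
  have := intervalIntegral.norm_integral_le_of_norm_le_const (a := 0) (b := 2 * Real.pi)
    (f := fun θ => f (circleMap 0 1 θ)) (C := C) (fun θ _ => h _ (by simp))
  have hp := Real.pi_pos
  rw [abs_of_pos (by linarith), sub_zero] at *
  rw [norm_inv, norm_of_nonneg (by positivity)]
  rw [inv_mul_le_iff₀ (by positivity)]
  linarith

theorem avg_sub {G : Type*} [NormedAddCommGroup G] [NormedSpace ℝ G] {f g : ℂ → G}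
    (hf : ContinuousOn f (sphere 0 1)) (hg : ContinuousOn g (sphere 0 1)) :
    avg f - avg g = avg (fun σ => f σ - g σ) :=
  (Real.circleAverage_fun_sub hf.circleIntegrable_sphere hg.circleIntegrable_sphere).symm

theorem avg_const {G : Type*} [NormedAddCommGroup G] [NormedSpace ℝ G] [CompleteSpace G] (a : G) :
    avg (fun _ => a) = a := Real.circleAverage_const a 0 1

theorem norm_avg_sub_le {G : Type*} [NormedAddCommGroup G] [NormedSpace ℝ G] {f g : ℂ → G} {C : ℝ}
    (hf : ContinuousOn f (sphere 0 1)) (hg : ContinuousOn g (sphere 0 1))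
    (h : ∀ σ ∈ sphere (0 : ℂ) 1, ‖f σ - g σ‖ ≤ C) : ‖avg f - avg g‖ ≤ C := by
  rw [avg_sub hf hg]; exact norm_avg_le h

theorem norm_avg_sub_const_le {G : Type*} [NormedAddCommGroup G] [NormedSpace ℝ G]
    [CompleteSpace G] {f : ℂ → G} {C : ℝ} {a : G}
    (hf : ContinuousOn f (sphere 0 1))
    (h : ∀ σ ∈ sphere (0 : ℂ) 1, ‖f σ - a‖ ≤ C) : ‖avg f - a‖ ≤ C := by
  have := norm_avg_sub_le hf (continuousOn_const (c := a)) h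
  rwa [avg_const] at this

theorem avg_diffContOnCl {G : Type*} [NormedAddCommGroup G] [NormedSpace ℂ G] [CompleteSpace G]
    {f : ℂ → G} (hf : DiffContOnCl ℂ f (ball 0 1)) : avg f = f 0 :=
  DiffContOnCl.circleAverage (by simpa using hf)

/-- continuity of averages in a parameter -/
theorem tendsto_avg {P G : Type*} [NormedAddCommGroup G] [NormedSpace ℝ G]
    {l : Filter P} {f : P → ℂ → G} {g : ℂ → G} (hg : ContinuousOn g (sphere 0 1))
    (hf : ∀ᶠ p in l, ContinuousOn (f p) (sphere 0 1))
    (hlim : TendstoUniformlyOn f g l (sphere 0 1)) :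
    Tendsto (fun p => avg (f p)) l (nhds (avg g)) := by
  rw [Metric.tendsto_nhds]
  intro ε hε
  filter_upwards [hf, Metric.tendstoUniformlyOn_iff.1 hlim (ε / 2) (by positivity)] with p hp1 hp2
  rw [dist_eq_norm]
  refine (norm_avg_sub_le (C := ε / 2) hp1 hg fun σ hσ => ?_).trans_lt (by linarith)
  have := hp2 σ hσ
  rw [dist_comm, dist_eq_norm] at this
  exact this.le

theorem differentiableOn_avg [ProperSpace E] {G : E → ℂ → ℂ} {W : Set E} (hW : IsOpen W)
    (hc : ContinuousOn (fun p : E × ℂ => G p.1 p.2) (W ×ˢ sphere 0 1))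
    (hd : ∀ σ ∈ sphere (0 : ℂ) 1, DifferentiableOn ℂ (fun z => G z σ) W) :
    DifferentiableOn ℂ (fun z => avg (G z)) W := by
  intro c hcW
  obtain ⟨R, hR, hRW⟩ := Metric.nhds_basis_closedBall.mem_iff.1 (hW.mem_nhds hcW)
  have hK : IsCompact (closedBall c R ×ˢ sphere (0 : ℂ) 1) :=
    (isCompact_closedBall c R).prod (isCompact_sphere 0 1)
  have hcK := hc.mono (prod_mono hRW (Subset.refl (sphere (0 : ℂ) 1)))
  obtain ⟨B, hB⟩ := hK.exists_bound_of_continuousOn hcK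
  have hsub : ball c R ⊆ W := ball_subset_closedBall.trans hRW
  have huc := hK.uniformContinuousOn_of_continuous hcK
  have hslice : ∀ z ∈ W, ContinuousOn (G z) (sphere 0 1) := fun z hz =>
    hc.comp (f := fun σ => (z, σ)) (by fun_prop) fun σ hσ => ⟨hz, hσ⟩
  have hLc : ContinuousOn (fun σ => fderiv ℂ (fun z => G z σ) c) (sphere 0 1) := by
    rw [Metric.continuousOn_iff]
    intro σ hσ ε hε
    rw [Metric.uniformContinuousOn_iff] at huc
    obtain ⟨δ, hδ, H⟩ := huc (ε * R / 4) (by positivity)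
    refine ⟨δ, hδ, fun σ' hσ' hdist => ?_⟩
    rw [dist_eq_norm]
    have hda : ∀ σ ∈ sphere (0 : ℂ) 1, DifferentiableAt ℂ (fun z => G z σ) c :=
      fun σ hσ => (hd σ hσ c hcW).differentiableAt (hW.mem_nhds hcW)
    rw [← fderiv_fun_sub (hda σ' hσ') (hda σ hσ)]
    refine (norm_fderiv_le_of_bound (B := ε * R / 4) hR
      (((hd σ' hσ').sub (hd σ hσ)).mono hsub) (fun w hw => ?_)).trans_lt ?_
    · have := H (w, σ') ⟨ball_subset_closedBall hw, hσ'⟩ (w, σ) ⟨ball_subset_closedBall hw, hσ⟩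
        (by rw [Prod.dist_eq]; simpa using hdist)
      rw [dist_eq_norm] at this
      exact this.le
    · have : 2 * (ε * R / 4) / R = ε / 2 := by field_simp; ring
      rw [this]; linarith
  have hL : ∀ v, avg (fun σ => fderiv ℂ (fun z => G z σ) c) v
      = avg (fun σ => fderiv ℂ (fun z => G z σ) c v) := by
    intro v
    exact ((ContinuousLinearMap.apply ℂ ℂ v).restrictScalars ℝ |>.circleAverage_comp_comm
      hLc.circleIntegrable_sphere).symm
  refine (hasFDerivAt_of_quadratic (C := 4 * B) hR
    (avg fun σ => fderiv ℂ (fun z => G z σ) c) fun w hw => ?_).differentiableAt.differentiableWithinAt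
  have hcw : ContinuousOn (fun σ => fderiv ℂ (fun z => G z σ) c (w - c)) (sphere 0 1) :=
    hLc.clm_apply continuousOn_const
  rw [hL, avg_sub (hslice w (hsub hw)) (hslice c hcW),
    avg_sub (f := fun σ => G w σ - G c σ) ((hslice w (hsub hw)).sub (hslice c hcW)) hcw]
  refine norm_avg_le fun σ hσ => ?_
  exact norm_sub_fderiv_le_of_bound hR ((hd σ hσ).mono hsub)
    (fun v hv => hB (v, σ) ⟨ball_subset_closedBall hv, hσ⟩) hw
end Hol

section Rigid
variable {E : Type*} [NormedAddCommGroup E]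

theorem exists_lt_of_forall_sphere_lt {V : ℂ → E} (hV : ContinuousOn V (sphere 0 1)) {ρ : ℝ}
    (hρ : 0 < ρ) (h : ∀ σ ∈ sphere (0 : ℂ) 1, ‖V σ‖ < ρ) :
    ∃ c, 0 < c ∧ c < ρ ∧ ∀ σ ∈ sphere (0 : ℂ) 1, ‖V σ‖ ≤ c := by
  obtain ⟨σ, hσ, hmax⟩ := (isCompact_sphere (0 : ℂ) 1).exists_isMaxOn ⟨1, by simp⟩ hV.norm
  refine ⟨max ‖V σ‖ (ρ / 2), by positivity, max_lt (h σ hσ) (by linarith), fun τ hτ => ?_⟩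
  exact (hmax hτ).trans (le_max_left _ _)

theorem exists_margin {A : ℂ → E} {W : Set E} (hW : IsOpen W) (hA : ContinuousOn A (sphere 0 1))
    (h : ∀ σ ∈ sphere (0 : ℂ) 1, A σ ∈ W) :
    ∃ ρ > 0, ∀ σ ∈ sphere (0 : ℂ) 1, ball (A σ) ρ ⊆ W := by
  obtain ⟨ρ, hρ, H⟩ := ((isCompact_sphere (0 : ℂ) 1).image_of_continuousOn hA).exists_thickening_subset_open
    hW (image_subset_iff.2 h)
  exact ⟨ρ, hρ, fun σ hσ => (ball_subset_thickening (mem_image_of_mem A hσ) ρ).trans H⟩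

variable [NormedSpace ℂ E]

theorem DiffContOnCl.continuousOn_sphere {V : ℂ → E} (hV : DiffContOnCl ℂ V (ball 0 1)) :
    ContinuousOn V (sphere 0 1) :=
  hV.continuousOn.mono (by rw [closure_ball _ one_ne_zero]; exact sphere_subset_closedBall)

/-- The average of `F` over small perturbations of the boundary of the disc `A` only depends on
the center of the perturbed disc. -/
def Rigid (F : E → ℂ) (A : ℂ → E) : Prop :=
  ∃ δ > 0, ∀ V V' : ℂ → E, DiffContOnCl ℂ V (ball 0 1) → DiffContOnCl ℂ V' (ball 0 1) →
    (∀ σ ∈ sphere (0 : ℂ) 1, ‖V σ‖ < δ) → (∀ σ ∈ sphere (0 : ℂ) 1, ‖V' σ‖ < δ) → V 0 = V' 0 →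
    avg (fun σ => F (A σ + V σ)) = avg (fun σ => F (A σ + V' σ))

variable {F : E → ℂ} {W : Set E} {A : ℂ → E} {ρ : ℝ}

theorem differentiableOn_avg_add_smul (hF : DifferentiableOn ℂ F W)
    (hA : ContinuousOn A (sphere 0 1))
    (hAW : ∀ σ ∈ sphere (0 : ℂ) 1, ball (A σ) ρ ⊆ W) {V : ℂ → E} (hV : ContinuousOn V (sphere 0 1))
    {c R : ℝ} (hc : 0 < c) (hcR : R * c ≤ ρ) (hVc : ∀ σ ∈ sphere (0 : ℂ) 1, ‖V σ‖ ≤ c) :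
    DifferentiableOn ℂ (fun s : ℂ => avg (fun σ => F (A σ + s • V σ))) (ball 0 R) := by
  have hmem : ∀ s ∈ ball (0 : ℂ) R, ∀ σ ∈ sphere (0 : ℂ) 1, A σ + s • V σ ∈ W := by
    intro s hs σ hσ
    refine hAW σ hσ ?_
    rw [mem_ball, dist_eq_norm, add_sub_cancel_left, norm_smul]
    rw [mem_ball, dist_zero_right] at hs
    calc ‖s‖ * ‖V σ‖ ≤ ‖s‖ * c := by gcongr; exact hVc σ hσ
      _ < R * c := by gcongr
      _ ≤ ρ := hcR
  refine differentiableOn_avg (G := fun s σ => F (A σ + s • V σ)) isOpen_ball ?_ ?_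
  · refine hF.continuousOn.comp ?_ fun p hp => hmem p.1 hp.1 p.2 hp.2
    refine (hA.comp continuousOn_snd fun p hp => hp.2).add ?_
    exact continuousOn_fst.smul (hV.comp continuousOn_snd fun p hp => hp.2)
  · intro σ hσ
    refine hF.comp ?_ fun s hs => hmem s hs σ hσ
    fun_prop

theorem Rigid.eq_of_margin (h : Rigid F A) (hF : DifferentiableOn ℂ F W)
    (hA : ContinuousOn A (sphere 0 1)) (hρ : 0 < ρ)
    (hAW : ∀ σ ∈ sphere (0 : ℂ) 1, ball (A σ) ρ ⊆ W) {V V' : ℂ → E}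
    (hV : DiffContOnCl ℂ V (ball 0 1)) (hV' : DiffContOnCl ℂ V' (ball 0 1))
    (hVρ : ∀ σ ∈ sphere (0 : ℂ) 1, ‖V σ‖ < ρ) (hVρ' : ∀ σ ∈ sphere (0 : ℂ) 1, ‖V' σ‖ < ρ)
    (h0 : V 0 = V' 0) : avg (fun σ => F (A σ + V σ)) = avg (fun σ => F (A σ + V' σ)) := by
  obtain ⟨δ, hδ, H⟩ := h
  obtain ⟨c1, hc1, hc1ρ, hb1⟩ := exists_lt_of_forall_sphere_lt hV.continuousOn_sphere hρ hVρ
  obtain ⟨c2, hc2, hc2ρ, hb2⟩ := exists_lt_of_forall_sphere_lt hV'.continuousOn_sphere hρ hVρ'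
  set c := max c1 c2
  have hc : 0 < c := lt_max_of_lt_left hc1
  have hcρ : c < ρ := max_lt hc1ρ hc2ρ
  have hb1' : ∀ σ ∈ sphere (0 : ℂ) 1, ‖V σ‖ ≤ c := fun σ hσ => (hb1 σ hσ).trans (le_max_left _ _)
  have hb2' : ∀ σ ∈ sphere (0 : ℂ) 1, ‖V' σ‖ ≤ c := fun σ hσ => (hb2 σ hσ).trans (le_max_right _ _)
  have hR1 : 1 < ρ / c := (one_lt_div hc).2 hcρ
  have hRc : ρ / c * c ≤ ρ := by rw [div_mul_cancel₀ _ hc.ne']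
  have d1 := differentiableOn_avg_add_smul hF hA hAW hV.continuousOn_sphere hc hRc hb1'
  have d2 := differentiableOn_avg_add_smul hF hA hAW hV'.continuousOn_sphere hc hRc hb2'
  have hev : (fun s : ℂ => avg (fun σ => F (A σ + s • V σ))) =ᶠ[nhds 0]
      fun s : ℂ => avg (fun σ => F (A σ + s • V' σ)) := by
    filter_upwards [ball_mem_nhds (0 : ℂ) (div_pos hδ hc)] with s hs
    rw [mem_ball, dist_zero_right, lt_div_iff₀ hc] at hs
    refine H (fun σ => s • V σ) (fun σ => s • V' σ) (hV.const_smul s) (hV'.const_smul s)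
      (fun σ hσ => ?_) (fun σ hσ => ?_) (by simp only [h0])
    · rw [norm_smul]
      exact (mul_le_mul_of_nonneg_left (hb1' σ hσ) (norm_nonneg s)).trans_lt hs
    · rw [norm_smul]
      exact (mul_le_mul_of_nonneg_left (hb2' σ hσ) (norm_nonneg s)).trans_lt hs
  have := AnalyticOnNhd.eqOn_of_preconnected_of_eventuallyEq (d1.analyticOnNhd isOpen_ball)
    (d2.analyticOnNhd isOpen_ball) (convex_ball (0 : ℂ) (ρ / c)).isPreconnected
    (mem_ball_self (zero_lt_one.trans hR1)) hev (x := 1) (by simpa using hR1)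
  simpa using this

theorem Rigid.of_near (h : Rigid F A) (hF : DifferentiableOn ℂ F W)
    (hA : DiffContOnCl ℂ A (ball 0 1)) (hρ : 0 < ρ)
    (hAW : ∀ σ ∈ sphere (0 : ℂ) 1, ball (A σ) ρ ⊆ W) {A' : ℂ → E}
    (hA' : DiffContOnCl ℂ A' (ball 0 1)) (hn : ∀ σ ∈ sphere (0 : ℂ) 1, ‖A' σ - A σ‖ < ρ) :
    Rigid F A' := by
  have hd : DiffContOnCl ℂ (fun σ => A' σ - A σ) (ball 0 1) := hA'.sub hA
  obtain ⟨c, hc, hcρ, hb⟩ := exists_lt_of_forall_sphere_lt hd.continuousOn_sphere hρ hn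
  refine ⟨ρ - c, by linarith, fun V V' hV hV' h1 h2 h0 => ?_⟩
  have key := h.eq_of_margin hF hA.continuousOn_sphere hρ hAW (V := fun σ => A' σ - A σ + V σ)
    (V' := fun σ => A' σ - A σ + V' σ) (hd.add hV) (hd.add hV')
    (fun σ hσ => (norm_add_le _ _).trans_lt (by linarith [hb σ hσ, h1 σ hσ]))
    (fun σ hσ => (norm_add_le _ _).trans_lt (by linarith [hb σ hσ, h2 σ hσ])) (by simp only [h0])
  have e : ∀ V : ℂ → E, (fun σ => F (A σ + (A' σ - A σ + V σ))) = fun σ => F (A' σ + V σ) := by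
    intro V; funext σ; congr 1; abel
  rwa [e, e] at key

theorem eventually_sphere_dist_lt {Y Z : Type*} [TopologicalSpace Y] [PseudoMetricSpace Z]
    {S : Set Y} {B : Y → ℂ → Z}
    (hB : ContinuousOn (fun p : Y × ℂ => B p.1 p.2) (S ×ˢ sphere 0 1)) {y : Y} (hy : y ∈ S)
    {ε : ℝ} (hε : 0 < ε) :
    ∀ᶠ y' in nhdsWithin y S, ∀ σ ∈ sphere (0 : ℂ) 1, dist (B y' σ) (B y σ) < ε := by
  obtain ⟨v, hv, H⟩ := (isCompact_sphere (0 : ℂ) 1).mem_uniformity_of_prod (f := B) hB hy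
    (Metric.dist_mem_uniformity hε)
  filter_upwards [hv] with y' hy' σ hσ using H y' hy' σ hσ

theorem continuousOn_avg {Y : Type*} [TopologicalSpace Y] {S : Set Y} {B : Y → ℂ → ℂ}
    (hB : ContinuousOn (fun p : Y × ℂ => B p.1 p.2) (S ×ˢ sphere 0 1)) :
    ContinuousOn (fun y => avg (B y)) S := by
  have hs : ∀ y ∈ S, ContinuousOn (B y) (sphere 0 1) := fun y hy =>
    hB.comp (f := fun σ => (y, σ)) (by fun_prop) fun σ hσ => ⟨hy, hσ⟩
  intro y hy
  refine tendsto_avg (hs y hy) (eventually_nhdsWithin_of_forall hs) ?_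
  rw [Metric.tendstoUniformlyOn_iff]
  intro ε hε
  filter_upwards [eventually_sphere_dist_lt hB hy hε] with y' h σ hσ
  rw [dist_comm]; exact h σ hσ

section Family
variable {Y : Type*} [TopologicalSpace Y] {S : Set Y} {B : Y → ℂ → E}

theorem eventually_rigid_iff (hF : DifferentiableOn ℂ F W) (hW : IsOpen W)
    (hB : ContinuousOn (fun p : Y × ℂ => B p.1 p.2) (S ×ˢ sphere 0 1))
    (hBd : ∀ y ∈ S, DiffContOnCl ℂ (B y) (ball 0 1))
    (hBW : ∀ y ∈ S, ∀ σ ∈ sphere (0 : ℂ) 1, B y σ ∈ W) {y : Y} (hy : y ∈ S) :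
    ∀ᶠ y' in nhdsWithin y S, Rigid F (B y) ↔ Rigid F (B y') := by
  obtain ⟨ρ, hρ, H⟩ := exists_margin hW (hBd y hy).continuousOn_sphere (hBW y hy)
  filter_upwards [eventually_sphere_dist_lt hB hy (half_pos hρ), self_mem_nhdsWithin] with y' h hy'
  have h' : ∀ σ ∈ sphere (0 : ℂ) 1, ‖B y' σ - B y σ‖ < ρ / 2 := fun σ hσ => by
    rw [← dist_eq_norm]; exact h σ hσ
  refine ⟨fun hr => hr.of_near hF (hBd y hy) hρ H (hBd y' hy')
    fun σ hσ => (h' σ hσ).trans (by linarith), fun hr => ?_⟩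
  refine hr.of_near hF (hBd y' hy') (half_pos hρ) (fun σ hσ => ?_) (hBd y hy)
    fun σ hσ => by rw [norm_sub_rev]; exact h' σ hσ
  refine (ball_subset_ball' ?_).trans (H σ hσ)
  linarith [h σ hσ]

theorem rigid_of_preconnected (hF : DifferentiableOn ℂ F W) (hW : IsOpen W)
    (hB : ContinuousOn (fun p : Y × ℂ => B p.1 p.2) (S ×ˢ sphere 0 1))
    (hBd : ∀ y ∈ S, DiffContOnCl ℂ (B y) (ball 0 1))
    (hBW : ∀ y ∈ S, ∀ σ ∈ sphere (0 : ℂ) 1, B y σ ∈ W) (hS : IsPreconnected S)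
    {y y' : Y} (hy : y ∈ S) (hy' : y' ∈ S) (h : Rigid F (B y)) : Rigid F (B y') :=
  (hS.induction₂ (fun y y' => (Rigid F (B y) ↔ Rigid F (B y')))
    (fun _ hy => eventually_rigid_iff hF hW hB hBd hBW hy)
    (fun _ _ _ _ _ _ h1 h2 => h1.trans h2) (fun _ _ _ _ h1 => h1.symm) hy hy').1 h

theorem eventually_avg_eq (hF : DifferentiableOn ℂ F W) (hW : IsOpen W)
    (hB : ContinuousOn (fun p : Y × ℂ => B p.1 p.2) (S ×ˢ sphere 0 1))
    (hBd : ∀ y ∈ S, DiffContOnCl ℂ (B y) (ball 0 1))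
    (hB0 : ContinuousOn (fun y => B y 0) S)
    (hBW : ∀ y ∈ S, ∀ σ ∈ sphere (0 : ℂ) 1, B y σ ∈ W) {y : Y} (hy : y ∈ S)
    (h : Rigid F (B y)) :
    ∀ᶠ y' in nhdsWithin y S,
      avg (fun σ => F (B y' σ)) = avg (fun σ => F (B y σ + (B y' 0 - B y 0))) := by
  obtain ⟨ρ, hρ, H⟩ := exists_margin hW (hBd y hy).continuousOn_sphere (hBW y hy)
  filter_upwards [eventually_sphere_dist_lt hB hy hρ, self_mem_nhdsWithin,
    Metric.continuousOn_iff'.1 hB0 y hy ρ hρ] with y' h1 hy' h2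
  have := h.eq_of_margin hF (hBd y hy).continuousOn_sphere hρ H
    (V := fun σ => B y' σ - B y σ) (V' := fun _ => B y' 0 - B y 0)
    ((hBd y' hy').sub (hBd y hy)) diffContOnCl_const
    (fun σ hσ => by rw [← dist_eq_norm]; exact h1 σ hσ)
    (fun σ hσ => by rw [← dist_eq_norm]; exact h2) rfl
  rw [← this]
  refine congrArg avg (funext fun σ => ?_)
  rw [add_sub_cancel]
end Family
end Rigid

section Cont
variable {E : Type*} [NormedAddCommGroup E] [NormedSpace ℂ E]
variable {X : Type*} [NormedAddCommGroup X] [NormedSpace ℝ X]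

/-- Parameters in a convex set `T` and centers in `Ω₀` for which the boundary of the disc `A z τ`
lies in `B`. -/
def goodSet (A : E → X → ℂ → E) (Ω₀ : Set E) (T : Set X) (B : Set E) : Set (E × X) :=
  {p | p.1 ∈ Ω₀ ∧ p.2 ∈ T ∧ ∀ σ ∈ sphere (0 : ℂ) 1, A p.1 p.2 σ ∈ B}

/-- The points near `p` whose parameters lie in `T`. -/
abbrev box (T : Set X) (p : E × X) (r : ℝ) : Set (E × X) := ball p.1 r ×ˢ (ball p.2 r ∩ T)

/-- Near `p` the boundaries of the discs `A z τ` lie in `B`, and are mapped to `W` by small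
translations in the direction `κ`. -/
def Pushes (A : E → X → ℂ → E) (T : Set X) (B W : Set E) (κ : E) (p : E × X) (r ε₁ : ℝ) : Prop :=
  ∀ p' ∈ box T p r, ∀ σ ∈ sphere (0 : ℂ) 1, A p'.1 p'.2 σ ∈ B ∧
    ∀ ε : ℝ, 0 < ε → ε < ε₁ → A p'.1 p'.2 σ + (ε : ℂ) • κ ∈ W

/-- A family of analytic discs `A z τ` centered at `z`, attached to `M₁`, together with a
function `F₁` which is holomorphic on `W` and continuous up to `B ⊆ M₁`. -/
structure DiscFamily (A : E → X → ℂ → E) (Ω₀ : Set E) (T : Set X) (M₁ B W : Set E) (κ : E)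
    (F₁ : E → ℂ) : Prop where
  isOpen_base : IsOpen Ω₀
  preconnected_base : IsPreconnected Ω₀
  convex_param : Convex ℝ T
  isOpen_hol : IsOpen W
  hol : DifferentiableOn ℂ F₁ W
  cont : ContinuousOn F₁ (W ∪ B)
  disc : ∀ z ∈ Ω₀, ∀ τ ∈ T, DiffContOnCl ℂ (A z τ) (ball 0 1)
  center : ∀ z ∈ Ω₀, ∀ τ ∈ T, A z τ 0 = z
  contDisc : ContinuousOn (fun p : (E × X) × ℂ => A p.1.1 p.1.2 p.2) ((Ω₀ ×ˢ T) ×ˢ sphere 0 1)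
  mem : ∀ z ∈ Ω₀, ∀ τ ∈ T, ∀ σ ∈ sphere (0 : ℂ) 1, A z τ σ ∈ M₁
  push : ∀ b ∈ B, ∃ ε₁ > 0, ∃ r > 0, ∀ q ∈ M₁ ∩ ball b r, q ∈ B ∧
    ∀ ε : ℝ, 0 < ε → ε < ε₁ → q + (ε : ℂ) • κ ∈ W
  fiber : ∀ z ∈ Ω₀, (∃ τ ∈ T, (z, τ) ∈ goodSet A Ω₀ T B)
  fiber_preconnected : ∀ z ∈ Ω₀, IsPreconnected {τ | (z, τ) ∈ goodSet A Ω₀ T B}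
  approx : ∀ b ∈ B, ∃ r > 0, ∃ P : ℕ → E → ℂ, (∀ j, Differentiable ℂ (P j)) ∧
    TendstoUniformlyOn P F₁ atTop (W ∩ ball b r)

namespace DiscFamily
variable {A : E → X → ℂ → E} {Ω₀ : Set E} {T : Set X} {M₁ B W : Set E} {κ : E} {F₁ : E → ℂ}

theorem exists_nhd (H : DiscFamily A Ω₀ T M₁ B W κ F₁) {p : E × X} (hp : p ∈ goodSet A Ω₀ T B) :
    ∃ r > 0, ∃ ε₁ > 0, ball p.1 r ⊆ Ω₀ ∧ Pushes A T B W κ p r ε₁ := by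
  obtain ⟨hp1, hp2, hpB⟩ := hp
  have key : ∀ᶠ y : ℝ × (E × X) in nhds ((0 : ℝ), p), ∀ σ ∈ sphere (0 : ℂ) 1, y.2 ∈ Ω₀ ×ˢ T →
      A y.2.1 y.2.2 σ ∈ B ∧ (0 < y.1 → A y.2.1 y.2.2 σ + (y.1 : ℂ) • κ ∈ W) := by
    have := (isCompact_sphere (0 : ℂ) 1).eventually_forall_of_forall_eventually
      (x₀ := ((0 : ℝ), p)) (P := fun y σ => σ ∈ sphere (0 : ℂ) 1 → y.2 ∈ Ω₀ ×ˢ T →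
        A y.2.1 y.2.2 σ ∈ B ∧ (0 < y.1 → A y.2.1 y.2.2 σ + (y.1 : ℂ) • κ ∈ W)) ?_
    · filter_upwards [this] with y hy σ hσ using hy σ hσ hσ
    intro σ hσ
    obtain ⟨ε₁, hε₁, r, hr, h⟩ := H.push _ (hpB σ hσ)
    have hc := H.contDisc (p, σ) ⟨⟨hp1, hp2⟩, hσ⟩
    have h1 : ∀ᶠ q : (E × X) × ℂ in nhds (p, σ), q ∈ (Ω₀ ×ˢ T) ×ˢ sphere (0 : ℂ) 1 →
        A q.1.1 q.1.2 q.2 ∈ ball (A p.1 p.2 σ) r :=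
      eventually_nhdsWithin_iff.1 (hc.eventually (ball_mem_nhds _ hr))
    have h2 : Tendsto (fun y : (ℝ × (E × X)) × ℂ => (y.1.2, y.2)) (nhds (((0 : ℝ), p), σ))
        (nhds (p, σ)) := by
      have : Continuous (fun y : (ℝ × (E × X)) × ℂ => (y.1.2, y.2)) := by fun_prop
      exact this.tendsto _
    have h3 : ∀ᶠ y : (ℝ × (E × X)) × ℂ in nhds (((0 : ℝ), p), σ), y.1.1 < ε₁ := by
      have : Continuous (fun y : (ℝ × (E × X)) × ℂ => y.1.1) := by fun_prop
      exact (this.tendsto (((0 : ℝ), p), σ)).eventually (gt_mem_nhds hε₁)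
    filter_upwards [h2.eventually h1, h3] with y hy1 hy3 hyσ hyT
    have hmem := hy1 ⟨hyT, hyσ⟩
    have := h _ ⟨H.mem _ hyT.1 _ hyT.2 _ hyσ, hmem⟩
    exact ⟨this.1, fun h0 => this.2 _ h0 hy3⟩
  have hev : ∀ᶠ y : ℝ × (E × X) in nhds ((0 : ℝ), p), y.2.1 ∈ Ω₀ := by
    have : Continuous (fun y : ℝ × (E × X) => y.2.1) := by fun_prop
    exact (this.tendsto ((0 : ℝ), p)).eventually (H.isOpen_base.mem_nhds hp1)
  obtain ⟨r, hr, hr'⟩ := Metric.eventually_nhds_iff.1 (key.and hev)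
  have hbase : ball p.1 r ⊆ Ω₀ := by
    intro z hz
    refine (hr' (y := (0, (z, p.2))) ?_).2
    rw [Prod.dist_eq, Prod.dist_eq]
    simp only [max_lt_iff, dist_self]
    exact ⟨hr, hz, hr⟩
  refine ⟨r, hr, r, hr, hbase, fun p' hp' σ hσ => ?_⟩
  have hd : ∀ ε : ℝ, 0 ≤ ε → ε < r → dist (ε, p') ((0 : ℝ), p) < r := by
    intro ε h0 h1
    rw [Prod.dist_eq, Prod.dist_eq]
    simp only [max_lt_iff]
    refine ⟨by simpa [abs_of_nonneg h0] using h1, hp'.1, hp'.2.1⟩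
  have hT : p' ∈ Ω₀ ×ˢ T := ⟨hbase hp'.1, hp'.2.2⟩
  refine ⟨((hr' (hd 0 le_rfl hr)).1 σ hσ hT).1, fun ε h0 h1 => ?_⟩
  exact ((hr' (hd ε h0.le h1)).1 σ hσ hT).2 h0

/-- The discs pushed in the direction `κ` are rigid. -/
def PushRigid (A : E → X → ℂ → E) (κ : E) (F₁ : E → ℂ) (p : E × X) : Prop :=
  ∃ ε₁ > 0, ∀ ε : ℝ, 0 < ε → ε < ε₁ → Rigid F₁ (fun σ => A p.1 p.2 σ + (ε : ℂ) • κ)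

theorem continuousOn_push (H : DiscFamily A Ω₀ T M₁ B W κ F₁) {S : Set (E × X)} (hS : S ⊆ Ω₀ ×ˢ T)
    (ε : ℝ) : ContinuousOn (fun q : (E × X) × ℂ => A q.1.1 q.1.2 q.2 + (ε : ℂ) • κ)
      (S ×ˢ sphere 0 1) :=
  (H.contDisc.mono (prod_mono_left hS)).add continuousOn_const

theorem rigid_nhd (H : DiscFamily A Ω₀ T M₁ B W κ F₁) {p : E × X} {r ε₁ : ℝ}
    (hbase : ball p.1 r ⊆ Ω₀) (h : Pushes A T B W κ p r ε₁)
    {ε : ℝ} (h0 : 0 < ε) (h1 : ε < ε₁) {p1 p2 : E × X}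
    (hp1 : p1 ∈ box T p r) (hp2 : p2 ∈ box T p r)
    (hr : Rigid F₁ (fun σ => A p1.1 p1.2 σ + (ε : ℂ) • κ)) :
    Rigid F₁ (fun σ => A p2.1 p2.2 σ + (ε : ℂ) • κ) := by
  have hsub : box T p r ⊆ Ω₀ ×ˢ T := prod_mono hbase inter_subset_right
  let : NormedSpace ℝ E := NormedSpace.restrictScalars ℝ ℂ E
  refine rigid_of_preconnected (B := fun (p : E × X) σ => A p.1 p.2 σ + (ε : ℂ) • κ)
    (S := box T p r) H.hol H.isOpen_hol
    (H.continuousOn_push hsub ε) (fun y hy => ?_) (fun y hy σ hσ => (h y hy σ hσ).2 ε h0 h1)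
    ?_ hp1 hp2 hr
  · exact (H.disc _ (hsub hy).1 _ (hsub hy).2).add diffContOnCl_const
  · exact (convex_ball p.1 r).isPreconnected.prod ((convex_ball p.2 r).inter H.convex_param).isPreconnected

theorem pushRigid_iff (H : DiscFamily A Ω₀ T M₁ B W κ F₁) {p : E × X}
    (hp : p ∈ goodSet A Ω₀ T B) : ∃ r > 0, ∀ p' ∈ box T p r,
      p' ∈ goodSet A Ω₀ T B ∧ (PushRigid A κ F₁ p ↔ PushRigid A κ F₁ p') := by
  obtain ⟨r, hr, ε₁, hε₁, hbase, h⟩ := H.exists_nhd hp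
  have hself : p ∈ box T p r := ⟨mem_ball_self hr, mem_ball_self hr, hp.2.1⟩
  refine ⟨r, hr, fun p' hp' => ⟨⟨hbase hp'.1, hp'.2.2, fun σ hσ => (h p' hp' σ hσ).1⟩, ?_, ?_⟩⟩
  · rintro ⟨ε₂, hε₂, h2⟩
    exact ⟨min ε₁ ε₂, lt_min hε₁ hε₂, fun ε h0 h1 => H.rigid_nhd hbase h h0
      (h1.trans_le (min_le_left _ _)) hself hp' (h2 ε h0 (h1.trans_le (min_le_right _ _)))⟩
  · rintro ⟨ε₂, hε₂, h2⟩
    exact ⟨min ε₁ ε₂, lt_min hε₁ hε₂, fun ε h0 h1 => H.rigid_nhd hbase h h0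
      (h1.trans_le (min_le_left _ _)) hp' hself (h2 ε h0 (h1.trans_le (min_le_right _ _)))⟩

theorem pushRigid_fiber (H : DiscFamily A Ω₀ T M₁ B W κ F₁) {z : E} (hz : z ∈ Ω₀) {τ τ' : X}
    (h : (z, τ) ∈ goodSet A Ω₀ T B) (h' : (z, τ') ∈ goodSet A Ω₀ T B) :
    PushRigid A κ F₁ (z, τ) ↔ PushRigid A κ F₁ (z, τ') := by
  refine (H.fiber_preconnected z hz).induction₂
    (fun τ τ' => (PushRigid A κ F₁ (z, τ) ↔ PushRigid A κ F₁ (z, τ'))) (fun τ hτ => ?_)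
    (fun _ _ _ _ _ _ h1 h2 => h1.trans h2) (fun _ _ _ _ h1 => h1.symm) h h'
  obtain ⟨r, hr, hr'⟩ := H.pushRigid_iff hτ
  filter_upwards [mem_nhdsWithin_of_mem_nhds (ball_mem_nhds τ hr), self_mem_nhdsWithin] with τ' h1 h2
  exact (hr' (z, τ') ⟨mem_ball_self hr, h1, h2.2.1⟩).2

theorem pushRigid_all (H : DiscFamily A Ω₀ T M₁ B W κ F₁) {p p' : E × X}
    (hp : p ∈ goodSet A Ω₀ T B) (hp' : p' ∈ goodSet A Ω₀ T B) (h : PushRigid A κ F₁ p) :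
    PushRigid A κ F₁ p' := by
  have key : ∀ {z z' : E}, z ∈ Ω₀ → z' ∈ Ω₀ → ∀ τ τ', (z, τ) ∈ goodSet A Ω₀ T B →
      (z', τ') ∈ goodSet A Ω₀ T B → (PushRigid A κ F₁ (z, τ) ↔ PushRigid A κ F₁ (z', τ')) := by
    intro z z' hz hz'
    refine H.preconnected_base.induction₂ (fun z z' => ∀ τ τ', (z, τ) ∈ goodSet A Ω₀ T B →
      (z', τ') ∈ goodSet A Ω₀ T B → (PushRigid A κ F₁ (z, τ) ↔ PushRigid A κ F₁ (z', τ')))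
      (fun z hz => ?_) (fun z1 z2 z3 _ h2 _ h12 h23 τ τ' hτ hτ' => ?_)
      (fun _ _ _ _ h1 τ τ' hτ hτ' => (h1 τ' τ hτ' hτ).symm) hz hz'
    · obtain ⟨τ₀, hτ₀, hg⟩ := H.fiber z hz
      obtain ⟨r, hr, hr'⟩ := H.pushRigid_iff hg
      filter_upwards [mem_nhdsWithin_of_mem_nhds (ball_mem_nhds z hr), self_mem_nhdsWithin]
        with z' h1 h2 τ τ' hτ hτ'
      have := hr' (z', τ₀) ⟨h1, mem_ball_self hr, hτ₀⟩
      exact (H.pushRigid_fiber hz hτ hg).trans (this.2.trans (H.pushRigid_fiber h2 this.1 hτ'))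
    · obtain ⟨τ₀, hτ₀, hg⟩ := H.fiber z2 h2
      exact (h12 τ τ₀ hτ hg).trans (h23 τ₀ τ' hg hτ')
  exact (key hp.1 hp'.1 p.2 p'.2 hp hp').1 h

/-- Discs close to a point of `B` near which `F₁` is a limit of entire functions are rigid. -/
theorem rigid_of_approx (hF : ContinuousOn F₁ W) (hW : IsOpen W) {D : ℂ → E}
    (hD : DiffContOnCl ℂ D (ball 0 1)) {b : E} {r : ℝ} {P : ℕ → E → ℂ}
    (hP : ∀ j, Differentiable ℂ (P j)) (hlim : TendstoUniformlyOn P F₁ atTop (W ∩ ball b r))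
    (hDW : ∀ σ ∈ sphere (0 : ℂ) 1, D σ ∈ W ∩ ball b r) : Rigid F₁ D := by
  obtain ⟨ρ, hρ, H⟩ := exists_margin (hW.inter isOpen_ball) hD.continuousOn_sphere hDW
  have key : ∀ V : ℂ → E, DiffContOnCl ℂ V (ball 0 1) → (∀ σ ∈ sphere (0 : ℂ) 1, ‖V σ‖ < ρ) →
      Tendsto (fun j => P j (D 0 + V 0)) atTop (nhds (avg (fun σ => F₁ (D σ + V σ)))) := by
    intro V hV hVρ
    have hmem : ∀ σ ∈ sphere (0 : ℂ) 1, D σ + V σ ∈ W ∩ ball b r := fun σ hσ =>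
      H σ hσ (by rw [mem_ball, dist_eq_norm, add_sub_cancel_left]; exact hVρ σ hσ)
    have hDV : DiffContOnCl ℂ (fun σ => D σ + V σ) (ball 0 1) := hD.add hV
    have e : ∀ j, avg (fun σ => P j (D σ + V σ)) = P j (D 0 + V 0) := fun j =>
      avg_diffContOnCl ((hP j).comp_diffContOnCl hDV)
    simp_rw [← e]
    refine tendsto_avg ?_ ?_ ?_
    · exact hF.comp hDV.continuousOn_sphere fun σ hσ => (hmem σ hσ).1
    · exact Eventually.of_forall fun j =>
        (hP j).continuous.comp_continuousOn hDV.continuousOn_sphere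
    · rw [Metric.tendstoUniformlyOn_iff] at hlim ⊢
      intro ε hε
      filter_upwards [hlim ε hε] with j hj σ hσ using hj _ (hmem σ hσ)
  refine ⟨ρ, hρ, fun V V' hV hV' h1 h2 h0 => ?_⟩
  exact tendsto_nhds_unique (key V hV h1) (by rw [h0]; exact key V' hV' h2)

theorem pushRigid_of_shrink (H : DiscFamily A Ω₀ T M₁ B W κ F₁) {b : E} (hb : b ∈ B)
    [(nhdsWithin b Ω₀).NeBot]
    (hshrink : ∀ r > 0, ∀ᶠ z in nhdsWithin b Ω₀, ∀ τ ∈ T, ∀ σ ∈ sphere (0 : ℂ) 1,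
      A z τ σ ∈ ball b r) : ∃ p ∈ goodSet A Ω₀ T B, PushRigid A κ F₁ p := by
  obtain ⟨r, hr, P, hP, hlim⟩ := H.approx b hb
  obtain ⟨z, hz, hzΩ⟩ := ((hshrink (r / 2) (half_pos hr)).and self_mem_nhdsWithin).exists
  obtain ⟨τ, hτ, hg⟩ := H.fiber z hzΩ
  obtain ⟨r', hr', ε₁, hε₁, hbase, h⟩ := H.exists_nhd hg
  refine ⟨(z, τ), hg, min ε₁ (r / 2 / (‖κ‖ + 1)), lt_min hε₁ (by positivity), fun ε h0 h1 => ?_⟩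
  refine rigid_of_approx (b := b) (r := r) H.hol.continuousOn H.isOpen_hol
    ((H.disc z hzΩ τ hτ).add diffContOnCl_const) hP hlim fun σ hσ => ⟨?_, ?_⟩
  · exact (h (z, τ) ⟨mem_ball_self hr', mem_ball_self hr', hτ⟩ σ hσ).2 ε h0
      (h1.trans_le (min_le_left _ _))
  · have h2 := hz τ hτ σ hσ
    rw [mem_ball, dist_eq_norm] at h2 ⊢
    have h3 : ‖(ε : ℂ) • κ‖ < r / 2 := by
      have := h1.trans_le (min_le_right _ _)
      rw [lt_div_iff₀ (by positivity)] at this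
      rw [norm_smul, norm_real, norm_of_nonneg h0.le]
      nlinarith [norm_nonneg κ]
    calc ‖A z τ σ + (ε : ℂ) • κ - b‖ = ‖(A z τ σ - b) + (ε : ℂ) • κ‖ := by congr 1; abel
      _ ≤ ‖A z τ σ - b‖ + ‖(ε : ℂ) • κ‖ := norm_add_le _ _
      _ < r := by linarith

section Limit
variable (H : DiscFamily A Ω₀ T M₁ B W κ F₁)
include H

theorem continuousOn_limit {p : E × X} {r ε₁ : ℝ}
    (hbase : ball p.1 r ⊆ Ω₀) (h : Pushes A T B W κ p r ε₁) :
    ContinuousOn (fun y : ℝ × (E × X) => avg (fun σ => F₁ (A y.2.1 y.2.2 σ + (y.1 : ℂ) • κ)))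
      (Ico 0 ε₁ ×ˢ (box T p r)) := by
  refine continuousOn_avg (B := fun (y : ℝ × (E × X)) σ => F₁ (A y.2.1 y.2.2 σ + (y.1 : ℂ) • κ)) ?_
  refine H.cont.comp ?_ ?_
  · refine ContinuousOn.add ?_ (by fun_prop)
    refine H.contDisc.comp (f := fun q : (ℝ × (E × X)) × ℂ => (q.1.2, q.2)) (by fun_prop) ?_
    exact fun q hq => ⟨⟨hbase hq.1.2.1, hq.1.2.2.2⟩, hq.2⟩
  · rintro ⟨⟨ε, p'⟩, σ⟩ ⟨⟨⟨h0, h1⟩, hp'⟩, hσ⟩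
    have := h p' hp' σ hσ
    rcases h0.eq_or_lt with rfl | h0
    · right; simpa using this.1
    · left; exact this.2 ε h0 h1

theorem local_hol [ProperSpace E] {p : E × X} {r ε₁ : ℝ} (hpT : p.2 ∈ T) (hr0 : 0 < r)
    (hbase : ball p.1 r ⊆ Ω₀) (h : Pushes A T B W κ p r ε₁)
    (hR : ∀ ε : ℝ, 0 < ε → ε < ε₁ → ∀ p' ∈ box T p r,
      Rigid F₁ (fun σ => A p'.1 p'.2 σ + (ε : ℂ) • κ)) {ε : ℝ} (h0 : 0 < ε) (h1 : ε < ε₁) :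
    DifferentiableOn ℂ (fun z => avg (fun σ => F₁ (A z p.2 σ + (ε : ℂ) • κ))) (ball p.1 r) := by
  intro z hz
  have hmem : ∀ z ∈ ball p.1 r, (z, p.2) ∈ box T p r := fun z hz =>
    ⟨hz, mem_ball_self hr0, hpT⟩
  have hd : ∀ y ∈ ball p.1 r, DiffContOnCl ℂ (fun σ => A y p.2 σ + (ε : ℂ) • κ) (ball 0 1) :=
    fun y hy => (H.disc y (hbase hy) p.2 hpT).add diffContOnCl_const
  have hcont : ContinuousOn (fun q : E × ℂ => A q.1 p.2 q.2 + (ε : ℂ) • κ)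
      (ball p.1 r ×ˢ sphere 0 1) :=
    (H.continuousOn_push Subset.rfl ε).comp (f := fun q : E × ℂ => ((q.1, p.2), q.2))
      (by fun_prop) fun q hq => ⟨⟨hbase hq.1, hpT⟩, hq.2⟩
  have hW : ∀ y ∈ ball p.1 r, ∀ σ ∈ sphere (0 : ℂ) 1, A y p.2 σ + (ε : ℂ) • κ ∈ W :=
    fun y hy σ hσ => (h _ (hmem y hy) σ hσ).2 ε h0 h1
  have hcen : ∀ y ∈ ball p.1 r, A y p.2 0 + (ε : ℂ) • κ = y + (ε : ℂ) • κ := fun y hy => by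
    rw [H.center y (hbase hy) p.2 hpT]
  have hev := eventually_avg_eq (B := fun y σ => A y p.2 σ + (ε : ℂ) • κ) (S := ball p.1 r)
    H.hol H.isOpen_hol hcont hd
    (ContinuousOn.congr (f := fun y => y + (ε : ℂ) • κ) (by fun_prop) fun y hy => hcen y hy)
    hW hz (hR ε h0 h1 _ (hmem z hz))
  rw [isOpen_ball.nhdsWithin_eq hz] at hev
  obtain ⟨ρ, hρ, hm⟩ := exists_margin H.isOpen_hol (hd z hz).continuousOn_sphere (hW z hz)
  have hzz : DifferentiableOn ℂ
      (fun z' => avg (fun σ => F₁ (A z p.2 σ + (ε : ℂ) • κ + (z' - z)))) (ball z ρ) := by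
    have hin : ∀ z' ∈ ball z ρ, ∀ σ ∈ sphere (0 : ℂ) 1, A z p.2 σ + (ε : ℂ) • κ + (z' - z) ∈ W :=
      fun z' hz' σ hσ => hm σ hσ (by
        rw [mem_ball, dist_eq_norm, add_sub_cancel_left, ← dist_eq_norm]; exact hz')
    refine differentiableOn_avg (G := fun z' σ => F₁ (A z p.2 σ + (ε : ℂ) • κ + (z' - z)))
      isOpen_ball ?_ fun σ hσ => ?_
    · refine H.hol.continuousOn.comp ?_ fun q hq => hin q.1 hq.1 q.2 hq.2
      refine ContinuousOn.add ?_ (by fun_prop)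
      exact (hd z hz).continuousOn_sphere.comp continuousOn_snd fun q hq => hq.2
    · exact H.hol.comp (by fun_prop) fun z' hz' => hin z' hz' σ hσ
  have hda := (hzz z (mem_ball_self hρ)).differentiableAt (ball_mem_nhds z hρ)
  refine (hda.congr_of_eventuallyEq ?_).differentiableWithinAt
  filter_upwards [hev, isOpen_ball.mem_nhds hz] with z' hz' hz''
  rw [hz']
  simp only [hcen z' hz'', hcen z hz, add_sub_add_right_eq_sub]

theorem local_const {p : E × X} {r ε₁ : ℝ} (hpT : p.2 ∈ T) (hr0 : 0 < r)
    (hbase : ball p.1 r ⊆ Ω₀) (h : Pushes A T B W κ p r ε₁)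
    (hR : ∀ ε : ℝ, 0 < ε → ε < ε₁ → ∀ p' ∈ box T p r,
      Rigid F₁ (fun σ => A p'.1 p'.2 σ + (ε : ℂ) • κ)) {ε : ℝ} (h0 : 0 < ε) (h1 : ε < ε₁)
    {τ : X} (hτ : τ ∈ ball p.2 r ∩ T) :
    avg (fun σ => F₁ (A p.1 τ σ + (ε : ℂ) • κ)) = avg (fun σ => F₁ (A p.1 p.2 σ + (ε : ℂ) • κ)) := by
  have hp1 : p.1 ∈ Ω₀ := hbase (mem_ball_self hr0)
  have hmem : ∀ τ ∈ ball p.2 r ∩ T, (p.1, τ) ∈ box T p r := fun τ hτ =>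
    ⟨mem_ball_self hr0, hτ⟩
  have hd : ∀ τ ∈ ball p.2 r ∩ T, DiffContOnCl ℂ (fun σ => A p.1 τ σ + (ε : ℂ) • κ) (ball 0 1) :=
    fun τ hτ => (H.disc p.1 hp1 τ hτ.2).add diffContOnCl_const
  have hcont : ContinuousOn (fun q : X × ℂ => A p.1 q.1 q.2 + (ε : ℂ) • κ)
      ((ball p.2 r ∩ T) ×ˢ sphere 0 1) :=
    (H.continuousOn_push Subset.rfl ε).comp (f := fun q : X × ℂ => ((p.1, q.1), q.2))
      (by fun_prop) fun q hq => ⟨⟨hp1, hq.1.2⟩, hq.2⟩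
  have hW : ∀ τ ∈ ball p.2 r ∩ T, ∀ σ ∈ sphere (0 : ℂ) 1, A p.1 τ σ + (ε : ℂ) • κ ∈ W :=
    fun τ hτ σ hσ => (h _ (hmem τ hτ) σ hσ).2 ε h0 h1
  have hcen : ∀ τ ∈ ball p.2 r ∩ T, A p.1 τ 0 + (ε : ℂ) • κ = p.1 + (ε : ℂ) • κ := fun τ hτ => by
    rw [H.center p.1 hp1 τ hτ.2]
  refine ((convex_ball p.2 r).inter H.convex_param).isPreconnected.induction₂
    (fun τ τ' => avg (fun σ => F₁ (A p.1 τ σ + (ε : ℂ) • κ))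
      = avg (fun σ => F₁ (A p.1 τ' σ + (ε : ℂ) • κ)))
    (fun τ hτ => ?_) (fun _ _ _ _ _ _ h1 h2 => h1.trans h2) (fun _ _ _ _ h1 => h1.symm) hτ
    ⟨mem_ball_self hr0, hpT⟩
  filter_upwards [eventually_avg_eq (B := fun τ σ => A p.1 τ σ + (ε : ℂ) • κ) (S := ball p.2 r ∩ T)
    H.hol H.isOpen_hol hcont hd
    (ContinuousOn.congr (f := fun _ => p.1 + (ε : ℂ) • κ) (by fun_prop) fun y hy => hcen y hy)
    hW hτ (hR ε h0 h1 _ (hmem τ hτ)), self_mem_nhdsWithin] with τ' hτ' hτ''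
  rw [hτ', hcen τ hτ, hcen τ' hτ'']
  simp

theorem exists_limit [ProperSpace E] {p : E × X} (hp : p ∈ goodSet A Ω₀ T B)
    (hrig : PushRigid A κ F₁ p) :
    ∃ r > 0, ball p.1 r ⊆ Ω₀ ∧ (∀ p' ∈ box T p r, p' ∈ goodSet A Ω₀ T B) ∧
      (∀ τ ∈ ball p.2 r ∩ T, avg (fun σ => F₁ (A p.1 τ σ)) = avg (fun σ => F₁ (A p.1 p.2 σ))) ∧
      DifferentiableAt ℂ (fun z => avg (fun σ => F₁ (A z p.2 σ))) p.1 := by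
  obtain ⟨r, hr, ε₂, hε₂, hbase, h⟩ := H.exists_nhd hp
  obtain ⟨ε₃, hε₃, hrig⟩ := hrig
  have hself : p ∈ box T p r := ⟨mem_ball_self hr, mem_ball_self hr, hp.2.1⟩
  set ε₁ := min ε₂ ε₃ with hε₁def
  have hε₁ : 0 < ε₁ := lt_min hε₂ hε₃
  have h' : Pushes A T B W κ p r ε₁ := fun p' hp' σ hσ =>
    ⟨(h p' hp' σ hσ).1, fun ε h0 h1 => (h p' hp' σ hσ).2 ε h0 (h1.trans_le (min_le_left _ _))⟩
  have hR : ∀ ε : ℝ, 0 < ε → ε < ε₁ → ∀ p' ∈ box T p r,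
      Rigid F₁ (fun σ => A p'.1 p'.2 σ + (ε : ℂ) • κ) := fun ε h0 h1 p' hp' =>
    H.rigid_nhd hbase h' h0 h1 hself hp' (hrig ε h0 (h1.trans_le (min_le_right _ _)))
  have hcl := H.continuousOn_limit hbase h'
  obtain ⟨u, -, hu, hulim⟩ := exists_seq_strictAnti_tendsto' hε₁
  have hucl : ∀ p' ∈ box T p r, Tendsto
      (fun j => avg (fun σ => F₁ (A p'.1 p'.2 σ + (u j : ℂ) • κ))) atTop
      (nhds (avg (fun σ => F₁ (A p'.1 p'.2 σ)))) := by
    intro p' hp'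
    have := hcl (0, p') ⟨⟨le_rfl, hε₁⟩, hp'⟩
    have h2 : Tendsto (fun j => (u j, p')) atTop
        (nhdsWithin (0, p') (Ico 0 ε₁ ×ˢ (box T p r))) := by
      refine tendsto_nhdsWithin_iff.2 ⟨hulim.prodMk_nhds tendsto_const_nhds, ?_⟩
      exact Eventually.of_forall fun j => ⟨⟨(hu j).1.le, (hu j).2⟩, hp'⟩
    have h3 := Tendsto.comp (ContinuousWithinAt.tendsto this) h2
    simp only [Complex.ofReal_zero, zero_smul, add_zero] at h3
    exact h3
  refine ⟨r, hr, hbase, fun p' hp' => ⟨hbase hp'.1, hp'.2.2, fun σ hσ => (h p' hp' σ hσ).1⟩,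
    fun τ hτ => ?_, ?_⟩
  · refine tendsto_nhds_unique (hucl (p.1, τ) ⟨mem_ball_self hr, hτ⟩) ?_
    refine (hucl p hself).congr fun j => ?_
    exact (H.local_const hp.2.1 hr hbase h' hR (hu j).1 (hu j).2 hτ).symm
  · have hunif : TendstoUniformlyOn
        (fun j z => avg (fun σ => F₁ (A z p.2 σ + (u j : ℂ) • κ)))
        (fun z => avg (fun σ => F₁ (A z p.2 σ))) atTop (ball p.1 (r / 2)) := by
      rw [Metric.tendstoUniformlyOn_iff]
      intro ε hε
      have hsub : closedBall p.1 (r / 2) ⊆ ball p.1 r := closedBall_subset_ball (by linarith)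
      obtain ⟨v, hv, hv'⟩ := (isCompact_closedBall p.1 (r / 2)).mem_uniformity_of_prod
        (f := fun (s : ℝ) z => avg (fun σ => F₁ (A z p.2 σ + (s : ℂ) • κ))) (s := Ico 0 ε₁) (q := 0)
        (hcl.comp (f := fun q : ℝ × E => (q.1, (q.2, p.2))) (by fun_prop)
          fun q hq => ⟨hq.1, hsub hq.2, mem_ball_self hr, hp.2.1⟩) ⟨le_rfl, hε₁⟩
        (Metric.dist_mem_uniformity hε)
      have h2 : Tendsto u atTop (nhdsWithin 0 (Ico 0 ε₁)) :=
        tendsto_nhdsWithin_iff.2 ⟨hulim, Eventually.of_forall fun j => ⟨(hu j).1.le, (hu j).2⟩⟩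
      filter_upwards [h2.eventually hv] with j hj z hz
      have := hv' (u j) hj z (ball_subset_closedBall hz)
      rw [dist_comm]
      simpa using this
    have := differentiableOn_of_tendstoUniformlyOn isOpen_ball (fun j =>
      (H.local_hol hp.2.1 hr hbase h' hR (hu j).1 (hu j).2).mono
        (ball_subset_ball (by linarith))) hunif
    exact (this p.1 (mem_ball_self (by linarith))).differentiableAt (ball_mem_nhds _ (by linarith))

theorem exists_extension [ProperSpace E] (p₀ : E) {ω' : Set E} (hω' : IsOpen ω')
    (hp₀ : p₀ ∈ M₁ ∩ ω') (hne : ∀ p ∈ M₁ ∩ ω', (nhdsWithin p Ω₀).NeBot)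
    (hshrink : ∀ p ∈ M₁ ∩ ω', ∀ r > 0, ∀ᶠ z in nhdsWithin p Ω₀, ∀ τ ∈ T,
      ∀ σ ∈ sphere (0 : ℂ) 1, A z τ σ ∈ ball p r) :
    ∃ F : E → ℂ, DifferentiableOn ℂ F Ω₀ ∧
      ∀ p ∈ M₁ ∩ ω', p ∈ B → Tendsto F (nhdsWithin p Ω₀) (nhds (F₁ p)) := by
  classical
  have hb : ∃ b ∈ M₁ ∩ ω', b ∈ B := by
    obtain ⟨r, hr, hrω⟩ := Metric.isOpen_iff.1 hω' p₀ hp₀.2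
    have := hne p₀ hp₀
    obtain ⟨z, hz, hzΩ⟩ := ((hshrink p₀ hp₀ r hr).and self_mem_nhdsWithin).exists
    obtain ⟨τ, hτ, hg⟩ := H.fiber z hzΩ
    have h1 : (1 : ℂ) ∈ sphere (0 : ℂ) 1 := by simp
    exact ⟨A z τ 1, ⟨H.mem z hzΩ τ hτ 1 h1, hrω (hz τ hτ 1 h1)⟩, hg.2.2 1 h1⟩
  obtain ⟨b, hbω, hbB⟩ := hb
  have := hne b hbω
  obtain ⟨p₁, hp₁, hrig⟩ := H.pushRigid_of_shrink hbB (hshrink b hbω)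
  have hall : ∀ p ∈ goodSet A Ω₀ T B, PushRigid A κ F₁ p := fun p hp =>
    H.pushRigid_all hp₁ hp hrig
  have hfib : ∀ z, ∃ τ, z ∈ Ω₀ → (z, τ) ∈ goodSet A Ω₀ T B := by
    intro z
    by_cases hz : z ∈ Ω₀
    · obtain ⟨τ, _, h⟩ := H.fiber z hz; exact ⟨τ, fun _ => h⟩
    · exact ⟨0, fun h => absurd h hz⟩
  choose t ht using hfib
  have hconst : ∀ z ∈ Ω₀, ∀ τ, (z, τ) ∈ goodSet A Ω₀ T B →
      avg (fun σ => F₁ (A z (t z) σ)) = avg (fun σ => F₁ (A z τ σ)) := by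
    intro z hz τ hτ
    refine (H.fiber_preconnected z hz).induction₂
      (fun τ τ' => avg (fun σ => F₁ (A z τ σ)) = avg (fun σ => F₁ (A z τ' σ))) (fun τ hτ => ?_)
      (fun _ _ _ _ _ _ h1 h2 => h1.trans h2) (fun _ _ _ _ h1 => h1.symm) (ht z hz) hτ
    obtain ⟨r, hr, -, -, h3, -⟩ := H.exists_limit hτ (hall _ hτ)
    filter_upwards [mem_nhdsWithin_of_mem_nhds (ball_mem_nhds τ hr), self_mem_nhdsWithin]
      with τ' h1 h2
    exact (h3 τ' ⟨h1, h2.2.1⟩).symm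
  refine ⟨fun z => avg (fun σ => F₁ (A z (t z) σ)), fun z hz => ?_, fun p hp hpB => ?_⟩
  · obtain ⟨r, hr, hbase, h2, -, h4⟩ := H.exists_limit (ht z hz) (hall _ (ht z hz))
    refine (h4.congr_of_eventuallyEq ?_).differentiableWithinAt
    filter_upwards [ball_mem_nhds z hr] with z' hz'
    exact hconst z' (hbase hz') _ (h2 (z', t z) ⟨hz', mem_ball_self hr, (ht z hz).2.1⟩)
  · rw [Metric.tendsto_nhds]
    intro ε hε
    obtain ⟨δ, hδ, hδ'⟩ := Metric.continuousOn_iff.1 H.cont p (Or.inr hpB) (ε / 2) (half_pos hε)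
    filter_upwards [hshrink p hp δ hδ, self_mem_nhdsWithin] with z hz hzΩ
    have hg := ht z hzΩ
    rw [dist_eq_norm]
    refine (norm_avg_sub_const_le (C := ε / 2) ?_ fun σ hσ => ?_).trans_lt (by linarith)
    · exact H.cont.comp (H.disc z hzΩ _ hg.2.1).continuousOn_sphere
        fun σ hσ => Or.inr (hg.2.2 σ hσ)
    · rw [← dist_eq_norm]
      exact (hδ' _ (Or.inr (hg.2.2 σ hσ)) (hz _ hg.2.1 σ hσ)).le
end Limit
end DiscFamily
end Cont

section Avoid
open scoped ENNReal
variable {X : Type*} [NormedAddCommGroup X] [NormedSpace ℝ X] [FiniteDimensional ℝ X]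
  [MeasurableSpace X] [BorelSpace X] (μ : Measure X) [μ.IsAddHaarMeasure]
variable {Y : Type*} [MetricSpace Y]

theorem measure_le_of_forall_dist_le {S : Set X} {δ : ℝ} (hδ : 0 ≤ δ)
    (h : ∀ v ∈ S, ∀ v' ∈ S, ‖v - v'‖ ≤ δ) :
    μ S ≤ ENNReal.ofReal (δ ^ Module.finrank ℝ X) * μ (closedBall 0 1) := by
  rcases S.eq_empty_or_nonempty with rfl | ⟨v, hv⟩
  · simp
  · rw [← Measure.addHaar_closedBall' μ v hδ]
    exact measure_mono fun w hw => by rw [mem_closedBall, dist_eq_norm]; exact h w hw v hv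

theorem abs_sub_le_of_floor_eq {k : ℕ} (hk : 0 < k) {a b : ℝ} (ha : 0 ≤ a) (hb : 0 ≤ b)
    (h : ⌊(k : ℝ) * a⌋₊ = ⌊(k : ℝ) * b⌋₊) : |a - b| ≤ 1 / k := by
  have hk' : (0 : ℝ) < k := by exact_mod_cast hk
  have a1 := Nat.floor_le (mul_nonneg hk'.le ha)
  have a2 := Nat.lt_floor_add_one ((k : ℝ) * a)
  have b1 := Nat.floor_le (mul_nonneg hk'.le hb)
  have b2 := Nat.lt_floor_add_one ((k : ℝ) * b)
  rw [h] at a1 a2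
  rw [abs_le, neg_le, le_div_iff₀ hk', le_div_iff₀ hk']
  constructor <;> nlinarith

variable {μ}
/-- The measure of the set of parameters `v` for which one of the points `G v q`, with `q` in the
unit square, lies in `t`. -/
theorem measure_hit_le {Z : Set (X × (ℝ × ℝ))} {G : X → ℝ × ℝ → Y} {C : ℝ} (hC : 0 ≤ C)
    (hZ : ∀ p ∈ Z, p.2 ∈ Icc (0 : ℝ) 1 ×ˢ Icc (0 : ℝ) 1)
    (hG : ∀ p ∈ Z, ∀ p' ∈ Z, ‖p.1 - p'.1‖ ≤ C * (dist (G p.1 p.2) (G p'.1 p'.2) + dist p.2 p'.2))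
    {s : ℕ} (hs : Module.finrank ℝ X = s + 2) {t : Set Y} {δ : ℝ} (hδ : 0 < δ) (hδ1 : δ ≤ 1)
    (ht : ∀ y ∈ t, ∀ y' ∈ t, dist y y' ≤ δ) :
    μ {v | ∃ q, (v, q) ∈ Z ∧ G v q ∈ t} ≤
      ENNReal.ofReal (9 * (2 * C) ^ (s + 2) * δ ^ s) * μ (closedBall 0 1) := by
  set k := ⌈1 / δ⌉₊ with hkdef
  have hk0 : 0 < k := Nat.ceil_pos.2 (by positivity)
  have hk0' : (0 : ℝ) < k := by exact_mod_cast hk0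
  have hk1 : 1 / (k : ℝ) ≤ δ := by
    rw [div_le_iff₀ hk0', ← div_le_iff₀' hδ]; exact Nat.le_ceil _
  have hk2 : ((k : ℝ) + 1) * δ ≤ 3 := by
    have : (k : ℝ) < 1 / δ + 1 := Nat.ceil_lt_add_one (by positivity)
    have h2 : (k : ℝ) * δ < (1 / δ + 1) * δ := by gcongr
    have h3 : (1 / δ + 1) * δ = 1 + δ := by field_simp
    nlinarith
  let P : ℕ × ℕ → Set X := fun i => {v | ∃ q, (v, q) ∈ Z ∧ G v q ∈ t ∧
    ⌊(k : ℝ) * q.1⌋₊ = i.1 ∧ ⌊(k : ℝ) * q.2⌋₊ = i.2}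
  have hcov : {v | ∃ q, (v, q) ∈ Z ∧ G v q ∈ t} ⊆
      ⋃ i ∈ Finset.range (k + 1) ×ˢ Finset.range (k + 1), P i := by
    rintro v ⟨q, hq, hqt⟩
    have h1 := hZ _ hq
    simp only [mem_iUnion]
    have hf : ∀ a : ℝ, a ≤ 1 → ⌊(k : ℝ) * a⌋₊ < k + 1 := by
      intro a ha
      refine Nat.lt_succ_of_le (Nat.floor_le_of_le ?_)
      nlinarith
    exact ⟨(⌊(k : ℝ) * q.1⌋₊, ⌊(k : ℝ) * q.2⌋₊), by
      simp only [Finset.mem_product, Finset.mem_range]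
      exact ⟨hf _ h1.1.2, hf _ h1.2.2⟩, q, hq, hqt, rfl, rfl⟩
  have hP : ∀ i, μ (P i) ≤ ENNReal.ofReal ((2 * C * δ) ^ (s + 2)) * μ (closedBall 0 1) := by
    intro i
    rw [← hs]
    refine measure_le_of_forall_dist_le μ (by positivity) ?_
    rintro v ⟨q, hq, hqt, hq1, hq2⟩ v' ⟨q', hq', hqt', hq1', hq2'⟩
    have h1 := hZ _ hq
    have h2 := hZ _ hq'
    have hd : dist q q' ≤ δ := by
      rw [Prod.dist_eq, max_le_iff, Real.dist_eq, Real.dist_eq]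
      exact ⟨(abs_sub_le_of_floor_eq hk0 h1.1.1 h2.1.1 (hq1.trans hq1'.symm)).trans hk1,
        (abs_sub_le_of_floor_eq hk0 h1.2.1 h2.2.1 (hq2.trans hq2'.symm)).trans hk1⟩
    calc ‖v - v'‖ ≤ C * (dist (G v q) (G v' q') + dist q q') := hG _ hq _ hq'
      _ ≤ C * (δ + δ) := by gcongr; exact ht _ hqt _ hqt'
      _ = 2 * C * δ := by ring
  calc μ {v | ∃ q, (v, q) ∈ Z ∧ G v q ∈ t}
      ≤ ∑ i ∈ Finset.range (k + 1) ×ˢ Finset.range (k + 1), μ (P i) :=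
        (measure_mono hcov).trans (measure_biUnion_finset_le _ _)
    _ ≤ ∑ i ∈ Finset.range (k + 1) ×ˢ Finset.range (k + 1),
          ENNReal.ofReal ((2 * C * δ) ^ (s + 2)) * μ (closedBall 0 1) :=
        Finset.sum_le_sum fun i _ => hP i
    _ = ENNReal.ofReal (((k : ℝ) + 1) ^ 2 * (2 * C * δ) ^ (s + 2)) * μ (closedBall 0 1) := by
        rw [Finset.sum_const, Finset.card_product, Finset.card_range, nsmul_eq_mul,
          ENNReal.ofReal_mul (by positivity), ← mul_assoc]
        congr 2
        rw [ENNReal.ofReal_pow (by positivity), ENNReal.ofReal_add (by positivity) zero_le_one,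
          ENNReal.ofReal_natCast, ENNReal.ofReal_one]
        push_cast
        ring
    _ ≤ _ := by
        refine mul_le_mul' (ENNReal.ofReal_le_ofReal ?_) le_rfl
        have e : ((k : ℝ) + 1) ^ 2 * (2 * C * δ) ^ (s + 2)
            = (((k : ℝ) + 1) * δ) ^ 2 * ((2 * C) ^ (s + 2) * δ ^ s) := by ring
        rw [e, mul_assoc]
        gcongr
        nlinarith [mul_pos (show (0 : ℝ) < k + 1 by positivity) hδ]

theorem measure_hit_eq_zero [MeasurableSpace Y] [BorelSpace Y]
    {Z : Set (X × (ℝ × ℝ))} {G : X → ℝ × ℝ → Y} {C : ℝ} (hC : 0 ≤ C)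
    (hZ : ∀ p ∈ Z, p.2 ∈ Icc (0 : ℝ) 1 ×ˢ Icc (0 : ℝ) 1)
    (hG : ∀ p ∈ Z, ∀ p' ∈ Z, ‖p.1 - p'.1‖ ≤ C * (dist (G p.1 p.2) (G p'.1 p'.2) + dist p.2 p'.2))
    {s : ℕ} (hs : Module.finrank ℝ X = s + 2) (hs0 : s ≠ 0) {K : Set Y} (hK : μH[(s : ℝ)] K = 0) :
    μ {v | ∃ q, (v, q) ∈ Z ∧ G v q ∈ K} = 0 := by
  set c : ℝ≥0∞ := ENNReal.ofReal (9 * (2 * C) ^ (s + 2)) * μ (closedBall 0 1) with hc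
  have hctop : c ≠ ∞ :=
    ENNReal.mul_ne_top ENNReal.ofReal_ne_top (isCompact_closedBall 0 1).measure_lt_top.ne
  have key : ∀ t : Set Y, ediam t < 1 → μ {v | ∃ q, (v, q) ∈ Z ∧ G v q ∈ t} ≤ c * ediam t ^ s := by
    intro t ht
    have htop : ediam t ≠ ∞ := (ht.trans ENNReal.one_lt_top).ne
    have hlim : Tendsto (fun δ : ℝ => c * ENNReal.ofReal δ ^ s) (nhdsWithin (diam t) (Ioi (diam t)))
        (nhds (c * ediam t ^ s)) := by
      have h1 : Tendsto (fun δ : ℝ => ENNReal.ofReal δ) (nhdsWithin (diam t) (Ioi (diam t)))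
          (nhds (ediam t)) := by
        have := (ENNReal.continuous_ofReal.tendsto (diam t)).mono_left
          (nhdsWithin_le_nhds (s := Ioi (diam t)))
        rwa [diam, ENNReal.ofReal_toReal htop] at this
      exact ENNReal.Tendsto.const_mul ((ENNReal.continuous_pow s).tendsto _ |>.comp h1)
        (Or.inr hctop)
    have hd1 : diam t < 1 := by
      rw [diam, ← ENNReal.toReal_one]; exact (ENNReal.toReal_lt_toReal htop ENNReal.one_ne_top).2 ht
    refine ge_of_tendsto hlim ?_
    filter_upwards [self_mem_nhdsWithin, mem_nhdsWithin_of_mem_nhds (Iio_mem_nhds hd1)] with δ h1 h2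
    have h0 : 0 < δ := diam_nonneg.trans_lt h1
    refine (measure_hit_le (μ := μ) hC hZ hG hs h0 (le_of_lt h2) fun y hy y' hy' =>
      (dist_le_diam_of_mem' htop hy hy').trans (le_of_lt h1)).trans (le_of_eq ?_)
    rw [hc, ENNReal.ofReal_mul (by positivity), ENNReal.ofReal_pow h0.le]
    ring
  have hK' := hK
  rw [Measure.hausdorffMeasure_apply, ENNReal.iSup_eq_zero] at hK'
  have h2 := hK' 2⁻¹
  simp only [ENNReal.inv_pos, ne_eq, ENNReal.ofNat_ne_top, not_false_eq_true, iSup_pos] at h2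
  refine le_antisymm (le_of_forall_gt fun ε hε => ?_) zero_le
  have hε' : (0 : ℝ≥0∞) < ε / (c + 1) := ENNReal.div_pos hε.ne' (by simp [hctop])
  rw [← h2] at hε'
  simp only [iInf_lt_iff] at hε'
  obtain ⟨t, hKt, htd, hsum⟩ := hε'
  have hlt : ∀ n, ediam (t n) < 1 := fun n => (htd n).trans_lt (by
    rw [ENNReal.inv_lt_one]; norm_num)
  calc μ {v | ∃ q, (v, q) ∈ Z ∧ G v q ∈ K}
      ≤ μ (⋃ n, {v | ∃ q, (v, q) ∈ Z ∧ G v q ∈ t n}) := by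
        refine measure_mono ?_
        rintro v ⟨q, hq, hqK⟩
        obtain ⟨n, hn⟩ := mem_iUnion.1 (hKt hqK)
        exact mem_iUnion.2 ⟨n, q, hq, hn⟩
    _ ≤ ∑' n, μ {v | ∃ q, (v, q) ∈ Z ∧ G v q ∈ t n} := measure_iUnion_le _
    _ ≤ ∑' n, c * ⨆ _ : (t n).Nonempty, ediam (t n) ^ (s : ℝ) := by
        refine ENNReal.tsum_le_tsum fun n => (key _ (hlt n)).trans ?_
        rw [← ENNReal.rpow_natCast]
        rcases (t n).eq_empty_or_nonempty with h | h
        · simp [h, hs0]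
        · simp [h]
    _ = c * ∑' n, ⨆ _ : (t n).Nonempty, ediam (t n) ^ (s : ℝ) := ENNReal.tsum_mul_left
    _ ≤ (c + 1) * ∑' n, ⨆ _ : (t n).Nonempty, ediam (t n) ^ (s : ℝ) := by
        gcongr; exact le_self_add
    _ < (c + 1) * (ε / (c + 1)) := by
        exact ENNReal.mul_lt_mul_right (by simp) (by simp [hctop]) hsum
    _ ≤ ε := ENNReal.mul_div_le

/-- A family of curves `a τ` with parameter domain `T` of dimension `s + 2`, which at each point of
the circle is bi-Lipschitz in the parameter from below: the parameters whose curve avoids an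
`s`-null set form a connected nonempty set. -/
theorem avoid_preconnected [MeasurableSpace Y] [BorelSpace Y] {T : Set X} (hT : IsOpen T)
    (hTc : Convex ℝ T) (hTne : T.Nonempty) {a : X → ℂ → Y} {C : ℝ} (hC : 0 ≤ C)
    (h1 : ∀ τ ∈ T, ∀ τ' ∈ T, ∀ σ ∈ sphere (0 : ℂ) 1, ‖τ - τ'‖ ≤ C * dist (a τ σ) (a τ' σ))
    (h2 : ∀ τ ∈ T, ∀ σ ∈ sphere (0 : ℂ) 1, ∀ σ' ∈ sphere (0 : ℂ) 1,
      dist (a τ σ) (a τ σ') ≤ C * dist σ σ')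
    {s : ℕ} (hs : Module.finrank ℝ X = s + 2) (hs0 : s ≠ 0) {K : Set Y} (hK : μH[(s : ℝ)] K = 0)
    (hopen : IsOpen {τ | τ ∈ T ∧ ∀ σ ∈ sphere (0 : ℂ) 1, a τ σ ∉ K}) :
    {τ | τ ∈ T ∧ ∀ σ ∈ sphere (0 : ℂ) 1, a τ σ ∉ K}.Nonempty ∧
    IsPreconnected {τ | τ ∈ T ∧ ∀ σ ∈ sphere (0 : ℂ) 1, a τ σ ∉ K} := by
  let ν : Measure X := Measure.addHaar
  let e : ℝ → ℂ := fun θ => Complex.exp ((2 * Real.pi * θ : ℝ) * I)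
  have he : ∀ θ, e θ ∈ sphere (0 : ℂ) 1 := fun θ => by
    rw [mem_sphere_zero_iff_norm]; exact Complex.norm_exp_ofReal_mul_I _
  have hsurj : ∀ σ ∈ sphere (0 : ℂ) 1, ∃ θ ∈ Icc (0 : ℝ) 1, e θ = σ := by
    intro σ hσ
    rw [mem_sphere_zero_iff_norm] at hσ
    obtain ⟨t, ht, hts⟩ : ∃ t ∈ Ico (0 : ℝ) (2 * Real.pi), Complex.exp (t * I) = σ := by
      refine ⟨toIcoMod Real.two_pi_pos 0 σ.arg, ?_, ?_⟩
      · simpa using toIcoMod_mem_Ico Real.two_pi_pos 0 σ.arg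
      · rw [toIcoMod]
        have := Complex.norm_mul_exp_arg_mul_I σ
        rw [hσ, Complex.ofReal_one, one_mul] at this
        refine Eq.trans ?_ this
        push_cast
        rw [Complex.exp_eq_exp_iff_exists_int]
        exact ⟨-toIcoDiv Real.two_pi_pos 0 σ.arg, by push_cast; simp; ring⟩
    have hpi := Real.two_pi_pos
    refine ⟨t / (2 * Real.pi), ⟨by have := ht.1; positivity, ?_⟩, ?_⟩
    · rw [div_le_one hpi]; exact ht.2.le
    · simp only [e]
      rw [mul_div_cancel₀ _ hpi.ne']
      exact hts
  have heLip : ∀ θ θ', dist (e θ) (e θ') ≤ 2 * Real.pi * |θ - θ'| := by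
    intro θ θ'
    have hlip := Real.norm_exp_I_mul_ofReal_sub_one_le (x := 2 * Real.pi * (θ - θ'))
    have : e θ - e θ' = e θ' * (Complex.exp (I * (2 * Real.pi * (θ - θ') : ℝ)) - 1) := by
      simp only [e]
      rw [mul_sub, ← Complex.exp_add, mul_one]
      congr 2
      push_cast; ring
    rw [dist_eq_norm, this, norm_mul, mem_sphere_zero_iff_norm.1 (he θ'), one_mul]
    refine hlip.trans (le_of_eq ?_)
    rw [Real.norm_eq_abs, abs_mul, abs_of_pos Real.two_pi_pos]
  have key : ∀ p w : X, ν {v | ∃ q : ℝ × ℝ, (q ∈ Icc (0 : ℝ) 1 ×ˢ Icc (0 : ℝ) 1 ∧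
      p + v + q.1 • w ∈ T) ∧ a (p + v + q.1 • w) (e q.2) ∈ K} = 0 := by
    intro p w
    refine measure_hit_eq_zero (μ := ν) (Z := {x : X × (ℝ × ℝ) |
      x.2 ∈ Icc (0 : ℝ) 1 ×ˢ Icc (0 : ℝ) 1 ∧ p + x.1 + x.2.1 • w ∈ T})
      (G := fun v q => a (p + v + q.1 • w) (e q.2)) (C := C + C * C * (2 * Real.pi) + ‖w‖) ?_
      (fun x hx => hx.1) ?_ hs hs0 hK
    · have := Real.pi_pos; positivity
    · rintro ⟨v, q⟩ ⟨-, hx⟩ ⟨v', q'⟩ ⟨-, hx'⟩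
      simp only at hx hx' ⊢
      set τ := p + v + q.1 • w
      set τ' := p + v' + q'.1 • w
      have e1 : v - v' = (τ - τ') - (q.1 - q'.1) • w := by
        simp only [τ, τ', sub_smul]; abel
      have e2 := h1 τ hx τ' hx' (e q.2) (he _)
      have e3 := h2 τ' hx' (e q'.2) (he _) (e q.2) (he _)
      have e4 := dist_triangle (a τ (e q.2)) (a τ' (e q'.2)) (a τ' (e q.2))
      have e5 : |q.1 - q'.1| ≤ dist q q' := le_max_left _ _
      have e6 : |q.2 - q'.2| ≤ dist q q' := le_max_right _ _
      have e7 : ‖(q.1 - q'.1) • w‖ ≤ dist q q' * ‖w‖ := by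
        rw [norm_smul, Real.norm_eq_abs]; gcongr
      have e8 : dist (e q'.2) (e q.2) ≤ 2 * Real.pi * dist q q' := by
        rw [dist_comm]
        exact (heLip _ _).trans (by have := Real.pi_pos; gcongr)
      have e9 : C * dist (a τ (e q.2)) (a τ' (e q.2)) ≤
          C * (dist (a τ (e q.2)) (a τ' (e q'.2)) + C * (2 * Real.pi * dist q q')) := by
        gcongr
        exact e4.trans (by gcongr; exact e3.trans (by gcongr))
      rw [e1]
      have hn := norm_sub_le (τ - τ') ((q.1 - q'.1) • w)
      have hd0 : 0 ≤ dist (a τ (e q.2)) (a τ' (e q'.2)) := dist_nonneg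
      have hq0 : 0 ≤ dist q q' := dist_nonneg
      have hpi := Real.pi_pos
      have p1 : 0 ≤ (C * C * (2 * Real.pi) + ‖w‖) * dist (a τ (e q.2)) (a τ' (e q'.2)) := by
        positivity
      have p2 : 0 ≤ C * dist q q' := by positivity
      nlinarith
  have hdense : ∀ S : Set X, ν S = 0 → ∀ x : X, ∀ r > 0, ∃ v ∈ ball x r, v ∉ S := by
    intro S hS x r hr
    by_contra! hcon
    have : ν (ball x r) ≤ 0 := hS ▸ measure_mono hcon
    exact (measure_ball_pos ν x hr).not_ge this
  constructor
  · obtain ⟨τ, hτ⟩ := hTne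
    obtain ⟨r, hr, hrT⟩ := Metric.isOpen_iff.1 hT τ hτ
    obtain ⟨v, hv, hvS⟩ := hdense _ (key 0 0) τ r hr
    refine ⟨v, hrT hv, fun σ hσ hK => hvS ?_⟩
    obtain ⟨θ, hθ, rfl⟩ := hsurj σ hσ
    refine ⟨(0, θ), ⟨⟨by simp, hθ⟩, ?_⟩, ?_⟩
    · simpa using hrT hv
    · simpa using hK
  · refine isPreconnected_of_forall_pair fun α hα β hβ => ?_
    obtain ⟨r, hr, hrα⟩ := Metric.isOpen_iff.1 hopen α hα
    obtain ⟨r', hr', hrβ⟩ := Metric.isOpen_iff.1 hopen β hβ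
    obtain ⟨v, hv, hvS⟩ := hdense _ (key α (β - α)) 0 (min r r') (lt_min hr hr')
    rw [mem_ball_zero_iff, lt_min_iff] at hv
    have hαv : α + v ∈ ball α r := by simpa [mem_ball, dist_eq_norm] using hv.1
    have hβv : β + v ∈ ball β r' := by simpa [mem_ball, dist_eq_norm] using hv.2
    refine ⟨segment ℝ α (α + v) ∪ segment ℝ (α + v) (β + v) ∪ segment ℝ (β + v) β, ?_,
      Or.inl (Or.inl (left_mem_segment _ _ _)), Or.inr (right_mem_segment _ _ _), ?_⟩
    · refine union_subset (union_subset ?_ ?_) ?_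
      · exact ((convex_ball α r).segment_subset (mem_ball_self hr) hαv).trans hrα
      · intro τ hτ
        have hτT : τ ∈ T := hTc.segment_subset (hrα hαv).1 (hrβ hβv).1 hτ
        refine ⟨hτT, fun σ hσ hK => hvS ?_⟩
        obtain ⟨θ, hθ, rfl⟩ := hsurj σ hσ
        rw [segment_eq_image'] at hτ
        obtain ⟨t, ht, rfl⟩ := hτ
        have : α + v + t • (β + v - (α + v)) = α + v + t • (β - α) := by simp
        simp only [this] at hτT hK
        exact ⟨(t, θ), ⟨⟨ht, hθ⟩, hτT⟩, hK⟩
      · exact ((convex_ball β r').segment_subset hβv (mem_ball_self hr')).trans hrβ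
    · refine IsPreconnected.union (β + v) (Or.inr (right_mem_segment _ _ _))
        (left_mem_segment _ _ _) (IsPreconnected.union (α + v) (right_mem_segment _ _ _)
          (left_mem_segment _ _ _) ?_ ?_) ?_
      all_goals exact (convex_segment _ _).isPreconnected
end Avoid

section Piola
variable {ι : Type*} [Fintype ι] [DecidableEq ι]
  {V : Type*} [NormedAddCommGroup V] [NormedSpace ℝ V]

/-- The determinant as a continuous real-multilinear function of the rows. -/
noncomputable def detMulti (ι : Type*) [Fintype ι] [DecidableEq ι] :
    ContinuousMultilinearMap ℝ (fun _ : ι => ι → ℂ) ℂ where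
  toMultilinearMap := (Matrix.detRowAlternating (n := ι) (R := ℂ)).toMultilinearMap.restrictScalars ℝ
  cont := Continuous.matrix_det (A := fun r : ι → ι → ℂ => (r : Matrix ι ι ℂ)) continuous_id

theorem detMulti_apply (r : ι → ι → ℂ) : detMulti ι r = Matrix.det (r : Matrix ι ι ℂ) := rfl

/-- The Jacobian of `Z` along the directions `e k`. -/
noncomputable def jac (e : ι → V) (Z : V → ι → ℂ) (w : V) : ℂ :=
  detMulti ι fun k => fderiv ℝ Z w (e k)

/-- The Jacobian of `Z` with the direction `e k` replaced by `v`. -/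
noncomputable def cof (e : ι → V) (v : V) (Z : V → ι → ℂ) (k : ι) (w : V) : ℂ :=
  jac (Function.update e k v) Z w

variable {Z : V → ι → ℂ}

theorem contDiff_jac (hZ : ContDiff ℝ 2 Z) (e : ι → V) : ContDiff ℝ 1 (jac e Z) := by
  refine (detMulti ι).contDiff.comp (contDiff_pi.2 fun k => ?_)
  exact (hZ.fderiv_right (m := 1) (by norm_num)).clm_apply contDiff_const

theorem fderiv_jac (hZ : ContDiff ℝ 2 Z) (e : ι → V) (w x : V) :
    fderiv ℝ (jac e Z) w x = ∑ l, detMulti ι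
      (Function.update (fun k => fderiv ℝ Z w (e k)) l (fderiv ℝ (fderiv ℝ Z) w x (e l))) := by
  have h1 : HasFDerivAt (fun w => fun k => fderiv ℝ Z w (e k))
      (ContinuousLinearMap.pi fun k => (fderiv ℝ (fderiv ℝ Z) w).flip (e k)) w := by
    refine hasFDerivAt_pi.2 fun k => ?_
    have h2 : HasFDerivAt (fderiv ℝ Z) (fderiv ℝ (fderiv ℝ Z) w) w :=
      ((hZ.fderiv_right (m := 1) (by norm_num)).differentiable (by norm_num) w).hasFDerivAt
    have := h2.clm_apply (hasFDerivAt_const (e k) w)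
    simpa using this
  have h3 := ((detMulti ι).hasFDerivAt (fun k => fderiv ℝ Z w (e k))).comp w h1
  have : jac e Z = (fun x => detMulti ι x) ∘ (fun w k => fderiv ℝ Z w (e k)) := rfl
  rw [this, h3.fderiv]
  simp [ContinuousMultilinearMap.linearDeriv_apply]

theorem detMulti_swap (r : ι → ι → ℂ) {i j : ι} (hij : i ≠ j) (a b : ι → ℂ) :
    detMulti ι (Function.update (Function.update r i a) j b)
      = -detMulti ι (Function.update (Function.update r i b) j a) := by
  have := (Matrix.detRowAlternating (n := ι) (R := ℂ)).map_swap
    (Function.update (Function.update r i b) j a) hij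
  have e : (Function.update (Function.update r i b) j a) ∘ Equiv.swap i j
      = Function.update (Function.update r i a) j b := by
    funext k
    by_cases h1 : k = i
    · subst h1; simp [hij]
    · by_cases h2 : k = j
      · subst h2; simp [hij]
      · simp [h1, h2, Equiv.swap_apply_of_ne_of_ne]
  rw [e] at this
  exact this

theorem fderiv_jac_eq_sum_cof (hZ : ContDiff ℝ 2 Z) (e : ι → V) (v w : V) :
    fderiv ℝ (jac e Z) w v = ∑ k, fderiv ℝ (cof e v Z k) w (e k) := by
  have hsymm : ∀ x y, fderiv ℝ (fderiv ℝ Z) w x y = fderiv ℝ (fderiv ℝ Z) w y x := fun x y =>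
    (hZ.contDiffAt.isSymmSndFDerivAt (by simp)).eq x y
  set r : ι → ι → ℂ := fun k => fderiv ℝ Z w (e k) with hr
  set T : ι → ι → ℂ := fun k l => detMulti ι
    (Function.update (Function.update r k (fderiv ℝ Z w v)) l
      (fderiv ℝ (fderiv ℝ Z) w (e k) (Function.update e k v l))) with hT
  have hco : ∀ k, fderiv ℝ (cof e v Z k) w (e k) = ∑ l, T k l := by
    intro k
    have : cof e v Z k = jac (Function.update e k v) Z := rfl
    rw [this, fderiv_jac hZ]
    refine sum_congr rfl fun l _ => ?_
    rw [hT]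
    congr 2
    funext m
    by_cases h : m = k
    · subst h; simp
    · simp [h, hr]
  simp_rw [hco]
  rw [fderiv_jac hZ]
  have hdiag : ∀ k, T k k = detMulti ι
      (Function.update r k (fderiv ℝ (fderiv ℝ Z) w v (e k))) := by
    intro k
    simp [hT, hsymm (e k) v]
  have hanti : ∀ k l, k ≠ l → T k l = -T l k := by
    intro k l hkl
    simp only [hT]
    rw [Function.update_of_ne hkl.symm, Function.update_of_ne hkl, detMulti_swap r hkl,
      Function.update_comm hkl, hsymm (e k) (e l)]
  have hsum : ∑ k, ∑ l, (if k = l then 0 else T k l) = 0 := by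
    have h1 : ∑ k, ∑ l, (if k = l then 0 else T k l)
        = -∑ k, ∑ l, (if k = l then 0 else T k l) := by
      conv_rhs => rw [Finset.sum_comm]
      simp_rw [← Finset.sum_neg_distrib]
      refine sum_congr rfl fun k _ => sum_congr rfl fun l _ => ?_
      by_cases h : k = l
      · simp [h]
      · rw [if_neg h, if_neg (Ne.symm h), hanti k l h]
    exact self_eq_neg.1 h1
  have hsplit : ∀ k, ∑ l, T k l = T k k + ∑ l, (if k = l then 0 else T k l) := by
    intro k
    have : ∀ l, T k l = (if k = l then T k k else 0) + (if k = l then 0 else T k l) := by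
      intro l; by_cases h : k = l
      · subst h; simp
      · simp [h]
    rw [sum_congr rfl fun l _ => this l, sum_add_distrib]
    simp
  simp_rw [hsplit, sum_add_distrib, hsum, add_zero, hdiag]
  rfl

theorem sum_cof_smul (e : ι → V) (v w : V) :
    ∑ k, cof e v Z k w • fderiv ℝ Z w (e k) = jac e Z w • fderiv ℝ Z w v := by
  let A : Matrix ι ι ℂ := Matrix.of fun k => fderiv ℝ Z w (e k)
  have h := Matrix.mulVec_cramer A.transpose (fderiv ℝ Z w v)
  have hc : ∀ k, Matrix.cramer A.transpose (fderiv ℝ Z w v) k = cof e v Z k w := by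
    intro k
    rw [Matrix.cramer_transpose_apply, cof, jac, detMulti_apply]
    congr 1
    ext i j
    by_cases hi : i = k
    · subst hi; simp
    · simp [hi, A]
  have hd : A.transpose.det = jac e Z w := by rw [Matrix.det_transpose]; rfl
  rw [hd] at h
  rw [← h]
  ext j
  simp [Matrix.mulVec, dotProduct, hc, A, mul_comm]

/-- The conservation law satisfied by `Φ · jac` when `Φ` is a CR function on the image of `Z`. -/
theorem fderiv_mul_jac (hZ : ContDiff ℝ 2 Z) (e : ι → V) (v w : V) {Φ : V → ℂ}
    (hΦ : DifferentiableAt ℝ Φ w)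
    (hCR : jac e Z w * fderiv ℝ Φ w v = ∑ k, cof e v Z k w * fderiv ℝ Φ w (e k)) :
    fderiv ℝ (fun w => Φ w * jac e Z w) w v
      = ∑ k, fderiv ℝ (fun w => Φ w * cof e v Z k w) w (e k) := by
  have hj : DifferentiableAt ℝ (jac e Z) w := (contDiff_jac hZ e).differentiable (by norm_num) w
  have hc : ∀ k, DifferentiableAt ℝ (cof e v Z k) w := fun k =>
    (contDiff_jac hZ _).differentiable (by norm_num) w
  rw [fderiv_fun_mul hΦ hj]
  simp_rw [fun k => fderiv_fun_mul hΦ (hc k)]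
  simp only [add_apply, smul_apply, smul_eq_mul]
  rw [hCR, fderiv_jac_eq_sum_cof hZ, mul_sum, ← sum_add_distrib]
end Piola

section HomotopyFormula
variable {ι : Type*} [Fintype ι]

variable {Z : (ι → ℝ) × ℝ → ι → ℂ} {χ : (ι → ℝ) → ℂ}

theorem hasDerivAt_integral_mul (hχ : Continuous χ) (hχc : HasCompactSupport χ)
    {Ψ : (ι → ℝ) × ℝ → ℂ} (hΨ : ContDiff ℝ 1 Ψ) (s : ℝ) :
    HasDerivAt (fun s => ∫ u, χ u * Ψ (u, s)) (∫ u, χ u * fderiv ℝ Ψ (u, s) (0, 1)) s := by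
  have hc' : Continuous fun w => fderiv ℝ Ψ w (0, 1) :=
    (hΨ.continuous_fderiv (by norm_num)).clm_apply continuous_const
  obtain ⟨C, hC⟩ := (hχc.isCompact.prod (isCompact_closedBall s 1)).exists_bound_of_continuousOn
    hc'.continuousOn
  have hInt : ∀ f : (ι → ℝ) → ℂ, Continuous f → Integrable (fun u => χ u * f u) := fun f hf =>
    (hχ.mul hf).integrable_of_hasCompactSupport hχc.mul_right
  refine (hasDerivAt_integral_of_dominated_loc_of_deriv_le (bound := fun u => ‖χ u‖ * C)
    (F' := fun s u => χ u * fderiv ℝ Ψ (u, s) (0, 1))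
    (ball_mem_nhds s one_pos) ?_ ?_ ?_ ?_ ?_ ?_).2
  · exact Eventually.of_forall fun s => (hχ.mul (by fun_prop)).aestronglyMeasurable
  · exact hInt _ (by fun_prop)
  · exact (hχ.mul (hc'.comp (by fun_prop))).aestronglyMeasurable
  · refine Eventually.of_forall fun u s' hs' => ?_
    by_cases hu : u ∈ tsupport χ
    · rw [norm_mul]
      exact mul_le_mul_of_nonneg_left (hC (u, s') ⟨hu, ball_subset_closedBall hs'⟩) (norm_nonneg _)
    · simp [image_eq_zero_of_notMem_tsupport hu]
  · exact (((hχ.norm).integrable_of_hasCompactSupport hχc.norm)).mul_const C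
  · refine Eventually.of_forall fun u s' _ => ?_
    have h1 : HasFDerivAt Ψ (fderiv ℝ Ψ (u, s')) (u, s') :=
      (hΨ.differentiable (by norm_num) _).hasFDerivAt
    have h2 : HasDerivAt (fun s : ℝ => (u, s)) ((0 : ι → ℝ), (1 : ℝ)) s' :=
      (hasDerivAt_const s' u).prodMk (hasDerivAt_id s')
    exact (h1.comp_hasDerivAt s' h2).const_mul (χ u)

variable [DecidableEq ι]

/-- The coordinate directions of `(ι → ℝ) × ℝ`. -/
def eR (k : ι) : (ι → ℝ) × ℝ := (Pi.single k 1, 0)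

theorem homotopy_bound (hχ : ContDiff ℝ 1 χ) (hχc : HasCompactSupport χ) (hZ : ContDiff ℝ 2 Z)
    {Φ : (ι → ℝ) × ℝ → ℂ} (hΦ : ContDiff ℝ 1 Φ)
    (hCR : ∀ u ∈ tsupport χ, ∀ s ∈ Icc (0 : ℝ) 1, jac eR Z (u, s) * fderiv ℝ Φ (u, s) (0, 1)
      = ∑ k, cof eR (0, 1) Z k (u, s) * fderiv ℝ Φ (u, s) (eR k))
    {C : ℝ} (hC : ∀ u ∈ tsupport χ, ∀ s ∈ Icc (0 : ℝ) 1,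
      ‖∑ k, fderiv ℝ χ u (Pi.single k 1) * (Φ (u, s) * cof eR (0, 1) Z k (u, s))‖ ≤ C) :
    ‖(∫ u, χ u * (Φ (u, 1) * jac eR Z (u, 1))) - ∫ u, χ u * (Φ (u, 0) * jac eR Z (u, 0))‖
      ≤ C * volume.real (tsupport χ) := by
  have hJ := contDiff_jac hZ eR
  have hV : ∀ k, ContDiff ℝ 1 (fun w => Φ w * cof eR (0, 1) Z k w) := fun k =>
    hΦ.mul (contDiff_jac hZ _)
  have hder : ∀ s ∈ Icc (0 : ℝ) 1, HasDerivWithinAt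
      (fun s => ∫ u, χ u * (Φ (u, s) * jac eR Z (u, s)))
      (∫ u, χ u * fderiv ℝ (fun w => Φ w * jac eR Z w) (u, s) (0, 1)) (Icc 0 1) s := fun s _ =>
    (hasDerivAt_integral_mul hχ.continuous hχc (hΦ.mul hJ) s).hasDerivWithinAt
  have := (norm_image_sub_le_of_norm_deriv_le_segment' (C := C * volume.real (tsupport χ)) hder ?_)
    1 (right_mem_Icc.2 zero_le_one)
  · simpa using this
  intro s hs
  have hs' : s ∈ Icc (0 : ℝ) 1 := Ico_subset_Icc_self hs
  have hslice : ∀ k u, fderiv ℝ (fun u => Φ (u, s) * cof eR (0, 1) Z k (u, s)) u (Pi.single k 1)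
      = fderiv ℝ (fun w => Φ w * cof eR (0, 1) Z k w) (u, s) (eR k) := by
    intro k u
    have h1 := ((hV k).differentiable (by norm_num) (u, s)).hasFDerivAt
    have h2 : HasFDerivAt (fun u : ι → ℝ => (u, s)) (inl ℝ (ι → ℝ) ℝ) u :=
      hasFDerivAt_prodMk_left u s
    have := (h1.comp u h2).fderiv
    rw [Function.comp_def] at this
    rw [this]
    rfl
  have hfd : Continuous (fderiv ℝ χ) := hχ.continuous_fderiv (by norm_num)
  have e1 : ∫ u, χ u * fderiv ℝ (fun w => Φ w * jac eR Z w) (u, s) (0, 1)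
      = -∫ u, ∑ k, fderiv ℝ χ u (Pi.single k 1) * (Φ (u, s) * cof eR (0, 1) Z k (u, s)) := by
    have e2 : ∀ u, χ u * fderiv ℝ (fun w => Φ w * jac eR Z w) (u, s) (0, 1)
        = ∑ k, χ u * fderiv ℝ (fun u => Φ (u, s) * cof eR (0, 1) Z k (u, s)) u (Pi.single k 1) := by
      intro u
      by_cases hu : u ∈ tsupport χ
      · rw [fderiv_mul_jac hZ eR (0, 1) (u, s) (hΦ.differentiable (by norm_num) _) (hCR u hu s hs'),
          mul_sum]
        simp_rw [hslice]
      · simp [image_eq_zero_of_notMem_tsupport hu]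
    have hsl : ∀ k, ContDiff ℝ 1 (fun u => Φ (u, s) * cof eR (0, 1) Z k (u, s)) := fun k =>
      (hV k).comp (contDiff_prodMk_left s)
    have hi1 : ∀ k, Integrable fun u : ι → ℝ => χ u *
        fderiv ℝ (fun u => Φ (u, s) * cof eR (0, 1) Z k (u, s)) u (Pi.single k 1) := fun k =>
      (hχ.continuous.mul (((hsl k).continuous_fderiv (by norm_num)).clm_apply
        continuous_const)).integrable_of_hasCompactSupport hχc.mul_right
    have hi2 : ∀ k, Integrable fun u : ι → ℝ => fderiv ℝ χ u (Pi.single k 1) *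
        (Φ (u, s) * cof eR (0, 1) Z k (u, s)) := fun k =>
      ((hfd.clm_apply continuous_const).mul
        (hsl k).continuous).integrable_of_hasCompactSupport
        ((hχc.fderiv_apply ℝ (Pi.single k 1)).mul_right)
    have hi3 : ∀ k, Integrable fun u : ι → ℝ => χ u *
        (Φ (u, s) * cof eR (0, 1) Z k (u, s)) := fun k =>
      (hχ.continuous.mul (hsl k).continuous).integrable_of_hasCompactSupport hχc.mul_right
    simp_rw [e2]
    rw [integral_finsetSum _ fun k _ => hi1 k, integral_finsetSum _ fun k _ => hi2 k,
      ← Finset.sum_neg_distrib]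
    refine sum_congr rfl fun k _ => ?_
    exact integral_mul_fderiv_eq_neg_fderiv_mul_of_integrable (hi2 k) (hi1 k) (hi3 k)
      (fun u _ => hχ.differentiable (by norm_num) u)
      (fun u _ => (hsl k).differentiable (by norm_num) u)
  rw [e1, norm_neg]
  have e3 : ∫ u, ∑ k, fderiv ℝ χ u (Pi.single k 1) * (Φ (u, s) * cof eR (0, 1) Z k (u, s))
      = ∫ u in tsupport χ, ∑ k, fderiv ℝ χ u (Pi.single k 1) *
        (Φ (u, s) * cof eR (0, 1) Z k (u, s)) := by
    rw [setIntegral_eq_integral_of_forall_compl_eq_zero]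
    intro u hu
    have : fderiv ℝ χ u = 0 :=
      image_eq_zero_of_notMem_tsupport fun h => hu (tsupport_fderiv_subset ℝ h)
    simp [this]
  rw [e3]
  exact norm_setIntegral_le_of_norm_le_const hχc.isCompact.measure_lt_top fun u hu => hC u hu s hs'
end HomotopyFormula

section Gauss
variable {ι : Type*} [Fintype ι]

/-- The complex Gaussian exponent `-μ² ∑ (ζ_j - z_j)²`. -/
noncomputable def gexp (μ : ℝ) (ζ z : ι → ℂ) : ℂ := Complex.exp (-(μ : ℂ) ^ 2 * ∑ j, (ζ j - z j) ^ 2)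

theorem norm_gexp_le {μ : ℝ} {ζ z : ι → ℂ} {c : ℝ} (hc : c ≤ ∑ j, ((ζ j - z j) ^ 2).re) :
    ‖gexp μ ζ z‖ ≤ exp (-μ ^ 2 * c) := by
  rw [gexp, Complex.norm_exp]
  have : (-(μ : ℂ) ^ 2 * ∑ j, (ζ j - z j) ^ 2).re = -μ ^ 2 * ∑ j, ((ζ j - z j) ^ 2).re := by
    rw [← Complex.re_sum, ← re_ofReal_mul]
    push_cast
    rfl
  rw [this]
  exact Real.exp_le_exp.2 (by nlinarith [sq_nonneg μ])

theorem hasFDerivAt_gexp_right (μ : ℝ) (ζ z : ι → ℂ) :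
    HasFDerivAt (gexp μ ζ) (gexp μ ζ z • ∑ j, (2 * (μ : ℂ) ^ 2 * (ζ j - z j)) •
      (proj j : (ι → ℂ) →L[ℂ] ℂ)) z := by
  have h1 : ∀ j, HasFDerivAt (fun z : ι → ℂ => (ζ j - z j) ^ 2)
      ((2 * (ζ j - z j)) • (-(proj j : (ι → ℂ) →L[ℂ] ℂ))) z := fun j => by
    have := ((hasFDerivAt_apply (𝕜 := ℂ) j z).const_sub (ζ j)).pow 2
    simpa using this
  have h2 := ((HasFDerivAt.fun_sum fun j (_ : j ∈ Finset.univ) => h1 j).const_mul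
    (-(μ : ℂ) ^ 2)).cexp
  refine h2.congr_fderiv ?_
  rw [gexp]
  congr 1
  rw [Finset.smul_sum]
  refine sum_congr rfl fun j _ => ?_
  ext v
  simp
  ring

theorem gexp_symm (μ : ℝ) (ζ z : ι → ℂ) : gexp μ ζ z = gexp μ z ζ := by
  unfold gexp
  congr 2
  exact sum_congr rfl fun j _ => by ring

theorem contDiff_gexp (μ : ℝ) (ζ : ι → ℂ) : ContDiff ℝ 2 (gexp μ ζ) := by
  unfold gexp
  fun_prop

theorem differentiable_integral_gexp {g : (ι → ℝ) → ℂ} (hg : Continuous g)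
    (hgc : HasCompactSupport g) {z : (ι → ℝ) → ι → ℂ} (hz : Continuous z) (μ : ℝ) :
    Differentiable ℂ fun ζ => ∫ u, g u * gexp μ ζ (z u) := by
  intro ζ₀
  set D : (ι → ℂ) → (ι → ℝ) → ((ι → ℂ) →L[ℂ] ℂ) := fun ζ u =>
    g u • (gexp μ (z u) ζ • ∑ j, (2 * (μ : ℂ) ^ 2 * (z u j - ζ j)) •
      (proj j : (ι → ℂ) →L[ℂ] ℂ)) with hD
  have hcE : Continuous fun q : (ι → ℂ) × (ι → ℝ) => gexp μ q.1 (z q.2) := by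
    unfold gexp; fun_prop
  have hcE' : Continuous fun q : (ι → ℂ) × (ι → ℝ) => gexp μ (z q.2) q.1 := by
    unfold gexp; fun_prop
  have hcD : Continuous fun q : (ι → ℂ) × (ι → ℝ) => D q.1 q.2 := by
    refine (hg.comp continuous_snd).smul (hcE'.smul (continuous_finsetSum _ fun j _ => ?_))
    fun_prop
  obtain ⟨C, hC⟩ := ((isCompact_closedBall ζ₀ 1).prod hgc.isCompact).exists_bound_of_continuousOn
    hcD.continuousOn
  have hdf : ∀ ζ u, HasFDerivAt (fun ζ => g u * gexp μ ζ (z u)) (D ζ u) ζ := fun ζ u => by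
    have := (hasFDerivAt_gexp_right μ (z u) ζ).const_mul (g u)
    refine this.congr_of_eventuallyEq (Eventually.of_forall fun ζ => ?_)
    simp only [gexp_symm μ ζ (z u)]
  have hInt : Integrable fun u => g u * gexp μ ζ₀ (z u) :=
    (hg.mul (hcE.comp (by fun_prop : Continuous fun u => (ζ₀, u)))).integrable_of_hasCompactSupport
      hgc.mul_right
  refine (hasFDerivAt_integral_of_dominated_of_fderiv_le (𝕜 := ℂ) (F' := D)
    (bound := (tsupport g).indicator fun _ => C) (ball_mem_nhds ζ₀ one_pos) ?_ hInt ?_ ?_ ?_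
    ?_).differentiableAt
  · exact Eventually.of_forall fun ζ => (hg.mul (hcE.comp
      (by fun_prop : Continuous fun u => (ζ, u)))).aestronglyMeasurable
  · exact (hcD.comp (by fun_prop : Continuous fun u => (ζ₀, u))).aestronglyMeasurable
  · refine Eventually.of_forall fun u ζ hζ => ?_
    by_cases hu : u ∈ tsupport g
    · rw [indicator_of_mem hu]
      exact hC (ζ, u) ⟨ball_subset_closedBall hζ, hu⟩
    · rw [indicator_of_notMem hu]
      simp [hD, image_eq_zero_of_notMem_tsupport hu]
  · exact (integrable_indicator_iff hgc.isCompact.measurableSet).2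
      (integrableOn_const hgc.isCompact.measure_lt_top.ne)
  · exact Eventually.of_forall fun u ζ _ => hdf ζ u

/-! ### Real Gaussian estimates -/

theorem norm_sq_le_sum_sq (u : ι → ℝ) : ‖u‖ ^ 2 ≤ ∑ j, u j ^ 2 := by
  have h0 : 0 ≤ ∑ j, u j ^ 2 := Finset.sum_nonneg fun j _ => sq_nonneg _
  have : ‖u‖ ≤ Real.sqrt (∑ j, u j ^ 2) := by
    refine (pi_norm_le_iff_of_nonneg (Real.sqrt_nonneg _)).2 fun j => ?_
    refine Real.le_sqrt_of_sq_le ?_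
    rw [Real.norm_eq_abs, sq_abs]
    exact Finset.single_le_sum (f := fun j => u j ^ 2) (fun j _ => sq_nonneg _) (Finset.mem_univ j)
  calc ‖u‖ ^ 2 ≤ Real.sqrt (∑ j, u j ^ 2) ^ 2 := by gcongr
    _ = _ := Real.sq_sqrt h0

theorem integrable_gauss {b : ℝ} (hb : 0 < b) :
    Integrable fun u : ι → ℝ => exp (-b * ∑ j, u j ^ 2) := by
  have : (fun u : ι → ℝ => exp (-b * ∑ j, u j ^ 2))
      = fun u => ∏ j, exp (-b * u j ^ 2) := by
    funext u
    rw [mul_sum, Real.exp_sum]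
  rw [this]
  exact Integrable.fintype_prod (f := fun _ x => exp (-b * x ^ 2))
    fun _ => integrable_exp_neg_mul_sq hb

theorem norm_mul_gauss_le (u : ι → ℝ) :
    ‖u‖ * exp (-(3 / 4) * ∑ j, u j ^ 2) ≤ exp (-(1 / 2) * ∑ j, u j ^ 2) := by
  have h1 : ‖u‖ ≤ exp (1 / 4 * ∑ j, u j ^ 2) := by
    have := Real.add_one_le_exp (1 / 4 * ∑ j, u j ^ 2)
    nlinarith [norm_sq_le_sum_sq u, sq_nonneg (‖u‖ - 2)]
  calc _ ≤ exp (1 / 4 * ∑ j, u j ^ 2) * exp (-(3 / 4) * ∑ j, u j ^ 2) := by gcongr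
    _ = _ := by rw [← Real.exp_add]; congr 1; ring

theorem integrable_norm_mul_gauss :
    Integrable fun u : ι → ℝ => ‖u‖ * exp (-(3 / 4) * ∑ j, u j ^ 2) := by
  refine (integrable_gauss (ι := ι) (b := 1 / 2) (by norm_num)).mono'
    (by fun_prop) (Eventually.of_forall fun u => ?_)
  rw [norm_of_nonneg (by positivity)]
  exact norm_mul_gauss_le u

/-- Rescaling an integral around a point. -/
theorem integral_rescale {F : Type*} [NormedAddCommGroup F] [NormedSpace ℝ F] (f : (ι → ℝ) → F)
    {μ : ℝ} (hμ : 0 < μ) (u₁ : ι → ℝ) :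
    μ ^ Fintype.card ι • ∫ u, f (μ • (u - u₁)) = ∫ u, f u := by
  have h1 := integral_sub_right_eq_self (μ := volume) (fun u => f (μ • u)) u₁
  have h2 := Measure.integral_comp_smul_of_nonneg volume f μ (hR := hμ.le)
  rw [h1, h2, Module.finrank_fintype_fun_eq_card, smul_smul, mul_inv_cancel₀ (by positivity),
    one_smul]

variable [DecidableEq ι]

theorem gauss_homotopy_aux {Z : (ι → ℝ) × ℝ → ι → ℂ} (hZ : ContDiff ℝ 2 Z)
    {φ : (ι → ℝ) × ℝ → ℂ} (hφ : ContDiff ℝ 1 φ) (μ : ℝ) (ζ : ι → ℂ) (w : (ι → ℝ) × ℝ)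
    (hCR : jac eR Z w * fderiv ℝ φ w (0, 1) = ∑ k, cof eR (0, 1) Z k w * fderiv ℝ φ w (eR k)) :
    jac eR Z w * fderiv ℝ (fun w => φ w * gexp μ ζ (Z w)) w (0, 1)
      = ∑ k, cof eR (0, 1) Z k w * fderiv ℝ (fun w => φ w * gexp μ ζ (Z w)) w (eR k) := by
  have hd : HasFDerivAt (fun w => gexp μ ζ (Z w)) _ w :=
    ((hasFDerivAt_gexp_right μ ζ (Z w)).restrictScalars ℝ).comp w
      (hZ.differentiable (by norm_num) w).hasFDerivAt
  set D : (ι → ℂ) →L[ℂ] ℂ := gexp μ ζ (Z w) • ∑ j, (2 * (μ : ℂ) ^ 2 * (ζ j - Z w j)) •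
      (proj j : (ι → ℂ) →L[ℂ] ℂ) with hD
  have hφd := (hφ.differentiable (by norm_num) w).hasFDerivAt
  have hm := hφd.mul hd
  have hmv : ∀ v, fderiv ℝ (fun w => φ w * gexp μ ζ (Z w)) w v
      = φ w * D (fderiv ℝ Z w v) + gexp μ ζ (Z w) * fderiv ℝ φ w v := fun v => by
    have : fderiv ℝ (fun w => φ w * gexp μ ζ (Z w)) w = _ := hm.fderiv
    rw [this]
    simp
  have hs := congrArg D (sum_cof_smul (Z := Z) eR (0, 1) w)
  rw [map_sum, map_smul] at hs
  simp only [map_smul, smul_eq_mul] at hs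
  simp_rw [hmv, mul_add, sum_add_distrib]
  have e1 : ∑ k, cof eR (0, 1) Z k w * (φ w * D (fderiv ℝ Z w (eR k)))
      = φ w * ∑ k, cof eR (0, 1) Z k w * D (fderiv ℝ Z w (eR k)) := by
    rw [mul_sum]; exact sum_congr rfl fun k _ => by ring
  have e2 : ∑ k, cof eR (0, 1) Z k w * (gexp μ ζ (Z w) * fderiv ℝ φ w (eR k))
      = gexp μ ζ (Z w) * ∑ k, cof eR (0, 1) Z k w * fderiv ℝ φ w (eR k) := by
    rw [mul_sum]; exact sum_congr rfl fun k _ => by ring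
  rw [e1, e2, hs, ← hCR]
  ring

theorem norm_cof_le {Z : (ι → ℝ) × ℝ → ι → ℂ} {w : (ι → ℝ) × ℝ} {L : ℝ}
    (hL : ‖fderiv ℝ Z w‖ ≤ L) (k : ι) :
    ‖cof eR (0, 1) Z k w‖ ≤ ‖detMulti ι‖ * L ^ Fintype.card ι := by
  refine ((detMulti ι).le_opNorm _).trans (mul_le_mul_of_nonneg_left ?_ (norm_nonneg _))
  calc ∏ i, ‖fderiv ℝ Z w (Function.update eR k (0, 1) i)‖ ≤ ∏ _i : ι, L := by
        refine Finset.prod_le_prod (fun _ _ => norm_nonneg _) fun i _ => ?_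
        refine ((fderiv ℝ Z w).le_opNorm _).trans ?_
        have : ‖(Function.update eR k (0, 1) i : (ι → ℝ) × ℝ)‖ ≤ 1 := by
          by_cases hi : i = k
          · subst hi; simp [Prod.norm_def]
          · simp [hi, eR, Prod.norm_def, Pi.norm_single]
        exact (mul_le_of_le_one_right (norm_nonneg _) this).trans hL
    _ = L ^ Fintype.card ι := by simp

theorem gauss_homotopy {χ : (ι → ℝ) → ℂ} (hχ : ContDiff ℝ 1 χ) (hχc : HasCompactSupport χ)
    {Z : (ι → ℝ) × ℝ → ι → ℂ} (hZ : ContDiff ℝ 2 Z)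
    {φ : (ι → ℝ) × ℝ → ℂ} (hφ : ContDiff ℝ 1 φ) (μ : ℝ) (ζ : ι → ℂ)
    (hCR : ∀ u ∈ tsupport χ, ∀ s ∈ Icc (0 : ℝ) 1, jac eR Z (u, s) * fderiv ℝ φ (u, s) (0, 1)
      = ∑ k, cof eR (0, 1) Z k (u, s) * fderiv ℝ φ (u, s) (eR k))
    {Cχ Cφ L c : ℝ} (hCχ : ∀ u, ‖fderiv ℝ χ u‖ ≤ Cχ)
    (hCφ : ∀ u ∈ tsupport χ, ∀ s ∈ Icc (0 : ℝ) 1, ‖φ (u, s)‖ ≤ Cφ)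
    (hL : ∀ u ∈ tsupport χ, ∀ s ∈ Icc (0 : ℝ) 1, ‖fderiv ℝ Z (u, s)‖ ≤ L)
    (hc : ∀ u ∈ tsupport χ, ∀ s ∈ Icc (0 : ℝ) 1, fderiv ℝ χ u ≠ 0 →
      c ≤ ∑ j, ((ζ j - Z (u, s) j) ^ 2).re) :
    ‖(∫ u, χ u * (φ (u, 1) * gexp μ ζ (Z (u, 1)) * jac eR Z (u, 1)))
      - ∫ u, χ u * (φ (u, 0) * gexp μ ζ (Z (u, 0)) * jac eR Z (u, 0))‖
      ≤ (Fintype.card ι * (Cχ * (Cφ * (‖detMulti ι‖ * L ^ Fintype.card ι)))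
        * volume.real (tsupport χ)) * exp (-μ ^ 2 * c) := by
  have hE : ContDiff ℝ 1 fun w => φ w * gexp μ ζ (Z w) :=
    hφ.mul (((contDiff_gexp μ ζ).comp hZ).of_le (by norm_num))
  refine (homotopy_bound hχ hχc hZ hE
    (fun u hu s hs => gauss_homotopy_aux hZ hφ μ ζ _ (hCR u hu s hs))
    (C := Fintype.card ι * (Cχ * (Cφ * exp (-μ ^ 2 * c)
      * (‖detMulti ι‖ * L ^ Fintype.card ι)))) fun u hu s hs => ?_).trans_eq (by ring)
  have hCφ0 : 0 ≤ Cφ := (norm_nonneg _).trans (hCφ u hu s hs)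
  have hCχ0 : 0 ≤ Cχ := (norm_nonneg _).trans (hCχ u)
  have hL0 : 0 ≤ L := (norm_nonneg _).trans (hL u hu s hs)
  by_cases h0 : fderiv ℝ χ u = 0
  · rw [h0]
    refine le_trans (le_of_eq ?_) (show (0 : ℝ) ≤ _ by positivity)
    simp
  refine (norm_sum_le _ _).trans ?_
  refine (Finset.sum_le_card_nsmul _ _ _ fun k _ => ?_).trans_eq (by
    rw [nsmul_eq_mul, Finset.card_univ])
  rw [norm_mul, norm_mul, norm_mul]
  have h1 : ‖fderiv ℝ χ u (Pi.single k 1)‖ ≤ Cχ := by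
    refine ((fderiv ℝ χ u).le_opNorm _).trans ?_
    refine (mul_le_of_le_one_right (norm_nonneg _) ?_).trans (hCχ u)
    rw [Pi.norm_single, norm_one]
  gcongr
  · exact hCφ u hu s hs
  · exact norm_gexp_le (hc u hu s hs h0)
  · exact norm_cof_le (hL u hu s hs) k
end Gauss

section BT
variable {ι : Type*} [Fintype ι]

theorem pow_mul_norm_integral_le {f : (ι → ℝ) → ℂ} {u₁ : ι → ℝ} {μ C : ℝ} (hμ : 0 < μ)
    (hf : ∀ u, ‖f u‖ ≤ C * (‖u - u₁‖ * exp (-μ ^ 2 * (3 / 4 * ∑ j, (u₁ j - u j) ^ 2)))) :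
    μ ^ Fintype.card ι * ‖∫ u, f u‖
      ≤ C * (∫ u : ι → ℝ, ‖u‖ * exp (-(3 / 4) * ∑ j, u j ^ 2)) / μ := by
  set g : (ι → ℝ) → ℝ := fun u => ‖u‖ * exp (-(3 / 4) * ∑ j, u j ^ 2) with hg
  have hgi : Integrable g := integrable_norm_mul_gauss
  have hgs : Integrable fun u => g (μ • (u - u₁)) :=
    (hgi.comp_smul hμ.ne').comp_sub_right u₁
  have hgeq : ∀ u, g (μ • (u - u₁))
      = μ * (‖u - u₁‖ * exp (-μ ^ 2 * (3 / 4 * ∑ j, (u₁ j - u j) ^ 2))) := fun u => by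
    simp only [hg]
    rw [norm_smul, norm_of_nonneg hμ.le, mul_assoc]
    congr 3
    rw [mul_sum, mul_sum, mul_sum]
    refine sum_congr rfl fun j _ => ?_
    simp only [Pi.smul_apply, Pi.sub_apply, smul_eq_mul]
    ring
  have h1 : ‖∫ u, f u‖ ≤ ∫ u, C / μ * g (μ • (u - u₁)) := by
    refine norm_integral_le_of_norm_le (hgs.const_mul _) (Eventually.of_forall fun u => ?_)
    rw [hgeq]
    refine (hf u).trans_eq ?_
    field_simp
  rw [integral_const_mul] at h1
  have h2 := integral_rescale g hμ u₁
  rw [smul_eq_mul] at h2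
  calc _ ≤ μ ^ Fintype.card ι * (C / μ * ∫ u, g (μ • (u - u₁))) := by gcongr
    _ = C / μ * (μ ^ Fintype.card ι * ∫ u, g (μ • (u - u₁))) := by ring
    _ = _ := by rw [h2]; ring

/-- The map `(a, b) ↦ a + i b`. -/
noncomputable def addI (ι : Type*) [Fintype ι] : (ι → ℝ) × (ι → ℝ) →L[ℝ] (ι → ℂ) :=
  ContinuousLinearMap.pi fun j =>
    (ofRealCLM ∘L (proj j : (ι → ℝ) →L[ℝ] ℝ)) ∘L
      fst ℝ _ _
    + I • ((ofRealCLM ∘L (proj j : (ι → ℝ) →L[ℝ] ℝ)) ∘L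
      snd ℝ _ _)

theorem addI_apply (a b : ι → ℝ) (j : ι) : addI ι (a, b) j = a j + I * b j := by
  simp [addI]

theorem norm_addI_le (a b : ι → ℝ) : ‖addI ι (a, b)‖ ≤ ‖a‖ + ‖b‖ := by
  refine (pi_norm_le_iff_of_nonneg (by positivity)).2 fun j => ?_
  rw [addI_apply]
  refine (norm_add_le _ _).trans ?_
  rw [norm_mul, norm_I, one_mul, norm_real, norm_real]
  exact add_le_add (norm_le_pi_norm a j) (norm_le_pi_norm b j)

theorem sum_re_sq_addI (a b a' b' : ι → ℝ) :
    ∑ j, ((addI ι (a, b) j - addI ι (a', b') j) ^ 2).re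
      = ∑ j, (a j - a' j) ^ 2 - ∑ j, (b j - b' j) ^ 2 := by
  rw [← Finset.sum_sub_distrib]
  refine sum_congr rfl fun j _ => ?_
  rw [addI_apply, addI_apply]
  simp [pow_two]

variable [DecidableEq ι] {F : Type*} [NormedAddCommGroup F] [NormedSpace ℝ F]

/-- The coordinate directions of the first factor of `(ι → ℝ) × F`. -/
def eX (F : Type*) [NormedAddCommGroup F] (k : ι) : (ι → ℝ) × F := (Pi.single k 1, 0)

theorem jac_slice {Z : (ι → ℝ) × F → ι → ℂ} {u : ι → ℝ} {t : F}
    (hZ : DifferentiableAt ℝ Z (u, t)) :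
    jac (eX F) Z (u, t) = jac (fun k => Pi.single k (1 : ℝ)) (fun u => Z (u, t)) u := by
  have h1 : HasFDerivAt (fun u => Z (u, t)) _ u :=
    HasFDerivAt.comp u hZ.hasFDerivAt (hasFDerivAt_prodMk_left u t)
  unfold jac
  congr 1
  funext k
  rw [h1.fderiv]
  simp [eX]

theorem jac_addI_const (b : ι → ℝ) (u : ι → ℝ) :
    jac (fun k => Pi.single k (1 : ℝ)) (fun u => addI ι (u, b)) u = 1 := by
  have h1 : HasFDerivAt (fun u => addI ι (u, b)) _ u :=
    (addI ι).hasFDerivAt.comp u ((hasFDerivAt_id u).prodMk (hasFDerivAt_const b u))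
  unfold jac
  rw [h1.fderiv, detMulti_apply]
  have : (fun k => ((addI ι).comp ((ContinuousLinearMap.id ℝ (ι → ℝ)).prod 0)) (Pi.single k 1))
      = (1 : Matrix ι ι ℂ) := by
    ext i j
    by_cases hij : j = i
    · subst hij; simp [addI_apply]
    · have hij' : i ≠ j := fun h => hij h.symm
      simp [addI_apply, hij, hij']
  rw [this, Matrix.det_one]

/-- Comparison of the Gaussian integrals over two slices `t = t₀` and `t = t₁`. -/
theorem gauss_slices {χ : (ι → ℝ) → ℂ} (hχ : ContDiff ℝ 1 χ) (hχc : HasCompactSupport χ)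
    {Z : (ι → ℝ) × F → ι → ℂ} (hZ : ContDiff ℝ 2 Z)
    {φ : (ι → ℝ) × F → ℂ} (hφ : ContDiff ℝ 1 φ) (μ : ℝ) (ζ : ι → ℂ) {S : Set F}
    (hS : Convex ℝ S) {t₀ t₁ : F} (ht₀ : t₀ ∈ S) (ht₁ : t₁ ∈ S) (ht : ‖t₁ - t₀‖ ≤ 1)
    (hCR : ∀ u ∈ tsupport χ, ∀ t ∈ S, ∀ v, jac (eX F) Z (u, t) * fderiv ℝ φ (u, t) (0, v)
      = ∑ k, cof (eX F) (0, v) Z k (u, t) * fderiv ℝ φ (u, t) (eX F k))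
    {Cχ Cφ L c : ℝ} (hCχ : ∀ u, ‖fderiv ℝ χ u‖ ≤ Cχ)
    (hCφ : ∀ u ∈ tsupport χ, ∀ t ∈ S, ‖φ (u, t)‖ ≤ Cφ)
    (hL : ∀ u ∈ tsupport χ, ∀ t ∈ S, ‖fderiv ℝ Z (u, t)‖ ≤ L)
    (hc : ∀ u ∈ tsupport χ, ∀ t ∈ S, fderiv ℝ χ u ≠ 0 → c ≤ ∑ j, ((ζ j - Z (u, t) j) ^ 2).re) :
    ‖(∫ u, χ u * (φ (u, t₁) * gexp μ ζ (Z (u, t₁)) * jac (eX F) Z (u, t₁)))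
      - ∫ u, χ u * (φ (u, t₀) * gexp μ ζ (Z (u, t₀)) * jac (eX F) Z (u, t₀))‖
      ≤ (Fintype.card ι * (Cχ * (Cφ * (‖detMulti ι‖ * L ^ Fintype.card ι)))
        * volume.real (tsupport χ)) * exp (-μ ^ 2 * c) := by
  set γ : (ι → ℝ) × ℝ → (ι → ℝ) × F := fun w => (w.1, t₀ + w.2 • (t₁ - t₀)) with hγ
  have hγd : ContDiff ℝ 2 γ := by fun_prop
  have hγS : ∀ s ∈ Icc (0 : ℝ) 1, t₀ + s • (t₁ - t₀) ∈ S := fun s hs =>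
    hS.add_smul_sub_mem ht₀ ht₁ hs
  set γ' : (ι → ℝ) × ℝ →L[ℝ] (ι → ℝ) × F :=
    (fst ℝ _ _).prod ((snd ℝ _ _).smulRight (t₁ - t₀))
  have hγ' : ∀ w, HasFDerivAt γ γ' w := fun w =>
    hasFDerivAt_fst.prodMk (((snd ℝ (ι → ℝ) ℝ).hasFDerivAt.smul_const
      (t₁ - t₀)).const_add t₀)
  have hγ'n : ‖γ'‖ ≤ 1 := by
    refine ContinuousLinearMap.opNorm_le_bound _ zero_le_one fun w => ?_
    rw [one_mul]
    refine norm_prod_le_iff.2 ⟨norm_fst_le w, ?_⟩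
    change ‖w.2 • (t₁ - t₀)‖ ≤ _
    rw [norm_smul]
    exact (mul_le_of_le_one_right (norm_nonneg _) ht).trans (norm_snd_le w)
  have hfZ : ∀ w, fderiv ℝ (Z ∘ γ) w = (fderiv ℝ Z (γ w)).comp γ' := fun w =>
    ((hZ.differentiable (by norm_num) (γ w)).hasFDerivAt.comp w (hγ' w)).fderiv
  have hfφ : ∀ w, fderiv ℝ (φ ∘ γ) w = (fderiv ℝ φ (γ w)).comp γ' := fun w =>
    ((hφ.differentiable (by norm_num) (γ w)).hasFDerivAt.comp w (hγ' w)).fderiv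
  have he : ∀ k, γ' (eR k) = eX F k := fun k => by simp [γ', eR, eX]
  have he1 : γ' (0, 1) = (0, t₁ - t₀) := by simp [γ']
  have hJ : ∀ w, jac eR (Z ∘ γ) w = jac (eX F) Z (γ w) := fun w => by
    unfold jac
    congr 1
    funext k
    rw [hfZ, comp_apply, he]
  have hco : ∀ k w, cof eR (0, 1) (Z ∘ γ) k w = cof (eX F) (0, t₁ - t₀) Z k (γ w) := fun k w => by
    unfold cof jac
    congr 1
    funext l
    rw [hfZ, comp_apply]
    by_cases hl : l = k
    · subst hl; simp [he1]
    · simp [hl, he]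
  have := gauss_homotopy hχ hχc (hZ.comp hγd) (hφ.comp (hγd.of_le (by norm_num))) μ ζ
    (Cχ := Cχ) (Cφ := Cφ) (L := L) (c := c) ?_ hCχ ?_ ?_ ?_
  · simp only [Function.comp_apply, hJ] at this
    simpa [hγ] using this
  · intro u hu s hs
    rw [hJ, hfφ]
    simp only [hco, comp_apply, he, he1]
    exact hCR u hu _ (hγS s hs) _
  · exact fun u hu s hs => hCφ u hu _ (hγS s hs)
  · intro u hu s hs
    rw [hfZ]
    refine (opNorm_comp_le _ _).trans ?_
    exact (mul_le_of_le_one_right (norm_nonneg _) hγ'n).trans (hL u hu _ (hγS s hs))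
  · exact fun u hu s hs => hc u hu _ (hγS s hs)

/-- Comparison of the Gaussian integral over a slice with a real Gaussian integral. -/
theorem gauss_flatten {χ : (ι → ℝ) → ℂ} (hχ : ContDiff ℝ 1 χ) (hχc : HasCompactSupport χ)
    {b : (ι → ℝ) → ι → ℝ} (hb : ContDiff ℝ 2 b) (μ : ℝ) (u₁ : ι → ℝ)
    {Cχ Cb L c : ℝ} (hCχ : ∀ u, ‖fderiv ℝ χ u‖ ≤ Cχ)
    (hCb : ∀ u ∈ tsupport χ, ‖b u - b u₁‖ ≤ Cb)
    (hL : ∀ u ∈ tsupport χ, ‖fderiv ℝ b u‖ ≤ L)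
    (hlip : ∀ u ∈ tsupport χ, ∑ j, (b u₁ j - b u j) ^ 2 ≤ 1 / 4 * ∑ j, (u₁ j - u j) ^ 2)
    (hc : ∀ u ∈ tsupport χ, fderiv ℝ χ u ≠ 0 → c ≤ 3 / 4 * ∑ j, (u₁ j - u j) ^ 2) :
    ‖(∫ u, χ u * (gexp μ (addI ι (u₁, b u₁)) (addI ι (u, b u))
          * jac (fun k => Pi.single k (1 : ℝ)) (fun u => addI ι (u, b u)) u))
      - ∫ u, χ u * (exp (-μ ^ 2 * ∑ j, (u₁ j - u j) ^ 2) : ℝ)‖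
      ≤ (Fintype.card ι * (Cχ * (1 * (‖detMulti ι‖ * (1 + Cb + L) ^ Fintype.card ι)))
        * volume.real (tsupport χ)) * exp (-μ ^ 2 * c) := by
  set β : (ι → ℝ) × ℝ → ι → ℝ := fun w => b u₁ + w.2 • (b w.1 - b u₁) with hβ
  have hβd : ContDiff ℝ 2 β := by fun_prop
  set Z : (ι → ℝ) × ℝ → ι → ℂ := fun w => addI ι (w.1, β w) with hZ
  have hZd : ContDiff ℝ 2 Z := (addI ι).contDiff.comp (contDiff_fst.prodMk hβd)
  have h1 : ∀ u, jac eR Z (u, 1)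
      = jac (fun k => Pi.single k (1 : ℝ)) (fun u => addI ι (u, b u)) u := fun u => by
    rw [show (eR : ι → (ι → ℝ) × ℝ) = eX ℝ from rfl, jac_slice (hZd.differentiable (by norm_num) _)]
    simp [hZ, hβ]
  have h0 : ∀ u, jac eR Z (u, 0) = 1 := fun u => by
    rw [show (eR : ι → (ι → ℝ) × ℝ) = eX ℝ from rfl, jac_slice (hZd.differentiable (by norm_num) _), ← jac_addI_const (b u₁) u]
    simp [hZ, hβ]
  have hg0 : ∀ u, gexp μ (addI ι (u₁, b u₁)) (Z (u, 0))
      = (exp (-μ ^ 2 * ∑ j, (u₁ j - u j) ^ 2) : ℝ) := fun u => by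
    rw [gexp]
    push_cast
    congr 2
    refine sum_congr rfl fun j _ => ?_
    simp [hZ, hβ, addI_apply]
  have hg1 : ∀ u, Z (u, 1) = addI ι (u, b u) := fun u => by simp [hZ, hβ]
  have := gauss_homotopy hχ hχc hZd (φ := fun _ => 1) contDiff_const μ (addI ι (u₁, b u₁))
    (Cχ := Cχ) (Cφ := 1) (L := 1 + Cb + L) (c := c) ?_ hCχ ?_ ?_ ?_
  · simpa only [one_mul, h1, h0, hg0, hg1, mul_one] using this
  · intro u _ s _
    simp
  · simp
  · intro u hu s hs
    have hbd : HasFDerivAt b (fderiv ℝ b u) u := (hb.differentiable (by norm_num) u).hasFDerivAt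
    have hb1 : HasFDerivAt (fun w : (ι → ℝ) × ℝ => b w.1)
        ((fderiv ℝ b u).comp (fst ℝ _ _)) (u, s) :=
      HasFDerivAt.comp (u, s) hbd hasFDerivAt_fst
    have hβ1 : HasFDerivAt β _ (u, s) :=
      ((hasFDerivAt_snd (𝕜 := ℝ) (p := (u, s))).smul (hb1.sub_const (b u₁))).const_add (b u₁)
    have hZ1 : HasFDerivAt Z _ (u, s) :=
      (addI ι).hasFDerivAt.comp (u, s) (hasFDerivAt_fst.prodMk hβ1)
    have hCb0 := (norm_nonneg _).trans (hCb u hu)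
    have hL0 := (norm_nonneg _).trans (hL u hu)
    rw [hZ1.fderiv]
    refine ContinuousLinearMap.opNorm_le_bound _ (by positivity) fun w => ?_
    rw [comp_apply, ContinuousLinearMap.prod_apply]
    refine (norm_addI_le _ _).trans ?_
    have e1 := norm_fst_le w
    have e2 := norm_snd_le w
    have e3 : ‖fderiv ℝ b u w.1‖ ≤ L * ‖w‖ :=
      ((fderiv ℝ b u).le_opNorm _).trans (by gcongr; exact hL u hu)
    have e4 : ‖w.2 • (b u - b u₁)‖ ≤ ‖w‖ * Cb := by
      rw [norm_smul]; gcongr; exact hCb u hu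
    have e5 : ‖s • fderiv ℝ b u w.1‖ ≤ L * ‖w‖ := by
      rw [norm_smul, norm_of_nonneg hs.1]
      exact (mul_le_of_le_one_left (norm_nonneg _) hs.2).trans e3
    have e6 : ‖s • fderiv ℝ b u w.1 + w.2 • (b u - b u₁)‖ ≤ L * ‖w‖ + ‖w‖ * Cb :=
      (norm_add_le _ _).trans (add_le_add e5 e4)
    calc _ ≤ ‖w‖ + (L * ‖w‖ + ‖w‖ * Cb) := add_le_add e1 e6
      _ = _ := by ring
  · intro u hu s hs hne
    refine (hc u hu hne).trans ?_
    rw [hZ, sum_re_sq_addI]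
    have hs2 : s ^ 2 ≤ 1 := by nlinarith [hs.1, hs.2]
    have h0' : 0 ≤ ∑ j, (b u₁ j - b u j) ^ 2 := Finset.sum_nonneg fun j _ => sq_nonneg _
    have : ∑ j, (b u₁ j - β (u, s) j) ^ 2 = s ^ 2 * ∑ j, (b u₁ j - b u j) ^ 2 := by
      rw [mul_sum]
      refine sum_congr rfl fun j _ => ?_
      simp [hβ]; ring
    rw [this]
    nlinarith [hlip u hu]
end BT

section BTmain
variable {ι : Type*} [Fintype ι]

theorem integral_gauss_ne_zero : (∫ u : ι → ℝ, exp (-∑ j, u j ^ 2)) ≠ 0 := by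
  have h : (fun u : ι → ℝ => exp (-∑ j, u j ^ 2))
      = fun u => ∏ j, exp (-1 * u j ^ 2) := by
    funext u
    rw [← Real.exp_sum, ← mul_sum, neg_one_mul]
  rw [h, integral_fintype_prod_volume_eq_prod (fun _ x => exp (-1 * x ^ 2))]
  simp only [integral_gaussian]
  exact Finset.prod_ne_zero_iff.2 fun _ _ => by positivity

theorem gauss_real_error {χ : (ι → ℝ) → ℂ} (hχ : Continuous χ) (hχc : HasCompactSupport χ)
    {u₁ : ι → ℝ} {C : ℝ} (hC : ∀ u, ‖χ u - 1‖ ≤ C * ‖u - u₁‖) {μ : ℝ} (hμ : 0 < μ) :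
    ‖((μ ^ Fintype.card ι : ℝ) : ℂ) * (∫ u, χ u * (exp (-μ ^ 2 * ∑ j, (u₁ j - u j) ^ 2) : ℝ))
        - ((∫ u : ι → ℝ, exp (-∑ j, u j ^ 2) : ℝ) : ℂ)‖
      ≤ C * (∫ u : ι → ℝ, ‖u‖ * exp (-(3 / 4) * ∑ j, u j ^ 2)) / μ := by
  have hr := integral_rescale (fun u : ι → ℝ => exp (-∑ j, u j ^ 2)) hμ u₁
  have he : ∀ u : ι → ℝ, exp (-∑ j, (μ • (u - u₁)) j ^ 2)
      = exp (-μ ^ 2 * ∑ j, (u₁ j - u j) ^ 2) := fun u => by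
    rw [mul_sum, ← Finset.sum_neg_distrib]
    congr 1
    refine sum_congr rfl fun j _ => ?_
    simp only [Pi.smul_apply, Pi.sub_apply, smul_eq_mul]
    ring
  simp only [he, smul_eq_mul] at hr
  have hi : Integrable fun u : ι → ℝ => exp (-μ ^ 2 * ∑ j, (u₁ j - u j) ^ 2) := by
    have := ((integrable_gauss (ι := ι) one_pos).comp_smul hμ.ne').comp_sub_right u₁
    refine this.congr (Eventually.of_forall fun u => ?_)
    simp only [neg_one_mul]
    exact he u
  have hi' : Integrable fun u : ι → ℝ =>
      ((exp (-μ ^ 2 * ∑ j, (u₁ j - u j) ^ 2) : ℝ) : ℂ) := hi.ofReal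
  have hi'' : Integrable fun u : ι → ℝ =>
      χ u * ((exp (-μ ^ 2 * ∑ j, (u₁ j - u j) ^ 2) : ℝ) : ℂ) :=
    (hχ.mul (by fun_prop)).integrable_of_hasCompactSupport hχc.mul_right
  rw [← hr, Complex.ofReal_mul, ← mul_sub, ← integral_complex_ofReal, ← integral_sub hi'' hi',
    norm_mul, norm_real, norm_of_nonneg (by positivity)]
  refine pow_mul_norm_integral_le (u₁ := u₁) hμ fun u => ?_
  rw [← sub_one_mul, norm_mul, norm_real, norm_of_nonneg (Real.exp_pos _).le]
  rw [← mul_assoc]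
  have h0 : 0 ≤ ∑ j, (u₁ j - u j) ^ 2 := Finset.sum_nonneg fun j _ => sq_nonneg _
  refine mul_le_mul (hC u) (Real.exp_le_exp.2 ?_) (Real.exp_pos _).le
    ((norm_nonneg _).trans (hC u))
  nlinarith [mul_nonneg (sq_nonneg μ) h0]

theorem gauss_slice_error {χ g : (ι → ℝ) → ℂ} {b : (ι → ℝ) → ι → ℝ} {J : (ι → ℝ) → ℂ}
    {u₁ : ι → ℝ} {C CJ : ℝ}
    (hlip : ∀ u ∈ tsupport χ, ∑ j, (b u₁ j - b u j) ^ 2 ≤ 1 / 4 * ∑ j, (u₁ j - u j) ^ 2)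
    (hχ1 : ∀ u, ‖χ u‖ ≤ 1) (hg : ∀ u ∈ tsupport χ, ‖g u - g u₁‖ ≤ C * ‖u - u₁‖)
    (hJ : ∀ u ∈ tsupport χ, ‖J u‖ ≤ CJ) (hC : 0 ≤ C) (hCJ : 0 ≤ CJ) {μ : ℝ} (hμ : 0 < μ) :
    μ ^ Fintype.card ι * ‖∫ u, χ u * ((g u - g u₁)
        * gexp μ (addI ι (u₁, b u₁)) (addI ι (u, b u)) * J u)‖
      ≤ (C * CJ) * (∫ u : ι → ℝ, ‖u‖ * exp (-(3 / 4) * ∑ j, u j ^ 2)) / μ := by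
  refine pow_mul_norm_integral_le (u₁ := u₁) hμ fun u => ?_
  by_cases hu : u ∈ tsupport χ
  · rw [norm_mul, norm_mul, norm_mul]
    have h1 : ‖gexp μ (addI ι (u₁, b u₁)) (addI ι (u, b u))‖
        ≤ exp (-μ ^ 2 * (3 / 4 * ∑ j, (u₁ j - u j) ^ 2)) := by
      refine norm_gexp_le ?_
      rw [sum_re_sq_addI]
      linarith [hlip u hu]
    calc _ ≤ 1 * (C * ‖u - u₁‖ * exp (-μ ^ 2 * (3 / 4 * ∑ j, (u₁ j - u j) ^ 2)) * CJ) := by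
          gcongr
          · exact hχ1 u
          · exact hg u hu
          · exact hJ u hu
      _ = _ := by ring
  · rw [image_eq_zero_of_notMem_tsupport hu, zero_mul, norm_zero]
    positivity

theorem tendsto_bt_error (A B c : ℝ) (hc : 0 < c) (N : ℕ) :
    Tendsto (fun j : ℕ => A * (((j : ℝ) + 1) ^ N * exp (-((j : ℝ) + 1) ^ 2 * c))
      + B / ((j : ℝ) + 1)) atTop (nhds 0) := by
  have h1 : Tendsto (fun j : ℕ => (j : ℝ) + 1) atTop atTop :=
    tendsto_natCast_atTop_atTop.atTop_add tendsto_const_nhds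
  have h2 : Tendsto (fun j : ℕ => B / ((j : ℝ) + 1)) atTop (nhds 0) := h1.const_div_atTop B
  have h3 : Tendsto (fun x : ℝ => x ^ N * exp (-c * x)) atTop (nhds 0) := by
    have := Real.tendsto_pow_mul_exp_neg_atTop_nhds_zero N
    have h4 := (this.comp (tendsto_id.const_mul_atTop hc)).const_mul ((c ^ N)⁻¹)
    rw [mul_zero] at h4
    refine h4.congr fun x => ?_
    simp only [Function.comp_apply, id_eq]
    rw [mul_pow, neg_mul]
    field_simp
  have h5 : Tendsto (fun j : ℕ => ((j : ℝ) + 1) ^ N * exp (-((j : ℝ) + 1) ^ 2 * c)) atTop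
      (nhds 0) := by
    refine squeeze_zero (fun j => by positivity) (fun j => ?_) (h3.comp h1)
    simp only [Function.comp_apply]
    have : (0 : ℝ) ≤ j := Nat.cast_nonneg j
    refine mul_le_mul_of_nonneg_left (Real.exp_le_exp.2 ?_) (by positivity)
    nlinarith [mul_nonneg hc.le this, mul_nonneg (mul_nonneg hc.le this) this]
  simpa using (h5.const_mul A).add h2

variable [DecidableEq ι] {F : Type*} [NormedAddCommGroup F] [NormedSpace ℝ F]

set_option maxHeartbeats 1000000 in
/-- **Baouendi–Treves approximation** for a tube-like parametrization `Z = u + i β(u, t)`. -/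
theorem bt_approx [ProperSpace F] {β : (ι → ℝ) × F → ι → ℝ} (hβ : ContDiff ℝ 2 β)
    {φ : (ι → ℝ) × F → ℂ} (hφ : ContDiff ℝ 1 φ) (u₀ : ι → ℝ) (t₀ : F) {R : ℝ} (hR : 0 < R)
    (hR1 : R ≤ 1)
    (hlip : ∀ t ∈ closedBall t₀ R, ∀ u ∈ closedBall u₀ R, ∀ u' ∈ closedBall u₀ R,
      ∑ j, (β (u, t) j - β (u', t) j) ^ 2 ≤ 1 / 4 * ∑ j, (u j - u' j) ^ 2)
    (hCR : ∀ u ∈ closedBall u₀ R, ∀ t ∈ closedBall t₀ R, ∀ v : F,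
      jac (eX F) (fun w => addI ι (w.1, β w)) (u, t) * fderiv ℝ φ (u, t) (0, v)
        = ∑ k, cof (eX F) (0, v) (fun w => addI ι (w.1, β w)) k (u, t)
          * fderiv ℝ φ (u, t) (eX F k)) :
    ∃ r > 0, ∃ P : ℕ → (ι → ℂ) → ℂ, (∀ j, Differentiable ℂ (P j)) ∧
      TendstoUniformlyOn (fun j w => P j (addI ι (w.1, β w))) φ atTop
        (closedBall u₀ r ×ˢ closedBall t₀ r) := by
  set N := Fintype.card ι
  set Z : (ι → ℝ) × F → ι → ℂ := fun w => addI ι (w.1, β w) with hZ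
  have hZd : ContDiff ℝ 2 Z := (addI ι).contDiff.comp (contDiff_fst.prodMk hβ)
  let bump : ContDiffBump u₀ := ⟨R / 2, R, by positivity, by linarith⟩
  set χ : (ι → ℝ) → ℂ := fun u => (bump u : ℂ) with hχdef
  have hχ : ContDiff ℝ 1 χ := Complex.ofRealCLM.contDiff.comp bump.contDiff
  have hsupp : tsupport χ ⊆ closedBall u₀ R := by
    refine (closure_mono fun u hu => ?_).trans bump.tsupport_eq.le
    intro h0
    exact hu (by simp [hχdef, h0])
  have hχc : HasCompactSupport χ := (isCompact_closedBall u₀ R).of_isClosed_subset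
    (isClosed_tsupport _) hsupp
  have hχ1 : ∀ u, ‖χ u‖ ≤ 1 := fun u => by
    rw [hχdef, norm_real, norm_of_nonneg bump.nonneg]
    exact bump.le_one
  have hχd0 : ∀ u, fderiv ℝ χ u ≠ 0 → R / 2 ≤ ‖u - u₀‖ := fun u hu => by
    by_contra hlt
    rw [not_le, ← dist_eq_norm] at hlt
    refine hu (((bump.eventuallyEq_one_of_mem_ball (show u ∈ ball u₀ (R / 2) from hlt)).fun_comp
      ((↑) : ℝ → ℂ)).fderiv_eq.trans ?_)
    simp
  set K : Set ((ι → ℝ) × F) := closedBall u₀ R ×ˢ closedBall t₀ R with hK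
  have hKc : IsCompact K := (isCompact_closedBall _ _).prod (isCompact_closedBall _ _)
  obtain ⟨Cχ, hCχ⟩ : ∃ C, ∀ u, ‖fderiv ℝ χ u‖ ≤ C :=
    (hχc.fderiv (𝕜 := ℝ)).exists_bound_of_continuous (hχ.continuous_fderiv (by norm_num))
  obtain ⟨Cφ, hCφ⟩ := hKc.exists_bound_of_continuousOn hφ.continuous.continuousOn
  obtain ⟨L, hL⟩ := hKc.exists_bound_of_continuousOn
    (hZd.continuous_fderiv (by norm_num)).continuousOn
  obtain ⟨Lφ, hLφ⟩ := hKc.exists_bound_of_continuousOn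
    (hφ.continuous_fderiv (by norm_num)).continuousOn
  obtain ⟨Lβ, hLβ⟩ := hKc.exists_bound_of_continuousOn
    (hβ.continuous_fderiv (by norm_num)).continuousOn
  obtain ⟨Cβ, hCβ⟩ := hKc.exists_bound_of_continuousOn hβ.continuous.continuousOn
  obtain ⟨CJ, hCJ⟩ := hKc.exists_bound_of_continuousOn
    (contDiff_jac hZd (eX F)).continuous.continuousOn
  have h00 : (u₀, t₀) ∈ K := ⟨mem_closedBall_self hR.le, mem_closedBall_self hR.le⟩
  have hCχ0 := (norm_nonneg _).trans (hCχ u₀)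
  have hCφ0 := (norm_nonneg _).trans (hCφ _ h00)
  have hL0 := (norm_nonneg _).trans (hL _ h00)
  have hLφ0 := (norm_nonneg _).trans (hLφ _ h00)
  have hLβ0 := (norm_nonneg _).trans (hLβ _ h00)
  have hCβ0 := (norm_nonneg _).trans (hCβ _ h00)
  have hCJ0 := (norm_nonneg _).trans (hCJ _ h00)
  -- choice of the radius
  obtain ⟨r₁, hr₁, hr₁'⟩ : ∃ r₁ > 0, ∀ u ∈ closedBall u₀ r₁, ∀ t ∈ closedBall t₀ r₁,
      ∀ t' ∈ closedBall t₀ r₁, ∑ j, (β (u, t) j - β (u, t') j) ^ 2 ≤ R ^ 2 / 128 := by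
    have hc : Continuous fun q : (ι → ℝ) × F × F =>
        ∑ j, (β (q.1, q.2.1) j - β (q.1, q.2.2) j) ^ 2 := by
      have := hβ.continuous
      fun_prop
    have h1 : ∀ᶠ q in nhds (u₀, t₀, t₀), ∑ j, (β (q.1, q.2.1) j - β (q.1, q.2.2) j) ^ 2
        < R ^ 2 / 128 := hc.continuousAt.eventually_lt continuousAt_const (by simp; positivity)
    obtain ⟨ε, hε, h2⟩ := Metric.eventually_nhds_iff.1 h1
    refine ⟨ε / 2, by positivity, fun u hu t ht t' ht' =>
      (h2 (y := (u, t, t')) ?_).le⟩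
    rw [mem_closedBall] at hu ht ht'
    simp only [Prod.dist_eq, max_lt_iff]
    exact ⟨by linarith, by linarith, by linarith⟩
  set r := min r₁ (R / 4)
  have hr : 0 < r := by positivity
  have hrR : r ≤ R / 4 := min_le_right _ _
  have hrr : r ≤ r₁ := min_le_left _ _
  set c := R ^ 2 / 64
  have hc : 0 < c := by positivity
  set c₀ : ℝ := ∫ u : ι → ℝ, exp (-∑ j, u j ^ 2) with hc₀
  have hc₀n : c₀ ≠ 0 := integral_gauss_ne_zero
  set G : ℝ := ∫ u : ι → ℝ, ‖u‖ * exp (-(3 / 4) * ∑ j, u j ^ 2)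
  set I : ℝ → (ι → ℂ) → F → ℂ := fun μ ζ t =>
    ∫ u, χ u * (φ (u, t) * gexp μ ζ (Z (u, t)) * jac (eX F) Z (u, t)) with hI
  set A₁ := N * (Cχ * (Cφ * (‖detMulti ι‖ * L ^ N))) * volume.real (tsupport χ)
  set A₂ := N * (Cχ * (1 * (‖detMulti ι‖ * (1 + 2 * Cβ + Lβ) ^ N)))
    * volume.real (tsupport χ)
  refine ⟨r, hr, fun j ζ => (c₀ : ℂ)⁻¹ * ((((j : ℝ) + 1 : ℝ) ^ N : ℝ) * I ((j : ℝ) + 1) ζ t₀),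
    fun j => ?_, ?_⟩
  · refine (Differentiable.const_mul ?_ _).const_mul _
    have := differentiable_integral_gexp
      (g := fun u => χ u * (φ (u, t₀) * jac (eX F) Z (u, t₀)))
      (hχ.continuous.mul ((hφ.continuous.comp (by fun_prop)).mul
        ((contDiff_jac hZd (eX F)).continuous.comp (by fun_prop)))) hχc.mul_right
      (z := fun u => Z (u, t₀)) (hZd.continuous.comp (by fun_prop)) ((j : ℝ) + 1)
    refine (congrArg (Differentiable ℂ) (funext fun ζ => integral_congr_ae
      (Eventually.of_forall fun u => ?_))).mpr this
    ring
  rw [Metric.tendstoUniformlyOn_iff]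
  intro ε hε
  have herr := tendsto_bt_error (|c₀|⁻¹ * (A₁ + Cφ * A₂)) (|c₀|⁻¹ * (Lφ * CJ * G + Cφ * (Cχ * G)))
    c hc N
  filter_upwards [herr.eventually_lt_const hε] with j hj
  rintro ⟨u₁, t₁⟩ ⟨hu₁, ht₁⟩
  refine lt_of_le_of_lt ?_ hj
  have hu₁R : u₁ ∈ closedBall u₀ R := closedBall_subset_closedBall (by linarith) hu₁
  have ht₁R : t₁ ∈ closedBall t₀ R := closedBall_subset_closedBall (by linarith) ht₁
  set μ : ℝ := (j : ℝ) + 1 with hμdef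
  have hμ : 0 < μ := by positivity
  have hS : ∀ u, fderiv ℝ χ u ≠ 0 → R ^ 2 / 16 ≤ ∑ j, (u₁ j - u j) ^ 2 := fun u hu => by
    have h1 := hχd0 u hu
    have h2 : R / 4 ≤ ‖u₁ - u‖ := by
      have h3 : ‖u - u₀‖ ≤ ‖u₁ - u‖ + ‖u₁ - u₀‖ := by
        rw [norm_sub_rev u₁ u]
        calc ‖u - u₀‖ = ‖(u - u₁) + (u₁ - u₀)‖ := by congr 1; abel
          _ ≤ _ := norm_add_le _ _
      rw [mem_closedBall, dist_eq_norm] at hu₁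
      linarith
    have h3 := norm_sq_le_sum_sq (u₁ - u)
    simp only [Pi.sub_apply] at h3
    nlinarith
  have hlip₁ : ∀ u ∈ tsupport χ, ∑ j, (β (u₁, t₁) j - β (u, t₁) j) ^ 2
      ≤ 1 / 4 * ∑ j, (u₁ j - u j) ^ 2 := fun u hu => hlip _ ht₁R _ hu₁R _ (hsupp hu)
  -- the three comparisons
  have E1 : ‖I μ (Z (u₁, t₁)) t₁ - I μ (Z (u₁, t₁)) t₀‖ ≤ A₁ * exp (-μ ^ 2 * c) := by
    refine gauss_slices hχ hχc hZd hφ μ (Z (u₁, t₁)) (convex_closedBall t₀ r)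
      (mem_closedBall_self hr.le) ht₁ ?_ ?_ hCχ ?_ ?_ ?_
    · rw [mem_closedBall, dist_eq_norm] at ht₁
      linarith
    · exact fun u hu t ht v => hCR u (hsupp hu) t (closedBall_subset_closedBall (by linarith) ht) v
    · exact fun u hu t ht => hCφ _ ⟨hsupp hu, closedBall_subset_closedBall (by linarith) ht⟩
    · exact fun u hu t ht => hL _ ⟨hsupp hu, closedBall_subset_closedBall (by linarith) ht⟩
    · intro u hu t ht hne
      rw [hZ, sum_re_sq_addI]
      have h1 := hS u hne
      have h2 := hlip t (closedBall_subset_closedBall (by linarith) ht) u₁ hu₁R u (hsupp hu)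
      have h3 := hr₁' u₁ (closedBall_subset_closedBall hrr hu₁) t₁
        (closedBall_subset_closedBall hrr ht₁) t (closedBall_subset_closedBall hrr ht)
      have h4 : ∑ j, (β (u₁, t₁) j - β (u, t) j) ^ 2
          ≤ 2 * ∑ j, (β (u₁, t₁) j - β (u₁, t) j) ^ 2
            + 2 * ∑ j, (β (u₁, t) j - β (u, t) j) ^ 2 := by
        rw [mul_sum, mul_sum, ← sum_add_distrib]
        refine Finset.sum_le_sum fun j _ => ?_
        nlinarith [sq_nonneg ((β (u₁, t₁) j - β (u₁, t) j) - (β (u₁, t) j - β (u, t) j))]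
      simp only [c]
      linarith
  have E2 := gauss_slice_error (χ := χ) (g := fun u => φ (u, t₁)) (b := fun u => β (u, t₁))
    (J := fun u => jac (eX F) Z (u, t₁)) (u₁ := u₁) (C := Lφ) (CJ := CJ) hlip₁ hχ1
    (fun u hu => by
      have h1 := (convex_closedBall u₀ R).norm_image_sub_le_of_norm_fderiv_le (𝕜 := ℝ)
        (f := fun u => φ (u, t₁)) (C := Lφ) (fun x _ => ?_) (fun x hx => ?_) hu₁R (hsupp hu)
      · exact h1
      · exact ((hφ.differentiable (by norm_num)).comp (by fun_prop :
          Differentiable ℝ fun u : ι → ℝ => (u, t₁))) x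
      · have h2 : HasFDerivAt (fun u => φ (u, t₁)) _ x :=
          HasFDerivAt.comp x (hφ.differentiable (by norm_num) (x, t₁)).hasFDerivAt
            (hasFDerivAt_prodMk_left x t₁)
        rw [h2.fderiv]
        refine (opNorm_comp_le _ _).trans ?_
        refine (mul_le_of_le_one_right (norm_nonneg _)
          (norm_inl_le_one ℝ _ _)).trans (hLφ _ ⟨hx, ht₁R⟩))
    (fun u hu => hCJ _ ⟨hsupp hu, ht₁R⟩) hLφ0 hCJ0 hμ
  have E3 := gauss_flatten hχ hχc (b := fun u => β (u, t₁)) (hβ.comp (by fun_prop)) μ u₁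
    (Cb := 2 * Cβ) (L := Lβ) (c := c) hCχ
    (fun u hu => (norm_sub_le _ _).trans (by
      linarith [hCβ _ (show (u, t₁) ∈ K from ⟨hsupp hu, ht₁R⟩),
        hCβ _ (show (u₁, t₁) ∈ K from ⟨hu₁R, ht₁R⟩)]))
    (fun u hu => by
      have h2 : HasFDerivAt (fun u => β (u, t₁)) _ u :=
        HasFDerivAt.comp u (hβ.differentiable (by norm_num) (u, t₁)).hasFDerivAt
          (hasFDerivAt_prodMk_left u t₁)
      rw [h2.fderiv]
      refine (opNorm_comp_le _ _).trans ?_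
      refine (mul_le_of_le_one_right (norm_nonneg _)
        (norm_inl_le_one ℝ _ _)).trans (hLβ _ ⟨hsupp hu, ht₁R⟩))
    hlip₁ (fun u hu hne => by simp only [c]; nlinarith [hS u hne])
  have E4 := gauss_real_error hχ.continuous hχc (u₁ := u₁) (C := Cχ) (fun u => by
      have h1 : χ u₁ = 1 := by
        have : bump u₁ = 1 := bump.one_of_mem_closedBall
          (closedBall_subset_closedBall (show r ≤ R / 2 by linarith) hu₁)
        simp [hχdef, this]
      rw [← h1]
      exact Convex.norm_image_sub_le_of_norm_fderiv_le (𝕜 := ℝ) (s := univ)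
        (fun x _ => hχ.differentiable (by norm_num) x) (fun x _ => hCχ x) convex_univ
        (mem_univ _) (mem_univ _)) hμ
  set X₀ := I μ (Z (u₁, t₁)) t₀
  set X₁ := I μ (Z (u₁, t₁)) t₁ with hX₁
  set X₂ := ∫ u, χ u * ((φ (u, t₁) - φ (u₁, t₁))
    * gexp μ (addI ι (u₁, β (u₁, t₁))) (addI ι (u, β (u, t₁))) * jac (eX F) Z (u, t₁)) with hX₂
  have hJs : ∀ u, jac (fun k => Pi.single k (1 : ℝ)) (fun u => addI ι (u, β (u, t₁))) u
      = jac (eX F) Z (u, t₁) := fun u =>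
    (jac_slice (hZd.differentiable (by norm_num) _)).symm
  simp only [hJs] at E3
  set X₃ := ∫ u, χ u * (gexp μ (addI ι (u₁, β (u₁, t₁))) (addI ι (u, β (u, t₁)))
    * jac (eX F) Z (u, t₁)) with hX₃
  set X₄ := ∫ u, χ u * ((exp (-μ ^ 2 * ∑ j, (u₁ j - u j) ^ 2) : ℝ) : ℂ)
  have hcg : Continuous fun u => gexp μ (addI ι (u₁, β (u₁, t₁))) (addI ι (u, β (u, t₁))) :=
    (contDiff_gexp μ _).continuous.comp (hZd.continuous.comp (by fun_prop : Continuous fun u => (u, t₁)))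
  have hcJ : Continuous fun u => jac (eX F) Z (u, t₁) :=
    (contDiff_jac hZd (eX F)).continuous.comp (by fun_prop)
  have hcφ : Continuous fun u => φ (u, t₁) := hφ.continuous.comp (by fun_prop)
  have hsplit : X₁ = X₂ + φ (u₁, t₁) * X₃ := by
    rw [hX₁, hX₂, hX₃, ← integral_const_mul, ← integral_add]
    · simp only [hI, hZ]
      congr 1
      funext u
      ring
    · exact (hχ.continuous.mul (((hcφ.sub continuous_const).mul hcg).mul
        hcJ)).integrable_of_hasCompactSupport hχc.mul_right
    · exact ((hχ.continuous.mul (hcg.mul hcJ)).integrable_of_hasCompactSupport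
        hχc.mul_right).const_mul _
  have hφ1 : ‖φ (u₁, t₁)‖ ≤ Cφ := hCφ _ ⟨hu₁R, ht₁R⟩
  have hμN : ‖((μ ^ N : ℝ) : ℂ)‖ = μ ^ N := by
    rw [norm_real, norm_of_nonneg (by positivity)]
  have hdec : (c₀ : ℂ)⁻¹ * (((μ ^ N : ℝ) : ℂ) * X₀) - φ (u₁, t₁)
      = (c₀ : ℂ)⁻¹ * (-(((μ ^ N : ℝ) : ℂ) * (X₁ - X₀)) + ((μ ^ N : ℝ) : ℂ) * X₂
        + φ (u₁, t₁) * (((μ ^ N : ℝ) : ℂ) * (X₃ - X₄))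
        + φ (u₁, t₁) * (((μ ^ N : ℝ) : ℂ) * X₄ - (c₀ : ℂ))) := by
    have : (c₀ : ℂ) ≠ 0 := by exact_mod_cast hc₀n
    rw [hsplit]
    field_simp
    ring
  rw [dist_comm, dist_eq_norm]
  refine le_of_eq_of_le (congrArg norm hdec) ?_
  rw [norm_mul, norm_inv, norm_real, Real.norm_eq_abs]
  have F1 : ‖-(((μ ^ N : ℝ) : ℂ) * (X₁ - X₀))‖ ≤ μ ^ N * (A₁ * exp (-μ ^ 2 * c)) := by
    rw [norm_neg, norm_mul, hμN]; gcongr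
  have F2 : ‖((μ ^ N : ℝ) : ℂ) * X₂‖ ≤ (Lφ * CJ) * G / μ := by
    rw [norm_mul, hμN]; exact E2
  have F3 : ‖φ (u₁, t₁) * (((μ ^ N : ℝ) : ℂ) * (X₃ - X₄))‖
      ≤ Cφ * (μ ^ N * (A₂ * exp (-μ ^ 2 * c))) := by
    rw [norm_mul, norm_mul, hμN]; gcongr
  have F4 : ‖φ (u₁, t₁) * (((μ ^ N : ℝ) : ℂ) * X₄ - (c₀ : ℂ))‖ ≤ Cφ * (Cχ * G / μ) := by
    rw [norm_mul]; gcongr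
  calc _ ≤ |c₀|⁻¹ * (μ ^ N * (A₁ * exp (-μ ^ 2 * c)) + (Lφ * CJ) * G / μ
        + Cφ * (μ ^ N * (A₂ * exp (-μ ^ 2 * c))) + Cφ * (Cχ * G / μ)) := by
        gcongr
        exact (norm_add_le _ _).trans (add_le_add ((norm_add_le _ _).trans
          (add_le_add ((norm_add_le _ _).trans (add_le_add F1 F2)) F3)) F4)
    _ = _ := by ring
end BTmain

section CR
theorem sum_smul_of_cr {ι κ W : Type*} [Fintype ι] [NormedAddCommGroup W]
    [NormedSpace ℝ W] {Z' : W →L[ℝ] (κ → ℂ)} [Fintype κ] {φ' : W →L[ℝ] ℂ}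
    (hCR : ∀ a b, Z' b = I • Z' a → φ' b = I * φ' a)
    {c : ℂ} {v : W} {ck : ι → ℂ} {e : ι → W} (h : ∑ k, ck k • Z' (e k) = c • Z' v) :
    c * φ' v = ∑ k, ck k * φ' (e k) := by
  set A : W := ∑ k, (ck k).re • e k - c.re • v with hA
  set B : W := ∑ k, (ck k).im • e k - c.im • v with hB
  have hsm : ∀ (z : ℂ) (x : κ → ℂ), z • x = z.re • x + I • z.im • x := fun z x => by
    conv_lhs => rw [← re_add_im z]
    rw [add_smul, mul_comm, mul_smul, Complex.coe_smul, Complex.coe_smul]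
  have h1 : Z' A = I • Z' (-B) := by
    rw [map_neg, smul_neg, ← add_eq_zero_iff_eq_neg, hA, hB]
    simp only [map_sub, map_sum, map_smul]
    have h2 : ∑ k, (ck k).re • Z' (e k) + I • ∑ k, (ck k).im • Z' (e k)
        = c.re • Z' v + I • c.im • Z' v := by
      rw [← hsm, ← h, Finset.smul_sum, ← sum_add_distrib]
      exact sum_congr rfl fun k _ => (hsm _ _).symm
    rw [smul_sub, sub_add_sub_comm, h2, sub_self]
  have h2 := hCR _ _ h1
  rw [hA, hB] at h2
  simp only [map_neg, map_sub, map_sum, map_smul, Complex.real_smul] at h2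
  have h3 : ∀ (z y : ℂ), z * y = (z.re : ℂ) * y + I * ((z.im : ℂ) * y) := fun z y => by
    conv_lhs => rw [← re_add_im z]
    ring
  rw [h3 c]
  simp_rw [h3 (ck _)]
  rw [sum_add_distrib, ← mul_sum]
  linear_combination -h2

variable {d m : ℕ}

/-- The complex space with coordinates `(z, w)`. -/
abbrev Ambient (d m : ℕ) := (Fin d → ℂ) × (Fin m → ℂ)

/-- The real space of parameters `(x, w)` of the graph. -/
abbrev Base (d m : ℕ) := (Fin d → ℝ) × (Fin m → ℂ)

/-- Families of discs depending on a perturbation, a shift, a center and a parameter. -/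
abbrev DiscSolver (d m : ℕ) :=
  C(Ambient d m, Fin d → ℝ) → (Fin d → ℝ) → (Fin d → ℝ) → Base d m → ℂ → Ambient d m

/-- The `ℝ^d`-valued real bilinear forms on `ℂ^m`. -/
abbrev VectorForm (d m : ℕ) := (Fin m → ℂ) →L[ℝ] (Fin m → ℂ) →L[ℝ] (Fin d → ℝ)

/-- The graph parametrization `(x, w) ↦ (x + i h(x, w), w)`. -/
noncomputable def graphMap (h : Base d m → Fin d → ℝ)
    (p : Base d m) : Ambient d m :=
  (fun l => (p.1 l : ℂ) + I * (h p l : ℂ), p.2)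

/-- The coordinates `(x, w) = (u_inl, u_inr + i t)`. -/
noncomputable def ofCoords (d m : ℕ) :
    (Fin d ⊕ Fin m → ℝ) × (Fin m → ℝ) →L[ℝ] Base d m :=
  (ContinuousLinearMap.pi fun l =>
    (proj (Sum.inl l) : (Fin d ⊕ Fin m → ℝ) →L[ℝ] ℝ) ∘L
      fst ℝ _ _).prod
  (addI (Fin m) ∘L ((ContinuousLinearMap.pi fun l =>
    (proj (Sum.inr l) : (Fin d ⊕ Fin m → ℝ) →L[ℝ] ℝ) ∘L
      fst ℝ _ _).prod (snd ℝ _ _)))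

/-- The inverse of `ofCoords`. -/
noncomputable def toCoords (d m : ℕ) :
    Base d m →L[ℝ] (Fin d ⊕ Fin m → ℝ) × (Fin m → ℝ) :=
  (ContinuousLinearMap.pi (Sum.rec (fun l => (proj l) ∘L
      fst ℝ (Fin d → ℝ) (Fin m → ℂ))
    (fun l => (Complex.reCLM ∘L (proj l : (Fin m → ℂ) →L[ℝ] ℂ)) ∘L
      snd ℝ _ _))).prod
  (ContinuousLinearMap.pi fun l =>
    (Complex.imCLM ∘L (proj l : (Fin m → ℂ) →L[ℝ] ℂ)) ∘L
      snd ℝ _ _)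

theorem ofCoords_toCoords (p : Base d m) :
    ofCoords d m (toCoords d m p) = p := by
  refine Prod.ext (funext fun l => ?_) (funext fun l => ?_)
  · simp [ofCoords, toCoords]
  · simp only [ofCoords, toCoords, ContinuousLinearMap.prod_apply, comp_apply,
      addI_apply]
    apply Complex.ext <;> simp

/-- Merging both blocks of complex coordinates. -/
noncomputable def mergeCoords (d m : ℕ) :
    Ambient d m →L[ℂ] (Fin d ⊕ Fin m → ℂ) :=
  ContinuousLinearMap.pi (Sum.rec (fun l => (proj l) ∘L
      fst ℂ (Fin d → ℂ) (Fin m → ℂ))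
    (fun l => (proj l) ∘L snd ℂ (Fin d → ℂ) (Fin m → ℂ)))

theorem mergeCoords_injective : Function.Injective (mergeCoords d m) := fun _ _ hab =>
  Prod.ext (funext fun l => congrFun hab (Sum.inl l)) (funext fun l => congrFun hab (Sum.inr l))

theorem addI_sumElim (h : Base d m → Fin d → ℝ)
    (w : (Fin d ⊕ Fin m → ℝ) × (Fin m → ℝ)) :
    addI (Fin d ⊕ Fin m) (w.1, Sum.elim (h (ofCoords d m w)) w.2)
      = mergeCoords d m (graphMap h (ofCoords d m w)) := by
  funext j
  rw [addI_apply]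
  rcases j with l | l
  · simp [mergeCoords, graphMap, ofCoords]
  · simp [mergeCoords, graphMap, ofCoords, addI_apply]

theorem ContDiffOn.exists_contDiff_eq_near {X F : Type*} [NormedAddCommGroup X] [NormedSpace ℝ X]
    [FiniteDimensional ℝ X] [NormedAddCommGroup F] [NormedSpace ℝ F] {k : ℕ∞} {O : Set X}
    (hO : IsOpen O) {g : X → F} (hg : ContDiffOn ℝ k g O) {p : X} (hp : p ∈ O) :
    ∃ g' : X → F, ContDiff ℝ k g' ∧ ∃ R > 0, ∀ q ∈ ball p R, g' q = g q := by
  obtain ⟨ε, hε, hball⟩ := Metric.isOpen_iff.1 hO p hp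
  let b : ContDiffBump p := ⟨ε / 4, ε / 2, by positivity, by linarith⟩
  refine ⟨fun q => b q • g q, ?_, ε / 4, by positivity, fun q hq => ?_⟩
  · rw [contDiff_iff_contDiffAt]
    intro q
    by_cases hq : q ∈ ball p ε
    · exact b.contDiff.contDiffAt.smul (hg.contDiffAt (hO.mem_nhds (hball hq)))
    · have hq' : q ∈ (closedBall p (ε / 2))ᶜ := fun h =>
        hq (closedBall_subset_ball (by linarith) h)
      refine (contDiffAt_const (c := (0 : F))).congr_of_eventuallyEq ?_
      filter_upwards [isClosed_closedBall.isOpen_compl.mem_nhds hq'] with x hx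
      have : b x = 0 := b.zero_of_le_dist (by
        rw [mem_compl_iff, mem_closedBall, not_le] at hx
        exact hx.le)
      rw [this, zero_smul]
  · have : b q = 1 := b.one_of_mem_closedBall (ball_subset_closedBall hq)
    simp [this]

theorem differentiableAt_graphMap {h : Base d m → Fin d → ℝ}
    {p : Base d m} (hh : DifferentiableAt ℝ h p) :
    DifferentiableAt ℝ (graphMap h) p := by
  unfold graphMap
  refine DifferentiableAt.prodMk (differentiableAt_pi.2 fun l => ?_) differentiableAt_snd
  have h1 : DifferentiableAt ℝ (fun p : Base d m => p.1 l) p := by fun_prop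
  have h2 : DifferentiableAt ℝ (fun p => h p l) p := differentiableAt_pi.1 hh l
  exact (Complex.ofRealCLM.differentiableAt.comp p h1).add
    ((Complex.ofRealCLM.differentiableAt.comp p h2).const_mul _)

/-- `φ` is a `C¹` CR function on the part of the graph of `h` over `O`. -/
structure IsCR (h : Base d m → Fin d → ℝ) (φ : Base d m → ℂ) (O : Set (Base d m)) : Prop where
  contDiffOn : ContDiffOn ℝ 1 φ O
  cauchyRiemann : ∀ p ∈ O, ∀ u u', fderiv ℝ (graphMap h) p u' =
    I • fderiv ℝ (graphMap h) p u → fderiv ℝ φ p u' = I * fderiv ℝ φ p u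

/-- **Baouendi–Treves approximation** near a point of the graph. -/
theorem cr_approx {O : Set (Base d m)} (hO : IsOpen O)
    {h : Base d m → Fin d → ℝ} (hh : ContDiffOn ℝ 2 h O)
    (hsmall : ∀ p ∈ O, ‖fderiv ℝ h p‖ ≤ 1 / (2 * (d + m))) {φ : Base d m → ℂ} (hφ : IsCR h φ O)
    {p₀ : Base d m} (hp₀ : p₀ ∈ O) :
    ∃ r > 0, ∃ P : ℕ → Ambient d m → ℂ, (∀ j, Differentiable ℂ (P j)) ∧
      TendstoUniformlyOn (fun j p => P j (graphMap h p)) φ atTop (ball p₀ r) := by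
  obtain ⟨h', hh', R₁, hR₁, hh'e⟩ := hh.exists_contDiff_eq_near (k := 2) hO hp₀
  obtain ⟨φ', hφ', R₂, hR₂, hφ'e⟩ := hφ.contDiffOn.exists_contDiff_eq_near (k := 1) hO hp₀
  obtain ⟨R₃, hR₃, hball⟩ := Metric.isOpen_iff.1 hO p₀ hp₀
  set R₀ := min (min R₁ R₂) R₃
  have hR₀ : 0 < R₀ := by positivity
  set u₀ := (toCoords d m p₀).1
  set t₀ := (toCoords d m p₀).2
  have hp₀e : ofCoords d m (u₀, t₀) = p₀ := ofCoords_toCoords p₀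
  set c := ofCoords d m with hc
  set β : (Fin d ⊕ Fin m → ℝ) × (Fin m → ℝ) → (Fin d ⊕ Fin m → ℝ) :=
    fun w => Sum.elim (h' (c w)) w.2 with hβ
  have hβd : ContDiff ℝ 2 β := by
    refine contDiff_pi.2 fun j => ?_
    rcases j with l | l
    · exact (contDiff_pi.1 hh' l).comp c.contDiff
    · change ContDiff ℝ 2 fun w : (Fin d ⊕ Fin m → ℝ) × (Fin m → ℝ) => w.2 l
      fun_prop
  have hcont : ∀ᶠ w in nhds (u₀, t₀), c w ∈ ball p₀ R₀ := by
    refine c.continuous.continuousAt.eventually_mem (isOpen_ball.mem_nhds ?_)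
    rw [hp₀e]; exact mem_ball_self hR₀
  obtain ⟨R₄, hR₄, hR₄'⟩ := Metric.eventually_nhds_iff.1 hcont
  set R := min (R₄ / 2) 1
  have hR : 0 < R := by positivity
  have hin : ∀ u ∈ closedBall u₀ R, ∀ t ∈ closedBall t₀ R, c (u, t) ∈ ball p₀ R₀ := by
    intro u hu t ht
    refine hR₄' ?_
    rw [mem_closedBall] at hu ht
    have : R ≤ R₄ / 2 := min_le_left _ _
    simp only [Prod.dist_eq, max_lt_iff]
    exact ⟨by linarith, by linarith⟩
  have hsub1 : ball p₀ R₀ ⊆ ball p₀ R₁ :=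
    ball_subset_ball ((min_le_left _ _).trans (min_le_left _ _))
  have hsub2 : ball p₀ R₀ ⊆ ball p₀ R₂ :=
    ball_subset_ball ((min_le_left _ _).trans (min_le_right _ _))
  have hsub3 : ball p₀ R₀ ⊆ O := (ball_subset_ball (min_le_right _ _)).trans hball
  have hge : ∀ q ∈ ball p₀ R₀, graphMap h' q = graphMap h q := fun q hq => by
    simp only [graphMap, hh'e q (hsub1 hq)]
  have hnear : ∀ q ∈ ball p₀ R₀, ∀ᶠ x in nhds q, x ∈ ball p₀ R₀ := fun q hq =>
    isOpen_ball.mem_nhds hq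
  have hlip : ∀ t ∈ closedBall t₀ R, ∀ u ∈ closedBall u₀ R, ∀ u' ∈ closedBall u₀ R,
      ∑ j, (β (u, t) j - β (u', t) j) ^ 2 ≤ 1 / 4 * ∑ j, (u j - u' j) ^ 2 := by
    intro t ht u hu u' hu'
    have hl : ∀ q ∈ ball p₀ R₀, ‖fderiv ℝ h' q‖ ≤ 1 / (2 * (d + m)) := fun q hq => by
      have : h' =ᶠ[nhds q] h := by
        filter_upwards [hnear q hq] with x hx using hh'e x (hsub1 hx)
      rw [this.fderiv_eq]
      exact hsmall q (hsub3 hq)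
    have h1 := (convex_ball p₀ R₀).norm_image_sub_le_of_norm_fderiv_le (𝕜 := ℝ)
      (fun q _ => hh'.differentiable (by norm_num) q) hl (hin u' hu' t ht) (hin u hu t ht)
    have h2 : ‖c (u, t) - c (u', t)‖ ≤ ‖u - u'‖ := by
      rw [← map_sub]
      refine norm_prod_le_iff.2 ⟨?_, ?_⟩
      · refine (pi_norm_le_iff_of_nonneg (norm_nonneg _)).2 fun l => ?_
        exact norm_le_pi_norm (u - u') (Sum.inl l)
      · refine (pi_norm_le_iff_of_nonneg (norm_nonneg _)).2 fun l => ?_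
        have := norm_le_pi_norm (u - u') (Sum.inr l)
        have e : (c (u, t) - c (u', t)).2 l = ((u - u') (Sum.inr l) : ℝ) := by
          simp [hc, ofCoords, addI_apply]
        rw [← map_sub] at e
        rw [e, norm_real]
        exact this
    have h3 : ∀ l, (h' (c (u, t)) l - h' (c (u', t)) l) ^ 2
        ≤ (1 / (2 * (d + m)) * ‖u - u'‖) ^ 2 := fun l => by
      rw [← sq_abs, ← Real.norm_eq_abs]
      gcongr
      have := norm_le_pi_norm (h' (c (u, t)) - h' (c (u', t))) l
      refine (this.trans h1).trans ?_
      gcongr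
    have h4 := norm_sq_le_sum_sq (u - u')
    simp only [hβ, Fintype.sum_sum_type, Sum.elim_inl, Sum.elim_inr, sub_self]
    have h5 := Finset.sum_le_sum fun l (_ : l ∈ Finset.univ) => h3 l
    rw [Finset.sum_const, Finset.card_univ, Fintype.card_fin, nsmul_eq_mul] at h5
    simp only [ne_eq, OfNat.ofNat_ne_zero, not_false_eq_true, zero_pow, Finset.sum_const_zero,
      add_zero]
    rw [← Fintype.sum_sum_type fun j => (u j - u' j) ^ 2]
    simp only [Pi.sub_apply] at h4
    refine h5.trans (le_trans ?_ (mul_le_mul_of_nonneg_left h4 (by norm_num)))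
    rw [mul_pow, ← mul_assoc]
    refine mul_le_mul_of_nonneg_right ?_ (sq_nonneg _)
    rcases Nat.eq_zero_or_pos d with rfl | hd
    · simp
    · have h6 : (1 : ℝ) ≤ d := by exact_mod_cast hd
      have h7 : (0 : ℝ) ≤ m := Nat.cast_nonneg m
      rw [div_pow, one_pow, mul_one_div, div_le_div_iff₀ (by positivity) (by norm_num)]
      nlinarith [mul_nonneg (zero_le_one.trans h6) h7, mul_nonneg h7 h7]
  have hcr : ∀ u ∈ closedBall u₀ R, ∀ t ∈ closedBall t₀ R, ∀ v : Fin m → ℝ,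
      jac (eX _) (fun w => addI _ (w.1, β w)) (u, t) * fderiv ℝ (φ' ∘ c) (u, t) (0, v)
        = ∑ k, cof (eX _) (0, v) (fun w => addI _ (w.1, β w)) k (u, t)
          * fderiv ℝ (φ' ∘ c) (u, t) (eX _ k) := by
    intro u hu t ht v
    have hq := hin u hu t ht
    set q := c (u, t)
    have hZe : (fun w => addI (Fin d ⊕ Fin m) (w.1, β w))
        = fun w => mergeCoords d m (graphMap h' (c w)) := funext fun w => addI_sumElim h' w
    have hg' : DifferentiableAt ℝ (graphMap h') q :=
      differentiableAt_graphMap (hh'.differentiable (by norm_num) q)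
    have hZd : fderiv ℝ (fun w => addI (Fin d ⊕ Fin m) (w.1, β w)) (u, t)
        = ((mergeCoords d m).restrictScalars ℝ) ∘L (fderiv ℝ (graphMap h') q ∘L c) := by
      rw [hZe]
      exact (((mergeCoords d m).restrictScalars ℝ).hasFDerivAt.comp (u, t)
        (hg'.hasFDerivAt.comp (u, t) c.hasFDerivAt)).fderiv
    have hφd : fderiv ℝ (φ' ∘ c) (u, t) = fderiv ℝ φ' q ∘L c :=
      ((hφ'.differentiable (by norm_num) q).hasFDerivAt.comp (u, t) c.hasFDerivAt).fderiv
    have e1 : fderiv ℝ (graphMap h') q = fderiv ℝ (graphMap h) q := by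
      refine Filter.EventuallyEq.fderiv_eq ?_
      filter_upwards [hnear q hq] with x hx using hge x hx
    have e2 : fderiv ℝ φ' q = fderiv ℝ φ q := by
      refine Filter.EventuallyEq.fderiv_eq ?_
      filter_upwards [hnear q hq] with x hx using hφ'e x (hsub2 hx)
    have hs := sum_cof_smul (Z := fun w : (Fin d ⊕ Fin m → ℝ) × (Fin m → ℝ) =>
      addI (Fin d ⊕ Fin m) (w.1, β w)) (eX (Fin m → ℝ)) (0, v) (u, t)
    have hcr' : ∀ a b, fderiv ℝ (fun w => addI (Fin d ⊕ Fin m) (w.1, β w)) (u, t) b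
        = I • fderiv ℝ (fun w => addI (Fin d ⊕ Fin m) (w.1, β w)) (u, t) a →
        fderiv ℝ (φ' ∘ c) (u, t) b = I * fderiv ℝ (φ' ∘ c) (u, t) a := by
      intro a b hab
      rw [hφd, e2]
      refine hφ.cauchyRiemann q (hsub3 hq) _ _ ?_
      rw [hZd, e1] at hab
      apply mergeCoords_injective
      rw [map_smul]
      exact hab
    exact sum_smul_of_cr hcr' hs
  obtain ⟨r, hr, P, hPd, hPt⟩ := bt_approx (F := Fin m → ℝ) (β := β) hβd (φ := φ' ∘ c)
    (hφ'.comp c.contDiff) u₀ t₀ hR (min_le_right _ _) hlip hcr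
  have hcont2 : ∀ᶠ p in nhds p₀, (toCoords d m p) ∈ closedBall u₀ r ×ˢ closedBall t₀ r ∧
      p ∈ ball p₀ R₀ := by
    refine ((toCoords d m).continuous.continuousAt.eventually_mem ?_).and
      (hnear p₀ (mem_ball_self hR₀))
    exact prod_mem_nhds (closedBall_mem_nhds _ hr) (closedBall_mem_nhds _ hr)
  obtain ⟨r', hr', hr''⟩ := Metric.eventually_nhds_iff.1 hcont2
  refine ⟨r', hr', fun j y => P j (mergeCoords d m y),
    fun j => (hPd j).comp (mergeCoords d m).differentiable, ?_⟩
  rw [Metric.tendstoUniformlyOn_iff] at hPt ⊢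
  intro ε hε
  filter_upwards [hPt ε hε] with j hj p hp
  obtain ⟨h1, h2⟩ := hr'' hp
  have h3 := hj _ h1
  have h4 := addI_sumElim h' (toCoords d m p)
  rw [ofCoords_toCoords, hge p h2] at h4
  simp only [Function.comp_apply, hβ, hc, ofCoords_toCoords] at h3
  rwa [h4, hφ'e p (hsub2 h2)] at h3
end CR

noncomputable section

section Shift
variable {Y : Type*} [NormedAddCommGroup Y]

/-- Translation of a function on the circle. -/
def circleShift (t : UnitAddCircle) (u : C(UnitAddCircle, Y)) : C(UnitAddCircle, Y) :=
  ⟨fun θ => u (θ + t), by fun_prop⟩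

@[simp] lemma circleShift_apply (t : UnitAddCircle) (u : C(UnitAddCircle, Y))
    (θ : UnitAddCircle) : circleShift t u θ = u (θ + t) := rfl

lemma continuous_circleShift (t : UnitAddCircle) :
    Continuous (circleShift t : C(UnitAddCircle, Y) → C(UnitAddCircle, Y)) :=
  ContinuousMap.continuous_precomp (⟨fun θ => θ + t, by fun_prop⟩ : C(UnitAddCircle, UnitAddCircle))
end Shift

section L2
variable {Y Z : Type*} [NormedAddCommGroup Y] [NormedSpace ℝ Y] [NormedAddCommGroup Z]
  [NormedSpace ℝ Z]

/-- The `L²` norm of a continuous function on the circle. -/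
def circleL2 (u : C(UnitAddCircle, Y)) : ℝ :=
  ‖ContinuousMap.toLp (E := Y) 2 haarAddCircle ℝ u‖

lemma circleL2_nonneg (u : C(UnitAddCircle, Y)) : 0 ≤ circleL2 u := norm_nonneg _

lemma continuous_circleL2 : Continuous (circleL2 : C(UnitAddCircle, Y) → ℝ) :=
  continuous_norm.comp (ContinuousMap.toLp (E := Y) 2 haarAddCircle ℝ).continuous

lemma circleL2_add_le (u v : C(UnitAddCircle, Y)) :
    circleL2 (u + v) ≤ circleL2 u + circleL2 v := by
  rw [circleL2, map_add]; exact norm_add_le _ _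

lemma circleL2_smul (c : ℝ) (u : C(UnitAddCircle, Y)) :
    circleL2 (c • u) = |c| * circleL2 u := by
  rw [circleL2, map_smul, norm_smul]; rfl

lemma circleL2_mono {u : C(UnitAddCircle, Y)} {v : C(UnitAddCircle, Z)}
    (h : ∀ θ, ‖u θ‖ ≤ ‖v θ‖) : circleL2 u ≤ circleL2 v := by
  refine Lp.norm_le_norm_of_ae_le ?_
  filter_upwards [coeFn_toLp (p := 2) (𝕜 := ℝ) haarAddCircle u,
    coeFn_toLp (p := 2) (𝕜 := ℝ) haarAddCircle v] with θ h1 h2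
  rw [h1, h2]; exact h θ

lemma circleL2_le_of_bound {u : C(UnitAddCircle, Y)} {b : ℝ} (hb : 0 ≤ b)
    (h : ∀ θ, ‖u θ‖ ≤ b) : circleL2 u ≤ b := by
  have h1 : circleL2 u ≤ circleL2 (ContinuousMap.const UnitAddCircle b) :=
    circleL2_mono fun θ => (h θ).trans (le_abs_self b)
  refine h1.trans ?_
  rw [circleL2, Lp.norm_def, eLpNorm_congr_ae (coeFn_toLp (p := 2) (𝕜 := ℝ)
    haarAddCircle (ContinuousMap.const UnitAddCircle b))]
  rw [show ⇑(ContinuousMap.const UnitAddCircle b) = fun _ => b from rfl, eLpNorm_const _ (by norm_num) (IsProbabilityMeasure.ne_zero _)]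
  simp [abs_of_nonneg hb]

/-- The pointwise norm of a continuous function on the circle. -/
def circleNorm (u : C(UnitAddCircle, Y)) : C(UnitAddCircle, ℝ) := ⟨fun θ => ‖u θ‖, by fun_prop⟩

lemma circleL2_circleNorm (u : C(UnitAddCircle, Y)) : circleL2 (circleNorm u) = circleL2 u :=
  le_antisymm (circleL2_mono fun θ => by simp [circleNorm])
    (circleL2_mono fun θ => by simp [circleNorm])

lemma circleL2_le_of_add {W : Type*} [NormedAddCommGroup W] [NormedSpace ℝ W]
    {u : C(UnitAddCircle, Y)} {v : C(UnitAddCircle, Z)} {w : C(UnitAddCircle, W)} {a b : ℝ}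
    (ha : 0 ≤ a) (hb : 0 ≤ b) (h : ∀ θ, ‖u θ‖ ≤ a * ‖v θ‖ + b * ‖w θ‖) :
    circleL2 u ≤ a * circleL2 v + b * circleL2 w := by
  have h1 : circleL2 u ≤ circleL2 (a • circleNorm v + b • circleNorm w) :=
    circleL2_mono fun θ => (h θ).trans (le_abs_self _)
  refine h1.trans ((circleL2_add_le _ _).trans ?_)
  rw [circleL2_smul, circleL2_smul, circleL2_circleNorm, circleL2_circleNorm, abs_of_nonneg ha,
    abs_of_nonneg hb]

lemma circleL2_le_mul {u : C(UnitAddCircle, Y)} {v : C(UnitAddCircle, Z)} {a : ℝ}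
    (ha : 0 ≤ a) (h : ∀ θ, ‖u θ‖ ≤ a * ‖v θ‖) : circleL2 u ≤ a * circleL2 v := by
  have := circleL2_le_of_add (w := v) ha le_rfl (fun θ => by simpa using h θ)
  simpa using this

lemma circleL2_circleShift (t : UnitAddCircle) (u : C(UnitAddCircle, Y)) :
    circleL2 (circleShift t u) = circleL2 u := by
  rw [circleL2, circleL2, Lp.norm_def, Lp.norm_def,
    eLpNorm_congr_ae (coeFn_toLp (p := 2) (𝕜 := ℝ) haarAddCircle u),
    eLpNorm_congr_ae (coeFn_toLp (p := 2) (𝕜 := ℝ) haarAddCircle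
      (circleShift t u))]
  congr 1
  exact eLpNorm_comp_measurePreserving (p := 2) u.continuous.aestronglyMeasurable
    (measurePreserving_add_right haarAddCircle t)

/-- `u` is bounded by `b` in the Sobolev space `H¹` of the circle. -/
structure HB (u : C(UnitAddCircle, Y)) (b : ℝ) : Prop where
  l2 : circleL2 u ≤ b
  shift : ∀ t, circleL2 (circleShift t u - u) ≤ b * ‖t‖

namespace HB
variable {u v : C(UnitAddCircle, Y)} {b c : ℝ}

lemma nonneg (h : HB u b) : 0 ≤ b := (circleL2_nonneg u).trans h.l2

lemma mono (h : HB u b) (hbc : b ≤ c) : HB u c :=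
  ⟨h.l2.trans hbc, fun t => (h.shift t).trans (by gcongr)⟩

lemma add (h : HB u b) (h' : HB v c) : HB (u + v) (b + c) := by
  refine ⟨(circleL2_add_le _ _).trans (add_le_add h.l2 h'.l2), fun t => ?_⟩
  have : circleShift t (u + v) - (u + v) = (circleShift t u - u) + (circleShift t v - v) := by
    ext θ; simp; abel
  rw [this, add_mul]
  exact (circleL2_add_le _ _).trans (add_le_add (h.shift t) (h'.shift t))

lemma of_le_mul {u : C(UnitAddCircle, Y)} {v : C(UnitAddCircle, Z)} {a b : ℝ} (ha : 0 ≤ a)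
    (h : HB v b) (h1 : ∀ θ, ‖u θ‖ ≤ a * ‖v θ‖)
    (h2 : ∀ θ θ', ‖u θ - u θ'‖ ≤ a * ‖v θ - v θ'‖) : HB u (a * b) := by
  refine ⟨(circleL2_le_mul ha h1).trans (by gcongr; exact h.l2), fun t => ?_⟩
  refine (circleL2_le_mul (v := circleShift t v - v) ha fun θ => h2 _ _).trans ?_
  rw [mul_assoc]; gcongr; exact h.shift t

lemma neg (h : HB u b) : HB (-u) b := by
  have := of_le_mul (u := -u) zero_le_one h (fun θ => by simp)
    (fun θ θ' => by
      rw [ContinuousMap.neg_apply, ContinuousMap.neg_apply, one_mul, ← norm_neg, neg_sub_neg,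
        neg_sub])
  simpa using this

lemma sub (h : HB u b) (h' : HB v c) : HB (u - v) (b + c) := by
  rw [sub_eq_add_neg]; exact h.add h'.neg

lemma zero (hb : 0 ≤ b) : HB (0 : C(UnitAddCircle, Y)) b := by
  have h0 : circleL2 (0 : C(UnitAddCircle, Y)) = 0 := by simp [circleL2]
  refine ⟨h0.trans_le hb, fun t => ?_⟩
  have : circleShift t (0 : C(UnitAddCircle, Y)) - 0 = 0 := by ext; simp
  rw [this, h0]; positivity

lemma of_lipschitz (hb : 0 ≤ b) (h1 : ∀ θ, ‖u θ‖ ≤ b)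
    (h2 : ∀ θ θ', ‖u θ - u θ'‖ ≤ b * ‖θ - θ'‖) : HB u b :=
  ⟨circleL2_le_of_bound hb h1, fun t => circleL2_le_of_bound (by positivity) fun θ => by
    simpa using h2 (θ + t) θ⟩

lemma const (y : Y) : HB (ContinuousMap.const UnitAddCircle y) ‖y‖ :=
  of_lipschitz (norm_nonneg y) (fun θ => le_rfl) (fun θ θ' => by simp; positivity)

lemma translate (h : HB u b) (t : UnitAddCircle) : HB (circleShift t u) b := by
  refine ⟨(circleL2_circleShift t u).trans_le h.l2, fun s => ?_⟩
  have : circleShift s (circleShift t u) - circleShift t u =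
      circleShift t (circleShift s u - u) := by
    ext θ; simp [add_right_comm]
  rw [this, circleL2_circleShift]
  exact h.shift s

lemma of_tendsto {ι : Type*} {l : Filter ι} [l.NeBot] {w : ι → C(UnitAddCircle, Y)}
    {β : ι → ℝ} (hw : Tendsto w l (nhds u)) (hβ : Tendsto β l (nhds b))
    (h : ∀ᶠ i in l, HB (w i) (β i)) : HB u b := by
  refine ⟨le_of_tendsto_of_tendsto ((continuous_circleL2.tendsto u).comp hw) hβ
    (h.mono fun i hi => hi.l2), fun t => ?_⟩
  have h1 : Tendsto (fun i => circleShift t (w i) - w i) l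
      (nhds (circleShift t u - u)) :=
    (((continuous_circleShift t).tendsto u).comp hw).sub hw
  exact le_of_tendsto_of_tendsto ((continuous_circleL2.tendsto _).comp h1) (hβ.mul_const _)
    (h.mono fun i hi => hi.shift t)
end HB
end L2

lemma circleL2_eq_complex (u : C(UnitAddCircle, ℂ)) :
    circleL2 u = ‖ContinuousMap.toLp (E := ℂ) 2 haarAddCircle ℂ u‖ := rfl

lemma sum_norm_fourierCoeff_sq_le (u : C(UnitAddCircle, ℂ)) (s : Finset ℤ) :
    ∑ k ∈ s, ‖fourierCoeff u k‖ ^ 2 ≤ circleL2 u ^ 2 := by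
  have h := (@orthonormal_fourier 1 _).sum_inner_products_le (s := s)
    (ContinuousMap.toLp (E := ℂ) 2 haarAddCircle ℂ u)
  rw [← circleL2_eq_complex] at h
  refine le_trans (le_of_eq (sum_congr rfl fun k _ => ?_)) h
  rw [← fourierCoeff_toLp, ← fourierBasis_repr, HilbertBasis.repr_apply_apply, coe_fourierBasis]

lemma fourierCoeff_circleShift (t : UnitAddCircle) (u : C(UnitAddCircle, ℂ)) (n : ℤ) :
    fourierCoeff (circleShift t u) n = fourier n t * fourierCoeff u n := by
  have h := integral_add_right_eq_self (μ := haarAddCircle)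
    (fun θ : UnitAddCircle => fourier (-n) (θ - t) • u θ) t
  rw [fourierCoeff, fourierCoeff, ← integral_const_mul]
  simp only [add_sub_cancel_right] at h
  refine h.trans (integral_congr_ae (Eventually.of_forall fun θ => ?_))
  simp only [smul_eq_mul]
  rw [← mul_assoc]
  congr 1
  simp only [fourier_apply, sub_eq_add_neg, smul_add]
  rw [AddCircle.toCircle_add]
  simp [mul_comm]

lemma fourierCoeff_sub' (u v : C(UnitAddCircle, ℂ)) (n : ℤ) :
    fourierCoeff (u - v : C(UnitAddCircle, ℂ)) n = fourierCoeff u n - fourierCoeff v n := by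
  have hi : ∀ w : C(UnitAddCircle, ℂ),
      Integrable (fun θ => fourier (-n) θ • w θ) haarAddCircle := fun w =>
    (by fun_prop : Continuous fun θ : UnitAddCircle => fourier (-n) θ • w θ).integrable_of_hasCompactSupport
      (HasCompactSupport.of_compactSpace _)
  rw [fourierCoeff, fourierCoeff, fourierCoeff, ← integral_sub (hi u) (hi v)]
  simp [mul_sub]

lemma HB.sum_sq_mul_norm_fourierCoeff_sq_le {u : C(UnitAddCircle, ℂ)} {b : ℝ} (h : HB u b)
    (s : Finset ℤ) : ∑ k ∈ s, (k : ℝ) ^ 2 * ‖fourierCoeff u k‖ ^ 2 ≤ b ^ 2 := by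
  have h1 : ∀ x : ℝ, x ≠ 0 → ∑ k ∈ s, ‖x⁻¹ • (fourier k ((0 + x : ℝ) : UnitAddCircle)
      - fourier k ((0 : ℝ) : UnitAddCircle))‖ ^ 2 * ‖fourierCoeff u k‖ ^ 2 ≤ b ^ 2 := by
    intro x hx
    have h2 := sum_norm_fourierCoeff_sq_le (circleShift (x : UnitAddCircle) u - u) s
    have h3 : circleL2 (circleShift (x : UnitAddCircle) u - u) ≤ b * |x| := by
      refine (h.shift _).trans (mul_le_mul_of_nonneg_left ?_ h.nonneg)
      exact QuotientAddGroup.norm_mk_le_norm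
    have h4 := h2.trans (pow_le_pow_left₀ (circleL2_nonneg _) h3 2)
    have h5 : ∑ k ∈ s, ‖x⁻¹ • (fourier k ((0 + x : ℝ) : UnitAddCircle)
        - fourier k ((0 : ℝ) : UnitAddCircle))‖ ^ 2 * ‖fourierCoeff u k‖ ^ 2
        = (|x|⁻¹) ^ 2 * ∑ k ∈ s,
          ‖fourierCoeff (circleShift (x : UnitAddCircle) u - u : C(UnitAddCircle, ℂ)) k‖ ^ 2 := by
      rw [mul_sum]
      refine sum_congr rfl fun k _ => ?_
      rw [fourierCoeff_sub', fourierCoeff_circleShift, norm_smul, zero_add, Real.norm_eq_abs,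
        abs_inv, ← sub_one_mul, norm_mul]
      simp only [QuotientAddGroup.mk_zero, fourier_eval_zero]
      ring
    rw [h5]
    have hx' : 0 < |x| := abs_pos.2 hx
    calc _ ≤ (|x|⁻¹) ^ 2 * (b * |x|) ^ 2 := by gcongr
      _ = b ^ 2 := by field_simp
  have h2 : ∀ k : ℤ, Tendsto (fun x : ℝ => ‖x⁻¹ • (fourier k ((0 + x : ℝ) : UnitAddCircle)
      - fourier k ((0 : ℝ) : UnitAddCircle))‖ ^ 2) (nhdsWithin 0 {0}ᶜ)
      (nhds ((2 * Real.pi * |(k : ℝ)|) ^ 2)) := by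
    intro k
    have h3 := (hasDerivAt_iff_tendsto_slope_zero.1 (hasDerivAt_fourier 1 k 0)).norm.pow 2
    convert h3 using 2
    congr 1
    simp [abs_of_pos Real.pi_pos]
  have h3 : Tendsto (fun x : ℝ => ∑ k ∈ s, ‖x⁻¹ • (fourier k ((0 + x : ℝ) : UnitAddCircle)
      - fourier k ((0 : ℝ) : UnitAddCircle))‖ ^ 2 * ‖fourierCoeff u k‖ ^ 2) (nhdsWithin 0 {0}ᶜ)
      (nhds (∑ k ∈ s, (2 * Real.pi * |(k : ℝ)|) ^ 2 * ‖fourierCoeff u k‖ ^ 2)) :=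
    tendsto_finsetSum _ fun k _ => (h2 k).mul_const _
  have h4 := le_of_tendsto h3 (eventually_mem_nhdsWithin.mono fun x hx => h1 x hx)
  refine le_trans (Finset.sum_le_sum fun k _ => ?_) h4
  refine mul_le_mul_of_nonneg_right ?_ (by positivity)
  rw [mul_pow, sq_abs]
  have : 1 ≤ 2 * Real.pi := by linarith [Real.pi_gt_three]
  exact le_mul_of_one_le_left (sq_nonneg _) (one_le_pow₀ this)

/-- The constant in the embedding of the Sobolev space `H¹` in the Wiener algebra. -/
def wienerC : ℝ := (∑' k : ℤ, 1 / (1 + (k : ℝ) ^ 2)) + 2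

lemma summable_one_div_one_add_sq : Summable fun k : ℤ => 1 / (1 + (k : ℝ) ^ 2) := by
  refine Summable.of_norm_bounded_eventually
    (Real.summable_one_div_int_pow (p := 2).2 (by norm_num)) ?_
  rw [Filter.eventually_cofinite]
  refine (Set.finite_singleton (0 : ℤ)).subset fun k hk => ?_
  by_contra h0
  have h0' : (k : ℝ) ≠ 0 := by exact_mod_cast h0
  refine hk ?_
  rw [norm_of_nonneg (by positivity)]
  have : 0 < (k : ℝ) ^ 2 := by positivity
  gcongr; linarith

lemma wienerC_pos : 0 < wienerC := by
  have : 0 ≤ ∑' k : ℤ, 1 / (1 + (k : ℝ) ^ 2) := tsum_nonneg fun k => by positivity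
  unfold wienerC; linarith

lemma HB.sum_norm_fourierCoeff_le {u : C(UnitAddCircle, ℂ)} {b : ℝ} (h : HB u b)
    (s : Finset ℤ) : ∑ k ∈ s, ‖fourierCoeff u k‖ ≤ wienerC * b := by
  have key : ∀ b, 0 < b → HB u b → ∑ k ∈ s, ‖fourierCoeff u k‖ ≤ wienerC * b := by
    intro b hb h
    have h1 : ∀ k ∈ s, ‖fourierCoeff u k‖ ≤ b * (1 / (1 + (k : ℝ) ^ 2)) +
        b⁻¹ * (‖fourierCoeff u k‖ ^ 2 + (k : ℝ) ^ 2 * ‖fourierCoeff u k‖ ^ 2) := by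
      intro k _
      set x := ‖fourierCoeff u k‖
      have hx : 0 ≤ x := norm_nonneg _
      set w := 1 + (k : ℝ) ^ 2
      have hw : 0 < w := by positivity
      have e1 : b * (1 / w) + b⁻¹ * (x ^ 2 + (k : ℝ) ^ 2 * x ^ 2) - x
          = (b / w) * ((1 - w * x / b) ^ 2 + w * x / b) := by
        simp only [w]; field_simp; ring
      have : 0 ≤ (b / w) * ((1 - w * x / b) ^ 2 + w * x / b) := by positivity
      linarith
    refine (Finset.sum_le_sum h1).trans ?_
    rw [sum_add_distrib, ← mul_sum, ← mul_sum, sum_add_distrib]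
    have a1 := (sum_norm_fourierCoeff_sq_le u s).trans
      (pow_le_pow_left₀ (circleL2_nonneg _) h.l2 2)
    have a2 := h.sum_sq_mul_norm_fourierCoeff_sq_le s
    have a3 : ∑ k ∈ s, 1 / (1 + (k : ℝ) ^ 2) ≤ ∑' k : ℤ, 1 / (1 + (k : ℝ) ^ 2) :=
      summable_one_div_one_add_sq.sum_le_tsum s fun k _ => by positivity
    calc _ ≤ b * (∑' k : ℤ, 1 / (1 + (k : ℝ) ^ 2)) + b⁻¹ * (b ^ 2 + b ^ 2) := by gcongr
      _ = wienerC * b := by unfold wienerC; field_simp; ring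
  refine le_of_forall_pos_le_add fun ε hε => ?_
  have hw := wienerC_pos
  have hb := h.nonneg
  have := key (b + ε / wienerC) (by positivity) (h.mono (by simp; positivity))
  rw [mul_add, mul_div_cancel₀ _ hw.ne'] at this
  exact this

lemma HB.summable_norm_fourierCoeff {u : C(UnitAddCircle, ℂ)} {b : ℝ} (h : HB u b) :
    Summable fun k => ‖fourierCoeff u k‖ :=
  summable_of_sum_le (fun _ => norm_nonneg _) h.sum_norm_fourierCoeff_le

lemma HB.tsum_norm_fourierCoeff_le {u : C(UnitAddCircle, ℂ)} {b : ℝ} (h : HB u b) :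
    ∑' k, ‖fourierCoeff u k‖ ≤ wienerC * b :=
  h.summable_norm_fourierCoeff.tsum_le_of_sum_le h.sum_norm_fourierCoeff_le

lemma norm_fourier_apply (k : ℤ) (θ : UnitAddCircle) : ‖fourier k θ‖ = 1 := by
  rw [fourier_apply]; exact Circle.norm_coe _

lemma HB.norm_apply_le_complex {u : C(UnitAddCircle, ℂ)} {b : ℝ} (h : HB u b)
    (θ : UnitAddCircle) : ‖u θ‖ ≤ wienerC * b := by
  have h1 := has_pointwise_sum_fourier_series_of_summable h.summable_norm_fourierCoeff.of_norm θ
  refine le_trans ?_ h.tsum_norm_fourierCoeff_le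
  refine h1.norm_le_of_bounded h.summable_norm_fourierCoeff.hasSum fun k => ?_
  rw [norm_smul, norm_fourier_apply, mul_one]

lemma HB.norm_apply_le {Y : Type*} [NormedAddCommGroup Y] [NormedSpace ℝ Y]
    {u : C(UnitAddCircle, Y)} {b : ℝ} (h : HB u b) (θ : UnitAddCircle) :
    ‖u θ‖ ≤ wienerC * b := by
  set w : C(UnitAddCircle, ℂ) := ⟨fun θ => (‖u θ‖ : ℂ), by fun_prop⟩
  have hw : HB w (1 * b) := of_le_mul zero_le_one h (fun θ => by simp [w]) fun θ θ' => by
    simp only [w, ContinuousMap.coe_mk, one_mul]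
    rw [← ofReal_sub, norm_real]
    exact abs_norm_sub_norm_le _ _
  rw [one_mul] at hw
  simpa [w] using hw.norm_apply_le_complex θ

/-- A real continuous function on the circle, viewed as a complex one. -/
def complexify (e : C(UnitAddCircle, ℝ)) : C(UnitAddCircle, ℂ) := ⟨fun θ => (e θ : ℂ), by fun_prop⟩

@[simp] lemma complexify_apply (e : C(UnitAddCircle, ℝ)) (θ : UnitAddCircle) :
    complexify e θ = (e θ : ℂ) := rfl

lemma HB.toComplex {e : C(UnitAddCircle, ℝ)} {b : ℝ} (h : HB e b) : HB (complexify e) b := by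
  have := HB.of_le_mul (u := complexify e) zero_le_one h (fun θ => by simp)
    (fun θ θ' => by simp [← ofReal_sub])
  simpa using this

lemma fourierCoeff_complexify_neg (e : C(UnitAddCircle, ℝ)) (k : ℤ) :
    fourierCoeff (complexify e) (-k) = conj (fourierCoeff (complexify e) k) := by
  rw [fourierCoeff, fourierCoeff, ← integral_conj]
  refine integral_congr_ae (Eventually.of_forall fun θ => ?_)
  simp only [smul_eq_mul, map_mul, complexify_apply, conj_ofReal, ← fourier_neg]

/-- The power series coefficients of the Schwarz transform. -/
def schwarzCoeff (e : C(UnitAddCircle, ℝ)) (k : ℕ) : ℂ :=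
  (if k = 0 then 1 else 2) * fourierCoeff (complexify e) k

/-- The Schwarz transform: the holomorphic function on the disc with real part `e` on the circle
and real value at the origin. -/
def schwarz (e : C(UnitAddCircle, ℝ)) (ζ : ℂ) : ℂ := ∑' k : ℕ, schwarzCoeff e k * ζ ^ k

/-- The boundary values of the Schwarz transform. -/
def schwarzC (e : C(UnitAddCircle, ℝ)) : C(UnitAddCircle, ℂ) :=
  ∑' k : ℕ, schwarzCoeff e k • fourier (k : ℤ)

lemma norm_schwarzCoeff_le (e : C(UnitAddCircle, ℝ)) (k : ℕ) :
    ‖schwarzCoeff e k‖ ≤ 2 * ‖fourierCoeff (complexify e) k‖ := by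
  unfold schwarzCoeff
  split_ifs
  · rw [one_mul]; linarith [norm_nonneg (fourierCoeff (complexify e) k)]
  · simp

lemma schwarzCoeff_sub (e e' : C(UnitAddCircle, ℝ)) (k : ℕ) :
    schwarzCoeff (e - e') k = schwarzCoeff e k - schwarzCoeff e' k := by
  have : complexify (e - e') = complexify e - complexify e' := by ext; simp
  rw [schwarzCoeff, this, fourierCoeff_sub', mul_sub]; rfl

lemma schwarzCoeff_circleShift (t : UnitAddCircle) (e : C(UnitAddCircle, ℝ)) (k : ℕ) :
    schwarzCoeff (circleShift t e) k = fourier (k : ℤ) t * schwarzCoeff e k := by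
  have : complexify (circleShift t e) = circleShift t (complexify e) := by ext; simp
  rw [schwarzCoeff, this, fourierCoeff_circleShift, schwarzCoeff]; ring

lemma natCast_pow_toCircle (k : ℕ) (θ : UnitAddCircle) :
    fourier (k : ℤ) θ = (toCircle θ : ℂ) ^ k := by
  rw [fourier_apply, natCast_zsmul, AddCircle.toCircle_nsmul, Circle.coe_pow]

namespace HB
variable {e e' : C(UnitAddCircle, ℝ)} {b b' : ℝ}

lemma summable_norm_schwarzCoeff (h : HB e b) : Summable fun k => ‖schwarzCoeff e k‖ :=
  Summable.of_nonneg_of_le (fun _ => norm_nonneg _) (norm_schwarzCoeff_le e)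
    ((h.toComplex.summable_norm_fourierCoeff.comp_injective Nat.cast_injective).mul_left 2)

lemma summable_schwarzC (h : HB e b) :
    Summable fun k : ℕ => schwarzCoeff e k • (fourier (k : ℤ) : C(UnitAddCircle, ℂ)) :=
  Summable.of_norm (by
    simp_rw [norm_smul, fourier_norm, mul_one]; exact h.summable_norm_schwarzCoeff)

lemma hasSum_schwarzC (h : HB e b) (θ : UnitAddCircle) :
    HasSum (fun k : ℕ => schwarzCoeff e k * fourier (k : ℤ) θ) (schwarzC e θ) :=
  (ContinuousMap.evalCLM ℂ θ).hasSum h.summable_schwarzC.hasSum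

lemma schwarzC_apply (h : HB e b) (θ : UnitAddCircle) :
    schwarzC e θ = schwarz e (toCircle θ) := by
  rw [← (h.hasSum_schwarzC θ).tsum_eq, schwarz]
  exact tsum_congr fun k => by rw [natCast_pow_toCircle]

lemma schwarzC_sub (h : HB e b) (h' : HB e' b') :
    schwarzC (e - e') = schwarzC e - schwarzC e' := by
  rw [schwarzC, schwarzC, schwarzC, ← h.summable_schwarzC.tsum_sub h'.summable_schwarzC]
  refine tsum_congr fun k => ?_
  rw [schwarzCoeff_sub]
  exact sub_smul (schwarzCoeff e k) (schwarzCoeff e' k) (fourier (k : ℤ) : C(UnitAddCircle, ℂ))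

lemma schwarzC_circleShift (h : HB e b) (t : UnitAddCircle) :
    schwarzC (circleShift t e) = circleShift t (schwarzC e) := by
  ext θ
  rw [circleShift_apply, ← ((h.translate t).hasSum_schwarzC θ).tsum_eq,
    ← (h.hasSum_schwarzC (θ + t)).tsum_eq]
  refine tsum_congr fun k => ?_
  rw [schwarzCoeff_circleShift, natCast_pow_toCircle, natCast_pow_toCircle, natCast_pow_toCircle,
    AddCircle.toCircle_add, Circle.coe_mul]
  ring

lemma diffContOnCl_schwarz (h : HB e b) : DiffContOnCl ℂ (schwarz e) (ball 0 1) := by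
  have hb : ∀ k : ℕ, ∀ ζ ∈ closedBall (0 : ℂ) 1, ‖schwarzCoeff e k * ζ ^ k‖ ≤ ‖schwarzCoeff e k‖ := by
    intro k ζ hζ
    rw [norm_mul, norm_pow]
    exact mul_le_of_le_one_right (norm_nonneg _)
      (pow_le_one₀ (norm_nonneg _) (mem_closedBall_zero_iff.1 hζ))
  refine ⟨?_, ?_⟩
  · exact Complex.differentiableOn_tsum_of_summable_norm h.summable_norm_schwarzCoeff
      (fun k => (by fun_prop : Differentiable ℂ fun ζ : ℂ => schwarzCoeff e k * ζ ^ k).differentiableOn)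
      isOpen_ball fun k ζ hζ => hb k ζ (ball_subset_closedBall hζ)
  · rw [closure_ball _ one_ne_zero]
    exact continuousOn_tsum (fun k => by fun_prop) h.summable_norm_schwarzCoeff hb

lemma schwarz_zero : schwarz e 0 = ((∫ θ, e θ ∂haarAddCircle : ℝ) : ℂ) := by
  rw [schwarz, tsum_eq_single 0 (fun k hk => by simp [hk]), ← integral_complex_ofReal]
  simp [schwarzCoeff, fourierCoeff]

lemma schwarzC_re (h : HB e b) (θ : UnitAddCircle) : (schwarzC e θ).re = e θ := by
  set c : ℤ → ℂ := fun k => fourierCoeff (complexify e) k • fourier k θ with hc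
  have hsum := h.toComplex.summable_norm_fourierCoeff
  have hsc : Summable c := by
    refine Summable.of_norm (hsum.congr fun k => ?_)
    rw [hc, norm_smul, norm_fourier_apply, mul_one]
  have hconj : ∀ k, c (-k) = conj (c k) := fun k => by
    simp only [hc, smul_eq_mul, map_mul, fourierCoeff_complexify_neg, fourier_neg]
  have h1 := (has_pointwise_sum_fourier_series_of_summable hsum.of_norm θ).tsum_eq
  have s1 : Summable fun n : ℕ => c n := hsc.comp_injective Nat.cast_injective
  have s2 : Summable fun n : ℕ => c ((n : ℤ) + 1) :=
    hsc.comp_injective fun a b hab => by simpa using hab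
  have s3 : Summable fun n : ℕ => c (-((n : ℤ) + 1)) :=
    hsc.comp_injective fun a b hab => by simpa using hab
  have h2 := tsum_of_nat_of_neg_add_one s1 s3
  have h3 : ∑' n : ℕ, c n = c 0 + ∑' n : ℕ, c ((n : ℤ) + 1) := by
    have := s1.tsum_eq_zero_add
    simpa using this
  have h4 : ∑' n : ℕ, c (-((n : ℤ) + 1)) = conj (∑' n : ℕ, c ((n : ℤ) + 1)) := by
    rw [Complex.conj_tsum]
    exact tsum_congr fun n => hconj _
  have h5 : schwarzC e θ = c 0 + 2 * ∑' n : ℕ, c ((n : ℤ) + 1) := by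
    rw [← (h.hasSum_schwarzC θ).tsum_eq, (h.hasSum_schwarzC θ).summable.tsum_eq_zero_add, ← tsum_mul_left]
    congr 1
    · simp [schwarzCoeff, hc]
    · refine tsum_congr fun n => ?_
      simp [schwarzCoeff, hc, mul_assoc]
  have h6 : c 0 = conj (c 0) := by simpa using hconj 0
  have h7 : (c 0).im = 0 := by
    have := congrArg Complex.im h6; simp at this; linarith
  rw [h1] at h2
  have h8 := congrArg Complex.re h2
  rw [h3, h4] at h8
  simp at h8
  rw [h5]
  simp
  linarith

lemma circleL2_schwarzC_le (h : HB e b) : circleL2 (schwarzC e) ≤ 2 * circleL2 e := by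
  have h1 := (h.summable_schwarzC.hasSum.tendsto_sum_nat)
  have h2 := (continuous_circleL2.tendsto _).comp h1
  refine le_of_tendsto h2 (Eventually.of_forall fun n => ?_)
  have hn := circleL2_nonneg e
  refine (pow_le_pow_iff_left₀ (circleL2_nonneg _) (by positivity) two_ne_zero).1 ?_
  have hor : Orthonormal ℂ fun k : ℕ => @fourierLp 1 _ 2 _ (k : ℤ) :=
    (@orthonormal_fourier 1 _).comp _ Nat.cast_injective
  have e1 : circleL2 (∑ k ∈ Finset.range n, schwarzCoeff e k •
      (fourier (k : ℤ) : C(UnitAddCircle, ℂ))) ^ 2 =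
      ∑ k ∈ Finset.range n, ‖schwarzCoeff e k‖ ^ 2 := by
    rw [circleL2_eq_complex, map_sum]
    simp_rw [map_smul]
    have := hor.inner_sum (schwarzCoeff e) (schwarzCoeff e) (Finset.range n)
    rw [← @inner_self_eq_norm_sq ℂ]
    erw [this]
    simp [← Complex.normSq_eq_norm_sq, Complex.normSq_apply]
  refine le_of_eq_of_le e1 ?_
  have e2 := sum_norm_fourierCoeff_sq_le (complexify e)
    ((Finset.range n).map Nat.castEmbedding)
  rw [Finset.sum_map] at e2
  have e3 : circleL2 (complexify e) = circleL2 e :=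
    le_antisymm (circleL2_mono fun θ => by simp) (circleL2_mono fun θ => by simp)
  rw [e3] at e2
  calc _ ≤ ∑ k ∈ Finset.range n, 4 * ‖fourierCoeff (complexify e) (k : ℤ)‖ ^ 2 := by
        refine Finset.sum_le_sum fun k _ => ?_
        have := pow_le_pow_left₀ (norm_nonneg _) (norm_schwarzCoeff_le e k) 2
        linarith [this, mul_pow 2 ‖fourierCoeff (complexify e) (k : ℤ)‖ 2]
    _ ≤ 4 * circleL2 e ^ 2 := by rw [← mul_sum]; gcongr; exact e2
    _ = _ := by ring

lemma schwarz_boundary (h : HB e b) : HB (schwarzC e) (2 * b) := by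
  refine ⟨h.circleL2_schwarzC_le.trans (by linarith [h.l2]), fun t => ?_⟩
  rw [← h.schwarzC_circleShift, ← (h.translate t).schwarzC_sub h]
  refine ((h.translate t).sub h).circleL2_schwarzC_le.trans ?_
  linarith [h.shift t]
end HB

section Fixed
variable {Z : Type*} [NormedAddCommGroup Z] [NormedSpace ℝ Z]

lemma HB.norm_le {u : C(UnitAddCircle, Z)} {b : ℝ} (h : HB u b) : ‖u‖ ≤ wienerC * b :=
  (ContinuousMap.norm_le _ (mul_nonneg wienerC_pos.le h.nonneg)).2 h.norm_apply_le

/-- `Φ` contracts the ball of radius `b` of `H¹` by a factor `1/2`. -/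
def HalfContracts (Φ : C(UnitAddCircle, Z) → C(UnitAddCircle, Z)) (b : ℝ) : Prop :=
  ∀ e e' β, HB e b → HB e' b → HB (e - e') β → HB (Φ e - Φ e') (β / 2)

lemma tendsto_div_two_pow (a : ℝ) : Tendsto (fun k : ℕ => a / 2 ^ k) atTop (nhds 0) := by
  have := (tendsto_pow_atTop_nhds_zero_of_lt_one (r := (1 / 2 : ℝ)) (by norm_num)
    (by norm_num)).const_mul a
  simpa [div_eq_mul_inv] using this

lemma exists_fixed_of_halfContracts [CompleteSpace Z]
    {Φ : C(UnitAddCircle, Z) → C(UnitAddCircle, Z)}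
    {b : ℝ} (hb : 0 ≤ b) (hself : ∀ e, HB e b → HB (Φ e) b) (hc : HalfContracts Φ b) :
    ∃ e, HB e b ∧ Φ e = e := by
  set x : ℕ → C(UnitAddCircle, Z) := fun k => Φ^[k] 0 with hx
  have hxs : ∀ k, x (k + 1) = Φ (x k) := fun k => Function.iterate_succ_apply' Φ k 0
  have hxb : ∀ k, HB (x k) b := by
    intro k
    induction k with
    | zero => exact HB.zero hb
    | succ k ih => rw [hxs]; exact hself _ ih
  have hdiff : ∀ k j, HB (x (k + j) - x k) (2 * b / 2 ^ k) := by
    intro k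
    induction k with
    | zero => intro j; simpa [two_mul] using (hxb (0 + j)).sub (hxb 0)
    | succ k ih =>
      intro j
      rw [show k + 1 + j = k + j + 1 by ring, hxs, hxs]
      have := hc _ _ _ (hxb _) (hxb _) (ih j)
      rwa [div_div, ← pow_succ] at this
  have hcau : CauchySeq x := by
    refine cauchySeq_of_le_geometric (1 / 2) (wienerC * (2 * b)) (by norm_num) fun k => ?_
    rw [dist_comm, dist_eq_norm]
    refine (hdiff k 1).norm_le.trans_eq ?_
    simp [div_eq_mul_inv, mul_assoc]
  obtain ⟨e, he⟩ := cauchySeq_tendsto_of_complete hcau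
  have heb : HB e b := HB.of_tendsto he tendsto_const_nhds (Eventually.of_forall hxb)
  refine ⟨e, heb, ?_⟩
  have h1 : ∀ k, HB (e - x k) (2 * b / 2 ^ k) := fun k => by
    refine HB.of_tendsto (l := atTop) (w := fun j => x (k + j) - x k) (β := fun _ => 2 * b / 2 ^ k)
      ?_ tendsto_const_nhds (Eventually.of_forall (hdiff k))
    refine Tendsto.sub_const ?_ _
    simpa only [add_comm] using (tendsto_add_atTop_iff_nat k).2 he
  have h2 : ∀ k, ‖Φ e - x (k + 1)‖ ≤ wienerC * (2 * b / 2 ^ k / 2) := fun k => by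
    rw [hxs]; exact (hc _ _ _ heb (hxb k) (h1 k)).norm_le
  have h3 : Tendsto (fun k => ‖Φ e - x (k + 1)‖) atTop (nhds ‖Φ e - e‖) :=
    (tendsto_const_nhds.sub ((tendsto_add_atTop_iff_nat 1).2 he)).norm
  have h4 : Tendsto (fun k : ℕ => wienerC * (2 * b / 2 ^ k / 2)) atTop (nhds 0) := by
    simpa using ((tendsto_div_two_pow (2 * b)).div_const 2).const_mul wienerC
  have h5 := le_of_tendsto_of_tendsto h3 h4 (Eventually.of_forall h2)
  exact sub_eq_zero.1 (norm_le_zero_iff.1 h5)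

lemma HalfContracts.compare {Φ Φ' : C(UnitAddCircle, Z) → C(UnitAddCircle, Z)}
    {b δ : ℝ} (hc : HalfContracts Φ b) {e e' : C(UnitAddCircle, Z)} (he : HB e b) (he' : HB e' b)
    (hfe : Φ e = e) (hfe' : Φ' e' = e') (hδ : HB (Φ e' - Φ' e') δ) : HB (e - e') (2 * δ) := by
  have h1 : ∀ k : ℕ, HB (e - e') (2 * b / 2 ^ k + 2 * δ) := by
    intro k
    induction k with
    | zero => exact (he.sub he').mono (by simp; linarith [hδ.nonneg])
    | succ k ih =>
      have h2 := (hc _ _ _ he he' ih).add hδ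
      rw [hfe, hfe', sub_add_sub_cancel] at h2
      refine h2.mono (le_of_eq ?_)
      rw [pow_succ]; field_simp; ring
  refine HB.of_tendsto (l := atTop) (w := fun _ : ℕ => e - e') tendsto_const_nhds ?_
    (Eventually.of_forall h1)
  simpa using (tendsto_div_two_pow (2 * b)).add_const (2 * δ)
end Fixed

section Comp
variable {Y Z : Type*} [NormedAddCommGroup Y] [NormedSpace ℝ Y] [NormedAddCommGroup Z]
  [NormedSpace ℝ Z]

/-- `E` vanishes at the origin and is small in `C^{1,1}` on the ball of radius `R`. -/
structure SmallC11 (E : Y → Z) (R κ : ℝ) : Prop where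
  nonneg : 0 ≤ κ
  zero : E 0 = 0
  lip : ∀ a ∈ closedBall (0 : Y) R, ∀ b ∈ closedBall (0 : Y) R, ‖E a - E b‖ ≤ κ * ‖a - b‖
  mixed : ∀ a₀ ∈ closedBall (0 : Y) R, ∀ a₁ ∈ closedBall (0 : Y) R,
    ∀ b₀ ∈ closedBall (0 : Y) R, ∀ b₁ ∈ closedBall (0 : Y) R,
    ‖(E a₁ - E b₁) - (E a₀ - E b₀)‖ ≤
      κ * ‖(a₁ - b₁) - (a₀ - b₀)‖ + κ * (‖b₁ - b₀‖ * ‖a₀ - b₀‖)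

lemma HB.comp_of_lip {u : C(UnitAddCircle, Y)} {B κ : ℝ} (hu : HB u B) (hκ : 0 ≤ κ)
    {E : C(Y, Z)} (h0 : E 0 = 0)
    (hE : ∀ a ∈ closedBall (0 : Y) (wienerC * B), ∀ b ∈ closedBall (0 : Y) (wienerC * B),
      ‖E a - E b‖ ≤ κ * ‖a - b‖) : HB (E.comp u) (κ * B) := by
  have hm : ∀ θ, u θ ∈ closedBall (0 : Y) (wienerC * B) := fun θ =>
    mem_closedBall_zero_iff.2 (hu.norm_apply_le θ)
  refine HB.of_le_mul hκ hu (fun θ => ?_) fun θ θ' => hE _ (hm θ) _ (hm θ')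
  have := hE _ (hm θ) 0 (mem_closedBall_self (mul_nonneg wienerC_pos.le hu.nonneg))
  simpa [h0] using this

lemma SmallC11.comp_sub {E : C(Y, Z)} {R κ B β : ℝ} (hE : SmallC11 E R κ)
    (hR : wienerC * B ≤ R) {u v : C(UnitAddCircle, Y)} (hu : HB u B) (hv : HB v B)
    (huv : HB (u - v) β) : HB (E.comp u - E.comp v) (κ * (1 + R) * β) := by
  have hm : ∀ {w : C(UnitAddCircle, Y)}, HB w B → ∀ θ, w θ ∈ closedBall (0 : Y) R := fun hw θ =>
    mem_closedBall_zero_iff.2 ((hw.norm_apply_le θ).trans hR)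
  have hβ := huv.nonneg
  have hκ := hE.nonneg
  have hR0 : 0 ≤ R := (mul_nonneg wienerC_pos.le hu.nonneg).trans hR
  constructor
  · have h1 : circleL2 (E.comp u - E.comp v) ≤ κ * circleL2 (u - v) :=
      circleL2_le_mul hκ fun θ => hE.lip _ (hm hu θ) _ (hm hv θ)
    calc _ ≤ κ * β := h1.trans (by gcongr; exact huv.l2)
      _ ≤ κ * (1 + R) * β := by
        have : 0 ≤ κ * R * β := by positivity
        linarith
  · intro t
    have h1 : circleL2 (circleShift t (E.comp u - E.comp v) - (E.comp u - E.comp v)) ≤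
        κ * circleL2 (circleShift t (u - v) - (u - v)) +
          κ * (wienerC * β) * circleL2 (circleShift t v - v) := by
      refine circleL2_le_of_add hκ (by have := wienerC_pos; positivity) fun θ => ?_
      refine (hE.mixed (u θ) (hm hu _) (u (θ + t)) (hm hu _) (v θ) (hm hv _) (v (θ + t))
        (hm hv _)).trans ?_
      have := huv.norm_apply_le θ
      simp only [ContinuousMap.sub_apply, circleShift_apply] at this ⊢
      gcongr _ + ?_
      rw [mul_assoc, mul_comm (wienerC * β)]
      gcongr
    refine h1.trans ?_
    have h2 := huv.shift t
    have h3 := hv.shift t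
    calc _ ≤ κ * (β * ‖t‖) + κ * (wienerC * β) * (B * ‖t‖) := by
          have := wienerC_pos
          gcongr
      _ = κ * (1 + wienerC * B) * β * ‖t‖ := by ring
      _ ≤ _ := by gcongr
end Comp

section PiTransform
variable {d : ℕ} {W : Type*} [NormedAddCommGroup W]

/-- A component of a vector valued function on the circle. -/
def circleCoord (l : Fin d) (e : C(UnitAddCircle, Fin d → ℝ)) : C(UnitAddCircle, ℝ) :=
  ⟨fun θ => e θ l, by fun_prop⟩

lemma HB.coord {e : C(UnitAddCircle, Fin d → ℝ)} {b : ℝ} (h : HB e b) (l : Fin d) :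
    HB (circleCoord l e) b := by
  have := HB.of_le_mul (u := circleCoord l e) zero_le_one h
    (fun θ => by simpa [circleCoord] using norm_le_pi_norm (e θ) l)
    (fun θ θ' => by simpa [circleCoord] using norm_le_pi_norm (e θ - e θ') l)
  simpa using this

/-- The boundary values of `(c + i 𝒮e, 0)` where `𝒮` is the Schwarz transform. -/
def bishopS (W : Type*) [NormedAddCommGroup W] (c : Fin d → ℝ)
    (e : C(UnitAddCircle, Fin d → ℝ)) : C(UnitAddCircle, (Fin d → ℂ) × W) :=
  ⟨fun θ => (fun l => (c l : ℂ) + I * schwarzC (circleCoord l e) θ, 0), by fun_prop⟩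

lemma bishopS_zero (c : Fin d → ℝ) :
    bishopS W c 0 = ContinuousMap.const UnitAddCircle ((fun l => (c l : ℂ), 0)) := by
  have h0 : ∀ l, schwarzC (circleCoord l (0 : C(UnitAddCircle, Fin d → ℝ))) = 0 := by
    intro l
    have h : HB (circleCoord l (0 : C(UnitAddCircle, Fin d → ℝ))) 0 := (HB.zero le_rfl).coord l
    have := h.schwarzC_sub h
    rw [sub_self, sub_self] at this
    rw [← this]; congr 1
  ext1 θ
  simp [bishopS, h0]

lemma bishopS_circleShift {e : C(UnitAddCircle, Fin d → ℝ)} {b : ℝ} (he : HB e b)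
    (c : Fin d → ℝ) (t : UnitAddCircle) :
    bishopS W c (circleShift t e) = circleShift t (bishopS W c e) := by
  ext1 θ
  refine Prod.ext (funext fun l => ?_) rfl
  have : circleCoord l (circleShift t e) = circleShift t (circleCoord l e) := rfl
  simp [bishopS, this, (he.coord l).schwarzC_circleShift]

variable [NormedSpace ℝ W]

lemma HB.of_pi {Y : Type*} [NormedAddCommGroup Y] [NormedSpace ℝ Y]
    {u : C(UnitAddCircle, (Fin d → ℂ) × Y)} {v : Fin d → C(UnitAddCircle, ℂ)} {b : ℝ}
    (hv : ∀ l, HB (v l) b) (hu : ∀ θ, u θ = (fun l => v l θ, 0)) : HB u (d * b) := by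
  have h1 : ∀ s : Finset (Fin d), ∀ w : C(UnitAddCircle, (Fin d → ℂ) × Y),
      (∀ θ, w θ = (fun l => if l ∈ s then v l θ else 0, 0)) → HB w (s.card * b) := by
    intro s
    induction s using Finset.induction_on with
    | empty =>
      intro w hw
      have : w = 0 := by ext θ <;> simp [hw]
      rw [this]; exact HB.zero (by simp)
    | insert a s ha ih =>
      intro w hw
      set w₁ : C(UnitAddCircle, (Fin d → ℂ) × Y) :=
        ⟨fun θ => (fun l => if l ∈ s then v l θ else 0, 0), by
          refine Continuous.prodMk (continuous_pi fun l => ?_) continuous_const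
          split_ifs
          · exact (v l).continuous
          · exact continuous_const⟩
      set w₂ : C(UnitAddCircle, (Fin d → ℂ) × Y) :=
        ⟨fun θ => (Pi.single a (v a θ), 0),
            ((continuous_single a).comp (v a).continuous).prodMk continuous_const⟩
      have e1 : w = w₁ + w₂ := by
        ext1 θ
        rw [hw]
        refine Prod.ext (funext fun l => ?_) (by simp [w₁, w₂])
        simp only [w₁, w₂, ContinuousMap.add_apply, ContinuousMap.coe_mk, Prod.fst_add,
          Pi.add_apply, Finset.mem_insert]
        by_cases hl : l = a
        · subst hl; simp [ha]
        · simp [hl]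
      have e2 : HB w₂ (1 * b) := by
        refine HB.of_le_mul zero_le_one (hv a) (fun θ => ?_) fun θ θ' => ?_
        · simp [w₂, Prod.norm_def, Pi.norm_single]
        · simp [w₂, Prod.norm_def, ← Pi.single_sub, Pi.norm_single]
      rw [e1, Finset.card_insert_of_notMem ha]
      push_cast
      rw [add_mul]
      exact (ih w₁ fun θ => rfl).add e2
  simpa using h1 Finset.univ u (fun θ => by simp [hu])

lemma HB.bishopS_sub {e e' : C(UnitAddCircle, Fin d → ℝ)} {b b' β : ℝ} (he : HB e b)
    (he' : HB e' b') (hee : HB (e - e') β) (c : Fin d → ℝ) :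
    HB (bishopS W c e - bishopS W c e') (2 * d * β) := by
  have : ∀ l, HB (I • schwarzC (circleCoord l e - circleCoord l e')) (1 * (2 * β)) := by
    intro l
    refine HB.of_le_mul zero_le_one (hee.coord l).schwarz_boundary (fun θ => ?_) fun θ θ' => ?_
    · simp; rfl
    · simp [← mul_sub]; rfl
  have := HB.of_pi (d := d) (Y := W) (u := bishopS W c e - bishopS W c e') this fun θ => by
    refine Prod.ext (funext fun l => ?_) (by simp [bishopS])
    simp [bishopS, (he.coord l).schwarzC_sub (he'.coord l)]
    ring
  refine this.mono (by ring_nf; rfl)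

lemma HB.bishop_bound {e : C(UnitAddCircle, Fin d → ℝ)} {b : ℝ} (he : HB e b) (c : Fin d → ℝ) :
    HB (bishopS W c e) (‖c‖ + 2 * d * b) := by
  have h1 := he.bishopS_sub (W := W) (HB.zero (le_refl 0)) (by rwa [sub_zero]) c
  rw [bishopS_zero] at h1
  have h2 := (HB.const ((fun l => (c l : ℂ), 0) : (Fin d → ℂ) × W)).add h1
  rw [add_sub_cancel] at h2
  refine h2.mono (add_le_add_left ?_ _)
  simp only [Prod.norm_def, norm_zero, norm_nonneg, sup_of_le_left]
  exact (pi_norm_le_iff_of_nonneg (norm_nonneg _)).2 fun l => by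
    rw [norm_real]; exact norm_le_pi_norm c l

lemma HB.norm_integral_le {Z : Type*} [NormedAddCommGroup Z] [NormedSpace ℝ Z]
    {u : C(UnitAddCircle, Z)} {b : ℝ} (h : HB u b) :
    ‖∫ θ, u θ ∂haarAddCircle‖ ≤ wienerC * b := by
  have := norm_integral_le_of_norm_le_const (μ := haarAddCircle) (f := u)
    (Eventually.of_forall h.norm_apply_le)
  simpa using this
end PiTransform

section Bishop
variable {d : ℕ} {W : Type*} [NormedAddCommGroup W]

/-- The Bishop operator attached to a family of discs `D` and a perturbation `E`. -/
def bishopMap (E : C((Fin d → ℂ) × W, Fin d → ℝ)) (D : (Fin d → ℝ) → C(UnitAddCircle, (Fin d → ℂ) × W))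
    (g c : Fin d → ℝ) (e : C(UnitAddCircle, Fin d → ℝ)) : C(UnitAddCircle, Fin d → ℝ) :=
  E.comp (D (g - ∫ θ, e θ ∂haarAddCircle) + bishopS W c e)

lemma bishopMap_circleShift {E : C((Fin d → ℂ) × W, Fin d → ℝ)}
    {D : (Fin d → ℝ) → C(UnitAddCircle, (Fin d → ℂ) × W)} {g c : Fin d → ℝ}
    {e : C(UnitAddCircle, Fin d → ℝ)} {b : ℝ} (he : HB e b) (t : UnitAddCircle)
    (hfe : bishopMap E D g c e = e) :
    bishopMap E (fun q => circleShift t (D q)) g c (circleShift t e) = circleShift t e := by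
  conv_rhs => rw [← hfe]
  have : ∫ θ, circleShift t e θ ∂haarAddCircle = ∫ θ, e θ ∂haarAddCircle :=
    integral_add_right_eq_self (μ := haarAddCircle) e t
  rw [bishopMap, this, bishopS_circleShift he]
  rfl

variable [NormedSpace ℝ W]

/-- A bound in `H¹` for the discs occurring in Bishop's equation. -/
def bishopB (d : ℕ) (C₀ : ℝ) : ℝ := C₀ + 1 + 2 * d

/-- The smallness of `κ` needed to solve Bishop's equation. -/
structure BishopConst (d : ℕ) (C₀ δ₀ κ : ℝ) : Prop where
  bound_nonneg : 0 ≤ C₀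
  nonneg : 0 ≤ κ
  le_one : κ * bishopB d C₀ ≤ 1
  le_radius : wienerC * (κ * bishopB d C₀) ≤ δ₀
  contract : κ * (1 + wienerC * bishopB d C₀) * (C₀ * wienerC + 2 * d) ≤ 1 / 2

lemma exists_bishopConst (d : ℕ) {C₀ δ₀ : ℝ} (hC : 0 ≤ C₀) (hδ : 0 < δ₀) :
    ∃ κ₀ > 0, ∀ κ, 0 ≤ κ → κ ≤ κ₀ → BishopConst d C₀ δ₀ κ := by
  have hw := wienerC_pos
  have hB : 0 < bishopB d C₀ := by unfold bishopB; positivity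
  have key : ∀ a b : ℝ, 0 < b → ∀ᶠ κ in nhds (0 : ℝ), κ * a < b := fun a b hb => by
    have : Tendsto (fun κ : ℝ => κ * a) (nhds 0) (nhds (0 * a)) := tendsto_id.mul_const a
    rw [zero_mul] at this
    exact this.eventually_lt_const hb
  have h := (key (bishopB d C₀) 1 one_pos).and ((key (wienerC * bishopB d C₀) δ₀ hδ).and
    (key ((1 + wienerC * bishopB d C₀) * (C₀ * wienerC + 2 * d)) (1 / 2) (by norm_num)))
  obtain ⟨ε, hε, hball⟩ := Metric.eventually_nhds_iff.1 h
  refine ⟨ε / 2, by positivity, fun κ hκ hκε => ?_⟩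
  obtain ⟨h1, h2, h3⟩ := hball (y := κ) (by
    rw [Real.dist_eq, sub_zero, abs_of_nonneg hκ]; linarith)
  exact ⟨hC, hκ, h1.le, by linarith, by linarith⟩

/-- The hypotheses under which Bishop's equation is solved. -/
structure BishopData (E : C((Fin d → ℂ) × W, Fin d → ℝ))
    (D : (Fin d → ℝ) → C(UnitAddCircle, (Fin d → ℂ) × W))
    (g c : Fin d → ℝ) (C₀ δ₀ κ : ℝ) : Prop where
  small : SmallC11 E (wienerC * bishopB d C₀) κ
  bound : ∀ g', ‖g' - g‖ ≤ δ₀ → HB (D g') C₀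
  lip : ∀ g' g'', ‖g' - g‖ ≤ δ₀ → ‖g'' - g‖ ≤ δ₀ → HB (D g' - D g'') (C₀ * ‖g' - g''‖)
  shift_le : ‖c‖ ≤ 1

namespace BishopData
variable {E E' : C((Fin d → ℂ) × W, Fin d → ℝ)}
  {D D' : (Fin d → ℝ) → C(UnitAddCircle, (Fin d → ℂ) × W)} {g g' c c' : Fin d → ℝ}
  {C₀ δ₀ κ : ℝ} {e e' : C(UnitAddCircle, Fin d → ℝ)}

lemma mean_le (hk : BishopConst d C₀ δ₀ κ) (he : HB e (κ * bishopB d C₀)) :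
    ‖∫ θ, e θ ∂haarAddCircle‖ ≤ δ₀ := he.norm_integral_le.trans hk.le_radius

lemma disc_bound (H : BishopData E D g c C₀ δ₀ κ) (hk : BishopConst d C₀ δ₀ κ)
    (he : HB e (κ * bishopB d C₀)) :
    HB (D (g - ∫ θ, e θ ∂haarAddCircle) + bishopS W c e) (bishopB d C₀) := by
  refine ((H.bound _ ?_).add (he.bishop_bound c)).mono ?_
  · simpa using mean_le hk he
  · have h1 := H.shift_le
    have h2 := hk.le_one
    have : 2 * (d : ℝ) * (κ * bishopB d C₀) ≤ 2 * d * 1 := by gcongr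
    change C₀ + (‖c‖ + _) ≤ C₀ + 1 + 2 * d
    linarith

lemma integral_sub_le {β : ℝ} (hee : HB (e - e') β) :
    ‖(∫ θ, e θ ∂haarAddCircle) - ∫ θ, e' θ ∂haarAddCircle‖ ≤ wienerC * β := by
  have hi : ∀ u : C(UnitAddCircle, Fin d → ℝ), Integrable u haarAddCircle := fun u =>
    u.continuous.integrable_of_hasCompactSupport (HasCompactSupport.of_compactSpace _)
  rw [← integral_sub (hi e) (hi e')]
  exact hee.norm_integral_le

lemma halfContracts (H : BishopData E D g c C₀ δ₀ κ) (hk : BishopConst d C₀ δ₀ κ) :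
    HalfContracts (bishopMap E D g c) (κ * bishopB d C₀) := by
  intro e e' β he he' hee
  have hw := wienerC_pos
  have hC := hk.bound_nonneg
  have h1 : HB ((D (g - ∫ θ, e θ ∂haarAddCircle) + bishopS W c e) -
      (D (g - ∫ θ, e' θ ∂haarAddCircle) + bishopS W c e'))
      ((C₀ * wienerC + 2 * d) * β) := by
    rw [add_sub_add_comm]
    refine ((H.lip _ _ ?_ ?_).add (he.bishopS_sub he' hee c)).mono ?_
    · simpa using mean_le hk he
    · simpa using mean_le hk he'
    · rw [sub_sub_sub_cancel_left, norm_sub_rev]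
      have := integral_sub_le hee
      calc _ ≤ C₀ * (wienerC * β) + 2 * d * β := by gcongr
        _ = _ := by ring
  refine (H.small.comp_sub le_rfl (H.disc_bound hk he) (H.disc_bound hk he') h1).mono ?_
  have := mul_le_mul_of_nonneg_right hk.contract hee.nonneg
  linarith

lemma exists_solution (H : BishopData E D g c C₀ δ₀ κ) (hk : BishopConst d C₀ δ₀ κ) :
    ∃ e, HB e (κ * bishopB d C₀) ∧ bishopMap E D g c e = e := by
  have hB : 0 ≤ bishopB d C₀ := by have := hk.bound_nonneg; unfold bishopB; positivity
  refine exists_fixed_of_halfContracts (mul_nonneg hk.nonneg hB) (fun e he => ?_)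
    (H.halfContracts hk)
  exact (H.disc_bound hk he).comp_of_lip hk.nonneg H.small.zero H.small.lip

lemma compare (H : BishopData E D g c C₀ δ₀ κ) (H' : BishopData E' D' g' c' C₀ δ₀ κ)
    (hk : BishopConst d C₀ δ₀ κ) (he : HB e (κ * bishopB d C₀)) (he' : HB e' (κ * bishopB d C₀))
    (hfe : bishopMap E D g c e = e) (hfe' : bishopMap E' D' g' c' e' = e') {ε δ : ℝ}
    (hε : 0 ≤ ε)
    (hE : ∀ a ∈ closedBall (0 : (Fin d → ℂ) × W) (wienerC * bishopB d C₀),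
      ∀ b ∈ closedBall (0 : (Fin d → ℂ) × W) (wienerC * bishopB d C₀),
      ‖(E a - E' a) - (E b - E' b)‖ ≤ ε * ‖a - b‖)
    (hD : ∀ q, ‖q‖ ≤ δ₀ → HB (D (g - q) - D' (g' - q)) δ) :
    HB (e - e') (2 * (κ * (1 + wienerC * bishopB d C₀) * (δ + ‖c - c'‖) + ε * bishopB d C₀)) := by
  refine (H.halfContracts hk).compare he he' hfe hfe' ?_
  set q := ∫ θ, e' θ ∂haarAddCircle with hq
  have hqδ : ‖q‖ ≤ δ₀ := mean_le hk he'
  have h1 : HB ((D (g - q) + bishopS W c e') - (D' (g' - q) + bishopS W c' e')) (δ + ‖c - c'‖) := by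
    rw [add_sub_add_comm]
    refine (hD q hqδ).add ?_
    have : bishopS W c e' - bishopS W c' e' =
        ContinuousMap.const UnitAddCircle ((fun l => ((c - c') l : ℂ), 0) : (Fin d → ℂ) × W) := by
      ext1 θ
      refine Prod.ext (funext fun l => ?_) (by simp [bishopS])
      simp [bishopS]
    rw [this]
    refine (HB.const _).mono ?_
    simp only [Prod.norm_def, norm_zero, norm_nonneg, sup_of_le_left]
    exact (pi_norm_le_iff_of_nonneg (norm_nonneg _)).2 fun l => by
      rw [norm_real]; exact norm_le_pi_norm (c - c') l
  have h2 := H.small.comp_sub le_rfl (H.disc_bound hk he') (H'.disc_bound hk he') h1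
  have h3 := (H'.disc_bound hk he').comp_of_lip hε (E := E - E')
    (by simp [H.small.zero, H'.small.zero]) hE
  have h4 := h2.add h3
  refine cast (congrArg (HB · _) ?_) h4
  ext1 θ
  simp [bishopMap]
end BishopData
end Bishop

section Levi
variable {d m : ℕ}

lemma smul_eq_re_add_im (c : ℂ) (a : Fin m → ℂ) :
    c • a = c.re • a + c.im • (I • a) := by
  ext j; simp; conv_lhs => rw [← re_add_im c]
  ring

lemma I_smul_smul_eq (c : ℂ) (a : Fin m → ℂ) :
    I • (c • a) = c.re • (I • a) - c.im • a := by
  ext j; simp; conv_lhs => rw [← re_add_im c]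
  ring_nf; simp; ring

/-- The sesquilinear Levi form of a real bilinear map, `ℂ`-linear in the second argument `a`. -/
def levi (β : VectorForm d m) (l : Fin d) (b : Fin m → ℂ) :
    (Fin m → ℂ) →ₗ[ℂ] ℂ where
  toFun a := (((β a b l + β (I • a) (I • b) l) / 4 : ℝ) : ℂ) +
    I * (((β a (I • b) l - β (I • a) b l) / 4 : ℝ) : ℂ)
  map_add' a a' := by
    simp only [smul_add, map_add, add_apply, Pi.add_apply]
    push_cast; ring
  map_smul' c a := by
    rw [I_smul_smul_eq, smul_eq_re_add_im]
    simp only [map_add, map_sub, map_smul, add_apply, Pi.add_apply,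
      sub_apply, Pi.sub_apply, smul_apply, Pi.smul_apply,
      smul_eq_mul, RingHom.id_apply]
    have h3 : I * (c.im * I) = -c.im := by ring_nf; simp
    conv_rhs => rw [← re_add_im c]
    push_cast
    linear_combination (-(1 / 4) * (β a (I • b) l - β (I • a) b l : ℂ)) * h3

lemma levi_conj {β : VectorForm d m}
    (hβ : ∀ a b, β a b = β b a) (l : Fin d) (a b : Fin m → ℂ) :
    levi β l a b = conj (levi β l b a) := by
  simp only [levi, LinearMap.coe_mk, AddHom.coe_mk, map_add, map_mul, Complex.conj_I,
    conj_ofReal]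
  rw [hβ b a, hβ (I • b) (I • a), hβ b (I • a), hβ (I • b) a]
  push_cast; ring

lemma levi_self {β : VectorForm d m}
    (hβ : ∀ a b, β a b = β b a) (l : Fin d) (a : Fin m → ℂ) :
    levi β l a a = (((β a a l + β (I • a) (I • a) l) / 4 : ℝ) : ℂ) := by
  simp only [levi, LinearMap.coe_mk, AddHom.coe_mk]
  rw [hβ (I • a) a]
  simp

lemma levi_smul_left {β : VectorForm d m}
    (hβ : ∀ a b, β a b = β b a) (l : Fin d) (c : ℂ) (a b : Fin m → ℂ) :
    levi β l (c • b) a = conj c * levi β l b a := by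
  rw [levi_conj hβ, map_smul, smul_eq_mul, map_mul, ← levi_conj hβ]

lemma levi_add_left {β : VectorForm d m}
    (hβ : ∀ a b, β a b = β b a) (l : Fin d) (a b b' : Fin m → ℂ) :
    levi β l (b + b') a = levi β l b a + levi β l b' a := by
  rw [levi_conj hβ, map_add, map_add, ← levi_conj hβ, ← levi_conj hβ]

lemma levi_sum_left {β : VectorForm d m}
    (hβ : ∀ a b, β a b = β b a) (l : Fin d) {ι : Type*} (s : Finset ι) (f : ι → Fin m → ℂ)
    (a : Fin m → ℂ) : levi β l (∑ i ∈ s, f i) a = ∑ i ∈ s, levi β l (f i) a := by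
  rw [levi_conj hβ, map_sum, map_sum]
  exact sum_congr rfl fun i _ => (levi_conj hβ l _ _).symm

/-- The complex bilinear form complementary to the Levi form. -/
def holBilin (β : VectorForm d m) (l : Fin d) (b : Fin m → ℂ) :
    (Fin m → ℂ) →ₗ[ℂ] ℂ where
  toFun a := (((β a b l - β (I • a) (I • b) l) / 4 : ℝ) : ℂ) -
    I * (((β a (I • b) l + β (I • a) b l) / 4 : ℝ) : ℂ)
  map_add' a a' := by
    simp only [smul_add, map_add, add_apply, Pi.add_apply]
    push_cast; ring
  map_smul' c a := by
    rw [I_smul_smul_eq, smul_eq_re_add_im]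
    simp only [map_add, map_sub, map_smul, add_apply, Pi.add_apply,
      sub_apply, Pi.sub_apply, smul_apply, Pi.smul_apply,
      smul_eq_mul, RingHom.id_apply]
    have h3 : I * (c.im * I) = -c.im := by ring_nf; simp
    conv_rhs => rw [← re_add_im c]
    push_cast
    linear_combination ((1 / 4) * (β a (I • b) l + β (I • a) b l : ℂ)) * h3

lemma holBilin_symm {β : VectorForm d m}
    (hβ : ∀ a b, β a b = β b a) (l : Fin d) (a b : Fin m → ℂ) :
    holBilin β l a b = holBilin β l b a := by
  simp only [holBilin, LinearMap.coe_mk, AddHom.coe_mk]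
  rw [hβ b a, hβ (I • b) (I • a), hβ b (I • a), hβ (I • b) a]
  push_cast; ring

lemma quadratic_eq_levi_add {β : VectorForm d m}
    (l : Fin d) (a : Fin m → ℂ) :
    1 / 2 * β a a l = (levi β l a a).re + (holBilin β l a a).re := by
  simp only [levi, holBilin, LinearMap.coe_mk, AddHom.coe_mk]
  simp
  ring

lemma differentiable_holBilin {β : VectorForm d m}
    (hβ : ∀ a b, β a b = β b a) (l : Fin d) :
    ContDiff ℂ ⊤ fun w : Fin m → ℂ => holBilin β l w w := by
  have : (fun w : Fin m → ℂ => holBilin β l w w) = fun w =>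
      ∑ j, w j * ∑ k, w k * holBilin β l (Pi.single j 1) (Pi.single k 1) := by
    funext w
    rw [LinearMap.pi_apply_eq_sum_univ]
    refine sum_congr rfl fun j _ => ?_
    rw [smul_eq_mul]
    congr 1
    rw [holBilin_symm hβ, LinearMap.pi_apply_eq_sum_univ]
    refine sum_congr rfl fun k _ => ?_
    rw [smul_eq_mul]
    congr 3 <;> · ext i; simp [Pi.single_apply, eq_comm]
  rw [this]
  fun_prop

lemma exists_levi_independent {β : VectorForm d m}
    (h : (interior (convexHull ℝ {v : Fin d → ℝ | ∃ a : Fin m → ℂ, v = fun l =>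
        (1 / 4) * (β a a l + β (fun i => I * a i) (fun i => I * a i) l)})).Nonempty)
    (hβ : ∀ a b, β a b = β b a) :
    ∃ e : Fin d → Fin m → ℂ, LinearIndependent ℝ fun i l => (levi β l (e i) (e i)).re := by
  set S := {v : Fin d → ℝ | ∃ a : Fin m → ℂ, v = fun l =>
        (1 / 4) * (β a a l + β (fun i => I * a i) (fun i => I * a i) l)} with hS
  have htop : Submodule.span ℝ S = ⊤ := by
    refine Submodule.eq_top_of_nonempty_interior' _ (h.mono (interior_mono ?_))
    exact convexHull_min Submodule.subset_span (Submodule.span ℝ S).convex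
  obtain ⟨t, htS, hts, hti⟩ := exists_linearIndependent ℝ S
  rw [htop] at hts
  let b := Module.Basis.mk hti (by rw [Subtype.range_coe, hts])
  have hfin : Finite t := Module.Finite.finite_basis b
  have := Fintype.ofFinite t
  have hcard : Fintype.card t = d := by
    have := Module.finrank_eq_card_basis b
    simpa using this.symm
  let ε : Fin d ≃ t := (finCongr hcard.symm).trans (Fintype.equivFin t).symm
  have hch : ∀ i : Fin d, ∃ a : Fin m → ℂ, ((ε i : t) : Fin d → ℝ) = fun l =>
      (1 / 4) * (β a a l + β (fun i => I * a i) (fun i => I * a i) l) :=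
    fun i => htS (ε i).2
  choose e he using hch
  refine ⟨e, ?_⟩
  have h2 := hti.comp ε ε.injective
  have hfun : (fun i l => (levi β l (e i) (e i)).re) = Subtype.val ∘ ε := ?_
  · rw [hfun]; exact h2
  funext i
  rw [Function.comp_apply, he i]
  funext l
  rw [levi_self hβ, ofReal_re]
  have : (I • e i) = fun j => I * e i j := rfl
  rw [this]; ring

/-- Scaling the vectors `e i` by rapidly decreasing weights makes the cross terms negligible. -/
lemma exists_hierarchy {β : VectorForm d m}
    (hβ : ∀ a b, β a b = β b a) {e₀ : Fin d → Fin m → ℂ}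
    (he₀ : LinearIndependent ℝ fun i l => (levi β l (e₀ i) (e₀ i)).re) :
    ∃ e : Fin d → Fin m → ℂ, LinearIndependent ℝ (fun i l => (levi β l (e i) (e i)).re) ∧
      ∀ α : Fin d → Fin d → ℂ, (∀ i j, ‖α i j‖ ≤ 2) → ∀ x : Fin d → ℝ,
        (∀ l, ∑ i, x i * ((levi β l (e i) (e i)).re +
          2 * ∑ j, if i < j then (α i j * levi β l (e j) (e i)).im else 0) = 0) → x = 0 := by
  set v : Fin d → Fin d → ℝ := fun i l => (levi β l (e₀ i) (e₀ i)).re with hv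
  have hinj : Function.Injective (Fintype.linearCombination ℝ v) :=
    he₀.fintypeLinearCombination_injective
  obtain ⟨K, hK, hanti⟩ := LinearMap.exists_antilipschitzWith (Fintype.linearCombination ℝ v)
    (LinearMap.ker_eq_bot.mpr hinj)
  obtain ⟨B, hB0, hB⟩ : ∃ B : ℝ, 0 ≤ B ∧ ∀ l i j, ‖levi β l (e₀ j) (e₀ i)‖ ≤ B := by
    refine ⟨∑ l, ∑ i, ∑ j, ‖levi β l (e₀ j) (e₀ i)‖, by positivity, fun l i j => ?_⟩
    calc ‖levi β l (e₀ j) (e₀ i)‖ ≤ ∑ j, ‖levi β l (e₀ j) (e₀ i)‖ :=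
          Finset.single_le_sum (f := fun j => ‖levi β l (e₀ j) (e₀ i)‖)
            (fun _ _ => norm_nonneg _) (Finset.mem_univ j)
      _ ≤ ∑ i, ∑ j, ‖levi β l (e₀ j) (e₀ i)‖ :=
          Finset.single_le_sum (f := fun i => ∑ j, ‖levi β l (e₀ j) (e₀ i)‖)
            (fun _ _ => by positivity) (Finset.mem_univ i)
      _ ≤ _ := Finset.single_le_sum (f := fun l => ∑ i, ∑ j, ‖levi β l (e₀ j) (e₀ i)‖)
            (fun _ _ => by positivity) (Finset.mem_univ l)
  set δ : ℝ := 1 / (1 + K * (d * (4 * d * B))) with hδ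
  have hKB : (0 : ℝ) ≤ K * (d * (4 * d * B)) := by positivity
  have hδ0 : 0 < δ := by positivity
  have hδ1 : δ ≤ 1 := by rw [hδ, div_le_one (by positivity)]; linarith
  have hδs : K * (d * (4 * d * B)) * δ < 1 := by
    rw [hδ, mul_one_div, div_lt_one (by positivity)]; linarith
  have hlev : ∀ (l i j : Fin d), levi β l (((δ ^ (j : ℕ) : ℝ) : ℂ) • e₀ j) (((δ ^ (i : ℕ) : ℝ) : ℂ) • e₀ i)
      = ((δ ^ (j : ℕ) * δ ^ (i : ℕ) : ℝ) : ℂ) * levi β l (e₀ j) (e₀ i) := by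
    intro l i j
    rw [levi_smul_left hβ, map_smul, conj_ofReal, smul_eq_mul]
    push_cast; ring
  have hz : ∀ α : Fin d → Fin d → ℂ, (∀ i j, ‖α i j‖ ≤ 2) → ∀ y : Fin d → ℝ,
      (∀ l, ∑ i, y i * (v i l + 2 * ∑ j, if i < j then
        (α i j * ((δ ^ ((j : ℕ) - (i : ℕ)) : ℝ) * levi β l (e₀ j) (e₀ i))).im else 0) = 0) →
      y = 0 := by
    intro α hα y hy
    by_contra hne
    have hpos : 0 < ‖y‖ := norm_pos_iff.mpr hne
    have h1 : ‖y‖ ≤ K * ‖Fintype.linearCombination ℝ v y‖ := by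
      simpa [dist_zero_right] using hanti.le_mul_dist y 0
    have h2 : ‖Fintype.linearCombination ℝ v y‖ ≤ d * (‖y‖ * (4 * d * B * δ)) := by
      refine (pi_norm_le_iff_of_nonneg (by positivity)).mpr fun l => ?_
      have h3 : Fintype.linearCombination ℝ v y l = -∑ i, y i * (2 * ∑ j, if i < j then
        (α i j * ((δ ^ ((j : ℕ) - (i : ℕ)) : ℝ) * levi β l (e₀ j) (e₀ i))).im else 0) := by
        have := hy l
        simp only [mul_add, sum_add_distrib] at this
        rw [Fintype.linearCombination_apply, Finset.sum_apply]
        simp only [Pi.smul_apply, smul_eq_mul]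
        linarith
      rw [h3, norm_neg]
      refine (norm_sum_le _ _).trans ((Finset.sum_le_card_nsmul _ _ (‖y‖ * (4 * d * B * δ))
        fun i _ => ?_).trans (by simp))
      rw [norm_mul]
      refine mul_le_mul (norm_le_pi_norm y i) ?_ (norm_nonneg _) (norm_nonneg _)
      rw [norm_mul, Real.norm_ofNat]
      have h4 : ‖∑ j, if i < j then (α i j * ((δ ^ ((j : ℕ) - (i : ℕ)) : ℝ) *
          levi β l (e₀ j) (e₀ i))).im else 0‖ ≤ d * (2 * (δ * B)) := by
        refine (norm_sum_le _ _).trans ((Finset.sum_le_card_nsmul _ _ (2 * (δ * B))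
          fun j _ => ?_).trans (by simp))
        split_ifs with hij
        · refine (Complex.abs_im_le_norm _).trans ?_
          rw [norm_mul, norm_mul, norm_real, norm_of_nonneg (by positivity)]
          have h5 : δ ^ ((j : ℕ) - (i : ℕ)) ≤ δ := by
            refine pow_le_of_le_one hδ0.le hδ1 ?_
            have : (i : ℕ) < j := hij
            omega
          have := hα i j; have := hB l i j
          gcongr
        · rw [norm_zero]; positivity
      linarith
    have h6 : ‖y‖ ≤ K * (d * (4 * d * B)) * δ * ‖y‖ := by
      calc ‖y‖ ≤ K * (d * (‖y‖ * (4 * d * B * δ))) := h1.trans (by gcongr)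
        _ = _ := by ring
    nlinarith
  have hsq : ∀ i : Fin d, 0 < δ ^ (i : ℕ) * δ ^ (i : ℕ) := fun i => by positivity
  refine ⟨fun i => ((δ ^ (i : ℕ) : ℝ) : ℂ) • e₀ i, ?_, fun α hα x hx => ?_⟩
  · have := he₀.units_smul fun i => Units.mk0 (δ ^ (i : ℕ) * δ ^ (i : ℕ)) (hsq i).ne'
    convert this using 1
    funext i l
    simp only [hlev, re_ofReal_mul]
    simp [hv, Units.smul_def]
  · have := hz α hα (fun i => x i * (δ ^ (i : ℕ) * δ ^ (i : ℕ))) fun l => by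
      refine Eq.trans (sum_congr rfl fun i _ => ?_) (hx l)
      simp only [hlev, re_ofReal_mul]
      rw [mul_assoc, mul_add (δ ^ (i : ℕ) * δ ^ (i : ℕ)), mul_left_comm _ (2 : ℝ), mul_sum]
      congr 4
      funext j
      split_ifs with hij
      · have h5 : δ ^ (j : ℕ) = δ ^ (i : ℕ) * δ ^ ((j : ℕ) - (i : ℕ)) := by
          rw [← pow_add]; congr 1
          have : (i : ℕ) < j := hij
          omega
        rw [← Complex.im_ofReal_mul, h5]
        congr 1
        push_cast; ring
      · simp
    funext i
    have := congrFun this i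
    simpa [(pow_pos hδ0 _).ne'] using this

/-- The `ℂ^m`-component of the model discs. -/
def modelW (e : Fin d → Fin m → ℂ) (ρ : Fin d → ℝ) (q : Fin d → ℂ) (u : Fin m → ℂ) (ζ : ℂ) :
    Fin m → ℂ :=
  ∑ i : Fin d, ((ρ i : ℂ) * (ζ ^ (2 * (i : ℕ) + 1) * (1 + q i * ζ))) • e i + ζ ^ (2 * d + 1) • u

/-- The holomorphic function whose real part on the unit circle is the quadratic form evaluated on
`modelW`. -/
def modelQ (β : VectorForm d m) (e : Fin d → Fin m → ℂ)
    (ρ : Fin d → ℝ) (q : Fin d → ℂ) (u : Fin m → ℂ) (ζ : ℂ) (l : Fin d) : ℂ :=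
  holBilin β l (modelW e ρ q u ζ) (modelW e ρ q u ζ)
    + ∑ i, (ρ i : ℂ) ^ 2 * levi β l (e i) (e i) * (2 + 2 * q i * ζ) + levi β l u u
    + 2 * ∑ i, ∑ j, (if j < i then (ρ i : ℂ) * ρ j * levi β l (e j) (e i) *
        (ζ ^ (2 * ((i : ℕ) - j) - 1) * (1 + q i * ζ) * (ζ + conj (q j))) else 0)
    + 2 * ∑ j, (ρ j : ℂ) * levi β l (e j) u *
        (ζ ^ (2 * (d - (j : ℕ)) - 1) * (ζ + conj (q j)))

lemma mul_conj_eq_one {ζ : ℂ} (hζ : ‖ζ‖ = 1) : ζ * conj ζ = 1 := by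
  rw [Complex.mul_conj, Complex.normSq_eq_norm_sq, hζ]; simp

lemma pow_mul_conj_pow_of_lt {ζ : ℂ} (hζ : ‖ζ‖ = 1) {i j : ℕ} (hij : j < i) (q : ℂ) :
    ζ ^ (2 * i + 1) * conj (ζ ^ (2 * j + 1) * (1 + q * ζ)) =
      ζ ^ (2 * (i - j) - 1) * (ζ + conj q) := by
  obtain ⟨k, rfl⟩ : ∃ k, i = j + (k + 1) := ⟨i - j - 1, by omega⟩
  have h1 : 2 * (j + (k + 1) - j) - 1 = 2 * k + 1 := by omega
  have h2 := mul_conj_eq_one hζ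
  rw [h1]
  simp only [map_mul, map_pow, map_add, map_one]
  have h3 : ζ ^ (2 * j) * conj ζ ^ (2 * j) = 1 := by rw [← mul_pow, h2, one_pow]
  have e1 : ζ ^ (2 * (j + (k + 1)) + 1) = ζ ^ (2 * j) * ζ ^ (2 * k + 1) * ζ ^ 2 := by ring
  have e2 : conj ζ ^ (2 * j + 1) = conj ζ ^ (2 * j) * conj ζ := by
    ring
  rw [e1, e2]
  linear_combination (ζ ^ (2 * k + 1) * ζ * (1 + conj q * conj ζ) *
    (ζ * conj ζ)) * h3 + (ζ ^ (2 * k + 1) * ζ + ζ ^ (2 * k + 1) *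
      conj q * (ζ * conj ζ + 1)) * h2

variable {β : VectorForm d m}

/-- On the unit circle the powers in `modelQ` are products `a i * conj (a j)`. -/
lemma modelQ_of_norm_eq_one (e : Fin d → Fin m → ℂ) (ρ : Fin d → ℝ) (q : Fin d → ℂ)
    (u : Fin m → ℂ) {ζ : ℂ} (hζ : ‖ζ‖ = 1) (l : Fin d) :
    modelQ β e ρ q u ζ l = holBilin β l (modelW e ρ q u ζ) (modelW e ρ q u ζ)
    + ∑ i, (ρ i : ℂ) ^ 2 * levi β l (e i) (e i) * (2 + 2 * q i * ζ) + levi β l u u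
    + 2 * ∑ i, ∑ j, (if j < i then (ρ i : ℂ) * ρ j * levi β l (e j) (e i) *
        ((ζ ^ (2 * (i : ℕ) + 1) * (1 + q i * ζ)) *
          conj (ζ ^ (2 * (j : ℕ) + 1) * (1 + q j * ζ))) else 0)
    + 2 * ∑ j, (ρ j : ℂ) * levi β l (e j) u *
        (ζ ^ (2 * d + 1) * conj (ζ ^ (2 * (j : ℕ) + 1) * (1 + q j * ζ))) := by
  rw [modelQ]
  refine congrArg₂ (· + ·) (congrArg₂ (· + ·) rfl (congrArg₂ (· * ·) rfl ?_))
    (congrArg₂ (· * ·) rfl ?_)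
  · refine (sum_congr rfl fun i _ => sum_congr rfl fun j _ => ?_)
    split_ifs with hij
    · rw [mul_right_comm (ζ ^ _) _ (conj _), pow_mul_conj_pow_of_lt hζ hij]; ring
    · rfl
  · refine sum_congr rfl fun j _ => ?_
    rw [pow_mul_conj_pow_of_lt hζ j.2]

lemma sum_sum_eq_diag_add_lt_add_gt (f : Fin d → Fin d → ℂ) :
    ∑ i, ∑ j, f i j = ∑ i, f i i + (∑ i, ∑ j, if j < i then f i j else 0)
      + ∑ i, ∑ j, if i < j then f i j else 0 := by
  have h1 : ∀ i j, f i j = (if j = i then f i j else 0) + (if j < i then f i j else 0)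
      + (if i < j then f i j else 0) := by
    intro i j
    rcases lt_trichotomy i j with h | h | h
    · simp [h, h.ne', h.not_gt]
    · simp [h]
    · simp [h, h.ne, h.not_gt]
  calc ∑ i, ∑ j, f i j = ∑ i, ∑ j, ((if j = i then f i j else 0) +
        (if j < i then f i j else 0) + (if i < j then f i j else 0)) :=
        sum_congr rfl fun i _ => sum_congr rfl fun j _ => h1 i j
    _ = _ := by
        simp only [sum_add_distrib]
        simp

/-- The expansion of a sesquilinear sum into its diagonal and its strictly triangular part. -/
lemma sum_sum_eq_diag_add {f : Fin d → Fin d → ℂ}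
    (hf : ∀ i j, f j i = conj (f i j)) :
    (∑ i, ∑ j, f i j).re = (∑ i, f i i + 2 * ∑ i, ∑ j, if j < i then f i j else 0).re := by
  have h2 : (∑ i, ∑ j, if i < j then f i j else 0) =
      conj (∑ i, ∑ j, if j < i then f i j else 0) := by
    rw [Finset.sum_comm, map_sum]
    refine sum_congr rfl fun j _ => ?_
    rw [map_sum]
    refine sum_congr rfl fun i _ => ?_
    split_ifs
    · exact hf j i
    · simp
  rw [sum_sum_eq_diag_add_lt_add_gt, h2]
  simp
  ring

lemma re_modelQ (hβ : ∀ a b, β a b = β b a) (e : Fin d → Fin m → ℂ) (ρ : Fin d → ℝ)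
    {q : Fin d → ℂ} (hq : ∀ i, ‖q i‖ = 1) (u : Fin m → ℂ) {ζ : ℂ} (hζ : ‖ζ‖ = 1) (l : Fin d) :
    (modelQ β e ρ q u ζ l).re =
      1 / 2 * β (modelW e ρ q u ζ) (modelW e ρ q u ζ) l := by
  rw [quadratic_eq_levi_add, modelQ_of_norm_eq_one e ρ q u hζ]
  set W := modelW e ρ q u ζ with hW
  set c : Fin d → ℂ := fun i => (ρ i : ℂ) * (ζ ^ (2 * (i : ℕ) + 1) * (1 + q i * ζ)) with hc
  have hWc : W = ∑ i, c i • e i + ζ ^ (2 * d + 1) • u := rfl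
  set S := ∑ i, c i • e i with hS
  set p := ζ ^ (2 * d + 1) with hp
  have hpp : p * conj p = 1 := mul_conj_eq_one (by rw [hp, norm_pow, hζ, one_pow])
  have h1 : levi β l W W = levi β l S S + levi β l u u
      + (levi β l S (p • u) + conj (levi β l S (p • u))) := by
    rw [hWc, map_add, levi_add_left hβ, levi_add_left hβ, ← levi_conj hβ]
    rw [levi_smul_left hβ l p (p • u) u, map_smul (levi β l u) p u, smul_eq_mul]
    linear_combination (levi β l u u) * hpp
  have h2 : levi β l S (p • u) = ∑ j, (ρ j : ℂ) * levi β l (e j) u *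
        (p * conj (ζ ^ (2 * (j : ℕ) + 1) * (1 + q j * ζ))) := by
    rw [hS, levi_sum_left hβ]
    refine sum_congr rfl fun j _ => ?_
    rw [levi_smul_left hβ, map_smul, smul_eq_mul, hc]
    simp only [map_mul, conj_ofReal]; ring
  have h3 : levi β l S S = ∑ i, ∑ j, c i * conj (c j) * levi β l (e j) (e i) := by
    conv_lhs => rw [hS, map_sum]
    refine sum_congr rfl fun i _ => ?_
    rw [map_smul, levi_sum_left hβ, smul_eq_mul, mul_sum]
    refine sum_congr rfl fun j _ => ?_
    rw [levi_smul_left hβ]; ring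
  have h4 := sum_sum_eq_diag_add (d := d)
    (f := fun i j => c i * conj (c j) * levi β l (e j) (e i)) fun i j => by
      simp only [map_mul, Complex.conj_conj]
      rw [← levi_conj hβ l (e i) (e j)]
      ring
  have h5 : ∀ i, (c i * conj (c i) * levi β l (e i) (e i)).re =
      ((ρ i : ℂ) ^ 2 * levi β l (e i) (e i) * (2 + 2 * q i * ζ)).re := by
    intro i
    have hz : ζ ^ (2 * (i : ℕ) + 1) * conj (ζ ^ (2 * (i : ℕ) + 1)) = 1 :=
      mul_conj_eq_one (by rw [norm_pow, hζ, one_pow])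
    have hqz : (q i * ζ) * conj (q i * ζ) = 1 :=
      mul_conj_eq_one (by rw [norm_mul, hq, hζ, one_mul])
    have e1 : c i * conj (c i) =
        (ρ i : ℂ) ^ 2 * (2 + (q i * ζ + conj (q i * ζ))) := by
      rw [hc]
      rw [map_mul, map_mul, conj_ofReal, map_add, map_one]
      linear_combination ((ρ i : ℂ) ^ 2 * (1 + q i * ζ) *
        (1 + conj (q i * ζ))) * hz + (ρ i : ℂ) ^ 2 * hqz
    rw [e1, Complex.add_conj, levi_self hβ]
    rw [← Complex.ofReal_pow, mul_assoc, mul_assoc, re_ofReal_mul, re_ofReal_mul]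
    simp only [Complex.mul_re, Complex.add_re, ofReal_re, Complex.ofReal_im, Complex.re_ofNat,
      Complex.im_ofNat, Complex.add_im, Complex.mul_im]
    ring
  have h6 : ∀ i j : Fin d, (if j < i then c i * conj (c j) * levi β l (e j) (e i) else 0)
      = if j < i then (ρ i : ℂ) * ρ j * levi β l (e j) (e i) *
        ((ζ ^ (2 * (i : ℕ) + 1) * (1 + q i * ζ)) *
          conj (ζ ^ (2 * (j : ℕ) + 1) * (1 + q j * ζ))) else 0 := by
    intro i j
    split_ifs
    · rw [hc]; rw [map_mul, conj_ofReal]; ring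
    · rfl
  rw [h3.symm] at h4
  simp only [h6] at h4
  rw [h1, ← h2]
  simp only [Complex.add_re, h4, Complex.add_conj]
  simp only [Complex.re_sum, h5]
  rw [show (2 : ℂ) = ((2 : ℝ) : ℂ) by norm_num]
  simp only [re_ofReal_mul, ofReal_re]
  ring

/-- The radii of the model disc with center `(i g, 0)`. -/
def modelRad (β : VectorForm d m)
    (γ : Fin d → (Fin d → ℝ) →L[ℝ] ℝ) (g : Fin d → ℝ) (u : Fin m → ℂ) (i : Fin d) : ℝ :=
  √(γ i (g - fun l => (levi β l u u).re) / 2)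

/-- The unimodular numbers attached to the angles `s`. -/
def modelPhase (s : Fin d → ℝ) (i : Fin d) : ℂ := Complex.exp (s i * I)

/-- Explicit analytic discs attached to the quadric `Im z = ½ β(w, w)`. -/
def modelDisc (β : VectorForm d m) (e : Fin d → Fin m → ℂ)
    (γ : Fin d → (Fin d → ℝ) →L[ℝ] ℝ) (g : Fin d → ℝ) (τ : Base d m) (ζ : ℂ) :
    Ambient d m :=
  (fun l => I * modelQ β e (modelRad β γ g τ.2) (modelPhase τ.1) τ.2 ζ l,
    modelW e (modelRad β γ g τ.2) (modelPhase τ.1) τ.2 ζ)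

/-- The properties of the family of model discs used in solving the Bishop equation. -/
structure ModelFamily (β : VectorForm d m)
    (D : (Fin d → ℝ) → Base d m → ℂ → Ambient d m)
    (O : Set ((Fin d → ℝ) × Base d m)) (g₀ : Fin d → ℝ) : Prop where
  isOpen : IsOpen O
  mem : (g₀, 0) ∈ O
  entire : ∀ g τ, Differentiable ℂ (D g τ)
  center : ∀ p ∈ O, D p.1 p.2 0 = (fun l => I * p.1 l, 0)
  boundary : ∀ g τ ζ, ‖ζ‖ = 1 → ∀ l, ((D g τ ζ).1 l).im = 1 / 2 * β (D g τ ζ).2 (D g τ ζ).2 l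
  smooth : ContDiffOn ℝ 2
    (fun p : ((Fin d → ℝ) × Base d m) × ℂ => D p.1.1 p.1.2 p.2) (O ×ˢ univ)
  inj : ∀ σ : ℂ, ‖σ‖ = 1 → ∀ v, HasDerivAt (fun t : ℝ => D g₀ (t • v) σ) 0 0 → v = 0

lemma norm_modelPhase (s : Fin d → ℝ) (i : Fin d) : ‖modelPhase s i‖ = 1 :=
  Complex.norm_exp_ofReal_mul_I _

lemma contDiff_levi_self (hβ : ∀ a b, β a b = β b a) {k : ℕ∞} :
    ContDiff ℝ k fun u : Fin m → ℂ => fun l => (levi β l u u).re := by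
  simp only [levi_self hβ, ofReal_re]
  fun_prop

lemma contDiff_modelW {E : Type*} [NormedAddCommGroup E] [NormedSpace ℝ E] {s : Set E} {k : ℕ∞}
    (e : Fin d → Fin m → ℂ) {ρ : E → Fin d → ℝ} {q : E → Fin d → ℂ} {u : E → Fin m → ℂ} {ζ : E → ℂ}
    (hρ : ContDiffOn ℝ k ρ s) (hq : ContDiffOn ℝ k q s) (hu : ContDiffOn ℝ k u s)
    (hζ : ContDiffOn ℝ k ζ s) :
    ContDiffOn ℝ k (fun x => modelW e (ρ x) (q x) (u x) (ζ x)) s := by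
  have hρi : ∀ i, ContDiffOn ℝ k (fun x => (ρ x i : ℂ)) s := fun i =>
    Complex.ofRealCLM.contDiff.comp_contDiffOn (contDiffOn_pi.mp hρ i)
  have hqi : ∀ i, ContDiffOn ℝ k (fun x => q x i) s := contDiffOn_pi.mp hq
  unfold modelW
  refine ContDiffOn.add (ContDiffOn.sum fun i _ => ContDiffOn.smul ((hρi i).mul
    ((hζ.pow _).mul (contDiffOn_const.add ((hqi i).mul hζ)))) contDiffOn_const)
    ((hζ.pow _).smul hu)

lemma contDiff_modelQ (hβ : ∀ a b, β a b = β b a) {E : Type*} [NormedAddCommGroup E]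
    [NormedSpace ℝ E] {s : Set E} {k : ℕ∞}
    (e : Fin d → Fin m → ℂ) {ρ : E → Fin d → ℝ} {q : E → Fin d → ℂ} {u : E → Fin m → ℂ} {ζ : E → ℂ}
    (hρ : ContDiffOn ℝ k ρ s) (hq : ContDiffOn ℝ k q s) (hu : ContDiffOn ℝ k u s)
    (hζ : ContDiffOn ℝ k ζ s) (l : Fin d) :
    ContDiffOn ℝ k (fun x => modelQ β e (ρ x) (q x) (u x) (ζ x) l) s := by
  have hρi : ∀ i, ContDiffOn ℝ k (fun x => (ρ x i : ℂ)) s := fun i =>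
    Complex.ofRealCLM.contDiff.comp_contDiffOn (contDiffOn_pi.mp hρ i)
  have hqi : ∀ i, ContDiffOn ℝ k (fun x => q x i) s := contDiffOn_pi.mp hq
  have hci : ∀ i, ContDiffOn ℝ k (fun x => conj (q x i)) s := fun i =>
    Complex.conjCLE.contDiff.comp_contDiffOn (hqi i)
  have hL : ∀ j, ContDiffOn ℝ k (fun x => levi β l (e j) (u x)) s := fun j =>
    ((LinearMap.toContinuousLinearMap ((levi β l (e j)).restrictScalars ℝ)).contDiff).comp_contDiffOn
      hu
  have hP : ContDiffOn ℝ k (fun x => holBilin β l (modelW e (ρ x) (q x) (u x) (ζ x))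
      (modelW e (ρ x) (q x) (u x) (ζ x))) s :=
    (((differentiable_holBilin hβ l).of_le le_top).restrict_scalars ℝ).comp_contDiffOn
      (contDiff_modelW e hρ hq hu hζ)
  have hS : ContDiffOn ℝ k (fun x => levi β l (u x) (u x)) s := by
    have : (fun x => levi β l (u x) (u x)) = fun x => (((levi β l (u x) (u x)).re : ℝ) : ℂ) := by
      funext x; rw [levi_self hβ, ofReal_re]
    rw [this]
    exact Complex.ofRealCLM.contDiff.comp_contDiffOn
      ((contDiff_pi.mp (contDiff_levi_self hβ) l).comp_contDiffOn hu)
  unfold modelQ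
  refine ((((hP.add (ContDiffOn.sum fun i _ => ?_)).add hS).add
    (contDiffOn_const.mul (ContDiffOn.sum fun i _ => ContDiffOn.sum fun j _ => ?_))).add
    (contDiffOn_const.mul (ContDiffOn.sum fun j _ => ?_)))
  · exact (((hρi i).pow 2).mul contDiffOn_const).mul
      (contDiffOn_const.add ((contDiffOn_const.mul (hqi i)).mul hζ))
  · split_ifs
    · exact (((hρi i).mul (hρi j)).mul contDiffOn_const).mul
        (((hζ.pow _).mul (contDiffOn_const.add ((hqi i).mul hζ))).mul (hζ.add (hci j)))
    · exact contDiffOn_const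
  · exact ((hρi j).mul (hL j)).mul ((hζ.pow _).mul (hζ.add (hci j)))

lemma modelW_zero (e : Fin d → Fin m → ℂ) (ρ : Fin d → ℝ) (q : Fin d → ℂ) (u : Fin m → ℂ) :
    modelW e ρ q u 0 = 0 := by
  simp [modelW]

lemma modelQ_zero (e : Fin d → Fin m → ℂ) (ρ : Fin d → ℝ) (q : Fin d → ℂ) (u : Fin m → ℂ)
    (l : Fin d) : modelQ β e ρ q u 0 l =
      ∑ i, (ρ i : ℂ) ^ 2 * levi β l (e i) (e i) * 2 + levi β l u u := by
  have h1 : ∀ i j : Fin d, (if j < i then (ρ i : ℂ) * ρ j * levi β l (e j) (e i) *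
        ((0 : ℂ) ^ (2 * ((i : ℕ) - j) - 1) * (1 + q i * 0) * (0 + conj (q j))) else 0)
      = 0 := by
    intro i j
    split_ifs with hij
    · have : (j : ℕ) < i := hij
      rw [zero_pow (by omega)]; simp
    · rfl
  have h2 : ∀ j : Fin d, (0 : ℂ) ^ (2 * (d - (j : ℕ)) - 1) = 0 := fun j =>
    zero_pow (by have := j.2; omega)
  rw [modelQ]
  simp only [h1]
  simp [modelW_zero, h2]

lemma differentiable_modelW (e : Fin d → Fin m → ℂ) (ρ : Fin d → ℝ) (q : Fin d → ℂ)
    (u : Fin m → ℂ) : Differentiable ℂ (modelW e ρ q u) := by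
  unfold modelW; fun_prop

lemma differentiable_modelQ (hβ : ∀ a b, β a b = β b a) (e : Fin d → Fin m → ℂ) (ρ : Fin d → ℝ)
    (q : Fin d → ℂ) (u : Fin m → ℂ) (l : Fin d) :
    Differentiable ℂ fun ζ => modelQ β e ρ q u ζ l := by
  have hP : Differentiable ℂ (fun ζ => holBilin β l (modelW e ρ q u ζ) (modelW e ρ q u ζ)) :=
    ((differentiable_holBilin hβ l).differentiable (by simp)).comp (differentiable_modelW e ρ q u)
  unfold modelQ
  refine ((((hP.add (Differentiable.fun_sum fun i _ => ?_)).add (differentiable_const _)).add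
    ((differentiable_const _).mul (Differentiable.fun_sum fun i _ =>
      Differentiable.fun_sum fun j _ => ?_))).add
    ((differentiable_const _).mul (Differentiable.fun_sum fun j _ => ?_)))
  · fun_prop
  · split_ifs
    · fun_prop
    · fun_prop
  · fun_prop

lemma modelDisc_deriv_eq_zero (hβ : ∀ a b, β a b = β b a) {e : Fin d → Fin m → ℂ}
    {ρ : ℝ → Fin d → ℝ} (hρ0 : ρ 0 = 1) (hρ : ∀ i, HasDerivAt (fun t => ρ t i) 0 0)
    {s : Fin d → ℝ} {u : Fin m → ℂ} {σ : ℂ} (hσ : ‖σ‖ = 1)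
    (hW : HasDerivAt (fun t : ℝ => modelW e (ρ t) (modelPhase (t • s)) (t • u) σ) 0 0)
    (l : Fin d)
    (hQ : HasDerivAt (fun t : ℝ => modelQ β e (ρ t) (modelPhase (t • s)) (t • u) σ l) 0 0) :
    σ ^ (2 * d + 1) • u = -∑ i : Fin d, (s i * (I * σ ^ (2 * (i : ℕ) + 2))) • e i ∧
    ∑ i, s i * ((levi β l (e i) (e i)).re + 2 * ∑ j, if i < j then
      (I * σ ^ (2 * (i : ℕ) + 2) * conj (σ ^ (2 * (j : ℕ) + 1) * (1 + σ)) *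
        levi β l (e j) (e i)).im else 0) = 0 := by
  set B : Fin d → ℂ := fun i => I * σ ^ (2 * (i : ℕ) + 2) with hB
  set A : Fin d → ℂ := fun i => σ ^ (2 * (i : ℕ) + 1) * (1 + σ) with hA
  have hq0 : modelPhase (0 : Fin d → ℝ) = 1 := by funext i; simp [modelPhase]
  have hq : ∀ i, HasDerivAt (fun t : ℝ => modelPhase (t • s) i) (s i * I) 0 := by
    intro i
    have h1 : HasDerivAt (fun t : ℝ => (((t * s i : ℝ) : ℂ)) * I) (s i * I) 0 := by
      have := ((hasDerivAt_id (0 : ℝ)).mul_const (s i)).ofReal_comp.mul_const I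
      simpa using this
    have := h1.cexp
    simpa [modelPhase] using this
  have hρc : ∀ i, HasDerivAt (fun t => (ρ t i : ℂ)) 0 0 := fun i => by
    simpa using (hρ i).ofReal_comp
  have ha : ∀ i : Fin d, HasDerivAt
      (fun t : ℝ => σ ^ (2 * (i : ℕ) + 1) * (1 + modelPhase (t • s) i * σ)) (s i * B i) 0 := by
    intro i
    have := (((hq i).mul_const σ).const_add 1).const_mul (σ ^ (2 * (i : ℕ) + 1))
    refine this.congr_deriv ?_
    simp only [hB]; ring
  have hac : ∀ j : Fin d, HasDerivAt (fun t : ℝ => conj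
      (σ ^ (2 * (j : ℕ) + 1) * (1 + modelPhase (t • s) j * σ)))
      (s j * conj (B j)) 0 := by
    intro j
    have := (Complex.conjCLE.toContinuousLinearMap.hasFDerivAt.comp_hasDerivAt (0 : ℝ) (ha j))
    have h2 : conj (s j * B j) = s j * conj (B j) := by
      rw [map_mul, conj_ofReal]
    rw [← h2]
    exact this
  have hu : HasDerivAt (fun t : ℝ => t • u) u 0 := by
    simpa using (hasDerivAt_id (0 : ℝ)).smul_const u
  have hρ0i : ∀ i, (ρ 0 i : ℂ) = 1 := fun i => by rw [hρ0]; simp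
  have h1 : HasDerivAt (fun t : ℝ => modelW e (ρ t) (modelPhase (t • s)) (t • u) σ)
      (∑ i, (s i * B i) • e i + σ ^ (2 * d + 1) • u) 0 := by
    unfold modelW
    refine HasDerivAt.add (HasDerivAt.fun_sum fun i _ => ?_) (hu.fun_const_smul _)
    have := ((hρc i).mul (ha i)).smul_const (e i)
    refine this.congr_deriv ?_
    rw [hρ0i]; ring_nf
  have hWu : σ ^ (2 * d + 1) • u = -∑ i : Fin d, (s i * B i) • e i := by
    have := hW.unique h1
    exact (neg_eq_of_add_eq_zero_right this.symm).symm
  refine ⟨hWu, ?_⟩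
  simp only [modelQ_of_norm_eq_one e _ _ _ hσ] at hQ
  have d0 : HasDerivAt (fun t : ℝ => holBilin β l (modelW e (ρ t) (modelPhase (t • s)) (t • u) σ)
      (modelW e (ρ t) (modelPhase (t • s)) (t • u) σ)) 0 0 := by
    have h2 := (((differentiable_holBilin hβ l).restrict_scalars ℝ).differentiable
      (by simp) (modelW e (ρ 0) (modelPhase ((0 : ℝ) • s)) ((0 : ℝ) • u) σ)).hasFDerivAt
    have := h2.comp_hasDerivAt (0 : ℝ) hW
    rw [map_zero] at this
    exact this
  have d1 : ∀ i, HasDerivAt (fun t : ℝ => (ρ t i : ℂ) ^ 2 * levi β l (e i) (e i) *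
      (2 + 2 * modelPhase (t • s) i * σ)) (levi β l (e i) (e i) * (2 * (s i * I) * σ)) 0 := by
    intro i
    have := (((hρc i).pow 2).mul_const (levi β l (e i) (e i))).mul
      ((((hq i).const_mul 2).mul_const σ).const_add 2)
    refine this.congr_deriv ?_
    simp [hρ0]
  have d2 : HasDerivAt (fun t : ℝ => levi β l (t • u) (t • u)) 0 0 := by
    have h3 : (fun t : ℝ => levi β l (t • u) (t • u)) =
        fun t : ℝ => ((t : ℂ)) ^ 2 * levi β l u u := by
      funext t
      have : t • u = (t : ℂ) • u := (RCLike.real_smul_eq_coe_smul (K := ℂ) t u)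
      rw [this, levi_smul_left hβ, map_smul, conj_ofReal, smul_eq_mul]; ring
    rw [h3]
    have := (((hasDerivAt_id (0 : ℝ)).ofReal_comp.pow 2).mul_const (levi β l u u))
    simpa using this
  have d3 : ∀ i j : Fin d, HasDerivAt (fun t : ℝ => if j < i then
      (ρ t i : ℂ) * ρ t j * levi β l (e j) (e i) *
        ((σ ^ (2 * (i : ℕ) + 1) * (1 + modelPhase (t • s) i * σ)) *
          conj (σ ^ (2 * (j : ℕ) + 1) * (1 + modelPhase (t • s) j * σ))) else 0)
      (if j < i then levi β l (e j) (e i) * (s i * B i * conj (A j) +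
        A i * (s j * conj (B j))) else 0) 0 := by
    intro i j
    split_ifs
    · have := (((hρc i).mul (hρc j)).mul_const (levi β l (e j) (e i))).mul ((ha i).mul (hac j))
      refine this.congr_deriv ?_
      simp [hρ0, hA, hq0]
    · exact hasDerivAt_const _ _
  have d4 : ∀ j : Fin d, HasDerivAt (fun t : ℝ => (ρ t j : ℂ) * levi β l (e j) (t • u) *
        (σ ^ (2 * d + 1) * conj (σ ^ (2 * (j : ℕ) + 1) * (1 + modelPhase (t • s) j * σ))))
      (levi β l (e j) u * (σ ^ (2 * d + 1) * conj (A j))) 0 := by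
    intro j
    have hl : HasDerivAt (fun t : ℝ => levi β l (e j) (t • u)) (levi β l (e j) u) 0 :=
      (LinearMap.toContinuousLinearMap
        ((levi β l (e j)).restrictScalars ℝ)).hasFDerivAt.comp_hasDerivAt (0 : ℝ) hu
    have := ((hρc j).mul hl).mul ((hac j).const_mul (σ ^ (2 * d + 1)))
    refine this.congr_deriv ?_
    simp [hρ0, hA, hq0]
  have hzero := hQ.unique ((((d0.fun_add (HasDerivAt.fun_sum (u := Finset.univ) fun i _ => d1 i)).fun_add
    d2).fun_add ((HasDerivAt.fun_sum (u := Finset.univ) fun i _ =>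
      HasDerivAt.fun_sum (u := Finset.univ) fun j _ => d3 i j).const_mul 2)).fun_add
    ((HasDerivAt.fun_sum (u := Finset.univ) fun j _ => d4 j).const_mul 2))
  set f : Fin d → Fin d → ℂ := fun i j => s i * (B i * conj (A j) * levi β l (e j) (e i))
    with hf
  have t4 : ∑ j, levi β l (e j) u * (σ ^ (2 * d + 1) * conj (A j)) =
      -∑ i, ∑ j, f i j := by
    rw [Finset.sum_comm, ← Finset.sum_neg_distrib]
    refine sum_congr rfl fun j _ => ?_
    have : levi β l (e j) u * (σ ^ (2 * d + 1) * conj (A j)) =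
        levi β l (e j) (σ ^ (2 * d + 1) • u) * conj (A j) := by
      rw [map_smul, smul_eq_mul]; ring
    rw [this, hWu, map_neg, map_sum, neg_mul, Finset.sum_mul]
    congr 1
    refine sum_congr rfl fun i _ => ?_
    rw [map_smul, smul_eq_mul, hf]; ring
  have t3 : (∑ i, ∑ j, if j < i then levi β l (e j) (e i) * (s i * B i * conj (A j) +
        A i * (s j * conj (B j))) else 0) = (∑ i, ∑ j, if j < i then f i j else 0) +
        ∑ i, ∑ j, if i < j then conj (f i j) else 0 := by
    rw [Finset.sum_comm (f := fun i j => if i < j then conj (f i j) else 0),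
      ← sum_add_distrib]
    refine sum_congr rfl fun i _ => ?_
    rw [← sum_add_distrib]
    refine sum_congr rfl fun j _ => ?_
    split_ifs
    · simp only [hf, map_mul, Complex.conj_conj, conj_ofReal]
      rw [← levi_conj hβ l (e j) (e i)]; ring
    · simp
  have t1 : ∀ i, f i i = s i * (I * (σ + 1) * levi β l (e i) (e i)) := by
    intro i
    have h5 := mul_conj_eq_one (ζ := σ ^ (2 * (i : ℕ) + 1)) (by rw [norm_pow, hσ, one_pow])
    have h6 := mul_conj_eq_one hσ
    simp only [hf, hA, hB, map_mul (starRingEnd ℂ), map_add, map_one]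
    linear_combination (s i * levi β l (e i) (e i) * I * σ * (1 + conj σ)) * h5 +
      (s i * levi β l (e i) (e i) * I) * h6
  rw [t4, t3, sum_sum_eq_diag_add_lt_add_gt f] at hzero
  have hconj : (∑ i, ∑ j, if i < j then conj (f i j) else 0) -
      (∑ i, ∑ j, if i < j then f i j else 0) =
      -2 * I * ((∑ i, ∑ j, if i < j then (f i j).im else 0 : ℝ) : ℂ) := by
    rw [← Finset.sum_sub_distrib, Complex.ofReal_sum, mul_sum]
    refine sum_congr rfl fun i _ => ?_
    rw [← Finset.sum_sub_distrib, Complex.ofReal_sum, mul_sum]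
    refine sum_congr rfl fun j _ => ?_
    split_ifs
    · have := Complex.sub_conj (f i j)
      push_cast at this
      linear_combination -this
    · simp
  have hdiag : ∑ i, levi β l (e i) (e i) * (2 * (s i * I) * σ) - 2 * ∑ i, f i i =
      -2 * I * ((∑ i, s i * (levi β l (e i) (e i)).re : ℝ) : ℂ) := by
    rw [mul_sum, ← Finset.sum_sub_distrib, Complex.ofReal_sum, mul_sum]
    refine sum_congr rfl fun i _ => ?_
    rw [t1, levi_self hβ, ofReal_re]
    push_cast; ring
  have hfin : (((∑ i, s i * (levi β l (e i) (e i)).re) +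
      2 * ∑ i, ∑ j, if i < j then (f i j).im else 0 : ℝ) : ℂ) = 0 := by
    have h7 : (-2 * I) * (((∑ i, s i * (levi β l (e i) (e i)).re) +
      2 * ∑ i, ∑ j, if i < j then (f i j).im else 0 : ℝ) : ℂ) = 0 := by
      rw [Complex.ofReal_add, Complex.ofReal_mul, Complex.ofReal_ofNat]
      linear_combination -hdiag - 2 * hconj - hzero
    exact (mul_eq_zero.mp h7).resolve_left (by simp)
  rw [Complex.ofReal_eq_zero] at hfin
  refine Eq.trans ?_ hfin
  rw [mul_sum, ← sum_add_distrib]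
  refine sum_congr rfl fun i _ => ?_
  rw [mul_add, mul_left_comm, mul_sum]
  refine congrArg₂ _ rfl (congrArg₂ _ rfl (sum_congr rfl fun j _ => ?_))
  split_ifs
  · rw [hf, Complex.im_ofReal_mul]
  · simp

theorem exists_modelFamily (hβ : ∀ a b, β a b = β b a)
    (h : (interior (convexHull ℝ {v : Fin d → ℝ | ∃ a : Fin m → ℂ, v = fun l =>
        (1 / 4) * (β a a l + β (fun i => I * a i) (fun i => I * a i) l)})).Nonempty) :
    ∃ D O g₀, ModelFamily β D O g₀ := by
  obtain ⟨e₀, he₀⟩ := exists_levi_independent h hβ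
  obtain ⟨e, he, hH⟩ := exists_hierarchy hβ he₀
  set v : Fin d → Fin d → ℝ := fun i l => (levi β l (e i) (e i)).re with hv
  have hspan : ⊤ ≤ Submodule.span ℝ (range v) :=
    (LinearIndependent.span_eq_top_of_card_eq_finrank' he (by simp)).ge
  let b := Module.Basis.mk he hspan
  have hbv : ∀ i, b i = v i := fun i => Module.Basis.mk_apply he hspan i
  let γ : Fin d → (Fin d → ℝ) →L[ℝ] ℝ := fun i => LinearMap.toContinuousLinearMap (b.coord i)
  have hγ : ∀ x : Fin d → ℝ, ∑ i, γ i x • v i = x := fun x => by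
    have := b.sum_repr x
    simpa [γ, hbv] using this
  set g₀ : Fin d → ℝ := ∑ i, (2 : ℝ) • v i with hg₀
  have hγg : ∀ i, γ i g₀ = 2 := by
    intro i
    have : g₀ = ∑ i, (2 : ℝ) • b i := by simp [hg₀, hbv]
    rw [this]
    simp [γ, Finsupp.single_apply]
  set Λ : (Fin m → ℂ) → Fin d → ℝ := fun u l => (levi β l u u).re with hΛ
  have hΛs : ContDiff ℝ 2 Λ := contDiff_levi_self (k := 2) hβ
  have hΛ0 : Λ 0 = 0 := by funext l; simp [hΛ]
  have hOc : ∀ i, ContDiff ℝ 2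
      fun p : (Fin d → ℝ) × Base d m => γ i (p.1 - Λ p.2.2) := fun i =>
    (γ i).contDiff.comp (contDiff_fst.sub (hΛs.comp (contDiff_snd.comp contDiff_snd)))
  set O : Set ((Fin d → ℝ) × Base d m) :=
    {p | ∀ i, 0 < γ i (p.1 - Λ p.2.2)} with hO
  have hrad0 : modelRad β γ g₀ 0 = 1 := by
    funext i
    change √(γ i (g₀ - Λ 0) / 2) = 1
    rw [hΛ0, sub_zero, hγg]; norm_num
  refine ⟨modelDisc β e γ, O, g₀, ?_, ?_, ?_, ?_, ?_, ?_, ?_⟩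
  · rw [hO, ofPred_forall]
    exact isOpen_iInter_of_finite fun i => isOpen_lt continuous_const (hOc i).continuous
  · intro i
    change 0 < γ i (g₀ - Λ 0)
    rw [hΛ0, sub_zero, hγg]; norm_num
  · intro g τ
    exact (differentiable_pi.mpr fun l => (differentiable_modelQ hβ _ _ _ _ l).const_mul _).prodMk
      (differentiable_modelW _ _ _ _)
  · rintro ⟨g, s, u⟩ hp
    refine Prod.ext (funext fun l => ?_) (modelW_zero _ _ _ _)
    change I * modelQ β e (modelRad β γ g u) (modelPhase s) u 0 l = I * g l
    rw [modelQ_zero]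
    congr 1
    have h1 : ∀ i, (modelRad β γ g u i : ℂ) ^ 2 * levi β l (e i) (e i) * 2 =
        ((γ i (g - Λ u) * v i l : ℝ) : ℂ) := by
      intro i
      have h2 : modelRad β γ g u i ^ 2 = γ i (g - Λ u) / 2 :=
        Real.sq_sqrt (by have := hp i; simp only at this; linarith)
      have h3 : levi β l (e i) (e i) = ((v i l : ℝ) : ℂ) := by
        simp only [hv]; rw [levi_self hβ, ofReal_re]
      rw [← Complex.ofReal_pow, h2, h3]
      push_cast; ring
    rw [sum_congr rfl fun i _ => h1 i, ← Complex.ofReal_sum]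
    have h4 : ∑ i, γ i (g - Λ u) * v i l = g l - Λ u l := by
      have := congrFun (hγ (g - Λ u)) l
      simpa using this
    have h5 : levi β l u u = ((Λ u l : ℝ) : ℂ) := by
      simp only [hΛ]; rw [levi_self hβ, ofReal_re]
    rw [h4, h5]
    push_cast; ring
  · intro g τ ζ hζ l
    refine Eq.trans ?_ (re_modelQ hβ e (modelRad β γ g τ.2) (q := modelPhase τ.1)
      (fun i => norm_modelPhase _ _) τ.2 hζ l)
    simp [modelDisc]
  · have hρ : ContDiffOn ℝ 2 (fun p : ((Fin d → ℝ) × Base d m) × ℂ =>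
        modelRad β γ p.1.1 p.1.2.2) (O ×ˢ univ) := by
      refine contDiffOn_pi.mpr fun i => ?_
      refine ContDiffOn.sqrt ((((hOc i).comp contDiff_fst).div_const 2).contDiffOn)
        fun p hp => ?_
      have := hp.1 i
      exact (by positivity : (0:ℝ) < γ i (p.1.1 - Λ p.1.2.2) / 2).ne'
    have hq : ContDiffOn ℝ 2 (fun p : ((Fin d → ℝ) × Base d m) × ℂ =>
        modelPhase p.1.2.1) (O ×ˢ univ) := by
      refine contDiffOn_pi.mpr fun i => ContDiff.contDiffOn ?_
      exact ((Complex.ofRealCLM.contDiff.comp (contDiff_apply ℝ ℝ i |>.comp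
        (contDiff_fst.comp (contDiff_snd.comp contDiff_fst)))).mul contDiff_const).cexp
    have hu : ContDiffOn ℝ 2 (fun p : ((Fin d → ℝ) × Base d m) × ℂ =>
        p.1.2.2) (O ×ˢ univ) :=
      (contDiff_snd.comp (contDiff_snd.comp contDiff_fst)).contDiffOn
    have hζ : ContDiffOn ℝ 2 (fun p : ((Fin d → ℝ) × Base d m) × ℂ =>
        p.2) (O ×ˢ univ) := contDiff_snd.contDiffOn
    exact (contDiffOn_pi.mpr fun l => contDiffOn_const.mul
      (contDiff_modelQ (k := 2) hβ e hρ hq hu hζ l)).prodMk (contDiff_modelW (k := 2) e hρ hq hu hζ)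
  · rintro σ hσ ⟨s, u⟩ hD
    have hρ0 : modelRad β γ g₀ ((0 : ℝ) • u) = 1 := by rw [zero_smul, hrad0]
    have hρ : ∀ i, HasDerivAt (fun t : ℝ => modelRad β γ g₀ (t • u) i) 0 0 := by
      intro i
      have h1 : ∀ t : ℝ, γ i (g₀ - Λ (t • u)) / 2 = 1 - t ^ 2 * (γ i (Λ u) / 2) := by
        intro t
        have : Λ (t • u) = t ^ 2 • Λ u := by
          funext l
          have h2 : t • u = (t : ℂ) • u := (RCLike.real_smul_eq_coe_smul (K := ℂ) t u)
          simp only [hΛ, Pi.smul_apply, smul_eq_mul]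
          rw [h2, levi_smul_left hβ, map_smul, conj_ofReal, smul_eq_mul,
            re_ofReal_mul, re_ofReal_mul]
          ring
        rw [this, map_sub, map_smul, hγg, smul_eq_mul]; ring
      have h3 : HasDerivAt (fun t : ℝ => 1 - t ^ 2 * (γ i (Λ u) / 2)) 0 0 := by
        have := (((hasDerivAt_id (0 : ℝ)).pow 2).mul_const (γ i (Λ u) / 2)).const_sub 1
        simpa using this
      have h4 := h3.sqrt (by norm_num)
      have h5 : (fun t : ℝ => modelRad β γ g₀ (t • u) i) =
          fun t : ℝ => √(1 - t ^ 2 * (γ i (Λ u) / 2)) := by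
        funext t; rw [← h1]; rfl
      rw [h5]
      simpa using h4
    have hW : HasDerivAt (fun t : ℝ => modelW e (modelRad β γ g₀ (t • u)) (modelPhase (t • s))
        (t • u) σ) 0 0 :=
      (snd ℝ (Fin d → ℂ) (Fin m → ℂ)).hasFDerivAt.comp_hasDerivAt (0 : ℝ) hD
    have hQ : ∀ l, HasDerivAt (fun t : ℝ => modelQ β e (modelRad β γ g₀ (t • u))
        (modelPhase (t • s)) (t • u) σ l) 0 0 := by
      intro l
      have h1 := (fst ℝ (Fin d → ℂ) (Fin m → ℂ)).hasFDerivAt.comp_hasDerivAt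
        (0 : ℝ) hD
      have h2 := ((hasDerivAt_pi.mp h1) l).const_mul (-I)
      refine HasDerivAt.congr_deriv (h2.congr_of_eventuallyEq (Eventually.of_forall fun t => ?_))
        (by simp)
      change _ = -I * (I * modelQ β e (modelRad β γ g₀ (t • u))
        (modelPhase (t • s)) (t • u) σ l)
      rw [← mul_assoc]; simp
    have key := fun l => modelDisc_deriv_eq_zero hβ hρ0 hρ hσ hW l (hQ l)
    have hs : s = 0 := by
      refine hH _ (fun i j => ?_) s fun l => (key l).2
      rw [norm_mul, norm_mul, RCLike.norm_conj, norm_mul, norm_pow, norm_pow, hσ]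
      simp only [norm_I, one_pow, one_mul]
      refine (norm_add_le _ _).trans ?_
      rw [hσ, norm_one]; norm_num
    subst hs
    rcases isEmpty_or_nonempty (Fin d) with hd | ⟨⟨l⟩⟩
    · have hu : u = 0 := by
        have h1 : ∀ t : ℝ, modelW e (modelRad β γ g₀ (t • u)) (modelPhase (t • (0 : Fin d → ℝ)))
            (t • u) σ = t • (σ ^ (2 * d + 1) • u) := by
          intro t
          simp [modelW, smul_comm t]
        simp only [h1] at hW
        have h2 : HasDerivAt (fun t : ℝ => t • (σ ^ (2 * d + 1) • u)) (σ ^ (2 * d + 1) • u) 0 := by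
          simpa using (hasDerivAt_id (0 : ℝ)).smul_const (σ ^ (2 * d + 1) • u)
        have h3 := h2.unique hW
        have hσ0 : σ ≠ 0 := norm_pos_iff.mp (by rw [hσ]; norm_num)
        exact (smul_eq_zero.mp h3).resolve_left (pow_ne_zero _ hσ0)
      rw [hu]; rfl
    · have h1 := (key l).1
      simp only [Pi.zero_apply, Complex.ofReal_zero, zero_mul, zero_smul, Finset.sum_const_zero,
        neg_zero] at h1
      have hσ0 : σ ≠ 0 := norm_pos_iff.mp (by rw [hσ]; norm_num)
      have hu := (smul_eq_zero.mp h1).resolve_left (pow_ne_zero _ hσ0)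
      rw [hu]; rfl
end Levi

section Bounds
variable {P Y : Type*} [NormedAddCommGroup P] [NormedSpace ℝ P] [NormedAddCommGroup Y]
  [NormedSpace ℝ Y]

lemma ContDiffOn.exists_lipschitz_bound {g : P → Y} {O K : Set P} (hO : IsOpen O)
    (hg : ContDiffOn ℝ 1 g O) (hK : IsCompact K) (hKc : Convex ℝ K) (hKO : K ⊆ O) :
    ∃ C ≥ 0, (∀ x ∈ K, ‖g x‖ ≤ C) ∧ (∀ x ∈ K, ‖fderiv ℝ g x‖ ≤ C) ∧
      ∀ x ∈ K, ∀ y ∈ K, ‖g x - g y‖ ≤ C * ‖x - y‖ := by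
  obtain ⟨C₁, h₁⟩ := hK.exists_bound_of_continuousOn (hg.continuousOn.mono hKO)
  obtain ⟨C₂, h₂⟩ := hK.exists_bound_of_continuousOn
    ((hg.continuousOn_fderiv_of_isOpen hO le_rfl).mono hKO)
  refine ⟨max 0 (max C₁ C₂), le_max_left _ _, fun x hx => (h₁ x hx).trans (by simp),
    fun x hx => (h₂ x hx).trans (by simp), fun x hx y hy => ?_⟩
  exact hKc.norm_image_sub_le_of_norm_fderiv_le (𝕜 := ℝ)
    (fun z hz => (hg.differentiableOn one_ne_zero).differentiableAt (hO.mem_nhds (hKO hz)))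
    (fun z hz => (h₂ z hz).trans (by simp)) hy hx

/-- A family of loops with uniform bounds up to the second order. -/
structure LoopBound (Φ : P × ℂ → Y) (K : Set P) (C : ℝ) : Prop where
  nonneg : 0 ≤ C
  bound : ∀ p ∈ K, ∀ ζ ∈ closedBall (0 : ℂ) 1, ‖Φ (p, ζ)‖ ≤ C
  lip : ∀ p ∈ K, ∀ p' ∈ K, ∀ ζ ∈ closedBall (0 : ℂ) 1, ∀ ζ' ∈ closedBall (0 : ℂ) 1,
    ‖Φ (p, ζ) - Φ (p', ζ')‖ ≤ C * (‖p - p'‖ + ‖ζ - ζ'‖)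
  mixed : ∀ p ∈ K, ∀ p' ∈ K, ∀ ζ ∈ closedBall (0 : ℂ) 1, ∀ ζ' ∈ closedBall (0 : ℂ) 1,
    ‖(Φ (p, ζ) - Φ (p', ζ)) - (Φ (p, ζ') - Φ (p', ζ'))‖ ≤ C * ‖p - p'‖ * ‖ζ - ζ'‖
  fderiv_le : ∀ p ∈ K, ∀ ζ ∈ closedBall (0 : ℂ) 1, ‖fderiv ℝ Φ (p, ζ)‖ ≤ C
  fderiv_lip : ∀ p ∈ K, ∀ p' ∈ K, ∀ ζ ∈ closedBall (0 : ℂ) 1,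
    ‖fderiv ℝ Φ (p, ζ) - fderiv ℝ Φ (p', ζ)‖ ≤ C * ‖p - p'‖

lemma hasFDerivAt_slice {Φ : P × ℂ → Y} {p : P} {ζ : ℂ} (h : DifferentiableAt ℝ Φ (p, ζ)) :
    HasFDerivAt (fun q => Φ (q, ζ)) ((fderiv ℝ Φ (p, ζ)).comp (inl ℝ P ℂ)) p :=
  h.hasFDerivAt.comp p (hasFDerivAt_prodMk_left p ζ)

lemma exists_loopBound {Φ : P × ℂ → Y} {O K : Set P} (hO : IsOpen O)
    (hΦ : ContDiffOn ℝ 2 Φ (O ×ˢ univ)) (hK : IsCompact K) (hKc : Convex ℝ K) (hKO : K ⊆ O) :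
    ∃ C, LoopBound Φ K C := by
  have hO' : IsOpen (O ×ˢ (univ : Set ℂ)) := hO.prod isOpen_univ
  have hK' : IsCompact (K ×ˢ closedBall (0 : ℂ) 1) := hK.prod (isCompact_closedBall 0 1)
  have hKc' : Convex ℝ (K ×ˢ closedBall (0 : ℂ) 1) := hKc.prod (convex_closedBall 0 1)
  have hKO' : K ×ˢ closedBall (0 : ℂ) 1 ⊆ O ×ˢ univ := prod_mono hKO (subset_univ _)
  obtain ⟨C₁, hC₁, a₁, b₁, c₁⟩ := (hΦ.of_le one_le_two).exists_lipschitz_bound hO' hK' hKc' hKO'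
  obtain ⟨C₂, hC₂, a₂, b₂, c₂⟩ := (hΦ.fderiv_of_isOpen hO' (m := 1) (by norm_num)
    ).exists_lipschitz_bound hO' hK' hKc' hKO'
  have hdiff : ∀ p ∈ K, ∀ ζ : ℂ, DifferentiableAt ℝ Φ (p, ζ) := fun p hp ζ =>
    (hΦ.differentiableOn two_ne_zero).differentiableAt (hO'.mem_nhds ⟨hKO hp, mem_univ _⟩)
  have hle : ∀ (p p' : P) (ζ ζ' : ℂ), ‖((p, ζ) : P × ℂ) - (p', ζ')‖ ≤ ‖p - p'‖ + ‖ζ - ζ'‖ := by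
    intro p p' ζ ζ'
    simp only [Prod.mk_sub_mk, Prod.norm_mk]
    exact max_le_add_of_nonneg (norm_nonneg _) (norm_nonneg _)
  have hL : LoopBound Φ K (C₁ + C₂) :=
    { nonneg := by positivity
      bound := fun p hp ζ hζ => (a₁ _ ⟨hp, hζ⟩).trans (by linarith)
      lip := fun p hp p' hp' ζ hζ ζ' hζ' => (c₁ _ ⟨hp, hζ⟩ _ ⟨hp', hζ'⟩).trans
        (mul_le_mul (by linarith) (hle _ _ _ _) (norm_nonneg _) (by positivity))
      mixed := fun p hp p' hp' ζ hζ ζ' hζ' => by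
        have h1 : ‖(Φ (p, ζ) - Φ (p, ζ')) - (Φ (p', ζ) - Φ (p', ζ'))‖ ≤
            (C₂ * ‖ζ - ζ'‖) * ‖p - p'‖ := by
          refine hKc.norm_image_sub_le_of_norm_hasFDerivWithin_le (𝕜 := ℝ)
            (f := fun q => Φ (q, ζ) - Φ (q, ζ'))
            (f' := fun q => (fderiv ℝ Φ (q, ζ) - fderiv ℝ Φ (q, ζ')).comp
              (inl ℝ P ℂ)) (fun q hq => ?_) (fun q hq => ?_) hp' hp
          · exact ((hasFDerivAt_slice (hdiff q hq ζ)).sub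
              (hasFDerivAt_slice (hdiff q hq ζ'))).hasFDerivWithinAt
          · refine (opNorm_comp_le _ _).trans ?_
            have := c₂ (q, ζ) ⟨hq, hζ⟩ (q, ζ') ⟨hq, hζ'⟩
            simp only [Prod.mk_sub_mk, sub_self, Prod.norm_mk, norm_zero] at this
            rw [max_eq_right (norm_nonneg _)] at this
            have h2 := norm_inl_le_one ℝ P ℂ
            calc _ ≤ (C₂ * ‖ζ - ζ'‖) * 1 := by gcongr
              _ = _ := mul_one _
        rw [sub_sub_sub_comm]
        refine h1.trans ?_
        rw [mul_right_comm]
        gcongr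
        linarith
      fderiv_le := fun p hp ζ hζ => (b₁ _ ⟨hp, hζ⟩).trans (by linarith)
      fderiv_lip := fun p hp p' hp' ζ hζ => by
        refine (c₂ _ ⟨hp, hζ⟩ _ ⟨hp', hζ⟩).trans ?_
        refine mul_le_mul (by linarith) ?_ (norm_nonneg _) (by positivity)
        simp }
  exact ⟨_, hL⟩
end Bounds

section LowerBound
variable {G X Y : Type*} [NormedAddCommGroup G] [NormedSpace ℝ G] [NormedAddCommGroup X]
  [NormedSpace ℝ X] [FiniteDimensional ℝ G] [FiniteDimensional ℝ X] [NormedAddCommGroup Y]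
  [NormedSpace ℝ Y]

lemma exists_lower_bound {Φ : (G × X) × ℂ → Y} {O : Set (G × X)} (hO : IsOpen O)
    (hΦ : ContDiffOn ℝ 2 Φ (O ×ˢ univ)) {p₀ : G × X} (hp₀ : p₀ ∈ O)
    (hinj : ∀ σ : ℂ, ‖σ‖ = 1 → ∀ v, HasDerivAt (fun t : ℝ => Φ ((p₀.1, p₀.2 + t • v), σ)) 0 0 →
      v = 0) :
    ∃ δ > 0, ∃ C > 0, closedBall p₀ δ ⊆ O ∧ ∀ p ∈ closedBall p₀ δ, ∀ p' ∈ closedBall p₀ δ,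
      ∀ σ : ℂ, ‖σ‖ = 1 →
        ‖p.2 - p'.2‖ ≤ C * (‖Φ (p, σ) - Φ (p', σ)‖ + ‖p.1 - p'.1‖) := by
  have hO' : IsOpen (O ×ˢ (univ : Set ℂ)) := hO.prod isOpen_univ
  obtain ⟨δ₁, hδ₁, hball⟩ := nhds_basis_closedBall.mem_iff.1 (hO.mem_nhds hp₀)
  obtain ⟨C, hC⟩ := exists_loopBound hO hΦ (isCompact_closedBall p₀ δ₁) (convex_closedBall p₀ δ₁)
    hball
  have hdiff : ∀ p ∈ O, ∀ ζ : ℂ, DifferentiableAt ℝ Φ (p, ζ) := fun p hp ζ =>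
    (hΦ.differentiableOn two_ne_zero).differentiableAt (hO'.mem_nhds ⟨hp, mem_univ _⟩)
  set L : ℂ → (G × X) →L[ℝ] Y := fun σ =>
    (fderiv ℝ Φ (p₀, σ)).comp (inl ℝ (G × X) ℂ) with hL
  have hLc : Continuous fun q : ℂ × X => L q.1 ((0 : G), q.2) := by
    have h1 : ContinuousOn (fderiv ℝ Φ) (O ×ˢ univ) :=
      hΦ.continuousOn_fderiv_of_isOpen hO' (by norm_num)
    have h2 : Continuous fun q : ℂ × X => fderiv ℝ Φ (p₀, q.1) :=
      h1.comp_continuous (by fun_prop) fun q => ⟨hp₀, mem_univ _⟩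
    simp only [hL, comp_apply, ContinuousLinearMap.inl_apply]
    exact h2.clm_apply (by fun_prop)
  have hpos : ∀ q ∈ sphere (0 : ℂ) 1 ×ˢ sphere (0 : X) 1, 0 < ‖L q.1 ((0 : G), q.2)‖ := by
    rintro ⟨σ, v⟩ ⟨hσ, hv⟩
    rw [norm_pos_iff]
    intro h0
    have hd : HasDerivAt (fun t : ℝ => Φ ((p₀.1, p₀.2 + t • v), σ)) (L σ ((0 : G), v)) 0 := by
      have h1 : HasDerivAt (fun t : ℝ => (p₀.1, p₀.2 + t • v)) ((0 : G), v) 0 := by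
        refine (hasDerivAt_const _ _).prodMk ?_
        simpa using ((hasDerivAt_id (0 : ℝ)).smul_const v).const_add p₀.2
      have h2 := hasFDerivAt_slice (hdiff p₀ hp₀ σ)
      refine HasFDerivAt.comp_hasDerivAt (0 : ℝ) (l := fun q => Φ (q, σ)) ?_ h1
      simpa using h2
    simp only at h0
    rw [h0] at hd
    have := hinj σ (by simpa using hσ) v hd
    simp [this] at hv
  obtain ⟨c, hc0, hc⟩ := ((isCompact_sphere (0 : ℂ) 1).prod (isCompact_sphere (0 : X) 1)
    ).exists_forall_le' hLc.norm.continuousOn hpos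
  have hlow : ∀ σ : ℂ, ‖σ‖ = 1 → ∀ v : X, c * ‖v‖ ≤ ‖L σ ((0 : G), v)‖ := by
    intro σ hσ v
    rcases eq_or_ne v 0 with rfl | hv
    · simp
    have hv' := norm_pos_iff.2 hv
    have h1 := hc (σ, ‖v‖⁻¹ • v) ⟨by simpa using hσ, by simp [norm_smul, hv'.ne']⟩
    have h2 : ((0 : G), ‖v‖⁻¹ • v) = ‖v‖⁻¹ • ((0 : G), v) := by simp
    rw [h2, map_smul, norm_smul, norm_inv, norm_norm, inv_mul_eq_div, le_div_iff₀ hv'] at h1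
    exact h1
  have hCn := hC.nonneg
  set δ := min δ₁ (c / (2 * (C + 1))) with hδ
  have hδ0 : 0 < δ := lt_min hδ₁ (by positivity)
  have hCδ : C * δ ≤ c / 2 := by
    have h1 : δ ≤ c / (2 * (C + 1)) := min_le_right _ _
    rw [le_div_iff₀ (by positivity)] at h1
    nlinarith
  have hsub : closedBall p₀ δ ⊆ closedBall p₀ δ₁ := closedBall_subset_closedBall (min_le_left _ _)
  refine ⟨δ, hδ0, 2 / c * (1 + C + c), by positivity, hsub.trans hball,
    fun p hp p' hp' σ hσ => ?_⟩
  have hσ' : σ ∈ closedBall (0 : ℂ) 1 := by simp [hσ]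
  have h1 : ‖Φ (p, σ) - Φ (p', σ) - L σ (p - p')‖ ≤ C * δ * ‖p - p'‖ := by
    refine (convex_closedBall p₀ δ).norm_image_sub_le_of_norm_hasFDerivWithin_le' (𝕜 := ℝ)
      (f := fun q => Φ (q, σ)) (f' := fun q => (fderiv ℝ Φ (q, σ)).comp
        (inl ℝ (G × X) ℂ)) (fun q hq => ?_) (fun q hq => ?_) hp' hp
    · exact (hasFDerivAt_slice (hdiff q (hball (hsub hq)) σ)).hasFDerivWithinAt
    · rw [hL, ← ContinuousLinearMap.sub_comp]
      refine (opNorm_comp_le _ _).trans ?_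
      have h2 := norm_inl_le_one ℝ (G × X) ℂ
      have h3 := hC.fderiv_lip q (hsub hq) p₀ (mem_closedBall_self hδ₁.le) σ hσ'
      have h4 : ‖q - p₀‖ ≤ δ := by simpa [dist_eq_norm] using hq
      calc _ ≤ (C * ‖q - p₀‖) * 1 := by gcongr
        _ ≤ C * δ := by rw [mul_one]; gcongr
  have h2 : ‖L σ (p.1 - p'.1, (0 : X))‖ ≤ C * ‖p.1 - p'.1‖ := by
    refine ((L σ).le_opNorm _).trans ?_
    have h3 : ‖L σ‖ ≤ C := by
      refine (opNorm_comp_le _ _).trans ?_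
      have h2 := norm_inl_le_one ℝ (G × X) ℂ
      calc _ ≤ C * 1 := by
            gcongr; exact hC.fderiv_le p₀ (mem_closedBall_self hδ₁.le) σ hσ'
        _ = C := mul_one _
    simp only [Prod.norm_mk, norm_zero, norm_nonneg, sup_of_le_left]
    gcongr
  have h3 : L σ (p - p') = L σ (p.1 - p'.1, (0 : X)) + L σ ((0 : G), p.2 - p'.2) := by
    rw [← map_add]; congr 1; ext <;> simp
  have h4 : ‖p - p'‖ ≤ ‖p.1 - p'.1‖ + ‖p.2 - p'.2‖ := by
    rw [Prod.norm_def]; exact max_le_add_of_nonneg (norm_nonneg _) (norm_nonneg _)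
  have h5 := hlow σ hσ (p.2 - p'.2)
  have h6 : ‖L σ ((0 : G), p.2 - p'.2)‖ ≤ ‖Φ (p, σ) - Φ (p', σ)‖ +
      ‖Φ (p, σ) - Φ (p', σ) - L σ (p - p')‖ + ‖L σ (p.1 - p'.1, (0 : X))‖ := by
    have : L σ ((0 : G), p.2 - p'.2) = (Φ (p, σ) - Φ (p', σ)) -
        (Φ (p, σ) - Φ (p', σ) - L σ (p - p')) - L σ (p.1 - p'.1, (0 : X)) := by rw [h3]; abel
    rw [this]
    exact (norm_sub_le _ _).trans (by gcongr; exact norm_sub_le _ _)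
  have h7 : C * δ * ‖p - p'‖ ≤ c / 2 * (‖p.1 - p'.1‖ + ‖p.2 - p'.2‖) := by gcongr
  have h8 : c / 2 * ‖p.2 - p'.2‖ ≤ (1 + C + c) * (‖Φ (p, σ) - Φ (p', σ)‖ + ‖p.1 - p'.1‖) := by
    have n1 := norm_nonneg (Φ (p, σ) - Φ (p', σ))
    have n2 := norm_nonneg (p.1 - p'.1)
    nlinarith [mul_nonneg hCn n1, mul_nonneg hc0.le n1, mul_nonneg hc0.le n2]
  calc ‖p.2 - p'.2‖ = 2 / c * (c / 2 * ‖p.2 - p'.2‖) := by field_simp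
    _ ≤ 2 / c * ((1 + C + c) * (‖Φ (p, σ) - Φ (p', σ)‖ + ‖p.1 - p'.1‖)) := by gcongr
    _ = _ := by ring
end LowerBound

section Circle
lemma norm_toCircle_sub_le (θ θ' : UnitAddCircle) :
    ‖(toCircle θ : ℂ) - toCircle θ'‖ ≤ 2 * Real.pi * ‖θ - θ'‖ := by
  have h0 : ∀ t : UnitAddCircle, ‖(toCircle t : ℂ) - 1‖ ≤ 2 * Real.pi * ‖t‖ := by
    intro t
    obtain ⟨x, rfl⟩ := QuotientAddGroup.mk_surjective t
    have hx : ((x - round x : ℝ) : UnitAddCircle) = (x : UnitAddCircle) := by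
      rw [AddCircle.coe_sub, sub_eq_self]
      exact (AddCircle.coe_eq_zero_iff (1 : ℝ)).2 ⟨round x, by simp⟩
    change ‖(toCircle (x : UnitAddCircle) : ℂ) - 1‖ ≤ 2 * Real.pi * ‖(x : UnitAddCircle)‖
    rw [UnitAddCircle.norm_eq, ← hx, AddCircle.toCircle_apply_mk, Circle.coe_exp, mul_comm]
    refine Real.norm_exp_I_mul_ofReal_sub_one_le.trans ?_
    rw [Real.norm_eq_abs, abs_mul, div_one, abs_of_pos Real.two_pi_pos]
  have h1 : (toCircle θ : ℂ) = toCircle (θ - θ') * toCircle θ' := by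
    rw [← Circle.coe_mul, ← AddCircle.toCircle_add, sub_add_cancel]
  rw [h1, ← sub_one_mul, norm_mul, Circle.norm_coe, mul_one]
  exact h0 _

lemma exists_toCircle_eq {σ : ℂ} (hσ : ‖σ‖ = 1) :
    ∃ θ : UnitAddCircle, (toCircle θ : ℂ) = σ := by
  obtain ⟨θ, hθ⟩ := (AddCircle.homeomorphCircle (one_ne_zero' ℝ)).surjective
    ⟨σ, mem_sphere_zero_iff_norm.2 hσ⟩
  refine ⟨θ, ?_⟩
  rw [← AddCircle.homeomorphCircle_apply (one_ne_zero' ℝ), hθ]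

lemma toCircle_mem (θ : UnitAddCircle) : (toCircle θ : ℂ) ∈ closedBall (0 : ℂ) 1 :=
  mem_closedBall_zero_iff.2 (Circle.norm_coe _).le
end Circle

section Loops
variable {P Y : Type*} [NormedAddCommGroup P] [NormedSpace ℝ P] [NormedAddCommGroup Y]
  [NormedSpace ℝ Y]

lemma LoopBound.hb {Φ : P × ℂ → Y} {K : Set P} {C : ℝ} (h : LoopBound Φ K C) {p : P} (hp : p ∈ K)
    {u : C(UnitAddCircle, Y)} (hu : ∀ θ, u θ = Φ (p, toCircle θ)) :
    HB u (2 * Real.pi * C) := by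
  have hC := h.nonneg
  have hpi := Real.two_le_pi
  refine HB.of_lipschitz (by positivity) (fun θ => ?_) fun θ θ' => ?_
  · rw [hu]
    refine (h.bound p hp _ (toCircle_mem _)).trans ?_
    nlinarith
  · rw [hu, hu]
    refine (h.lip p hp p hp _ (toCircle_mem _) _ (toCircle_mem _)).trans ?_
    rw [sub_self, norm_zero, zero_add]
    calc _ ≤ C * (2 * Real.pi * ‖θ - θ'‖) := by gcongr; exact norm_toCircle_sub_le θ θ'
      _ = _ := by ring

lemma LoopBound.hb_sub {Φ : P × ℂ → Y} {K : Set P} {C : ℝ} (h : LoopBound Φ K C) {p p' : P}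
    (hp : p ∈ K) (hp' : p' ∈ K) {u u' : C(UnitAddCircle, Y)}
    (hu : ∀ θ, u θ = Φ (p, toCircle θ))
    (hu' : ∀ θ, u' θ = Φ (p', toCircle θ)) :
    HB (u - u') (2 * Real.pi * C * ‖p - p'‖) := by
  have hC := h.nonneg
  have hpi := Real.two_le_pi
  refine HB.of_lipschitz (by positivity) (fun θ => ?_) fun θ θ' => ?_
  · rw [ContinuousMap.sub_apply, hu, hu']
    refine (h.lip p hp p' hp' _ (toCircle_mem _) _ (toCircle_mem _)).trans ?_
    rw [sub_self, norm_zero, add_zero]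
    gcongr
    nlinarith
  · rw [ContinuousMap.sub_apply, ContinuousMap.sub_apply, hu, hu', hu, hu']
    refine (h.mixed p hp p' hp' _ (toCircle_mem _) _ (toCircle_mem _)).trans ?_
    calc _ ≤ C * ‖p - p'‖ * (2 * Real.pi * ‖θ - θ'‖) := by
          gcongr; exact norm_toCircle_sub_le θ θ'
      _ = _ := by ring
end Loops

section General
variable {d : ℕ} {W : Type*} [NormedAddCommGroup W] [NormedSpace ℝ W]

lemma HB.bishopS_sub_le {e e' : C(UnitAddCircle, Fin d → ℝ)} {b b' β : ℝ} (he : HB e b)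
    (he' : HB e' b') (hee : HB (e - e') β) (c c' : Fin d → ℝ) (θ : UnitAddCircle) :
    ‖bishopS W c e θ - bishopS W c' e' θ‖ ≤ ‖c - c'‖ + wienerC * (2 * d * β) := by
  have h1 := (he.bishopS_sub (W := W) he' hee c).norm_apply_le θ
  have h2 : ‖bishopS W c e' θ - bishopS W c' e' θ‖ ≤ ‖c - c'‖ := by
    simp only [bishopS, ContinuousMap.coe_mk, Prod.mk_sub_mk, sub_self, Prod.norm_mk, norm_zero,
      norm_nonneg, sup_of_le_left]
    refine (pi_norm_le_iff_of_nonneg (norm_nonneg _)).2 fun l => ?_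
    simp only [Pi.sub_apply, add_sub_add_right_eq_sub, ← ofReal_sub, norm_real]
    exact norm_le_pi_norm (c - c') l
  rw [ContinuousMap.sub_apply] at h1
  calc _ ≤ ‖bishopS W c e' θ - bishopS W c' e' θ‖ + ‖bishopS W c e θ - bishopS W c e' θ‖ := by
        rw [add_comm]; exact norm_sub_le_norm_sub_add_norm_sub _ _ _
    _ ≤ _ := by gcongr
end General

variable {d m : ℕ}

/-- The boundary values of the model discs. -/
def modelLoop {D : (Fin d → ℝ) → Base d m → ℂ → Ambient d m}
    (hD : ∀ g τ, Differentiable ℂ (D g τ)) (τ : Base d m) (g : Fin d → ℝ) :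
    C(UnitAddCircle, Ambient d m) :=
  ⟨fun θ => D g τ (toCircle θ), (hD g τ).continuous.comp (by fun_prop)⟩

/-- The parameters for which perturbed discs are constructed. -/
structure DiscParam (g₀ : Fin d → ℝ) (δ R κ : ℝ) (E : C(Ambient d m, Fin d → ℝ))
    (c g : Fin d → ℝ) (τ : Base d m) : Prop where
  small : SmallC11 E R κ
  shift : ‖c‖ ≤ 1
  near : ‖g - g₀‖ ≤ δ
  param : ‖τ‖ ≤ δ

/-- Analytic discs `U E c g τ` whose boundaries lie in the perturbation
`Im z'' = β(w, w) / 2 + E(z'', w)` of the model quadric. -/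
structure AttachedDiscs (β : VectorForm d m) (g₀ : Fin d → ℝ)
    (U : DiscSolver d m) (δ C R κ : ℝ) : Prop where
  radius_pos : 0 < δ
  const_nonneg : 0 ≤ C
  bound_nonneg : 0 ≤ R
  small_pos : 0 < κ
  disc : ∀ {E c g τ}, DiscParam g₀ δ R κ E c g τ → DiffContOnCl ℂ (U E c g τ) (ball 0 1)
  center : ∀ {E c g τ}, DiscParam g₀ δ R κ E c g τ →
    U E c g τ 0 = (fun l => (c l : ℂ) + I * g l, 0)
  boundary : ∀ {E c g τ}, DiscParam g₀ δ R κ E c g τ → ∀ σ : ℂ, ‖σ‖ = 1 → ∀ l,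
    ((U E c g τ σ).1 l).im =
      1 / 2 * β (U E c g τ σ).2 (U E c g τ σ).2 l + E (U E c g τ σ) l
  bound : ∀ {E c g τ}, DiscParam g₀ δ R κ E c g τ → ∀ σ : ℂ, ‖σ‖ = 1 → ‖U E c g τ σ‖ ≤ R
  lower : ∀ {E c g τ τ'}, DiscParam g₀ δ R κ E c g τ → DiscParam g₀ δ R κ E c g τ' →
    ∀ σ : ℂ, ‖σ‖ = 1 → ‖τ - τ'‖ ≤ C * ‖U E c g τ σ - U E c g τ' σ‖
  lip : ∀ {E c g τ E' c' g' τ'}, DiscParam g₀ δ R κ E c g τ → DiscParam g₀ δ R κ E' c' g' τ' →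
    ∀ ε ≥ 0, (∀ a ∈ closedBall (0 : Ambient d m) R,
      ∀ b ∈ closedBall (0 : Ambient d m) R,
      ‖(E a - E' a) - (E b - E' b)‖ ≤ ε * ‖a - b‖) →
    ∀ σ σ' : ℂ, ‖σ‖ = 1 → ‖σ'‖ = 1 →
    ‖U E c g τ σ - U E' c' g' τ' σ'‖ ≤
      C * (‖g - g'‖ + ‖τ - τ'‖ + ‖σ - σ'‖ + ‖c - c'‖ + ε)

section Solve
variable {D : (Fin d → ℝ) → Base d m → ℂ → Ambient d m}
  {hD : ∀ g τ, Differentiable ℂ (D g τ)} {g₀ : Fin d → ℝ} {C₁ δ κ : ℝ}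

/-- The model loops reparametrized by a rotation. -/
def rotatedModel (D : (Fin d → ℝ) → Base d m → ℂ → Ambient d m)
    (q : (((Fin d → ℝ) × Base d m) × ℂ) × ℂ) : Ambient d m :=
  D q.1.1.1 q.1.1.2 (q.1.2 * q.2)

lemma circleShift_modelLoop (τ : Base d m) (g : Fin d → ℝ)
    (t θ : UnitAddCircle) : circleShift t (modelLoop hD τ g) θ =
      rotatedModel D (((g, τ), toCircle t), toCircle θ) := by
  change D g τ _ = D g τ _
  rw [AddCircle.toCircle_add, Circle.coe_mul, mul_comm]

lemma mem_rotatedDomain {g g' : Fin d → ℝ} {τ : Base d m} (hg : ‖g - g₀‖ ≤ δ)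
    (hg' : ‖g' - g‖ ≤ δ) (hτ : ‖τ‖ ≤ δ) (t : UnitAddCircle) :
    ((g', τ), (toCircle t : ℂ)) ∈
      closedBall ((g₀, 0) : (Fin d → ℝ) × Base d m) (2 * δ) ×ˢ
        closedBall (0 : ℂ) 1 := by
  have hδ : 0 ≤ δ := (norm_nonneg _).trans hg
  refine ⟨?_, toCircle_mem t⟩
  rw [mem_closedBall, dist_eq_norm, Prod.mk_sub_mk, sub_zero, Prod.norm_mk]
  refine max_le ?_ (by linarith)
  have := norm_add_le (g' - g) (g - g₀)
  rw [sub_add_sub_cancel] at this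
  linarith

variable (hL : LoopBound (rotatedModel D)
  (closedBall ((g₀, 0) : (Fin d → ℝ) × Base d m) (2 * δ) ×ˢ
    closedBall (0 : ℂ) 1) C₁)
include hL

lemma bishopData_modelLoop {E : C(Ambient d m, Fin d → ℝ)} {c g : Fin d → ℝ}
    {τ : Base d m}
    (H : DiscParam g₀ δ (wienerC * bishopB d (2 * Real.pi * C₁)) κ E c g τ) (t : UnitAddCircle) :
    BishopData E (fun q => circleShift t (modelLoop hD τ q)) g c (2 * Real.pi * C₁) δ κ where
  small := H.small
  bound g' hg' := hL.hb (mem_rotatedDomain H.near hg' H.param t) (circleShift_modelLoop τ g' t)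
  lip g' g'' hg' hg'' := by
    have := hL.hb_sub (mem_rotatedDomain H.near hg' H.param t) (mem_rotatedDomain H.near hg'' H.param t)
      (circleShift_modelLoop (hD := hD) τ g' t) (circleShift_modelLoop (hD := hD) τ g'' t)
    simpa using this
  shift_le := H.shift

/-- Comparison of the solutions of Bishop's equation for two sets of data. -/
lemma hb_shift_sub (hk : BishopConst d (2 * Real.pi * C₁) δ κ)
    {E E' : C(Ambient d m, Fin d → ℝ)} {c g c' g' : Fin d → ℝ}
    {τ τ' : Base d m} {e e' : C(UnitAddCircle, Fin d → ℝ)}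
    (H : DiscParam g₀ δ (wienerC * bishopB d (2 * Real.pi * C₁)) κ E c g τ)
    (H' : DiscParam g₀ δ (wienerC * bishopB d (2 * Real.pi * C₁)) κ E' c' g' τ')
    (he : HB e (κ * bishopB d (2 * Real.pi * C₁)))
    (he' : HB e' (κ * bishopB d (2 * Real.pi * C₁)))
    (hfe : bishopMap E (modelLoop hD τ) g c e = e)
    (hfe' : bishopMap E' (modelLoop hD τ') g' c' e' = e') {ε : ℝ} (hε : 0 ≤ ε)
    (hEE : ∀ a ∈ closedBall (0 : Ambient d m)
        (wienerC * bishopB d (2 * Real.pi * C₁)),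
      ∀ b ∈ closedBall (0 : Ambient d m) (wienerC * bishopB d (2 * Real.pi * C₁)),
      ‖(E a - E' a) - (E b - E' b)‖ ≤ ε * ‖a - b‖) (t t' : UnitAddCircle) :
    HB (circleShift t e - circleShift t' e')
      (2 * (κ * (1 + wienerC * bishopB d (2 * Real.pi * C₁)) *
        (2 * Real.pi * C₁ * (‖g - g'‖ + ‖τ - τ'‖ +
          ‖(toCircle t : ℂ) - toCircle t'‖) + ‖c - c'‖) +
        ε * bishopB d (2 * Real.pi * C₁))) := by
  refine (bishopData_modelLoop (hD := hD) hL H t).compare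
    (bishopData_modelLoop (hD := hD) hL H' t') hk (he.translate t) (he'.translate t')
    (bishopMap_circleShift he t hfe) (bishopMap_circleShift he' t' hfe') hε hEE fun q hq => ?_
  have h1 : ∀ x : Fin d → ℝ, ‖x - q - x‖ ≤ δ := fun x => by rw [sub_sub_cancel_left, norm_neg]; exact hq
  refine (hL.hb_sub (mem_rotatedDomain H.near (h1 g) H.param t) (mem_rotatedDomain H'.near (h1 g') H'.param t')
    (circleShift_modelLoop (hD := hD) τ _ t) (circleShift_modelLoop (hD := hD) τ' _ t')).mono ?_
  have hC := hL.nonneg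
  refine mul_le_mul_of_nonneg_left ?_ (by positivity)
  simp only [Prod.mk_sub_mk, Prod.norm_mk, sub_sub_sub_cancel_right]
  refine max_le (max_le ?_ ?_) ?_ <;>
  linarith [norm_nonneg (g - g'), norm_nonneg (τ - τ'),
    norm_nonneg ((toCircle t : ℂ) - toCircle t')]
end Solve

/-- The disc determined by a solution of Bishop's equation. -/
def bishopDisc (D : (Fin d → ℝ) → Base d m → ℂ → Ambient d m)
    (c g : Fin d → ℝ) (τ : Base d m) (e : C(UnitAddCircle, Fin d → ℝ)) (ζ : ℂ) :
    Ambient d m :=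
  D (g - ∫ θ, e θ ∂haarAddCircle) τ ζ +
    (fun l => (c l : ℂ) + I * schwarz (circleCoord l e) ζ, 0)

section
variable {D : (Fin d → ℝ) → Base d m → ℂ → Ambient d m}
  {hD : ∀ g τ, Differentiable ℂ (D g τ)} {c g : Fin d → ℝ} {τ : Base d m}
  {e : C(UnitAddCircle, Fin d → ℝ)} {b : ℝ}

lemma bishopDisc_toCircle (he : HB e b) (t : UnitAddCircle) :
    bishopDisc D c g τ e (toCircle t) =
      modelLoop hD τ (g - ∫ θ, e θ ∂haarAddCircle) t + bishopS (Fin m → ℂ) c e t := by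
  unfold bishopDisc
  congr 1
  refine Prod.ext (funext fun l => ?_) rfl
  simp only [bishopS, ContinuousMap.coe_mk]
  rw [(he.coord l).schwarzC_apply]

include hD in
lemma bishopDisc_diffContOnCl (he : HB e b) : DiffContOnCl ℂ (bishopDisc D c g τ e) (ball 0 1) := by
  refine (hD _ τ).diffContOnCl.add ?_
  have h : ∀ l, DiffContOnCl ℂ (fun ζ => (c l : ℂ) + I * schwarz (circleCoord l e) ζ)
      (ball 0 1) := fun l => by
    have := ((he.coord l).diffContOnCl_schwarz.const_smul I).const_add (c l : ℂ)
    simpa [smul_eq_mul] using this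
  refine ⟨?_, ?_⟩
  · exact (differentiableOn_pi.2 fun l => (h l).differentiableOn).prodMk
      (differentiableOn_const _)
  · exact (continuousOn_pi.2 fun l => (h l).continuousOn).prodMk continuousOn_const

lemma integral_circleCoord (l : Fin d) :
    ∫ θ, circleCoord l e θ ∂haarAddCircle =
      (∫ θ, e θ ∂haarAddCircle) l := by
  have hi : Integrable e haarAddCircle :=
    e.continuous.integrable_of_hasCompactSupport (HasCompactSupport.of_compactSpace _)
  exact ((proj (R := ℝ) (φ := fun _ : Fin d => ℝ) l).integral_comp_comm hi)
end

lemma exists_mul_le_half (G : ℝ) (hG : 0 ≤ G) {κ : ℝ} (hκ : κ ≤ 1 / (2 * (G + 1))) (h0 : 0 ≤ κ) :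
    κ * G ≤ 1 / 2 := by
  rw [le_div_iff₀ (by positivity)] at hκ
  nlinarith

theorem ModelFamily.exists_attachedDiscs {β : VectorForm d m}
    {D : (Fin d → ℝ) → Base d m → ℂ → Ambient d m}
    {O : Set ((Fin d → ℝ) × Base d m)} {g₀ : Fin d → ℝ}
    (H : ModelFamily β D O g₀) : ∃ U δ C R κ, AttachedDiscs β g₀ U δ C R κ := by
  have hD := H.entire
  obtain ⟨δ₁, hδ₁, C₂, hC₂, hball, hlow⟩ := exists_lower_bound H.isOpen H.smooth H.mem
    (fun σ hσ v hv => H.inj σ hσ v (by simpa using hv))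
  set δ := δ₁ / 2 with hδ
  have hδ0 : 0 < δ := by positivity
  have h2δ : 2 * δ = δ₁ := by rw [hδ]; ring
  have hrot : ContDiffOn ℝ 2 (rotatedModel D) ((O ×ˢ univ) ×ˢ univ) := by
    refine H.smooth.comp (s := (O ×ˢ (univ : Set ℂ)) ×ˢ (univ : Set ℂ))
      (f := fun q => (q.1.1, q.1.2 * q.2)) (ContDiff.contDiffOn (by fun_prop)) ?_
    rintro ⟨⟨p, ω⟩, ζ⟩ hp
    exact ⟨hp.1.1, mem_univ _⟩
  obtain ⟨C₁, hL⟩ := exists_loopBound (H.isOpen.prod isOpen_univ) hrot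
    ((isCompact_closedBall ((g₀, 0) : (Fin d → ℝ) × Base d m) (2 * δ)).prod
      (isCompact_closedBall (0 : ℂ) 1)) ((convex_closedBall _ _).prod (convex_closedBall _ _))
    (prod_mono (by rw [h2δ]; exact hball) (subset_univ _))
  have hC₁ := hL.nonneg
  have hw := wienerC_pos
  set C₀ := 2 * Real.pi * C₁ with hC₀
  have hC₀0 : 0 ≤ C₀ := by positivity
  obtain ⟨κ₁, hκ₁, hBC⟩ := exists_bishopConst d hC₀0 hδ0
  set B := bishopB d C₀ with hB
  have hB0 : 0 ≤ B := by rw [hB]; unfold bishopB; positivity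
  set G := C₂ * wienerC * (2 * d + 1) * (2 * ((1 + wienerC * B) * C₀)) with hG
  have hG0 : 0 ≤ G := by positivity
  set κ := min κ₁ (1 / (2 * (G + 1))) with hκ
  have hκ0 : 0 < κ := lt_min hκ₁ (by positivity)
  have hk : BishopConst d C₀ δ κ := hBC κ hκ0.le (min_le_left _ _)
  have hκG : κ * G ≤ 1 / 2 := exists_mul_le_half G hG0 (min_le_right _ _) hκ0.le
  have hsol : ∀ E c g τ, ∃ e, DiscParam g₀ δ (wienerC * B) κ E c g τ →
      HB e (κ * B) ∧ bishopMap E (modelLoop hD τ) g c e = e := by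
    intro E c g τ
    by_cases hP : DiscParam g₀ δ (wienerC * B) κ E c g τ
    · have h0 := bishopData_modelLoop (hD := hD) hL hP 0
      have h1 : (fun q => circleShift 0 (modelLoop hD τ q)) = modelLoop hD τ := by
        ext1 q; ext1 θ; simp
      rw [h1] at h0
      obtain ⟨e, he⟩ := h0.exists_solution hk
      exact ⟨e, fun _ => he⟩
    · exact ⟨0, fun h => absurd h hP⟩
  choose e he using hsol
  have hbd : ∀ {E c g τ E' c' g' τ'}, DiscParam g₀ δ (wienerC * B) κ E c g τ →
      DiscParam g₀ δ (wienerC * B) κ E' c' g' τ' → ∀ ε ≥ 0,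
      (∀ a ∈ closedBall (0 : Ambient d m) (wienerC * B),
      ∀ b ∈ closedBall (0 : Ambient d m) (wienerC * B),
      ‖(E a - E' a) - (E b - E' b)‖ ≤ ε * ‖a - b‖) → ∀ t t' : UnitAddCircle,
      ‖bishopS (Fin m → ℂ) c (e E c g τ) t - bishopS (Fin m → ℂ) c' (e E' c' g' τ') t'‖ ≤
        ‖c - c'‖ + wienerC * (2 * d * (2 * (κ * (1 + wienerC * B) *
        (C₀ * (‖g - g'‖ + ‖τ - τ'‖ + ‖(toCircle t : ℂ) - toCircle t'‖) +
          ‖c - c'‖) + ε * B))) ∧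
      ‖(∫ θ, e E c g τ θ ∂haarAddCircle) -
          ∫ θ, e E' c' g' τ' θ ∂haarAddCircle‖ ≤
        wienerC * (2 * (κ * (1 + wienerC * B) *
        (C₀ * (‖g - g'‖ + ‖τ - τ'‖ + ‖(toCircle t : ℂ) - toCircle t'‖) +
          ‖c - c'‖) + ε * B)) := by
    intro E c g τ E' c' g' τ' hP hP' ε hε hEE t t'
    obtain ⟨h1, h2⟩ := he E c g τ hP
    obtain ⟨h1', h2'⟩ := he E' c' g' τ' hP'
    have hs := hb_shift_sub (hD := hD) hL hk hP hP' h1 h1' h2 h2' hε hEE t t'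
    have hInt : ∀ (u : C(UnitAddCircle, Fin d → ℝ)) (s : UnitAddCircle),
        ∫ θ, circleShift s u θ ∂haarAddCircle = ∫ θ, u θ ∂haarAddCircle :=
      fun u s => integral_add_right_eq_self (μ := haarAddCircle) u s
    refine ⟨?_, ?_⟩
    · have h3 := (h1.translate t).bishopS_sub_le (W := Fin m → ℂ) (h1'.translate t') hs c c' 0
      rw [bishopS_circleShift h1, bishopS_circleShift h1', circleShift_apply, circleShift_apply,
        zero_add, zero_add] at h3
      exact h3
    · have h3 := BishopData.integral_sub_le hs
      rw [hInt, hInt] at h3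
      exact h3
  have hUt : ∀ {E c g τ}, DiscParam g₀ δ (wienerC * B) κ E c g τ → ∀ t : UnitAddCircle,
      bishopDisc D c g τ (e E c g τ) (toCircle t) =
        modelLoop hD τ (g - ∫ θ, e E c g τ θ ∂haarAddCircle) t +
          bishopS (Fin m → ℂ) c (e E c g τ) t := fun hP t =>
    bishopDisc_toCircle (he _ _ _ _ hP).1 t
  have hmean : ∀ {E c g τ}, DiscParam g₀ δ (wienerC * B) κ E c g τ →
      ‖g - (∫ θ, e E c g τ θ ∂haarAddCircle) - g‖ ≤ δ := fun {E c g τ} hP => by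
    rw [sub_sub_cancel_left, norm_neg]
    exact BishopData.mean_le hk (he _ _ _ _ hP).1
  set C := 2 * C₂ + (C₁ + 1 + (C₁ + 2 * d) * (wienerC * (2 * (κ * (1 + wienerC * B) * (C₀ + 1) + B))))
    with hC
  refine ⟨fun E c g τ => bishopDisc D c g τ (e E c g τ), δ, C, wienerC * B, κ, ?_⟩
  refine
    { radius_pos := hδ0
      const_nonneg := by positivity
      bound_nonneg := by positivity
      small_pos := hκ0
      disc := fun hP => bishopDisc_diffContOnCl (hD := hD) (he _ _ _ _ hP).1
      center := fun {E c g τ} hP => ?_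
      boundary := fun {E c g τ} hP σ hσ l => ?_
      bound := fun {E c g τ} hP σ hσ => ?_
      lower := fun {E c g τ τ'} hP hP' σ hσ => ?_
      lip := fun {E c g τ E' c' g' τ'} hP hP' ε hε hEE σ σ' hσ hσ' => ?_ }
  · have h1 := (mem_rotatedDomain hP.near (hmean hP) hP.param 0).1
    rw [h2δ] at h1
    have h2 := H.center _ (hball h1)
    simp only at h2
    unfold bishopDisc
    rw [h2]
    refine Prod.ext (funext fun l => ?_) (by simp)
    simp only [Prod.mk_add_mk, Pi.add_apply, Pi.sub_apply]
    rw [HB.schwarz_zero, integral_circleCoord]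
    push_cast
    ring
  · obtain ⟨t, rfl⟩ := exists_toCircle_eq hσ
    have h1 := hUt hP t
    have h2 : ∀ l, E (bishopDisc D c g τ (e E c g τ) (toCircle t)) l = e E c g τ t l := by
      intro l
      rw [h1]
      exact congrArg (fun u : C(UnitAddCircle, Fin d → ℝ) => u t l) (he _ _ _ _ hP).2
    have h3 := H.boundary (g - ∫ θ, e E c g τ θ ∂haarAddCircle) τ
      (toCircle t) (Circle.norm_coe _) l
    have h4 := ((he _ _ _ _ hP).1.coord l).schwarzC_re t
    rw [h2]
    have h5 : (bishopDisc D c g τ (e E c g τ) (toCircle t)).2 =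
        (D (g - ∫ θ, e E c g τ θ ∂haarAddCircle) τ (toCircle t)).2 := by
      simp [bishopDisc]
    rw [h5, ← h3, h1]
    simp only [Prod.fst_add, Pi.add_apply, Complex.add_im, bishopS, ContinuousMap.coe_mk,
      Complex.ofReal_im, Complex.I_mul_im, zero_add]
    rw [h4]
    rfl
  · obtain ⟨t, rfl⟩ := exists_toCircle_eq hσ
    rw [hUt hP t]
    have h0 := bishopData_modelLoop (hD := hD) hL hP 0
    have h1 : (fun q => circleShift 0 (modelLoop hD τ q)) = modelLoop hD τ := by
      ext1 q; ext1 θ; simp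
    rw [h1] at h0
    exact (h0.disc_bound hk (he _ _ _ _ hP).1).norm_apply_le t
  · obtain ⟨t, rfl⟩ := exists_toCircle_eq hσ
    rw [hUt hP t, hUt hP' t]
    obtain ⟨h1, h2⟩ := hbd hP hP' 0 le_rfl (by simp) t t
    have p1 := (mem_rotatedDomain hP.near (hmean hP) hP.param 0).1
    have p2 := (mem_rotatedDomain hP'.near (hmean hP') hP'.param 0).1
    rw [h2δ] at p1 p2
    have h3 := hlow _ p1 _ p2 (toCircle t) (Circle.norm_coe _)
    simp only [sub_sub_sub_cancel_left] at h3
    rw [norm_sub_rev (∫ θ, e E c g τ' θ ∂haarAddCircle)] at h3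
    simp only [sub_self, norm_zero, zero_add, add_zero, zero_mul] at h1 h2
    change ‖τ - τ'‖ ≤ C₂ * (‖modelLoop hD τ _ t - modelLoop hD τ' _ t‖ + _) at h3
    set a := modelLoop hD τ (g - ∫ θ, e E c g τ θ ∂haarAddCircle) t
    set a' := modelLoop hD τ' (g - ∫ θ, e E c g τ' θ ∂haarAddCircle) t
    set s := bishopS (Fin m → ℂ) c (e E c g τ) t
    set s' := bishopS (Fin m → ℂ) c (e E c g τ') t
    have h4 : ‖a - a'‖ ≤ ‖(a + s) - (a' + s')‖ + ‖s - s'‖ := by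
      have : a - a' = ((a + s) - (a' + s')) - (s - s') := by abel
      rw [this]; exact norm_sub_le _ _
    have h5 : ‖τ - τ'‖ ≤ C₂ * ‖(a + s) - (a' + s')‖ + κ * G * ‖τ - τ'‖ := by
      refine h3.trans ?_
      calc _ ≤ C₂ * ((‖(a + s) - (a' + s')‖ +
            wienerC * (2 * d * (2 * (κ * (1 + wienerC * B) * (C₀ * ‖τ - τ'‖))))) +
            wienerC * (2 * (κ * (1 + wienerC * B) * (C₀ * ‖τ - τ'‖)))) := by
              gcongr
              exact h4.trans (by gcongr)
        _ = _ := by rw [hG]; ring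
    have h6 : κ * G * ‖τ - τ'‖ ≤ 1 / 2 * ‖τ - τ'‖ := by gcongr
    have h7 : ‖τ - τ'‖ ≤ 2 * C₂ * ‖(a + s) - (a' + s')‖ := by linarith
    refine h7.trans ?_
    gcongr
    rw [hC]
    have : 0 ≤ C₁ + 1 + (C₁ + 2 * d) * (wienerC * (2 * (κ * (1 + wienerC * B) * (C₀ + 1) + B))) := by
      positivity
    linarith
  · obtain ⟨t, rfl⟩ := exists_toCircle_eq hσ
    obtain ⟨t', rfl⟩ := exists_toCircle_eq hσ'
    rw [hUt hP t, hUt hP' t']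
    obtain ⟨h1, h2⟩ := hbd hP hP' ε hε hEE t t'
    have p1 := mem_rotatedDomain hP.near (hmean hP) hP.param 0
    have p2 := mem_rotatedDomain hP'.near (hmean hP') hP'.param 0
    have h3 := hL.lip _ p1 _ p2 _ (toCircle_mem t) _ (toCircle_mem t')
    simp only [rotatedModel, AddCircle.toCircle_zero, Circle.coe_one, one_mul, Prod.mk_sub_mk,
      sub_self, Prod.norm_mk, norm_zero] at h3
    change ‖modelLoop hD τ _ t - modelLoop hD τ' _ t'‖ ≤ _ at h3
    rw [sub_sub_sub_comm] at h3
    set J := (∫ θ, e E c g τ θ ∂haarAddCircle) -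
          ∫ θ, e E' c' g' τ' θ ∂haarAddCircle with hJ
    set N := ‖g - g'‖ + ‖τ - τ'‖ + ‖(toCircle t : ℂ) - toCircle t'‖ +
      ‖c - c'‖ + ε with hN
    have n1 := norm_nonneg (g - g')
    have n2 := norm_nonneg (τ - τ')
    have n3 := norm_nonneg ((toCircle t : ℂ) - toCircle t')
    have n4 := norm_nonneg (c - c')
    have n5 := norm_nonneg J
    have hN0 : 0 ≤ N := by positivity
    have h4 : max (max ‖g - g' - J‖ ‖τ - τ'‖) 0 +
        ‖(toCircle t : ℂ) - toCircle t'‖ ≤ N + ‖J‖ := by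
      have : max (max ‖g - g' - J‖ ‖τ - τ'‖) 0 ≤ ‖g - g'‖ + ‖τ - τ'‖ + ‖J‖ := by
        refine max_le (max_le ?_ (by linarith)) (by linarith)
        have := norm_sub_le (g - g') J
        linarith
      linarith
    have h5 : 2 * (κ * (1 + wienerC * B) *
        (C₀ * (‖g - g'‖ + ‖τ - τ'‖ + ‖(toCircle t : ℂ) - toCircle t'‖) +
          ‖c - c'‖) + ε * B) ≤ 2 * (κ * (1 + wienerC * B) * (C₀ + 1) + B) * N := by
      have a1 : C₀ * (‖g - g'‖ + ‖τ - τ'‖ + ‖(toCircle t : ℂ) - toCircle t'‖) +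
          ‖c - c'‖ ≤ (C₀ + 1) * N := by
        rw [add_mul]
        refine add_le_add (mul_le_mul_of_nonneg_left (by linarith) hC₀0) (by linarith)
      have a2 : ε * B ≤ B * N := by rw [mul_comm]; exact mul_le_mul_of_nonneg_left (by linarith) hB0
      have a3 := mul_le_mul_of_nonneg_left a1
        (show 0 ≤ κ * (1 + wienerC * B) by positivity)
      linarith
    have h6 : ‖J‖ ≤ wienerC * (2 * (κ * (1 + wienerC * B) * (C₀ + 1) + B) * N) :=
      h2.trans (by gcongr)
    have h7 : ‖bishopS (Fin m → ℂ) c (e E c g τ) t - bishopS (Fin m → ℂ) c' (e E' c' g' τ') t'‖ ≤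
        N + wienerC * (2 * d * (2 * (κ * (1 + wienerC * B) * (C₀ + 1) + B) * N)) :=
      h1.trans (add_le_add (by linarith) (by gcongr))
    rw [add_sub_add_comm]
    refine (norm_add_le _ _).trans ?_
    have h8 := h3.trans ((mul_le_mul_of_nonneg_left h4 hC₁).trans
      (mul_le_mul_of_nonneg_left (add_le_add_right h6 N) hC₁))
    have h9 : 0 ≤ 2 * C₂ * N := by positivity
    rw [hC]
    linarith

section
variable {Y Z : Type*} [NormedAddCommGroup Y] [NormedSpace ℝ Y] [NormedAddCommGroup Z]
  [NormedSpace ℝ Z]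

lemma smallC11_of_hasFDerivAt {E : Y → Z} {E' : Y → Y →L[ℝ] Z} {R κ : ℝ} (hR : 0 ≤ R)
    (hκ : 0 ≤ κ) (hE : ∀ v, HasFDerivAt E (E' v) v) (h0 : E 0 = 0) (h0' : E' 0 = 0)
    (hlip : ∀ a ∈ closedBall (0 : Y) R, ∀ b ∈ closedBall (0 : Y) R,
      ‖E' a - E' b‖ ≤ κ * ‖a - b‖) : SmallC11 E R (κ * (1 + 3 * R)) := by
  have hbd : ∀ a ∈ closedBall (0 : Y) R, ‖E' a‖ ≤ κ * R := fun a ha => by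
    have := hlip a ha 0 (mem_closedBall_self hR)
    rw [h0', sub_zero, sub_zero] at this
    exact this.trans (by gcongr; simpa using ha)
  have hle : κ * R ≤ κ * (1 + 3 * R) := by gcongr; linarith
  refine ⟨by positivity, h0, fun a ha b hb => ?_, fun a₀ ha₀ a₁ ha₁ b₀ hb₀ b₁ hb₁ => ?_⟩
  · refine (convex_closedBall (0 : Y) R).norm_image_sub_le_of_norm_hasFDerivWithin_le (𝕜 := ℝ)
      (fun v _ => (hE v).hasFDerivWithinAt) (fun v hv => (hbd v hv).trans hle) hb ha
  · set γ : ℝ → Y := fun t => b₀ + t • (b₁ - b₀) with hγ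
    set c : ℝ → Y := fun t => a₀ + t • (a₁ - a₀) with hc
    have hγm : ∀ t ∈ Icc (0 : ℝ) 1, γ t ∈ closedBall (0 : Y) R := fun t ht =>
      (convex_closedBall (0 : Y) R).add_smul_sub_mem hb₀ hb₁ ht
    have hcm : ∀ t ∈ Icc (0 : ℝ) 1, c t ∈ closedBall (0 : Y) R := fun t ht =>
      (convex_closedBall (0 : Y) R).add_smul_sub_mem ha₀ ha₁ ht
    have hγd : ∀ t, HasDerivAt γ (b₁ - b₀) t := fun t =>
      (((hasDerivAt_id t).smul_const (b₁ - b₀)).const_add b₀).congr_deriv (one_smul _ _)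
    have hcd : ∀ t, HasDerivAt c (a₁ - a₀) t := fun t =>
      (((hasDerivAt_id t).smul_const (a₁ - a₀)).const_add a₀).congr_deriv (one_smul _ _)
    have hf : ∀ t, HasDerivAt (fun t => E (c t) - E (γ t))
        (E' (c t) (a₁ - a₀) - E' (γ t) (b₁ - b₀)) t := fun t =>
      ((hE (c t)).comp_hasDerivAt t (hcd t)).sub ((hE (γ t)).comp_hasDerivAt t (hγd t))
    set p := ‖(a₁ - b₁) - (a₀ - b₀)‖
    set q := ‖b₁ - b₀‖
    set s := ‖a₀ - b₀‖
    have hdiff : ∀ t ∈ Icc (0 : ℝ) 1, ‖c t - γ t‖ ≤ s + p := by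
      intro t ht
      have : c t - γ t = (a₀ - b₀) + t • ((a₁ - b₁) - (a₀ - b₀)) := by
        simp only [hc, hγ, smul_sub]; abel
      rw [this]
      refine (norm_add_le _ _).trans ?_
      gcongr
      rw [norm_smul, norm_of_nonneg ht.1]
      exact mul_le_of_le_one_left (norm_nonneg _) ht.2
    have hq : q ≤ 2 * R := by
      have h1 : ‖b₁‖ ≤ R := by simpa using hb₁
      have h2 : ‖b₀‖ ≤ R := by simpa using hb₀
      exact (norm_sub_le _ _).trans (by linarith)
    have hp : 0 ≤ p := norm_nonneg _
    have hs : 0 ≤ s := norm_nonneg _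
    have hq0 : 0 ≤ q := norm_nonneg _
    have hbound : ∀ t ∈ Icc (0 : ℝ) 1, ‖E' (c t) (a₁ - a₀) - E' (γ t) (b₁ - b₀)‖ ≤
        κ * (1 + 3 * R) * p + κ * (1 + 3 * R) * (q * s) := by
      intro t ht
      have e1 : E' (c t) (a₁ - a₀) - E' (γ t) (b₁ - b₀) =
          E' (c t) ((a₁ - b₁) - (a₀ - b₀)) + (E' (c t) - E' (γ t)) (b₁ - b₀) := by
        have : (a₁ - b₁) - (a₀ - b₀) = (a₁ - a₀) - (b₁ - b₀) := by abel
        rw [this]; simp only [map_sub, sub_apply]; abel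
      rw [e1]
      refine (norm_add_le _ _).trans ?_
      have e2 : ‖E' (c t) ((a₁ - b₁) - (a₀ - b₀))‖ ≤ κ * R * p :=
        (ContinuousLinearMap.le_opNorm _ _).trans (by gcongr; exact hbd _ (hcm t ht))
      have e3 : ‖(E' (c t) - E' (γ t)) (b₁ - b₀)‖ ≤ κ * (s + p) * q := by
        refine (ContinuousLinearMap.le_opNorm _ _).trans ?_
        gcongr
        exact (hlip _ (hcm t ht) _ (hγm t ht)).trans (by gcongr; exact hdiff t ht)
      have e4 : κ * p * q ≤ κ * p * (2 * R) := by gcongr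
      have e5 : 0 ≤ κ * R * (q * s) := by positivity
      have e6 : 0 ≤ κ * p := by positivity
      have e7 : 0 ≤ κ * R * p := by positivity
      nlinarith
    have h1 := (convex_Icc (0 : ℝ) 1).norm_image_sub_le_of_norm_hasDerivWithin_le
      (fun t _ => (hf t).hasDerivWithinAt) hbound (left_mem_Icc.2 zero_le_one)
      (right_mem_Icc.2 zero_le_one)
    simpa [hc, hγ] using h1
end

section
variable {X Y Z : Type*} [NormedAddCommGroup X] [NormedSpace ℝ X] [NormedAddCommGroup Y]
  [NormedSpace ℝ Y] [NormedAddCommGroup Z] [NormedSpace ℝ Z] {h : X → Z}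

/-- The rescaled Taylor remainder of `h` at `p` composed with `B`, minus the quadratic form of
the second derivative at `0` composed with `π`. -/
def pert (hh : ContDiff ℝ 2 h) (π : Y →L[ℝ] X) (q : X × ℝ × (Y →L[ℝ] X)) : C(Y, Z) :=
  ⟨fun v => (q.2.1 ^ 2)⁻¹ • (h (q.1 + q.2.1 • q.2.2 v) - h q.1 - fderiv ℝ h q.1 (q.2.1 • q.2.2 v))
      - (1 / 2 : ℝ) • fderiv ℝ (fderiv ℝ h) 0 (π v) (π v), by
    have := hh.continuous
    fun_prop⟩

/-- The derivative of `pert`. -/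
def pertDeriv (h : X → Z) (π : Y →L[ℝ] X) (q : X × ℝ × (Y →L[ℝ] X)) (v : Y) : Y →L[ℝ] Z :=
  q.2.1⁻¹ • (fderiv ℝ h (q.1 + q.2.1 • q.2.2 v) - fderiv ℝ h q.1).comp q.2.2 -
    (fderiv ℝ (fderiv ℝ h) 0 (π v)).comp π

lemma hasFDerivAt_pert (hh : ContDiff ℝ 2 h) (π : Y →L[ℝ] X) {q : X × ℝ × (Y →L[ℝ] X)}
    (hq : q.2.1 ≠ 0) (v : Y) : HasFDerivAt (pert hh π q) (pertDeriv h π q v) v := by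
  obtain ⟨p, r, B⟩ := q
  dsimp only at hq
  have hd : Differentiable ℝ h := hh.differentiable (by norm_num)
  have hB : HasFDerivAt (fun v => r • B v) (r • B) v := B.hasFDerivAt.const_smul r
  have h1 : HasFDerivAt (fun v => h (p + r • B v)) ((fderiv ℝ h (p + r • B v)).comp (r • B)) v :=
    (hd _).hasFDerivAt.comp v (hB.const_add p)
  have h2 : HasFDerivAt (fun v => fderiv ℝ h p (r • B v)) ((fderiv ℝ h p).comp (r • B)) v :=
    (fderiv ℝ h p).hasFDerivAt.comp v hB
  have hsym : ∀ a b, fderiv ℝ (fderiv ℝ h) 0 a b = fderiv ℝ (fderiv ℝ h) 0 b a := fun a b =>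
    (hh.contDiffAt.isSymmSndFDerivAt (by simp)) a b
  have h3 : HasFDerivAt (fun v => fderiv ℝ (fderiv ℝ h) 0 (π v) (π v))
      ((2 : ℝ) • (fderiv ℝ (fderiv ℝ h) 0 (π v)).comp π) v := by
    have := ((fderiv ℝ (fderiv ℝ h) 0).comp π).hasFDerivAt (x := v) |>.clm_apply
      (π.hasFDerivAt (x := v))
    refine this.congr_fderiv ?_
    ext u
    simp [hsym (π u), two_smul]
  refine ((((h1.sub_const (h p)).sub h2).const_smul ((r ^ 2)⁻¹)).sub
    (h3.const_smul (1 / 2 : ℝ))).congr_fderiv ?_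
  ext u
  simp only [pertDeriv, sub_apply, smul_apply,
    comp_apply, map_smul, ← smul_sub, smul_smul]
  congr 1
  · congr 1
    field_simp
  · norm_num

lemma exists_smallC11_pert (hh : ContDiff ℝ 2 h) {π : Y →L[ℝ] X} (hπ : ‖π‖ ≤ 1) {R κ : ℝ}
    (hR : 0 ≤ R) (hκ : 0 < κ) : ∃ θ > 0, ∀ p r B, ‖p‖ ≤ θ → 0 < r → r ≤ θ → ‖B - π‖ ≤ θ →
      SmallC11 (pert hh π (p, r, B)) R κ := by
  set S := fderiv ℝ (fderiv ℝ h) 0 with hS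
  have hst : HasStrictFDerivAt (fderiv ℝ h) S 0 :=
    ((hh.fderiv_right (m := 1) (by norm_num)).contDiffAt).hasStrictFDerivAt (by norm_num)
  set κ' := κ / (1 + 3 * R) with hκ'
  have hκ'0 : 0 < κ' := by positivity
  have hev := hst.isLittleO.def (c := κ' / 8) (by positivity)
  rw [Metric.eventually_nhds_iff] at hev
  obtain ⟨ρ, hρ, hev⟩ := hev
  obtain ⟨θ, hθ, hθ1, hθ2, hθ3⟩ : ∃ θ > 0, θ ≤ 1 ∧ θ * (1 + 2 * R) < ρ ∧
      3 * ‖S‖ * θ ≤ κ' / 2 := by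
    refine ⟨min 1 (min (ρ / (2 * (1 + 2 * R))) (κ' / 2 / (3 * ‖S‖ + 1))), by positivity,
      min_le_left _ _, ?_, ?_⟩
    · calc _ ≤ ρ / (2 * (1 + 2 * R)) * (1 + 2 * R) := by
            gcongr; exact (min_le_right _ _).trans (min_le_left _ _)
        _ = ρ / 2 := by field_simp
        _ < ρ := by linarith
    · calc _ ≤ (3 * ‖S‖ + 1) * (κ' / 2 / (3 * ‖S‖ + 1)) := by
            gcongr
            · linarith
            · exact (min_le_right _ _).trans (min_le_right _ _)
        _ = κ' / 2 := by field_simp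
  refine ⟨θ, hθ, fun p r B hp hr hrθ hB => ?_⟩
  have hB2 : ‖B‖ ≤ 2 := by
    have : B = (B - π) + π := by abel
    rw [this]; exact (norm_add_le _ _).trans (by linarith)
  have hκe : κ = κ' * (1 + 3 * R) := by rw [hκ']; field_simp
  rw [hκe]
  refine smallC11_of_hasFDerivAt hR hκ'0.le (hasFDerivAt_pert hh π hr.ne') ?_ ?_ ?_
  · simp [pert]
  · simp [pertDeriv]
  intro a ha b hb
  have hmem : ∀ v ∈ closedBall (0 : Y) R, ‖p + r • B v‖ < ρ := by
    intro v hv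
    have hv : ‖v‖ ≤ R := by simpa using hv
    calc _ ≤ ‖p‖ + ‖r • B v‖ := norm_add_le _ _
      _ ≤ θ + θ * (2 * R) := by
          rw [norm_smul, norm_of_nonneg hr.le]
          gcongr
          exact (B.le_opNorm v).trans (by gcongr)
      _ < ρ := by linarith
  have h1 := @hev (p + r • B a, p + r • B b) (by
    rw [dist_eq_norm, Prod.norm_def]; simpa using ⟨hmem a ha, hmem b hb⟩)
  have hsub : (p + r • B a) - (p + r • B b) = r • B (a - b) := by
    rw [map_sub, smul_sub]; abel
  simp only [hsub] at h1
  set Δ := fderiv ℝ h (p + r • B a) - fderiv ℝ h (p + r • B b) - S (r • B (a - b)) with hΔ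
  have e : pertDeriv h π (p, r, B) a - pertDeriv h π (p, r, B) b =
      r⁻¹ • Δ.comp B + ((S ((B - π) (a - b))).comp B + (S (π (a - b))).comp (B - π)) := by
    ext u
    simp only [pertDeriv, hΔ, ← hS, sub_apply, smul_apply,
      comp_apply, map_smul, add_apply, map_sub, smul_sub,
      smul_smul, inv_mul_cancel₀ hr.ne', one_smul]
    abel
  rw [e]
  have hBab : ‖B (a - b)‖ ≤ 2 * ‖a - b‖ := (B.le_opNorm _).trans (by gcongr)
  have n1 : ‖r⁻¹ • Δ.comp B‖ ≤ κ' / 2 * ‖a - b‖ := by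
    rw [norm_smul, norm_inv, norm_of_nonneg hr.le]
    calc _ ≤ r⁻¹ * (κ' / 8 * (r * (2 * ‖a - b‖)) * 2) := by
          gcongr
          refine (opNorm_comp_le _ _).trans ?_
          gcongr
          refine h1.trans ?_
          rw [norm_smul, norm_of_nonneg hr.le]
          gcongr
      _ = _ := by field_simp; ring
  have n2 : ‖(S ((B - π) (a - b))).comp B‖ ≤ ‖S‖ * (θ * ‖a - b‖) * 2 := by
    refine (opNorm_comp_le _ _).trans ?_
    gcongr
    refine (S.le_opNorm _).trans ?_
    gcongr
    exact ((B - π).le_opNorm _).trans (by gcongr)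
  have n3 : ‖(S (π (a - b))).comp (B - π)‖ ≤ ‖S‖ * (1 * ‖a - b‖) * θ := by
    refine (opNorm_comp_le _ _).trans ?_
    gcongr
    refine (S.le_opNorm _).trans ?_
    gcongr
    exact (π.le_opNorm _).trans (by gcongr)
  calc _ ≤ κ' / 2 * ‖a - b‖ + (‖S‖ * (θ * ‖a - b‖) * 2 + ‖S‖ * (1 * ‖a - b‖) * θ) :=
        (norm_add_le _ _).trans (add_le_add n1 ((norm_add_le _ _).trans (add_le_add n2 n3)))
    _ = κ' / 2 * ‖a - b‖ + 3 * ‖S‖ * θ * ‖a - b‖ := by ring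
    _ ≤ κ' / 2 * ‖a - b‖ + κ' / 2 * ‖a - b‖ := by gcongr
    _ = κ' * ‖a - b‖ := by ring

lemma eventually_pert_sub_le [ProperSpace Y] (hh : ContDiff ℝ 2 h) (π : Y →L[ℝ] X) (R : ℝ)
    {q₀ : X × ℝ × (Y →L[ℝ] X)} (hq₀ : q₀.2.1 ≠ 0) {ε : ℝ} (hε : 0 < ε) :
    ∀ᶠ q in nhds q₀, ∀ a ∈ closedBall (0 : Y) R, ∀ b ∈ closedBall (0 : Y) R,
      ‖(pert hh π q a - pert hh π q₀ a) - (pert hh π q b - pert hh π q₀ b)‖ ≤ ε * ‖a - b‖ := by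
  have hc : Continuous (fderiv ℝ h) := hh.continuous_fderiv (by norm_num)
  have hne : ∀ᶠ q : X × ℝ × (Y →L[ℝ] X) in nhds q₀, q.2.1 ≠ 0 :=
    (continuous_fst.comp continuous_snd).continuousAt.eventually_ne hq₀
  have hD : ∀ᶠ q in nhds q₀, ∀ v ∈ closedBall (0 : Y) R,
      ‖pertDeriv h π q v - pertDeriv h π q₀ v‖ < ε := by
    refine (isCompact_closedBall (0 : Y) R).eventually_forall_of_forall_eventually fun v _ => ?_
    have hcont : ContinuousAt (fun z : (X × ℝ × (Y →L[ℝ] X)) × Y =>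
        ‖pertDeriv h π z.1 z.2 - pertDeriv h π q₀ z.2‖) (q₀, v) := by
      have hinv : ContinuousAt (fun z : (X × ℝ × (Y →L[ℝ] X)) × Y => z.1.2.1⁻¹) (q₀, v) :=
        ContinuousAt.inv₀ (by fun_prop) hq₀
      have hF : Continuous (fun z : (X × ℝ × (Y →L[ℝ] X)) × Y =>
          (fderiv ℝ h (z.1.1 + z.1.2.1 • z.1.2.2 z.2) - fderiv ℝ h z.1.1).comp z.1.2.2) := by
        fun_prop
      have hG : Continuous (fun z : (X × ℝ × (Y →L[ℝ] X)) × Y =>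
          (fderiv ℝ (fderiv ℝ h) 0 (π z.2)).comp π) := by fun_prop
      have hH : Continuous (fun z : (X × ℝ × (Y →L[ℝ] X)) × Y => pertDeriv h π q₀ z.2) := by
        unfold pertDeriv; fun_prop
      exact (((hinv.smul hF.continuousAt).sub hG.continuousAt).sub hH.continuousAt).norm
    exact hcont.eventually_lt_const (u := ε) (by simpa using hε)
  filter_upwards [hne, hD] with q hq hqD a ha b hb
  exact (convex_closedBall (0 : Y) R).norm_image_sub_le_of_norm_hasFDerivWithin_le (𝕜 := ℝ)
    (f := fun v => pert hh π q v - pert hh π q₀ v)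
    (fun v _ => ((hasFDerivAt_pert hh π hq v).sub (hasFDerivAt_pert hh π hq₀ v)).hasFDerivWithinAt)
    (fun v hv => (hqD v hv).le) hb ha
end

/-- The projection `(x + iy, w) ↦ (x, w)`. -/
def baseL (d m : ℕ) : Ambient d m →L[ℝ] Base d m :=
  (ContinuousLinearMap.pi fun l => Complex.reCLM.comp
    ((proj l).comp (fst ℝ _ _))).prod
    (snd ℝ _ _)

/-- The projection `(x + iy, w) ↦ y`. -/
def imL (d m : ℕ) : Ambient d m →L[ℝ] (Fin d → ℝ) :=
  ContinuousLinearMap.pi fun l => Complex.imCLM.comp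
    ((proj l).comp (fst ℝ _ _))

@[simp] lemma baseL_apply_fst (v : Ambient d m) (l : Fin d) :
    (baseL d m v).1 l = (v.1 l).re := rfl

@[simp] lemma baseL_apply_snd (v : Ambient d m) : (baseL d m v).2 = v.2 := rfl

@[simp] lemma imL_apply (v : Ambient d m) (l : Fin d) :
    imL d m v l = (v.1 l).im := rfl

lemma norm_baseL_apply_le (v : Ambient d m) : ‖baseL d m v‖ ≤ ‖v‖ := by
  refine max_le ((pi_norm_le_iff_of_nonneg (norm_nonneg _)).2 fun l => ?_) (norm_snd_le v)
  exact (Complex.abs_re_le_norm _).trans ((norm_le_pi_norm _ l).trans (norm_fst_le v))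

/-- The complex linear endomorphism `v ↦ (i J v, 0)`, with `J` the complex linear map whose real
part is `v ↦ ℓ (base v)`. -/
def crN (ℓ : Base d m →L[ℝ] (Fin d → ℝ)) :
    Ambient d m →L[ℂ] Ambient d m :=
  LinearMap.mkContinuous
    { toFun := fun v => (fun l => I * ((ℓ (baseL d m v) l : ℂ) -
        I * (ℓ (baseL d m (I • v)) l : ℂ)), 0)
      map_add' := fun u v => by
        ext l
        · simp only [smul_add, map_add, Pi.add_apply, Complex.ofReal_add, Prod.mk_add_mk]
          ring
        · simp
      map_smul' := fun c v => by
        have h1 : baseL d m (c • v) = c.re • baseL d m v + c.im • baseL d m (I • v) := by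
          ext l
          · simp; ring
          · simp only [baseL_apply_snd, Prod.smul_snd, Prod.snd_add, Pi.smul_apply, Pi.add_apply,
              smul_eq_mul, Complex.real_smul]
            conv_lhs => rw [← re_add_im c]
            ring
        have h2 : baseL d m (I • c • v) =
            c.re • baseL d m (I • v) - c.im • baseL d m v := by
          ext l
          · simp; ring
          · simp only [baseL_apply_snd, Prod.smul_snd, Prod.snd_sub, Pi.smul_apply, Pi.sub_apply,
              smul_eq_mul, Complex.real_smul]
            conv_lhs => rw [← re_add_im c]
            linear_combination (c.im * v.2 l : ℂ) * Complex.I_sq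
        ext l
        · simp only [h1, h2, map_add, map_sub, map_smul, Pi.add_apply, Pi.sub_apply, Pi.smul_apply,
            smul_eq_mul, Complex.ofReal_add, ofReal_sub, Complex.ofReal_mul,
            RingHom.id_apply, Prod.smul_mk]
          conv_rhs => rw [← re_add_im c]
          linear_combination (c.im * ℓ (baseL d m (I • v)) l * I : ℂ) * Complex.I_sq
        · simp }
    (2 * ‖ℓ‖) fun v => by
      refine max_le ((pi_norm_le_iff_of_nonneg (by positivity)).2 fun l => ?_) ?_
      · have hb : ∀ v : Ambient d m, ‖(ℓ (baseL d m v) l : ℂ)‖ ≤ ‖ℓ‖ * ‖v‖ := by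
          intro v
          rw [norm_real]
          refine (norm_le_pi_norm _ l).trans ((ℓ.le_opNorm _).trans ?_)
          gcongr
          exact norm_baseL_apply_le v
        have h1 := hb v
        have h2 := hb (I • v)
        rw [norm_smul, norm_I, one_mul] at h2
        calc _ ≤ _ := by
              simp only [LinearMap.coe_mk, AddHom.coe_mk, norm_mul, norm_I, one_mul]
              exact norm_sub_le _ _
          _ ≤ ‖ℓ‖ * ‖v‖ + ‖ℓ‖ * ‖v‖ := by
              rw [norm_mul, norm_I, one_mul]; gcongr
          _ = _ := by ring
      · simp only [LinearMap.coe_mk, AddHom.coe_mk, norm_zero]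
        positivity

lemma crN_apply_fst (ℓ : Base d m →L[ℝ] (Fin d → ℝ))
    (v : Ambient d m) (l : Fin d) :
    (crN ℓ v).1 l = I * ((ℓ (baseL d m v) l : ℂ) -
        I * (ℓ (baseL d m (I • v)) l : ℂ)) := rfl

lemma crN_apply_snd (ℓ : Base d m →L[ℝ] (Fin d → ℝ))
    (v : Ambient d m) : (crN ℓ v).2 = 0 := rfl

lemma norm_crN_le (ℓ : Base d m →L[ℝ] (Fin d → ℝ)) : ‖crN ℓ‖ ≤ 2 * ‖ℓ‖ :=
  LinearMap.mkContinuous_norm_le _ (by positivity) _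

lemma continuous_crN : Continuous (crN : (Base d m →L[ℝ] (Fin d → ℝ)) → _) := by
  refine (LipschitzWith.of_dist_le_mul (K := 2) fun ℓ ℓ' => ?_).continuous
  have : crN ℓ - crN ℓ' = crN (ℓ - ℓ') := by
    refine ContinuousLinearMap.ext fun v => Prod.ext (funext fun l => ?_) ?_
    · simp only [sub_apply, Prod.fst_sub, Pi.sub_apply, crN_apply_fst,
        ofReal_sub]
      ring
    · simp [crN_apply_snd]
  rw [dist_eq_norm, dist_eq_norm, this]
  exact norm_crN_le _

/-- The inverse of `1 - crN ℓ`. -/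
def crInv (ℓ : Base d m →L[ℝ] (Fin d → ℝ)) :
    Ambient d m →L[ℂ] Ambient d m :=
  Ring.inverse (1 - crN ℓ)

section
variable {ℓ : Base d m →L[ℝ] (Fin d → ℝ)}

lemma isUnit_one_sub_crN (h : 2 * ‖ℓ‖ < 1) : IsUnit (1 - crN ℓ) :=
  (Units.oneSub (crN ℓ) ((norm_crN_le ℓ).trans_lt h)).isUnit

lemma one_sub_crN_crInv (h : 2 * ‖ℓ‖ < 1) (u : Ambient d m) :
    crInv ℓ u - crN ℓ (crInv ℓ u) = u :=
  congrArg (fun T => T u) (Ring.mul_inverse_cancel _ (isUnit_one_sub_crN h))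

lemma crInv_one_sub_crN (h : 2 * ‖ℓ‖ < 1) (v : Ambient d m) :
    crInv ℓ (v - crN ℓ v) = v :=
  congrArg (fun T => T v) (Ring.inverse_mul_cancel _ (isUnit_one_sub_crN h))

lemma crInv_apply_snd (h : 2 * ‖ℓ‖ < 1) (u : Ambient d m) :
    (crInv ℓ u).2 = u.2 := by
  conv_rhs => rw [← one_sub_crN_crInv h u]
  rw [Prod.snd_sub, crN_apply_snd, sub_zero]

lemma im_crInv (h : 2 * ‖ℓ‖ < 1) (u : Ambient d m) (l : Fin d) :
    ((crInv ℓ u).1 l).im = (u.1 l).im + ℓ (baseL d m (crInv ℓ u)) l := by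
  have h1 := congrArg (fun v => (v.1 l).im) (one_sub_crN_crInv h u)
  simp only [Prod.fst_sub, Pi.sub_apply, crN_apply_fst, Complex.sub_im] at h1
  simp only [Complex.I_mul_im, Complex.sub_re, ofReal_re, Complex.I_mul_re,
    Complex.ofReal_im, neg_zero, sub_zero] at h1
  linarith

lemma continuousAt_crInv (h : 2 * ‖ℓ‖ < 1) : ContinuousAt crInv ℓ := by
  obtain ⟨x, hx⟩ := isUnit_one_sub_crN h
  have h1 := NormedRing.inverse_continuousAt x
  rw [hx] at h1
  exact ContinuousAt.comp (f := fun ℓ => 1 - crN ℓ) h1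
    (continuous_const.sub continuous_crN).continuousAt

lemma crInv_zero : crInv (0 : Base d m →L[ℝ] (Fin d → ℝ)) = 1 := by
  have : crN (0 : Base d m →L[ℝ] (Fin d → ℝ)) = 0 := by
    refine ContinuousLinearMap.ext fun v => Prod.ext (funext fun l => ?_) ?_
    · simp [crN_apply_fst]
    · simp [crN_apply_snd]
  rw [crInv, this, sub_zero, Ring.inverse_one]
end

/-- The dilation `(z, w) ↦ (r z, w)`. -/
def scaleL (d m : ℕ) (r : ℝ) : Ambient d m →L[ℂ] Ambient d m :=
  ((r : ℂ) • fst ℂ _ _).prod (snd ℂ _ _)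

@[simp] lemma scaleL_apply (r : ℝ) (v : Ambient d m) :
    scaleL d m r v = ((r : ℂ) • v.1, v.2) := rfl

/-- The projection `(z, w) ↦ (0, w)`. -/
def tanL (d m : ℕ) : Ambient d m →L[ℝ] Base d m :=
  (ContinuousLinearMap.inr ℝ _ _).comp (snd ℝ _ _)

@[simp] lemma tanL_apply (v : Ambient d m) : tanL d m v = (0, v.2) := rfl

lemma norm_tanL_le : ‖tanL d m‖ ≤ 1 :=
  ContinuousLinearMap.opNorm_le_bound _ zero_le_one fun v => by
    rw [tanL_apply, one_mul]
    exact max_le (by simp) (norm_snd_le v)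

/-- The linear part of the parametrization of the discs. -/
def discL (ℓ : Base d m →L[ℝ] (Fin d → ℝ)) (r : ℝ) :
    Ambient d m →L[ℂ] Ambient d m :=
  (crInv ℓ).comp (scaleL d m r)

/-- The base part of `discL`. -/
def baseD (ℓ : Base d m →L[ℝ] (Fin d → ℝ)) (r : ℝ) :
    Ambient d m →L[ℝ] Base d m :=
  (baseL d m).comp ((discL ℓ r).restrictScalars ℝ)

lemma baseD_apply (ℓ : Base d m →L[ℝ] (Fin d → ℝ)) (r : ℝ)
    (v : Ambient d m) : baseD ℓ r v = baseL d m (discL ℓ r v) := rfl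

lemma norm_scaleL_apply_le {r : ℝ} (hr : 0 ≤ r) (hr1 : r ≤ 1) (v : Ambient d m) :
    ‖scaleL d m r v‖ ≤ ‖v‖ := by
  refine max_le ?_ (norm_snd_le v)
  rw [scaleL_apply, norm_smul, norm_real, norm_of_nonneg hr]
  exact (mul_le_of_le_one_left (norm_nonneg _) hr1).trans (norm_fst_le v)

lemma norm_discL_apply_le {ℓ : Base d m →L[ℝ] (Fin d → ℝ)}
    (hℓ : ‖crInv ℓ - 1‖ ≤ 1) {r : ℝ} (hr : 0 ≤ r) (hr1 : r ≤ 1)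
    (v : Ambient d m) : ‖discL ℓ r v‖ ≤ 2 * ‖v‖ := by
  have : discL ℓ r v = (crInv ℓ - 1) (scaleL d m r v) + scaleL d m r v := by
    simp only [sub_apply, one_apply_eq_self, sub_add_cancel]; rfl
  rw [this]
  have h1 := norm_scaleL_apply_le hr hr1 v
  have h2 : ‖(crInv ℓ - 1) (scaleL d m r v)‖ ≤ 1 * ‖v‖ :=
    ((crInv ℓ - 1).le_opNorm _).trans (by gcongr)
  exact (norm_add_le _ _).trans (by linarith)

lemma norm_baseD_sub_le (ℓ : Base d m →L[ℝ] (Fin d → ℝ)) {r : ℝ} (hr : 0 ≤ r)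
    (hr1 : r ≤ 1) : ‖baseD ℓ r - tanL d m‖ ≤ ‖crInv ℓ - 1‖ + r := by
  refine ContinuousLinearMap.opNorm_le_bound _ (by positivity) fun v => ?_
  have : (baseD ℓ r - tanL d m) v =
      baseL d m ((crInv ℓ - 1) (scaleL d m r v)) + (r • (baseL d m v).1, 0) := by
    have e : discL ℓ r v = (crInv ℓ - 1) (scaleL d m r v) + scaleL d m r v := by
      simp only [sub_apply, one_apply_eq_self, sub_add_cancel]; rfl
    rw [sub_apply, baseD_apply, e, map_add, add_sub_assoc]
    congr 1
    ext l <;> simp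
  rw [this, add_mul]
  refine (norm_add_le _ _).trans (add_le_add ?_ ?_)
  · refine (norm_baseL_apply_le _).trans (((crInv ℓ - 1).le_opNorm _).trans ?_)
    gcongr
    exact norm_scaleL_apply_le hr hr1 v
  · refine max_le ?_ (by simpa using by positivity)
    rw [norm_smul, norm_of_nonneg hr]
    gcongr
    exact (norm_fst_le _).trans (norm_baseL_apply_le v)

lemma continuousAt_discL {ℓ : Base d m →L[ℝ] (Fin d → ℝ)} (h : 2 * ‖ℓ‖ < 1)
    (r : ℝ) : ContinuousAt (fun q : (Base d m →L[ℝ] (Fin d → ℝ)) × ℝ =>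
      discL q.1 q.2) (ℓ, r) := by
  have h1 : ContinuousAt (fun q : (Base d m →L[ℝ] (Fin d → ℝ)) × ℝ =>
      crInv q.1) (ℓ, r) :=
    ContinuousAt.comp (g := crInv) (f := Prod.fst) (x := (ℓ, r)) (continuousAt_crInv h)
      continuousAt_fst
  have h2 : Continuous (scaleL d m) := by
    have : scaleL d m = fun r => r • (inl ℂ _ _).comp
        (fst ℂ _ _) + (ContinuousLinearMap.inr ℂ _ _).comp
        (snd ℂ _ _) := by
      refine funext fun r => ContinuousLinearMap.ext fun v => Prod.ext ?_ ?_
      · ext l; simp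
      · ext l; simp
    rw [this]
    fun_prop
  exact h1.clm_comp (h2.comp continuous_snd).continuousAt

lemma continuousAt_baseD {ℓ : Base d m →L[ℝ] (Fin d → ℝ)} (h : 2 * ‖ℓ‖ < 1)
    (r : ℝ) : ContinuousAt (fun q : (Base d m →L[ℝ] (Fin d → ℝ)) × ℝ =>
      baseD q.1 q.2) (ℓ, r) :=
  continuousAt_const.clm_comp
    (((ContinuousLinearMap.restrictScalarsL ℂ _ _ ℝ ℝ).continuous.continuousAt).comp
      (continuousAt_discL h r))

lemma eq_of_discL {ℓ : Base d m →L[ℝ] (Fin d → ℝ)} (h : 2 * ‖ℓ‖ < 1)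
    {r : ℝ} (hr : r ≠ 0) (v : Ambient d m) :
    ((scaleL d m r⁻¹).comp (1 - crN ℓ)) (discL ℓ r v) = v := by
  have : (1 - crN ℓ) (discL ℓ r v) = scaleL d m r v := one_sub_crN_crInv h _
  rw [comp_apply, this, scaleL_apply, scaleL_apply]
  simp only [smul_smul, ← Complex.ofReal_mul, inv_mul_cancel₀ hr, Complex.ofReal_one, one_smul]

/-- The height of a point over the graph of `h`. -/
def height (h : Base d m → Fin d → ℝ) (z : Ambient d m) :
    Fin d → ℝ := imL d m z - h (baseL d m z)

/-- Half of the second derivative of `h` at the origin in the complex directions. -/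
def hessL (h : Base d m → Fin d → ℝ) :
    VectorForm d m :=
  (fderiv ℝ (fderiv ℝ h) 0).bilinearComp (ContinuousLinearMap.inr ℝ _ _)
    (ContinuousLinearMap.inr ℝ _ _)

section
variable {h : Base d m → Fin d → ℝ} (hh : ContDiff ℝ 2 h)
  (ρ : (Fin d → ℝ) →L[ℝ] ℝ)
  (U : DiscSolver d m)

/-- The size of the disc centred at `z`. -/
def discR (h : Base d m → Fin d → ℝ) (ρ : (Fin d → ℝ) →L[ℝ] ℝ)
    (z : Ambient d m) : ℝ := √(ρ (height h z))

/-- The data from which the perturbation for the disc centred at `z` is built. -/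
def discQ (h : Base d m → Fin d → ℝ) (ρ : (Fin d → ℝ) →L[ℝ] ℝ)
    (z : Ambient d m) : (Base d m) × ℝ ×
      (Ambient d m →L[ℝ] Base d m) :=
  (baseL d m z, discR h ρ z, baseD (fderiv ℝ h (baseL d m z)) (discR h ρ z))

/-- The imaginary part of the centre of the rescaled disc. -/
def discG (h : Base d m → Fin d → ℝ) (ρ : (Fin d → ℝ) →L[ℝ] ℝ)
    (z : Ambient d m) : Fin d → ℝ := (ρ (height h z))⁻¹ • height h z

/-- The real part of the centre of the rescaled disc. -/
def discC (h : Base d m → Fin d → ℝ) (ρ : (Fin d → ℝ) →L[ℝ] ℝ)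
    (z : Ambient d m) : Fin d → ℝ := fderiv ℝ h (baseL d m z) (discG h ρ z, 0)

/-- The rescaled disc whose image is the disc centred at `z`. -/
def scaledDisc (z : Ambient d m) (τ : Base d m) (ζ : ℂ) :
    Ambient d m :=
  U (pert hh (tanL d m) (discQ h ρ z)) (discC h ρ z) (discG h ρ z) τ ζ

/-- The disc centred at `z` with boundary in the graph of `h`. -/
def curvedDisc (z : Ambient d m) (τ : Base d m) (ζ : ℂ) :
    Ambient d m :=
  graphMap h (baseL d m z) + (discR h ρ z : ℂ) •
    discL (fderiv ℝ h (baseL d m z)) (discR h ρ z) (scaledDisc hh ρ U z τ ζ)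

/-- The conditions on `z` under which the disc centred at `z` is available. -/
structure DiscAdmissible (g₀ : Fin d → ℝ) (δ R κ : ℝ) (z : Ambient d m) : Prop where
  deriv_lt : 2 * ‖fderiv ℝ h (baseL d m z)‖ < 1
  pos : 0 < ρ (height h z)
  le_one : ρ (height h z) ≤ 1
  inv_near : ‖crInv (fderiv ℝ h (baseL d m z)) - 1‖ ≤ 1
  param : ∀ τ ∈ ball (0 : Base d m) δ, DiscParam g₀ δ R κ
    (pert hh (tanL d m) (discQ h ρ z)) (discC h ρ z) (discG h ρ z) τ

lemma eq_graphMap_add_height (z : Ambient d m) :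
    z = graphMap h (baseL d m z) + (fun l => I * (height h z l : ℂ), 0) := by
  ext l
  · simp only [graphMap, Prod.fst_add, Pi.add_apply, baseL_apply_fst, height, Pi.sub_apply,
      imL_apply, ofReal_sub]
    conv_lhs => rw [← re_add_im (z.1 l)]
    ring
  · simp [graphMap]

lemma eq_graphMap_iff (z : Ambient d m) :
    z = graphMap h (baseL d m z) ↔ height h z = 0 := by
  constructor
  · intro hz
    ext l
    have := congrArg (fun z => (z.1 l).im) hz
    simp only [graphMap] at this
    simp [height, this]
  · intro hz
    conv_lhs => rw [eq_graphMap_add_height (h := h) z]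
    rw [hz]
    ext l <;> simp

variable {hh ρ U} {g₀ : Fin d → ℝ} {δ C R κ : ℝ} {z : Ambient d m}
  {τ : Base d m}

lemma DiscAdmissible.discR_pos (hz : DiscAdmissible hh ρ g₀ δ R κ z) : 0 < discR h ρ z :=
  Real.sqrt_pos.2 hz.pos

lemma DiscAdmissible.discR_le_one (hz : DiscAdmissible hh ρ g₀ δ R κ z) : discR h ρ z ≤ 1 :=
  Real.sqrt_le_one.2 hz.le_one

lemma DiscAdmissible.discR_sq (hz : DiscAdmissible hh ρ g₀ δ R κ z) :
    discR h ρ z ^ 2 = ρ (height h z) := Real.sq_sqrt hz.pos.le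

lemma DiscAdmissible.disc (hz : DiscAdmissible hh ρ g₀ δ R κ z)
    (HU : AttachedDiscs (hessL h) g₀ U δ C R κ) (hτ : τ ∈ ball 0 δ) :
    DiffContOnCl ℂ (curvedDisc hh ρ U z τ) (ball 0 1) := by
  have h1 := HU.disc (hz.param τ hτ)
  have h2 : Differentiable ℂ fun v => graphMap h (baseL d m z) + (discR h ρ z : ℂ) •
      discL (fderiv ℝ h (baseL d m z)) (discR h ρ z) v := by fun_prop
  exact h2.comp_diffContOnCl h1

lemma DiscAdmissible.center (hz : DiscAdmissible hh ρ g₀ δ R κ z)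
    (HU : AttachedDiscs (hessL h) g₀ U δ C R κ) (hτ : τ ∈ ball 0 δ) :
    curvedDisc hh ρ U z τ 0 = z := by
  rw [curvedDisc, scaledDisc, HU.center (hz.param τ hτ)]
  conv_rhs => rw [eq_graphMap_add_height (h := h) z]
  congr 1
  set ℓ := fderiv ℝ h (baseL d m z) with hℓ
  set v : Ambient d m := (fun l => I * (height h z l : ℂ), 0) with hv
  rw [← crInv_one_sub_crN hz.deriv_lt v, ← map_smul, discL, comp_apply]
  congr 1
  have hr := hz.discR_sq
  have hb : baseL d m v = 0 := by ext l <;> simp [hv]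
  have hb' : baseL d m (I • v) = - (height h z, 0) := by ext l <;> simp [hv]
  have hη : height h z = discR h ρ z ^ 2 • discG h ρ z := by
    rw [hr, discG, smul_smul, mul_inv_cancel₀ hz.pos.ne', one_smul]
  have hC : ℓ (height h z, 0) = discR h ρ z ^ 2 • discC h ρ z := by
    rw [discC, ← hℓ, ← map_smul, Prod.smul_mk, smul_zero, ← hη]
  ext l
  · rw [Prod.fst_sub, Pi.sub_apply, crN_apply_fst, hb, hb', map_neg, hC, map_zero]
    have := congrFun hη l
    simp only [Prod.smul_fst, Pi.smul_apply, scaleL_apply, smul_eq_mul, hv, this, Pi.neg_apply,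
      Pi.zero_apply, Complex.ofReal_neg, Complex.ofReal_mul, Complex.ofReal_pow,
      Complex.ofReal_zero]
    linear_combination ((discR h ρ z : ℂ) ^ 2 * discC h ρ z l) * Complex.I_sq
  · simp [crN_apply_snd, hv]

lemma baseL_curvedDisc (z : Ambient d m) (τ : Base d m) (ζ : ℂ) :
    baseL d m (curvedDisc hh ρ U z τ ζ) = baseL d m z + discR h ρ z •
      baseD (fderiv ℝ h (baseL d m z)) (discR h ρ z) (scaledDisc hh ρ U z τ ζ) := by
  rw [curvedDisc, map_add, baseD_apply, ← map_smul (baseL d m), Complex.coe_smul]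
  congr 1
  ext l <;> simp [graphMap]

lemma DiscAdmissible.boundary (hz : DiscAdmissible hh ρ g₀ δ R κ z)
    (HU : AttachedDiscs (hessL h) g₀ U δ C R κ) (hτ : τ ∈ ball 0 δ) {σ : ℂ} (hσ : ‖σ‖ = 1) :
    curvedDisc hh ρ U z τ σ = graphMap h (baseL d m (curvedDisc hh ρ U z τ σ)) := by
  rw [eq_graphMap_iff]
  ext l
  rw [height, Pi.sub_apply, Pi.zero_apply, sub_eq_zero, baseL_curvedDisc, imL_apply]
  have hb := HU.boundary (hz.param τ hτ) σ hσ l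
  change ((scaledDisc hh ρ U z τ σ).1 l).im = _ at hb
  set y := scaledDisc hh ρ U z τ σ with hy
  set r := discR h ρ z with hr
  have hr0 : r ≠ 0 := hz.discR_pos.ne'
  set ℓ := fderiv ℝ h (baseL d m z) with hℓ
  have him := im_crInv (ℓ := ℓ) hz.deriv_lt (scaleL d m r y) l
  have hE : (pert hh (tanL d m) (discQ h ρ z)) y l = (r ^ 2)⁻¹ *
      (h (baseL d m z + r • baseD ℓ r y) l - h (baseL d m z) l - r * ℓ (baseD ℓ r y) l) -
      1 / 2 * hessL h y.2 y.2 l := by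
    simp [pert, discQ, hessL, ← hr, ← hℓ]
  have hb' : (r : ℝ) ^ 2 * (y.1 l).im = h (baseL d m z + r • baseD ℓ r y) l -
      h (baseL d m z) l - r * ℓ (baseD ℓ r y) l := by
    rw [hb]
    change r ^ 2 * (1 / 2 * hessL h y.2 y.2 l + (pert hh (tanL d m) (discQ h ρ z)) y l) = _
    rw [hE]; field_simp; ring
  have e1 : ((curvedDisc hh ρ U z τ σ).1 l).im =
      h (baseL d m z) l + r * ((crInv ℓ (scaleL d m r y)).1 l).im := by
    simp [curvedDisc, graphMap, discL, ← hr, ← hℓ, ← hy]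
  have e2 : baseD ℓ r y = baseL d m (crInv ℓ (scaleL d m r y)) := rfl
  have e3 : (((scaleL d m r y).1 l).im : ℝ) = r * (y.1 l).im := by simp
  rw [e1, him, e3, ← e2]
  linear_combination hb'

lemma norm_graphMap_baseL_sub_le (z : Ambient d m) :
    ‖graphMap h (baseL d m z) - z‖ ≤ ‖height h z‖ := by
  have e : graphMap h (baseL d m z) - z = -(fun l => I * (height h z l : ℂ), 0) := by
    rw [sub_eq_iff_eq_add, neg_add_eq_sub, eq_sub_iff_add_eq]
    exact (eq_graphMap_add_height z).symm
  rw [e, norm_neg]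
  refine max_le ((pi_norm_le_iff_of_nonneg (norm_nonneg _)).2 fun l => ?_) (by simp)
  rw [norm_mul, norm_I, one_mul, norm_real]
  exact norm_le_pi_norm _ l

lemma DiscAdmissible.near (hz : DiscAdmissible hh ρ g₀ δ R κ z)
    (HU : AttachedDiscs (hessL h) g₀ U δ C R κ) (hτ : τ ∈ ball 0 δ) {σ : ℂ} (hσ : ‖σ‖ = 1) :
    ‖curvedDisc hh ρ U z τ σ - z‖ ≤ ‖height h z‖ + 2 * R * discR h ρ z := by
  have h1 := HU.bound (hz.param τ hτ) σ hσ
  rw [curvedDisc, add_sub_right_comm]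
  refine (norm_add_le _ _).trans (add_le_add (norm_graphMap_baseL_sub_le z) ?_)
  rw [norm_smul, norm_real, norm_of_nonneg hz.discR_pos.le, mul_comm]
  refine mul_le_mul_of_nonneg_right ?_ hz.discR_pos.le
  exact (norm_discL_apply_le hz.inv_near hz.discR_pos.le hz.discR_le_one _).trans
    (mul_le_mul_of_nonneg_left h1 zero_le_two)

lemma DiscAdmissible.lower (hz : DiscAdmissible hh ρ g₀ δ R κ z)
    (HU : AttachedDiscs (hessL h) g₀ U δ C R κ) : ∃ C' ≥ 0, ∀ τ ∈ ball 0 δ, ∀ τ' ∈ ball 0 δ,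
      ∀ σ : ℂ, ‖σ‖ = 1 → ‖τ - τ'‖ ≤
        C' * dist (curvedDisc hh ρ U z τ σ) (curvedDisc hh ρ U z τ' σ) := by
  set r := discR h ρ z with hr
  have hr0 : 0 < r := hz.discR_pos
  set ℓ := fderiv ℝ h (baseL d m z) with hℓ
  set T := (scaleL d m r⁻¹).comp (1 - crN ℓ) with hT
  have hC := HU.const_nonneg
  refine ⟨C * (‖T‖ * r⁻¹), by positivity, fun τ hτ τ' hτ' σ hσ => ?_⟩
  refine (HU.lower (hz.param τ hτ) (hz.param τ' hτ') σ hσ).trans ?_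
  rw [mul_assoc]
  refine mul_le_mul_of_nonneg_left ?_ hC
  change ‖scaledDisc hh ρ U z τ σ - scaledDisc hh ρ U z τ' σ‖ ≤ _
  set y := scaledDisc hh ρ U z τ σ - scaledDisc hh ρ U z τ' σ with hy
  have e : curvedDisc hh ρ U z τ σ - curvedDisc hh ρ U z τ' σ = (r : ℂ) • discL ℓ r y := by
    rw [curvedDisc, curvedDisc, hy, map_sub, smul_sub]; abel
  have e2 : ‖discL ℓ r y‖ = r⁻¹ * dist (curvedDisc hh ρ U z τ σ) (curvedDisc hh ρ U z τ' σ) := by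
    rw [dist_eq_norm, e, norm_smul, norm_real, norm_of_nonneg hr0.le,
      inv_mul_cancel_left₀ hr0.ne']
  rw [mul_assoc, ← e2]
  conv_lhs => rw [← eq_of_discL (ℓ := ℓ) hz.deriv_lt hr0.ne' y]
  exact T.le_opNorm _

lemma DiscAdmissible.lip (hz : DiscAdmissible hh ρ g₀ δ R κ z)
    (HU : AttachedDiscs (hessL h) g₀ U δ C R κ) (hτ : τ ∈ ball 0 δ) {σ σ' : ℂ} (hσ : ‖σ‖ = 1)
    (hσ' : ‖σ'‖ = 1) : dist (curvedDisc hh ρ U z τ σ) (curvedDisc hh ρ U z τ σ') ≤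
      2 * C * dist σ σ' := by
  have h1 := HU.lip (hz.param τ hτ) (hz.param τ hτ) 0 le_rfl (by simp) σ σ' hσ hσ'
  simp only [sub_self, norm_zero, zero_add, add_zero] at h1
  have e : curvedDisc hh ρ U z τ σ - curvedDisc hh ρ U z τ σ' = (discR h ρ z : ℂ) •
      discL (fderiv ℝ h (baseL d m z)) (discR h ρ z)
        (scaledDisc hh ρ U z τ σ - scaledDisc hh ρ U z τ σ') := by
    rw [curvedDisc, curvedDisc, map_sub, smul_sub]; abel
  rw [dist_eq_norm, dist_eq_norm, e, norm_smul, norm_real,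
    norm_of_nonneg hz.discR_pos.le]
  refine (mul_le_of_le_one_left (norm_nonneg _) hz.discR_le_one).trans ?_
  refine (norm_discL_apply_le hz.inv_near hz.discR_pos.le hz.discR_le_one _).trans ?_
  rw [mul_assoc]
  exact mul_le_mul_of_nonneg_left h1 zero_le_two
end

lemma AttachedDiscs.recenter {β : VectorForm d m}
    {g₀ g₁ : Fin d → ℝ} {U : DiscSolver d m} {δ C R κ : ℝ}
    (H : AttachedDiscs β g₀ U δ C R κ) (hg : ‖g₁ - g₀‖ ≤ δ / 2) :
    AttachedDiscs β g₁ U (δ / 2) C R κ := by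
  have key : ∀ {E c g τ}, DiscParam g₁ (δ / 2) R κ E c g τ →
      DiscParam (m := m) g₀ δ R κ E c g τ := fun {E c g τ} hP =>
    ⟨hP.small, hP.shift,
      (norm_sub_le_norm_sub_add_norm_sub g g₁ g₀).trans (by linarith [hP.near]), hP.param.trans (by linarith [H.radius_pos])⟩
  exact ⟨half_pos H.radius_pos, H.const_nonneg, H.bound_nonneg, H.small_pos,
    fun h => H.disc (key h), fun h => H.center (key h), fun h => H.boundary (key h),
    fun h => H.bound (key h), fun h h' => H.lower (key h) (key h'),
    fun h h' => H.lip (key h) (key h')⟩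

section
variable {h : Base d m → Fin d → ℝ} {hh : ContDiff ℝ 2 h}
  {ρ : (Fin d → ℝ) →L[ℝ] ℝ}
  {U : DiscSolver d m}
  {g₀ : Fin d → ℝ} {δ C R κ : ℝ} {z : Ambient d m}

lemma continuous_height (hc : Continuous h) : Continuous (height h) := by
  unfold height; fun_prop

lemma continuous_discR (hc : Continuous h) : Continuous (discR h ρ) := by
  have := continuous_height hc
  unfold discR; fun_prop

lemma continuous_fderiv_baseL (hh : ContDiff ℝ 2 h) :
    Continuous fun z => fderiv ℝ h (baseL d m z) :=
  (hh.continuous_fderiv (by norm_num)).comp (baseL d m).continuous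

lemma continuousAt_discG (hc : Continuous h) (hz : ρ (height h z) ≠ 0) :
    ContinuousAt (discG h ρ) z := by
  have := continuous_height hc
  have h1 : ContinuousAt (fun z => (ρ (height h z))⁻¹) z := ContinuousAt.inv₀ (by fun_prop) hz
  exact h1.smul this.continuousAt

lemma continuousAt_discC (hh : ContDiff ℝ 2 h) (hz : ρ (height h z) ≠ 0) :
    ContinuousAt (discC h ρ) z :=
  (continuous_fderiv_baseL hh).continuousAt.clm_apply
    ((continuousAt_discG hh.continuous hz).prodMk continuousAt_const)

lemma continuousAt_discQ (hh : ContDiff ℝ 2 h) (hz : 2 * ‖fderiv ℝ h (baseL d m z)‖ < 1) :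
    ContinuousAt (discQ h ρ) z := by
  have hR := continuous_discR (ρ := ρ) hh.continuous
  refine (baseL d m).continuous.continuousAt.prodMk (hR.continuousAt.prodMk ?_)
  exact ContinuousAt.comp (f := fun z => (fderiv ℝ h (baseL d m z), discR h ρ z))
    (continuousAt_baseD hz (discR h ρ z))
    ((continuous_fderiv_baseL hh).prodMk hR).continuousAt

lemma continuousOn_scaledDisc (HU : AttachedDiscs (hessL h) g₀ U δ C R κ) :
    ContinuousOn (fun p : (Ambient d m × Base d m) × ℂ =>
      scaledDisc hh ρ U p.1.1 p.1.2 p.2)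
      (({z | DiscAdmissible hh ρ g₀ δ R κ z} ×ˢ ball 0 δ) ×ˢ sphere 0 1) := by
  rintro ⟨⟨z₀, τ₀⟩, σ₀⟩ ⟨⟨hz₀, hτ₀⟩, hσ₀⟩
  dsimp only at hz₀ hτ₀ hσ₀
  refine Metric.tendsto_nhds.2 fun e he => ?_
  have hC := HU.const_nonneg
  set ε := e / (2 * (C + 1)) with hε
  have hε0 : 0 < ε := by positivity
  have hCε : C * ε ≤ e / 2 := by
    rw [hε]
    calc C * (e / (2 * (C + 1))) ≤ (C + 1) * (e / (2 * (C + 1))) := by gcongr; linarith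
      _ = e / 2 := by field_simp
  have hE : ∀ᶠ p : (Ambient d m × Base d m) × ℂ
      in nhds ((z₀, τ₀), σ₀), ∀ a ∈ closedBall (0 : Ambient d m) R,
        ∀ b ∈ closedBall (0 : Ambient d m) R,
        ‖(pert hh (tanL d m) (discQ h ρ p.1.1) a - pert hh (tanL d m) (discQ h ρ z₀) a) -
          (pert hh (tanL d m) (discQ h ρ p.1.1) b - pert hh (tanL d m) (discQ h ρ z₀) b)‖ ≤
          ε * ‖a - b‖ := by
    have h1 := eventually_pert_sub_le hh (tanL d m) R (q₀ := discQ h ρ z₀)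
      hz₀.discR_pos.ne' hε0
    have h2 : ContinuousAt (fun p : (Ambient d m × Base d m) × ℂ => discQ h ρ p.1.1) ((z₀, τ₀), σ₀) :=
      ContinuousAt.comp (g := discQ h ρ) (continuousAt_discQ hh hz₀.deriv_lt)
        (continuous_fst.comp continuous_fst).continuousAt
    exact h2.eventually h1
  have hψ : ∀ᶠ p : (Ambient d m × Base d m) × ℂ
      in nhds ((z₀, τ₀), σ₀), C * (‖discG h ρ p.1.1 - discG h ρ z₀‖ + ‖p.1.2 - τ₀‖ +
        ‖p.2 - σ₀‖ + ‖discC h ρ p.1.1 - discC h ρ z₀‖) < e / 2 := by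
    have hg : ContinuousAt (fun p : (Ambient d m × Base d m) × ℂ => discG h ρ p.1.1) ((z₀, τ₀), σ₀) :=
      ContinuousAt.comp (g := discG h ρ) (continuousAt_discG hh.continuous hz₀.pos.ne')
        (continuous_fst.comp continuous_fst).continuousAt
    have hc : ContinuousAt (fun p : (Ambient d m × Base d m) × ℂ => discC h ρ p.1.1) ((z₀, τ₀), σ₀) :=
      ContinuousAt.comp (g := discC h ρ) (continuousAt_discC hh hz₀.pos.ne')
        (continuous_fst.comp continuous_fst).continuousAt
    have : ContinuousAt (fun p : (Ambient d m × Base d m) × ℂ => C * (‖discG h ρ p.1.1 - discG h ρ z₀‖ +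
        ‖p.1.2 - τ₀‖ + ‖p.2 - σ₀‖ + ‖discC h ρ p.1.1 - discC h ρ z₀‖)) ((z₀, τ₀), σ₀) := by
      fun_prop
    exact this.eventually_lt_const (by simpa using half_pos he)
  filter_upwards [nhdsWithin_le_nhds hE, nhdsWithin_le_nhds hψ, self_mem_nhdsWithin]
    with p hEp hψp hp
  obtain ⟨⟨hz, hτ⟩, hσ⟩ := hp
  rw [dist_eq_norm]
  refine (HU.lip (hz.param _ hτ) (hz₀.param _ hτ₀) ε hε0.le hEp p.2 σ₀
    (mem_sphere_zero_iff_norm.1 hσ) (mem_sphere_zero_iff_norm.1 hσ₀)).trans_lt ?_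
  rw [mul_add]
  linarith

lemma continuousOn_curvedDisc (HU : AttachedDiscs (hessL h) g₀ U δ C R κ) :
    ContinuousOn (fun p : (Ambient d m × Base d m) × ℂ =>
      curvedDisc hh ρ U p.1.1 p.1.2 p.2)
      (({z | DiscAdmissible hh ρ g₀ δ R κ z} ×ˢ ball 0 δ) ×ˢ sphere 0 1) := by
  have hR := continuous_discR (ρ := ρ) hh.continuous
  have hG : Continuous (graphMap h) := by
    have := hh.continuous
    unfold graphMap; fun_prop
  have hL : ContinuousOn (fun p : (Ambient d m × Base d m) × ℂ =>
      discL (fderiv ℝ h (baseL d m p.1.1)) (discR h ρ p.1.1))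
      (({z | DiscAdmissible hh ρ g₀ δ R κ z} ×ˢ ball 0 δ) ×ˢ sphere 0 1) := by
    intro p hp
    refine ContinuousAt.continuousWithinAt ?_
    exact ContinuousAt.comp (f := fun p : (Ambient d m × Base d m) × ℂ => (fderiv ℝ h (baseL d m p.1.1), discR h ρ p.1.1))
      (continuousAt_discL hp.1.1.deriv_lt _)
      (((continuous_fderiv_baseL hh).prodMk hR).comp
        (continuous_fst.comp continuous_fst)).continuousAt
  have h1 : Continuous (fun p : (Ambient d m × Base d m) × ℂ => graphMap h (baseL d m p.1.1)) := by fun_prop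
  have h2 : Continuous (fun p : (Ambient d m × Base d m) × ℂ => (discR h ρ p.1.1 : ℂ)) := by fun_prop
  exact h1.continuousOn.add (h2.continuousOn.smul (hL.clm_apply (continuousOn_scaledDisc HU)))
end

/-- The points over the ball of radius `s` with height in the cone `C₀` and smaller than `t`. -/
def wedgeRegion (h : Base d m → Fin d → ℝ) (C₀ : Set (Fin d → ℝ)) (s t : ℝ) :
    Set (Ambient d m) :=
  {z | ‖baseL d m z‖ < s ∧ height h z ∈ C₀ ∧ ‖height h z‖ < t}

/-- A family of analytic discs `A z τ` with centre `z` and boundary in the graph of `h`, for `z`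
in a wedge. -/
structure CurvedDiscs (h : Base d m → Fin d → ℝ) (C₀ : Set (Fin d → ℝ))
    (g₁ : Fin d → ℝ) (A : Ambient d m → Base d m → ℂ → Ambient d m) (δ s C : ℝ) : Prop where
  cone_open : IsOpen C₀
  cone_convex : Convex ℝ C₀
  cone_smul : ∀ r : ℝ, 0 < r → ∀ c ∈ C₀, r • c ∈ C₀
  cone_mem : g₁ ∈ C₀
  zero_notMem : (0 : Fin d → ℝ) ∉ C₀
  param_pos : 0 < δ
  size_pos : 0 < s
  const_nonneg : 0 ≤ C
  disc : ∀ z ∈ wedgeRegion h C₀ s s, ∀ τ ∈ ball 0 δ, DiffContOnCl ℂ (A z τ) (ball 0 1)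
  center : ∀ z ∈ wedgeRegion h C₀ s s, ∀ τ ∈ ball 0 δ, A z τ 0 = z
  boundary : ∀ z ∈ wedgeRegion h C₀ s s, ∀ τ ∈ ball 0 δ, ∀ σ ∈ sphere (0 : ℂ) 1,
    A z τ σ = graphMap h (baseL d m (A z τ σ))
  near : ∀ z ∈ wedgeRegion h C₀ s s, ∀ τ ∈ ball 0 δ, ∀ σ ∈ sphere (0 : ℂ) 1,
    ‖A z τ σ - z‖ ≤ ‖height h z‖ + C * √‖height h z‖
  lower : ∀ z ∈ wedgeRegion h C₀ s s, ∃ C' ≥ 0, ∀ τ ∈ ball 0 δ, ∀ τ' ∈ ball 0 δ,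
    ∀ σ ∈ sphere (0 : ℂ) 1, ‖τ - τ'‖ ≤ C' * dist (A z τ σ) (A z τ' σ)
  lip : ∀ z ∈ wedgeRegion h C₀ s s, ∀ τ ∈ ball 0 δ, ∀ σ ∈ sphere (0 : ℂ) 1,
    ∀ σ' ∈ sphere (0 : ℂ) 1, dist (A z τ σ) (A z τ σ') ≤ C * dist σ σ'
  cont : ContinuousOn (fun p : (Ambient d m × Base d m) × ℂ => A p.1.1 p.1.2 p.2)
      ((wedgeRegion h C₀ s s ×ˢ ball 0 δ) ×ˢ sphere 0 1)

lemma exists_discAdmissible {h : Base d m → Fin d → ℝ} (hh : ContDiff ℝ 2 h)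
    (hD0 : fderiv ℝ h 0 = 0) (ρ : (Fin d → ℝ) →L[ℝ] ℝ) (g₁ : Fin d → ℝ) {δ R κ : ℝ}
    (hδ : 0 < δ) (hR : 0 ≤ R) (hκ : 0 < κ) : ∃ s > 0, ∀ z ∈ wedgeRegion h
      {η | ‖η - ρ η • g₁‖ < δ * ρ η} s s, DiscAdmissible (m := m) hh ρ g₁ δ R κ z := by
  obtain ⟨θ, hθ, hsmall⟩ := exists_smallC11_pert hh norm_tanL_le hR hκ
  have hcD := hh.continuous_fderiv (n := 2) (by norm_num)
  have h1 : ∀ᶠ p in nhds (0 : Base d m), 2 * ‖fderiv ℝ h p‖ < 1 :=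
    Tendsto.eventually_lt_const (f := fun p => 2 * ‖fderiv ℝ h p‖)
      (v := 2 * ‖fderiv ℝ h 0‖) (by simp [hD0]) (Continuous.tendsto (by fun_prop) 0)
  have h2 : ∀ᶠ p in nhds (0 : Base d m),
      ‖fderiv ℝ h p‖ * (‖g₁‖ + δ) < 1 :=
    Tendsto.eventually_lt_const (f := fun p => ‖fderiv ℝ h p‖ * (‖g₁‖ + δ))
      (v := ‖fderiv ℝ h 0‖ * (‖g₁‖ + δ)) (by simp [hD0]) (Continuous.tendsto (by fun_prop) 0)
  have h3 : ∀ᶠ p in nhds (0 : Base d m),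
      ‖crInv (fderiv ℝ h p) - 1‖ < min 1 (θ / 2) := by
    refine Tendsto.eventually_lt_const (f := fun p => ‖crInv (fderiv ℝ h p) - 1‖)
      (v := ‖crInv (fderiv ℝ h 0) - 1‖)
      (by simp [hD0, crInv_zero, hθ]) ?_
    refine (ContinuousAt.sub ?_ continuousAt_const).norm
    exact ContinuousAt.comp (f := fderiv ℝ h) (continuousAt_crInv (by simp [hD0]))
      hcD.continuousAt
  obtain ⟨s₁, hs₁, hball⟩ := Metric.eventually_nhds_iff.1 (h1.and (h2.and h3))
  set μ := min 1 (θ / 2) with hμ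
  have hμ0 : 0 < μ := by positivity
  refine ⟨min (min s₁ θ) (μ ^ 2 / (‖ρ‖ + 1)), by positivity, fun z hz => ?_⟩
  obtain ⟨hzb, hzc, hzh⟩ := hz
  obtain ⟨d1, d2, d3⟩ := hball (y := baseL d m z) (by
    rw [dist_zero_right]; exact hzb.trans_le ((min_le_left _ _).trans (min_le_left _ _)))
  have hpos : 0 < ρ (height h z) := by
    have : 0 < δ * ρ (height h z) := (norm_nonneg _).trans_lt hzc
    exact pos_of_mul_pos_right this hδ.le
  have hρle : ρ (height h z) ≤ μ ^ 2 := by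
    calc _ ≤ ‖ρ‖ * ‖height h z‖ := (Real.le_norm_self _).trans (ρ.le_opNorm _)
      _ ≤ (‖ρ‖ + 1) * (μ ^ 2 / (‖ρ‖ + 1)) := by
          gcongr
          · linarith
          · exact hzh.le.trans (min_le_right _ _)
      _ = μ ^ 2 := by field_simp
  have hrμ : discR h ρ z ≤ μ := Real.sqrt_le_iff.2 ⟨hμ0.le, hρle⟩
  have hr0 : 0 < discR h ρ z := Real.sqrt_pos.2 hpos
  have hμ1 : μ ≤ 1 := min_le_left _ _
  have hμθ : μ ≤ θ / 2 := min_le_right _ _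
  have hG : ‖discG h ρ z - g₁‖ ≤ δ := by
    have : discG h ρ z - g₁ = (ρ (height h z))⁻¹ • (height h z - ρ (height h z) • g₁) := by
      rw [smul_sub, smul_smul, inv_mul_cancel₀ hpos.ne', one_smul]; rfl
    rw [this, norm_smul, norm_inv, norm_of_nonneg hpos.le, inv_mul_le_iff₀ hpos, mul_comm]
    exact hzc.le
  refine ⟨d1, hpos, hρle.trans (by nlinarith), (d3.trans_le hμ1).le, fun τ hτ => ⟨?_, ?_, hG,
    (mem_ball_zero_iff.1 hτ).le⟩⟩
  · refine hsmall _ _ _ (hzb.le.trans ((min_le_left _ _).trans (min_le_right _ _))) hr0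
      (hrμ.trans (by linarith)) ?_
    exact (norm_baseD_sub_le _ hr0.le (hrμ.trans hμ1)).trans (by linarith)
  · refine ((fderiv ℝ h (baseL d m z)).le_opNorm _).trans (le_trans ?_ d2.le)
    gcongr
    refine max_le ?_ (by simpa using by positivity)
    have : discG h ρ z = g₁ + (discG h ρ z - g₁) := by abel
    dsimp only
    rw [this]
    exact (norm_add_le _ _).trans (by gcongr)

lemma exists_curvedDiscs (hd : 0 < d) {h : Base d m → Fin d → ℝ}
    (hh : ContDiff ℝ 2 h) (hD0 : fderiv ℝ h 0 = 0)
    (hLevi : (interior (convexHull ℝ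
      {v : Fin d → ℝ | ∃ a : Fin m → ℂ, v = fun l =>
        (1 / 4) * (fderiv ℝ (fderiv ℝ h) 0 (0, a) (0, a) l
          + fderiv ℝ (fderiv ℝ h) 0 (0, fun i => I * a i)
            (0, fun i => I * a i) l)})).Nonempty) :
    ∃ C₀ g₁ A δ s C, CurvedDiscs (m := m) h C₀ g₁ A δ s C := by
  have hsym : ∀ a b, hessL h a b = hessL h b a := fun a b =>
    (hh.contDiffAt.isSymmSndFDerivAt (by simp)) _ _
  obtain ⟨D, O, g₀, HM⟩ := exists_modelFamily hsym hLevi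
  obtain ⟨U, δ₀, C, R, κ, HU₀⟩ := HM.exists_attachedDiscs
  obtain ⟨g₁, hg₁, hg₁0⟩ : ∃ g₁ : Fin d → ℝ, ‖g₁ - g₀‖ ≤ δ₀ / 2 ∧ g₁ ≠ 0 := by
    have hδ₀ := HU₀.radius_pos
    have : Nonempty (Fin d) := ⟨⟨0, hd⟩⟩
    by_cases hg : g₀ = 0
    · refine ⟨fun _ => δ₀ / 2, ?_, fun h => ?_⟩
      · rw [hg, sub_zero, pi_norm_const, norm_of_nonneg (by positivity)]
      · have := congrFun h ⟨0, hd⟩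
        simp only [Pi.zero_apply] at this
        linarith
    · exact ⟨g₀, by simpa using by positivity, hg⟩
  have HU := HU₀.recenter hg₁
  set δ := δ₀ / 2
  obtain ⟨ρ, hρ⟩ := SeparatingDual.exists_eq_one (R := ℝ) hg₁0
  have hδ := HU.radius_pos
  have hC := HU.const_nonneg
  have hR := HU.bound_nonneg
  obtain ⟨s, hs, hadm⟩ := exists_discAdmissible hh hD0 ρ g₁ hδ hR HU.small_pos
  refine ⟨{η | ‖η - ρ η • g₁‖ < δ * ρ η}, g₁, curvedDisc hh ρ U, δ, s,
    max (2 * C) (2 * R * √‖ρ‖), ?_⟩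
  refine ⟨isOpen_lt (by fun_prop) (by fun_prop), ?_, ?_, by simpa [hρ] using hδ, by simp, hδ,
    hs, by positivity, ?_, ?_, ?_, ?_, ?_, ?_, ?_⟩
  · intro a ha b hb x y hx hy hxy
    simp only [mem_ofPred_eq] at ha hb ⊢
    have e : x • a + y • b - ρ (x • a + y • b) • g₁ =
        x • (a - ρ a • g₁) + y • (b - ρ b • g₁) := by
      simp only [map_add, map_smul, smul_eq_mul]; module
    have e2 : δ * ρ (x • a + y • b) = x * (δ * ρ a) + y * (δ * ρ b) := by
      simp only [map_add, map_smul, smul_eq_mul]; ring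
    rw [e, e2]
    refine (norm_add_le _ _).trans_lt ?_
    rw [norm_smul, norm_smul, norm_of_nonneg hx, norm_of_nonneg hy]
    rcases hx.eq_or_lt with rfl | hx
    · rw [zero_add] at hxy; subst hxy; simpa using hb
    · nlinarith [mul_lt_mul_of_pos_left ha hx, mul_le_mul_of_nonneg_left hb.le hy]
  · intro r hr c hc
    simp only [mem_ofPred_eq, map_smul, smul_eq_mul] at hc ⊢
    have e : r • c - (r * ρ c) • g₁ = r • (c - ρ c • g₁) := by module
    rw [e, norm_smul, norm_of_nonneg hr.le]
    nlinarith [mul_lt_mul_of_pos_left hc hr]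
  · exact fun z hz τ hτ => (hadm z hz).disc HU hτ
  · exact fun z hz τ hτ => (hadm z hz).center HU hτ
  · exact fun z hz τ hτ σ hσ => (hadm z hz).boundary HU hτ (mem_sphere_zero_iff_norm.1 hσ)
  · intro z hz τ hτ σ hσ
    refine ((hadm z hz).near HU hτ (mem_sphere_zero_iff_norm.1 hσ)).trans ?_
    refine add_le_add le_rfl ?_
    calc 2 * R * discR h ρ z ≤ 2 * R * (√‖ρ‖ * √‖height h z‖) := by
          gcongr
          rw [← Real.sqrt_mul (norm_nonneg _)]
          exact Real.sqrt_le_sqrt ((Real.le_norm_self _).trans (ρ.le_opNorm _))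
      _ = 2 * R * √‖ρ‖ * √‖height h z‖ := by ring
      _ ≤ _ := by gcongr; exact le_max_right _ _
  · intro z hz
    obtain ⟨C', hC', H⟩ := (hadm z hz).lower HU
    exact ⟨C', hC', fun τ hτ τ' hτ' σ hσ => H τ hτ τ' hτ' σ (mem_sphere_zero_iff_norm.1 hσ)⟩
  · intro z hz τ hτ σ hσ σ' hσ'
    refine ((hadm z hz).lip HU hτ (mem_sphere_zero_iff_norm.1 hσ)
      (mem_sphere_zero_iff_norm.1 hσ')).trans ?_
    gcongr
    exact le_max_left _ _
  · exact (continuousOn_curvedDisc HU).mono (prod_mono (prod_mono hadm subset_rfl) subset_rfl)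

section
variable {h : Base d m → Fin d → ℝ} {C₀ : Set (Fin d → ℝ)}
  {s s' t t' : ℝ}

lemma wedgeRegion_mono (hs : s' ≤ s) (ht : t' ≤ t) :
    wedgeRegion (m := m) h C₀ s' t' ⊆ wedgeRegion h C₀ s t :=
  fun _ hz => ⟨hz.1.trans_le hs, hz.2.1, hz.2.2.trans_le ht⟩

lemma isOpen_wedgeRegion (hc : Continuous h) (hC : IsOpen C₀) :
    IsOpen (wedgeRegion (m := m) h C₀ s t) := by
  have h1 := continuous_height hc
  exact (isOpen_lt (baseL d m).continuous.norm continuous_const).inter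
    ((hC.preimage h1).inter (isOpen_lt h1.norm continuous_const))

@[simp] lemma baseL_graphMap (p : Base d m) : baseL d m (graphMap h p) = p := by
  refine Prod.ext (funext fun l => ?_) rfl
  simp [graphMap]

lemma baseL_graphMap_add (p : Base d m) (η : Fin d → ℝ) :
    baseL d m (graphMap h p + (fun l => I * (η l : ℂ), 0)) = p := by
  refine Prod.ext (funext fun l => ?_) ?_ <;> simp [graphMap]

lemma height_graphMap_add (p : Base d m) (η : Fin d → ℝ) :
    height h (graphMap h p + (fun l => I * (η l : ℂ), 0)) = η := by
  unfold height
  rw [baseL_graphMap_add]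
  ext l
  simp [graphMap]

@[simp] lemma height_graphMap (p : Base d m) : height h (graphMap h p) = 0 :=
  (eq_graphMap_iff _).1 (by rw [baseL_graphMap])

lemma continuous_graphMap (hc : Continuous h) : Continuous (graphMap h) := by
  unfold graphMap; fun_prop

lemma wedgeRegion_eq (h : Base d m → Fin d → ℝ) (C₀ : Set (Fin d → ℝ)) (s t : ℝ) :
    wedgeRegion h C₀ s t = (fun q : (Base d m) × (Fin d → ℝ) =>
      graphMap h q.1 + (fun l => I * (q.2 l : ℂ), 0)) '' (ball 0 s ×ˢ (C₀ ∩ ball 0 t)) := by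
  ext z
  constructor
  · rintro ⟨h1, h2, h3⟩
    exact ⟨(baseL d m z, height h z), ⟨mem_ball_zero_iff.2 h1, h2, mem_ball_zero_iff.2 h3⟩,
      (eq_graphMap_add_height z).symm⟩
  · rintro ⟨q, ⟨h1, h2, h3⟩, rfl⟩
    refine ⟨?_, ?_, ?_⟩
    · rw [baseL_graphMap_add]; exact mem_ball_zero_iff.1 h1
    · rw [height_graphMap_add]; exact h2
    · rw [height_graphMap_add]; exact mem_ball_zero_iff.1 h3

lemma isPreconnected_wedgeRegion (hc : Continuous h) (hC : Convex ℝ C₀) :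
    IsPreconnected (wedgeRegion (m := m) h C₀ s t) := by
  have hG := continuous_graphMap hc
  rw [wedgeRegion_eq]
  refine IsPreconnected.image ((convex_ball _ _).prod (hC.inter (convex_ball _ _))).isPreconnected
    _ (Continuous.continuousOn ?_)
  fun_prop
end

/-- The function `φ` on the graph of `h`, together with the means of `φ` over the boundaries of
the discs `A z 0`. -/
def discExt (h : Base d m → Fin d → ℝ)
    (A : Ambient d m → Base d m → ℂ → Ambient d m)
    (φ : Base d m → ℂ) (z : Ambient d m) : ℂ :=
  open Classical in
  if height h z = 0 then φ (baseL d m z) else avg fun σ => φ (baseL d m (A z 0 σ))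

namespace CurvedDiscs
variable {h : Base d m → Fin d → ℝ} {C₀ : Set (Fin d → ℝ)}
  {g₁ : Fin d → ℝ} {A : Ambient d m → Base d m → ℂ → Ambient d m} {δ s C s' s₁ t : ℝ} {O : Set (Base d m)}
  {φ : Base d m → ℂ} {b : Base d m}

lemma mono (H : CurvedDiscs h C₀ g₁ A δ s C) (h0 : 0 < s') (hs : s' ≤ s) :
    CurvedDiscs h C₀ g₁ A δ s' C := by
  have hm := wedgeRegion_mono (m := m) (h := h) (C₀ := C₀) hs hs
  exact ⟨H.cone_open, H.cone_convex, H.cone_smul, H.cone_mem, H.zero_notMem, H.param_pos, h0,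
    H.const_nonneg, fun z hz => H.disc z (hm hz), fun z hz => H.center z (hm hz),
    fun z hz => H.boundary z (hm hz), fun z hz => H.near z (hm hz), fun z hz => H.lower z (hm hz),
    fun z hz => H.lip z (hm hz), H.cont.mono (prod_mono (prod_mono hm subset_rfl) subset_rfl)⟩

lemma height_ne_zero (H : CurvedDiscs h C₀ g₁ A δ s C) {z} (hz : z ∈ wedgeRegion h C₀ s s) :
    height h z ≠ 0 := fun h0 => H.zero_notMem (h0 ▸ hz.2.1)

lemma exists_approx (H : CurvedDiscs h C₀ g₁ A δ s C) (hh : ContDiff ℝ 2 h) (hO : IsOpen O)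
    (hsmall : ∀ p ∈ O, ‖fderiv ℝ h p‖ ≤ 1 / (2 * (d + m))) (hφ : IsCR h φ O)
    (hb : b ∈ O) :
    ∃ r > 0, (∃ P : ℕ → Ambient d m → ℂ, (∀ j, Differentiable ℂ (P j)) ∧
      TendstoUniformlyOn P (discExt h A φ) atTop
        ((wedgeRegion h C₀ s s ∪ {z | height h z = 0}) ∩ ball (graphMap h b) r)) ∧
      ∀ z ∈ ball (graphMap h b) r, baseL d m z ∈ O := by
  obtain ⟨r₀, hr₀, P, hP, hlim⟩ := cr_approx hO hh.contDiffOn hsmall hφ hb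
  obtain ⟨r₁, hr₁, hball⟩ := Metric.isOpen_iff.1 hO b hb
  set ρ := min r₀ r₁ with hρ
  have hρ0 : 0 < ρ := by positivity
  have hH := continuous_height (m := m) hh.continuous
  have hev : ∀ᶠ z in nhds (graphMap h b), ‖height h z‖ + C * √‖height h z‖ < ρ / 2 :=
    Tendsto.eventually_lt_const (f := fun z => ‖height h z‖ + C * √‖height h z‖)
      (v := ‖height h (graphMap h b)‖ + C * √‖height h (graphMap h b)‖) (by simpa using hρ0)
      (Continuous.tendsto (by fun_prop) _)
  obtain ⟨r₂, hr₂, hev⟩ := Metric.eventually_nhds_iff.1 hev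
  have hdist : ∀ z ∈ ball (graphMap h b) (min r₂ (ρ / 2)), dist (baseL d m z) b < ρ / 2 := by
    intro z hz
    calc dist (baseL d m z) b = ‖baseL d m (z - graphMap h b)‖ := by
          rw [map_sub, baseL_graphMap, dist_eq_norm]
      _ ≤ ‖z - graphMap h b‖ := norm_baseL_apply_le _
      _ < ρ / 2 := by
          rw [← dist_eq_norm]; exact (mem_ball.1 hz).trans_le (min_le_right _ _)
  refine ⟨min r₂ (ρ / 2), by positivity, ⟨P, hP, ?_⟩, fun z hz => hball ?_⟩
  swap
  · exact (hdist z hz).trans_le ((half_le_self hρ0.le).trans (min_le_right _ _))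
  rw [Metric.tendstoUniformlyOn_iff] at hlim ⊢
  intro ε hε
  filter_upwards [hlim (ε / 2) (half_pos hε)] with j hj z hz
  obtain ⟨hz1, hz2⟩ := hz
  have hbz := hdist z hz2
  rcases hz1 with hz1 | hz1
  · have h0 := mem_ball_self (x := (0 : Base d m)) H.param_pos
    have hA : ∀ σ ∈ sphere (0 : ℂ) 1, baseL d m (A z 0 σ) ∈ ball b ρ := by
      intro σ hσ
      refine (dist_triangle _ (baseL d m z) _).trans_lt ?_
      have h1 : dist (baseL d m (A z 0 σ)) (baseL d m z) < ρ / 2 := by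
        rw [dist_eq_norm, ← map_sub]
        exact ((norm_baseL_apply_le _).trans (H.near z hz1 0 h0 σ hσ)).trans_lt
          (hev ((mem_ball.1 hz2).trans_le (min_le_left _ _)))
      linarith
    have hAc := (H.disc z hz1 0 h0).continuousOn_sphere
    rw [discExt, if_neg (H.height_ne_zero hz1), dist_eq_norm]
    have hPz : P j z = avg fun σ => P j (A z 0 σ) := by
      rw [avg_diffContOnCl (f := fun σ => P j (A z 0 σ))
        ((hP j).comp_diffContOnCl (H.disc z hz1 0 h0)), H.center z hz1 0 h0]
    rw [hPz]
    refine (norm_avg_sub_le (C := ε / 2) ?_ ((hP j).continuous.comp_continuousOn hAc) ?_).trans_lt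
      (half_lt_self hε)
    · exact hφ.contDiffOn.continuousOn.comp ((baseL d m).continuous.comp_continuousOn hAc)
        fun σ hσ => hball (ball_subset_ball (min_le_right _ _) (hA σ hσ))
    · intro σ hσ
      rw [← dist_eq_norm]
      have := (hj _ (ball_subset_ball (min_le_left _ _) (hA σ hσ))).le
      rwa [← H.boundary z hz1 0 h0 σ hσ] at this
  · have h1 := hj (baseL d m z) (hbz.trans_le ((half_le_self hρ0.le).trans (min_le_left _ _)))
    rw [← (eq_graphMap_iff z).2 hz1] at h1
    rw [discExt, if_pos (show height h z = 0 from hz1)]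
    exact h1.trans (half_lt_self hε)

lemma norm_baseL_lt (H : CurvedDiscs h C₀ g₁ A δ s C) (hs₁ : s₁ ≤ s) (ht : t ≤ s)
    (hst : s₁ + (t + C * √t) ≤ s) {z} (hz : z ∈ wedgeRegion h C₀ s₁ t) {τ} (hτ : τ ∈ ball 0 δ)
    {σ : ℂ} (hσ : σ ∈ sphere (0 : ℂ) 1) : ‖baseL d m (A z τ σ)‖ < s := by
  have hC := H.const_nonneg
  have h1 := H.near z (wedgeRegion_mono hs₁ ht hz) τ hτ σ hσ
  have h2 : √‖height h z‖ ≤ √t := Real.sqrt_le_sqrt hz.2.2.le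
  have h3 : baseL d m (A z τ σ) = baseL d m z + baseL d m (A z τ σ - z) := by
    rw [map_sub, add_sub_cancel]
  rw [h3]
  refine (norm_add_le _ _).trans_lt ?_
  have h4 := norm_baseL_apply_le (A z τ σ - z)
  have h5 := hz.1
  have h6 := hz.2.2
  nlinarith [mul_le_mul_of_nonneg_left h2 hC]

lemma isOpen_param (H : CurvedDiscs h C₀ g₁ A δ s C) (hO : IsOpen O) {z}
    (hz : z ∈ wedgeRegion h C₀ s s) :
    IsOpen {τ | τ ∈ ball 0 δ ∧ ∀ σ ∈ sphere (0 : ℂ) 1, baseL d m (A z τ σ) ∈ O} := by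
  refine isOpen_iff_mem_nhds.2 fun τ₀ hτ₀ => ?_
  have key : ∀ᶠ τ in nhds τ₀, ∀ σ ∈ sphere (0 : ℂ) 1, σ ∈ sphere (0 : ℂ) 1 → τ ∈ ball 0 δ →
      baseL d m (A z τ σ) ∈ O := by
    refine (isCompact_sphere (0 : ℂ) 1).eventually_forall_of_forall_eventually fun σ hσ => ?_
    have h1 : ContinuousWithinAt (fun q : (Base d m) × ℂ =>
        baseL d m (A z q.1 q.2)) (ball 0 δ ×ˢ sphere 0 1) (τ₀, σ) := by
      refine (baseL d m).continuous.continuousAt.comp_continuousWithinAt ?_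
      exact ContinuousWithinAt.comp (f := fun q : (Base d m) × ℂ =>
        ((z, q.1), q.2)) (t := (wedgeRegion h C₀ s s ×ˢ ball 0 δ) ×ˢ sphere 0 1)
        (H.cont _ ⟨⟨hz, hτ₀.1⟩, hσ⟩) (Continuous.continuousWithinAt (by fun_prop))
        fun q hq => ⟨⟨hz, hq.1⟩, hq.2⟩
    filter_upwards [eventually_nhdsWithin_iff.1 (h1.eventually (hO.mem_nhds (hτ₀.2 σ hσ)))]
      with q hq h2 h3 using hq ⟨h3, h2⟩
  filter_upwards [key, isOpen_ball.mem_nhds hτ₀.1] with τ h1 h2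
  exact ⟨h2, fun σ hσ => h1 σ hσ hσ h2⟩

lemma exists_discFamily (H : CurvedDiscs h C₀ g₁ A δ s C) (hd : 0 < d) (hm : 0 < m)
    (hh : ContDiff ℝ 2 h) (hs₁ : s₁ ≤ s) (ht : t ≤ s) (hst : s₁ + (t + C * √t) ≤ s)
    (hO : IsOpen O)
    (hsmall : ∀ p ∈ O, ‖fderiv ℝ h p‖ ≤ 1 / (2 * (d + m))) (hφ : IsCR h φ O)
    (hK : μH[((d + 2 * m - 2 : ℕ) : ℝ)] (graphMap h '' (ball 0 s \ O)) = 0) :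
    ∃ W, DiscFamily A (wedgeRegion h C₀ s₁ t) (ball 0 δ) (graphMap h '' ball 0 s)
      (graphMap h '' O) W (fun l => I * (g₁ l : ℂ), 0) (discExt h A φ) := by
  have hloc := fun b (hb : b ∈ O) => H.exists_approx hh hO hsmall hφ hb
  choose! r hr hP hbase using hloc
  have hΩ : IsOpen (wedgeRegion (m := m) h C₀ s s) := isOpen_wedgeRegion hh.continuous H.cone_open
  have hsub := wedgeRegion_mono (m := m) (h := h) (C₀ := C₀) hs₁ ht
  have hmemO : ∀ {z} (S : Set (Base d m)), z ∈ wedgeRegion h C₀ s₁ t →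
      ∀ {τ}, τ ∈ ball 0 δ → ∀ {σ : ℂ}, σ ∈ sphere (0 : ℂ) 1 →
      (A z τ σ ∈ graphMap h '' S ↔ baseL d m (A z τ σ) ∈ S) := by
    intro z S hz τ hτ σ hσ
    refine ⟨?_, fun hS => ⟨_, hS, (H.boundary z (hsub hz) τ hτ σ hσ).symm⟩⟩
    rintro ⟨p, hp, he⟩
    rwa [← he, baseL_graphMap]
  have hcap : ∀ z ∈ wedgeRegion h C₀ s₁ t, {τ | (z, τ) ∈ goodSet A (wedgeRegion h C₀ s₁ t)
      (ball 0 δ) (graphMap h '' O)} = {τ | τ ∈ ball 0 δ ∧ ∀ σ ∈ sphere (0 : ℂ) 1,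
        A z τ σ ∉ graphMap h '' (ball 0 s \ O)} := by
    intro z hz
    ext τ
    refine ⟨fun hτ => ⟨hτ.2.1, fun σ hσ hn => ?_⟩, fun hτ => ⟨hz, hτ.1, fun σ hσ => ?_⟩⟩
    · exact ((hmemO _ hz hτ.2.1 hσ).1 hn).2 ((hmemO _ hz hτ.2.1 hσ).1 (hτ.2.2 σ hσ))
    · rw [hmemO _ hz hτ.1 hσ]
      by_contra hn
      exact hτ.2 σ hσ ((hmemO _ hz hτ.1 hσ).2
        ⟨mem_ball_zero_iff.2 (H.norm_baseL_lt hs₁ ht hst hz hτ.1 hσ), hn⟩)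
  have hgood : ∀ z ∈ wedgeRegion h C₀ s₁ t, {τ | (z, τ) ∈ goodSet A (wedgeRegion h C₀ s₁ t)
      (ball 0 δ) (graphMap h '' O)}.Nonempty ∧ IsPreconnected {τ | (z, τ) ∈ goodSet A
        (wedgeRegion h C₀ s₁ t) (ball 0 δ) (graphMap h '' O)} := by
    intro z hz
    obtain ⟨C', hC', hlow⟩ := H.lower z (hsub hz)
    have hopen : IsOpen {τ | τ ∈ ball 0 δ ∧ ∀ σ ∈ sphere (0 : ℂ) 1,
        A z τ σ ∉ graphMap h '' (ball 0 s \ O)} := by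
      rw [← hcap z hz]
      convert H.isOpen_param hO (hsub hz) using 1
      ext τ
      exact ⟨fun hτ => ⟨hτ.2.1, fun σ hσ => (hmemO _ hz hτ.2.1 hσ).1 (hτ.2.2 σ hσ)⟩,
        fun hτ => ⟨hz, hτ.1, fun σ hσ => (hmemO _ hz hτ.1 hσ).2 (hτ.2 σ hσ)⟩⟩
    rw [hcap z hz]
    refine avoid_preconnected isOpen_ball (convex_ball _ _) ⟨0, mem_ball_self H.param_pos⟩
      (C := max C C') (H.const_nonneg.trans (le_max_left _ _)) ?_ ?_ (s := d + 2 * m - 2) ?_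
      (by omega) hK hopen
    · exact fun τ hτ τ' hτ' σ hσ => (hlow τ hτ τ' hτ' σ hσ).trans
        (mul_le_mul_of_nonneg_right (le_max_right _ _) dist_nonneg)
    · exact fun τ hτ σ hσ σ' hσ' => (H.lip z (hsub hz) τ hτ σ hσ σ' hσ').trans
        (mul_le_mul_of_nonneg_right (le_max_left _ _) dist_nonneg)
    · rw [Module.finrank_prod, Module.finrank_fin_fun, Module.finrank_pi_fintype]
      simp only [Complex.finrank_real_complex, Finset.sum_const, Finset.card_univ,
        Fintype.card_fin, smul_eq_mul]
      omega
  have hWopen : ∀ b, IsOpen (wedgeRegion (m := m) h C₀ s s ∩ ball (graphMap h b) (r b)) :=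
    fun b => hΩ.inter isOpen_ball
  refine ⟨⋃ b ∈ O, wedgeRegion h C₀ s s ∩ ball (graphMap h b) (r b), ?_⟩
  refine ⟨isOpen_wedgeRegion hh.continuous H.cone_open,
    isPreconnected_wedgeRegion hh.continuous H.cone_convex, convex_ball _ _,
    isOpen_biUnion fun b _ => hWopen b, ?_, ?_, fun z hz => H.disc z (hsub hz),
    fun z hz => H.center z (hsub hz), H.cont.mono (prod_mono (prod_mono hsub subset_rfl) subset_rfl),
    ?_, ?_, fun z hz => (hgood z hz).1.imp fun τ hτ => ⟨hτ.2.1, hτ⟩, fun z hz => (hgood z hz).2, ?_⟩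
  · intro z hz
    obtain ⟨b, hb, hzb⟩ := mem_iUnion₂.1 hz
    obtain ⟨P, hPd, hPl⟩ := hP b hb
    refine ((differentiableOn_of_tendstoUniformlyOn (hWopen b) (fun j => (hPd j).differentiableOn)
      (hPl.mono (inter_subset_inter_left _ subset_union_left))).differentiableAt
        ((hWopen b).mem_nhds hzb)).differentiableWithinAt
  · have hsubset : (⋃ b ∈ O, wedgeRegion h C₀ s s ∩ ball (graphMap h b) (r b)) ∪ graphMap h '' O ⊆
        wedgeRegion h C₀ s s ∪ {z | height h z = 0} := by
      refine union_subset_union (iUnion₂_subset fun b _ => inter_subset_left) ?_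
      rintro _ ⟨p, _, rfl⟩
      exact height_graphMap p
    have hex : ∀ z ∈ (⋃ b ∈ O, wedgeRegion h C₀ s s ∩ ball (graphMap h b) (r b)) ∪ graphMap h '' O,
        ∃ b ∈ O, z ∈ ball (graphMap h b) (r b) := by
      rintro z (hz | ⟨b, hb, rfl⟩)
      · obtain ⟨b, hb, hzb⟩ := mem_iUnion₂.1 hz
        exact ⟨b, hb, hzb.2⟩
      · exact ⟨b, hb, mem_ball_self (hr b hb)⟩
    intro z hz
    obtain ⟨b, hb, hzb⟩ := hex z hz
    obtain ⟨P, hPd, hPl⟩ := hP b hb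
    have hc := (hPl.continuousOn (Frequently.of_forall fun j => (hPd j).continuous.continuousOn))
      z ⟨hsubset hz, hzb⟩
    exact ((continuousWithinAt_inter (isOpen_ball.mem_nhds hzb)).1 hc).mono hsubset
  · exact fun z hz τ hτ σ hσ => (hmemO _ hz hτ hσ).2
      (mem_ball_zero_iff.2 (H.norm_baseL_lt hs₁ ht hst hz hτ hσ))
  · rintro _ ⟨b, hb, rfl⟩
    set κ : Ambient d m := (fun l => I * (g₁ l : ℂ), 0) with hκ
    have hrb := hr b hb
    have hs := H.size_pos
    set N := ‖κ‖ + ‖g₁‖ + 1 with hN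
    have hN0 : 0 < N := by positivity
    refine ⟨min s (r b / 2) / N, by positivity, r b / 2, half_pos hrb, ?_⟩
    rintro _ ⟨⟨p, hp, rfl⟩, hpb⟩
    have hpO : p ∈ O := by
      have := hbase b hb _ (ball_subset_ball (half_le_self hrb.le) hpb)
      rwa [baseL_graphMap] at this
    refine ⟨⟨p, hpO, rfl⟩, fun ε hε hε₁ => mem_iUnion₂.2 ⟨b, hb, ?_, ?_⟩⟩
    all_goals rw [lt_div_iff₀ hN0, lt_min_iff] at hε₁
    · have he : graphMap h p + (ε : ℂ) • κ =
          graphMap h p + (fun l => I * ((ε • g₁) l : ℂ), 0) := by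
        congr 1
        refine Prod.ext (funext fun l => ?_) (by simp [hκ])
        simp [hκ]; ring
      rw [he, wedgeRegion_eq]
      refine ⟨(p, ε • g₁), ⟨hp, H.cone_smul ε hε _ H.cone_mem, ?_⟩, rfl⟩
      rw [mem_ball_zero_iff, norm_smul, norm_of_nonneg hε.le]
      nlinarith [norm_nonneg κ]
    · rw [mem_ball, dist_eq_norm] at hpb ⊢
      have h1 : ‖(ε : ℂ) • κ‖ < r b / 2 := by
        rw [norm_smul, norm_real, norm_of_nonneg hε.le]
        nlinarith [norm_nonneg g₁]
      rw [add_sub_right_comm]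
      exact (norm_add_le _ _).trans_lt (by linarith)
  · rintro _ ⟨b, hb, rfl⟩
    obtain ⟨P, hPd, hPl⟩ := hP b hb
    exact ⟨r b, hr b hb, P, hPd, hPl.mono (inter_subset_inter_left _
      (iUnion₂_subset fun b _ => inter_subset_left.trans subset_union_left))⟩

lemma exists_extension (H : CurvedDiscs h C₀ g₁ A δ s C) (hd : 0 < d) (hm : 0 < m)
    (hh : ContDiff ℝ 2 h) (hs₀ : 0 < s₁) (hs₁ : s₁ ≤ s) (ht₀ : 0 < t) (ht : t ≤ s)
    (hst : s₁ + (t + C * √t) ≤ s) (hO : IsOpen O) (hOs : O ⊆ ball 0 s)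
    (hsmall : ∀ p ∈ O, ‖fderiv ℝ h p‖ ≤ 1 / (2 * (d + m))) (hφ : IsCR h φ O)
    (hK : μH[((d + 2 * m - 2 : ℕ) : ℝ)] (graphMap h '' (ball 0 s \ O)) = 0) :
    ∃ F, DifferentiableOn ℂ F (wedgeRegion h C₀ s₁ t) ∧ ∀ p ∈ O, ‖p‖ < s₁ →
      Tendsto F (nhdsWithin (graphMap h p) (wedgeRegion h C₀ s₁ t)) (nhds (φ p)) := by
  obtain ⟨W, hW⟩ := H.exists_discFamily hd hm hh hs₁ ht hst hO hsmall hφ hK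
  have hH := continuous_height (m := m) hh.continuous
  have hω : IsOpen {z | ‖baseL d m z‖ < s₁} := isOpen_lt (baseL d m).continuous.norm continuous_const
  have hne : ∀ p ∈ graphMap h '' ball 0 s ∩ {z | ‖baseL d m z‖ < s₁},
      (nhdsWithin p (wedgeRegion h C₀ s₁ t)).NeBot := by
    rintro _ ⟨⟨p, -, rfl⟩, hp⟩
    rw [mem_ofPred_eq, baseL_graphMap] at hp
    have hlim : Tendsto (fun ε : ℝ => graphMap h p +
        (fun l => I * ((ε • g₁) l : ℂ), 0)) (nhdsWithin 0 (Ioi 0)) (nhds (graphMap h p)) := by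
      have hc : Continuous (fun ε : ℝ => graphMap h p +
        ((fun l => I * ((ε • g₁) l : ℂ), 0) : Ambient d m)) := by
        simp only [Pi.smul_apply, smul_eq_mul]
        fun_prop
      have h0 := hc.tendsto 0
      have e : graphMap h p + ((fun l => I * (((0 : ℝ) • g₁) l : ℂ), 0) :
          Ambient d m) = graphMap h p := by
        rw [add_eq_left]
        refine Prod.ext (funext fun l => by simp) rfl
      rw [e] at h0
      exact h0.mono_left nhdsWithin_le_nhds
    refine mem_closure_iff_nhdsWithin_neBot.1 (mem_closure_of_tendsto hlim ?_)
    have hsm : ∀ᶠ ε : ℝ in nhdsWithin 0 (Ioi 0), ‖ε • g₁‖ < t :=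
      (Tendsto.eventually_lt_const (f := fun ε : ℝ => ‖ε • g₁‖) (v := ‖(0 : ℝ) • g₁‖)
        (by simpa using ht₀) (Continuous.tendsto (by fun_prop) 0)).filter_mono nhdsWithin_le_nhds
    filter_upwards [self_mem_nhdsWithin, hsm] with ε hε hε'
    rw [wedgeRegion_eq]
    exact ⟨(p, ε • g₁), ⟨mem_ball_zero_iff.2 hp, H.cone_smul ε hε _ H.cone_mem,
      mem_ball_zero_iff.2 hε'⟩, rfl⟩
  have hshrink : ∀ p ∈ graphMap h '' ball 0 s ∩ {z | ‖baseL d m z‖ < s₁}, ∀ r > 0,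
      ∀ᶠ z in nhdsWithin p (wedgeRegion h C₀ s₁ t), ∀ τ ∈ ball 0 δ,
        ∀ σ ∈ sphere (0 : ℂ) 1, A z τ σ ∈ ball p r := by
    rintro _ ⟨⟨p, -, rfl⟩, -⟩ r hr
    have hev : ∀ᶠ z in nhds (graphMap h p), ‖height h z‖ + C * √‖height h z‖ < r / 2 :=
      Tendsto.eventually_lt_const (f := fun z => ‖height h z‖ + C * √‖height h z‖)
        (v := ‖height h (graphMap h p)‖ + C * √‖height h (graphMap h p)‖) (by simpa using hr)
        (Continuous.tendsto (by fun_prop) _)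
    filter_upwards [nhdsWithin_le_nhds hev, nhdsWithin_le_nhds (ball_mem_nhds _ (half_pos hr)),
      self_mem_nhdsWithin] with z h1 h2 hz τ hτ σ hσ
    refine (dist_triangle _ z _).trans_lt ?_
    have h3 := (H.near z (wedgeRegion_mono hs₁ ht hz) τ hτ σ hσ).trans_lt h1
    rw [← dist_eq_norm] at h3
    linarith [mem_ball.1 h2]
  obtain ⟨F, hF, hlim⟩ := hW.exists_extension (graphMap h 0) hω
    ⟨⟨0, mem_ball_self H.size_pos, rfl⟩, by simpa using hs₀⟩ hne hshrink
  refine ⟨F, hF, fun p hp hps => ?_⟩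
  have := hlim (graphMap h p) ⟨⟨p, hOs hp, rfl⟩, by simpa using hps⟩ ⟨p, hp, rfl⟩
  rwa [discExt, if_pos (height_graphMap p), baseL_graphMap] at this
end CurvedDiscs
end

theorem stmt0 (n d : ℕ) (hn : 2 ≤ n) (hd1 : 1 ≤ d) (hdn : d ≤ n - 1)
    (V : Set ((Fin d → ℝ) × (Fin (n - d) → ℂ))) (hVopen : IsOpen V)
    (hV0 : (0 : (Fin d → ℝ) × (Fin (n - d) → ℂ)) ∈ V)
    (h : (Fin d → ℝ) × (Fin (n - d) → ℂ) → Fin d → ℝ)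
    (hsmooth : ContDiffOn ℝ 4 h V) (hh0 : h 0 = 0) (hDh0 : fderiv ℝ h 0 = 0)
    (U : Set ((Fin d → ℂ) × (Fin (n - d) → ℂ))) (hUopen : IsOpen U)
    (hU0 : (0 : (Fin d → ℂ) × (Fin (n - d) → ℂ)) ∈ U)
    (hUV : ∀ zw ∈ U, (((fun l => (zw.1 l).re) : Fin d → ℝ), zw.2) ∈ V)
    (M : Set ((Fin d → ℂ) × (Fin (n - d) → ℂ)))
    (hMdef : M = {zw ∈ U | ∀ l, (zw.1 l).im = h (((fun l' => (zw.1 l').re) : Fin d → ℝ), zw.2) l})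
    -- the graph parametrization Γ(x, w) = (x + i h(x, w), w) of M
    (Γ : (Fin d → ℝ) × (Fin (n - d) → ℂ) → (Fin d → ℂ) × (Fin (n - d) → ℂ))
    (hΓ : ∀ xw, Γ xw = (((fun l => (xw.1 l : ℂ) + Complex.I * (h xw l : ℂ)) : Fin d → ℂ), xw.2))
    -- the convex hull of the image of the Levi form at 0 has nonempty interior in ℝ^d
    (hLevi : (interior (convexHull ℝ
      {v : Fin d → ℝ | ∃ a : Fin (n - d) → ℂ, v = fun l =>
        (1 / 4) * (fderiv ℝ (fderiv ℝ h) 0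
            ((0, a) : (Fin d → ℝ) × (Fin (n - d) → ℂ))
            ((0, a) : (Fin d → ℝ) × (Fin (n - d) → ℂ)) l
          + fderiv ℝ (fderiv ℝ h) 0
            ((0, fun i => Complex.I * a i) : (Fin d → ℝ) × (Fin (n - d) → ℂ))
            ((0, fun i => Complex.I * a i) : (Fin d → ℝ) × (Fin (n - d) → ℂ)) l)})).Nonempty) :
    -- there is a wedge 𝒲 = ω + C of edge M at 0
    ∃ (ω : Set ((Fin d → ℂ) × (Fin (n - d) → ℂ))) (C₀ : Set (Fin d → ℝ)) (ε : ℝ)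
      (𝒲 : Set ((Fin d → ℂ) × (Fin (n - d) → ℂ))),
      (0 : (Fin d → ℂ) × (Fin (n - d) → ℂ)) ∈ ω ∧ ω ⊆ M ∧
      (∃ ω' : Set ((Fin d → ℂ) × (Fin (n - d) → ℂ)), IsOpen ω' ∧ ω = M ∩ ω') ∧
      C₀.Nonempty ∧ IsOpen C₀ ∧ (∀ r : ℝ, 0 < r → ∀ c ∈ C₀, r • c ∈ C₀) ∧ 0 < ε ∧
      𝒲 = {zw | ∃ p ∈ ω, ∃ c ∈ C₀ ∩ ball (0 : Fin d → ℝ) ε,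
        zw = p + (((fun l => Complex.I * (c l : ℂ)) : Fin d → ℂ), 0)} ∧
      -- such that for every relatively closed K ⊆ M of null (2n-d-2)-Hausdorff measure
      ∀ K : Set ((Fin d → ℂ) × (Fin (n - d) → ℂ)), K ⊆ M →
        (∀ z ∈ M, z ∈ closure K → z ∈ K) →
        μH[((2 * n - d - 2 : ℕ) : ℝ)] K = 0 →
        -- and every C¹ CR function f on M ∖ K
        ∀ f : (Fin d → ℂ) × (Fin (n - d) → ℂ) → ℂ,
          ContDiffOn ℝ 1 (fun xw => f (Γ xw)) {xw | xw ∈ V ∧ Γ xw ∈ M \ K} →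
          (∀ xw ∈ {xw | xw ∈ V ∧ Γ xw ∈ M \ K},
            ∀ u u' : (Fin d → ℝ) × (Fin (n - d) → ℂ),
              fderiv ℝ Γ xw u' = Complex.I • fderiv ℝ Γ xw u →
              fderiv ℝ (fun xw' => f (Γ xw')) xw u'
                = Complex.I * fderiv ℝ (fun xw' => f (Γ xw')) xw u) →
          -- f extends holomorphically to 𝒲, with boundary value f(p) at every p ∈ ω ∖ K
          ∃ F : (Fin d → ℂ) × (Fin (n - d) → ℂ) → ℂ,
            DifferentiableOn ℂ F 𝒲 ∧
            ∀ p ∈ ω, p ∉ K → Tendsto F (nhdsWithin p 𝒲) (nhds (f p)) := by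
  have hd : 0 < d := hd1
  have hm : 0 < n - d := by omega
  obtain ⟨g, hg, R, hR, hgh⟩ := ContDiffOn.exists_contDiff_eq_near (k := 2) hVopen
    (hsmooth.of_le (by norm_num)) hV0
  replace hg : ContDiff ℝ 2 g := hg
  have hev : ∀ {p}, p ∈ ball (0 : (Fin d → ℝ) × (Fin (n - d) → ℂ)) R →
      h =ᶠ[nhds p] g := fun hp => by
    filter_upwards [isOpen_ball.mem_nhds hp] with q hq using (hgh q hq).symm
  have hev0 := hev (mem_ball_self hR)
  have hg0 : g 0 = 0 := by rw [← hh0]; exact hev0.eq_of_nhds.symm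
  have hDg0 : fderiv ℝ g 0 = 0 := by rw [← hDh0]; exact hev0.fderiv_eq.symm
  rw [hev0.fderiv.fderiv_eq] at hLevi
  obtain ⟨C₀, g₁, A, δ, s₀, C, H₀⟩ := exists_curvedDiscs hd hg hDg0 hLevi
  have hΓg : ∀ {p}, h p = g p → Γ p = graphMap g p := fun {p} hp => by
    rw [hΓ, hp]; rfl
  have hGc := continuous_graphMap (m := n - d) hg.continuous
  have hG0 : graphMap g 0 = (0 : (Fin d → ℂ) × (Fin (n - d) → ℂ)) :=
    Prod.ext (funext fun l => by simp [graphMap, hg0]) rfl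
  have h1 : ∀ᶠ p in nhds (0 : (Fin d → ℝ) × (Fin (n - d) → ℂ)), graphMap g p ∈ U :=
    hGc.continuousAt.eventually (hUopen.mem_nhds (by rwa [hG0]))
  have h2 : ∀ᶠ p in nhds (0 : (Fin d → ℝ) × (Fin (n - d) → ℂ)),
      ‖fderiv ℝ g p‖ < 1 / (2 * (d + (n - d : ℕ))) :=
    Tendsto.eventually_lt_const (f := fun p => ‖fderiv ℝ g p‖) (v := ‖fderiv ℝ g 0‖)
      (by rw [hDg0, norm_zero]; positivity)
      (hg.continuous_fderiv (by norm_num)).norm.continuousAt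
  obtain ⟨r, hr, hball⟩ := Metric.eventually_nhds_iff_ball.1
    (((hVopen.eventually_mem hV0).and h1).and h2)
  set s := min s₀ (min R r) with hs
  have hs0 : 0 < s := lt_min H₀.size_pos (lt_min hR hr)
  have H := H₀.mono hs0 (min_le_left _ _)
  have hsR : ball (0 : (Fin d → ℝ) × (Fin (n - d) → ℂ)) s ⊆ ball 0 R :=
    ball_subset_ball ((min_le_right _ _).trans (min_le_left _ _))
  have hsr : ball (0 : (Fin d → ℝ) × (Fin (n - d) → ℂ)) s ⊆ ball 0 r :=
    ball_subset_ball ((min_le_right _ _).trans (min_le_right _ _))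
  have hΓs : ∀ p ∈ ball 0 s, Γ p = graphMap g p := fun p hp => hΓg (hgh p (hsR hp)).symm
  have hMs : ∀ z, ‖baseL d (n - d) z‖ < s → (z ∈ M ↔ height g z = 0) := by
    intro z hz
    rw [← mem_ball_zero_iff] at hz
    have e : (∀ l, (z.1 l).im = h ((fun l' => (z.1 l').re), z.2) l) ↔ height g z = 0 := by
      change (∀ l, (z.1 l).im = h (baseL d (n - d) z) l) ↔ _
      rw [← hgh _ (hsR hz), funext_iff]
      exact forall_congr' fun l => sub_eq_zero.symm
    rw [hMdef, mem_ofPred_eq, e]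
    refine ⟨And.right, fun h0 => ⟨?_, h0⟩⟩
    rw [(eq_graphMap_iff z).2 h0]
    exact (hball _ (hsr hz)).1.2
  have hGM : ∀ p ∈ ball 0 s, graphMap g p ∈ M := fun p hp =>
    (hMs _ (by rw [baseL_graphMap]; exact mem_ball_zero_iff.1 hp)).2 (height_graphMap p)
  obtain ⟨t, ht0, hts, htC⟩ : ∃ t > 0, t ≤ s ∧ t + C * √t < s / 2 := by
    have h3 : ∀ᶠ t : ℝ in nhds 0, t + C * √t < s / 2 :=
      Tendsto.eventually_lt_const (f := fun t : ℝ => t + C * √t) (v := 0 + C * √0)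
        (by simpa using hs0) (Continuous.tendsto (by fun_prop) 0)
    obtain ⟨e, he, h3⟩ := Metric.eventually_nhds_iff_ball.1 h3
    refine ⟨min s (e / 2), by positivity, min_le_left _ _, h3 _ ?_⟩
    rw [mem_ball_zero_iff, norm_of_nonneg (by positivity)]
    exact (min_le_right _ _).trans_lt (half_lt_self he)
  have hωopen : IsOpen {z | ‖baseL d (n - d) z‖ < s / 2} :=
    isOpen_lt (baseL d (n - d)).continuous.norm continuous_const
  have hwedge : {zw | ∃ p ∈ M ∩ {z | ‖baseL d (n - d) z‖ < s / 2}, ∃ c ∈ C₀ ∩ ball 0 t,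
      zw = p + (fun l => I * (c l : ℂ), 0)} = wedgeRegion g C₀ (s / 2) t := by
    rw [wedgeRegion_eq]
    ext z
    constructor
    · rintro ⟨p, ⟨hpM, hp⟩, c, hc, rfl⟩
      refine ⟨(baseL d (n - d) p, c), ⟨mem_ball_zero_iff.2 hp, hc⟩, ?_⟩
      dsimp only
      rw [← (eq_graphMap_iff p).2 ((hMs p (lt_trans hp (half_lt_self hs0))).1 hpM)]
    · rintro ⟨⟨p, c⟩, ⟨hp, hc⟩, rfl⟩
      refine ⟨graphMap g p, ⟨hGM p (ball_subset_ball (half_le_self hs0.le) hp), ?_⟩, c, hc, rfl⟩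
      rw [mem_ofPred_eq, baseL_graphMap]
      exact mem_ball_zero_iff.1 hp
  refine ⟨M ∩ {z | ‖baseL d (n - d) z‖ < s / 2}, C₀, t, _, ⟨?_, ?_⟩, inter_subset_left,
    ⟨_, hωopen, rfl⟩, ⟨g₁, H.cone_mem⟩, H.cone_open, H.cone_smul, ht0, rfl, ?_⟩
  · rw [← hG0]; exact hGM 0 (mem_ball_self hs0)
  · simpa using half_pos hs0
  intro K hKM hKcl hK f hf hfCR
  set O : Set ((Fin d → ℝ) × (Fin (n - d) → ℂ)) := ball 0 s ∩ {p | graphMap g p ∉ K} with hOdef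
  have hOopen : IsOpen O := by
    have : O = ball 0 s ∩ graphMap g ⁻¹' (closure K)ᶜ := by
      ext p
      refine and_congr_right fun hp => not_congr ⟨fun hk => subset_closure hk, fun hk =>
        hKcl _ (hGM p hp) hk⟩
    rw [this]
    exact isOpen_ball.inter (isClosed_closure.isOpen_compl.preimage hGc)
  have hOV : O ⊆ {xw | xw ∈ V ∧ Γ xw ∈ M \ K} := fun p hp =>
    ⟨(hball p (hsr hp.1)).1.1, by rw [hΓs p hp.1]; exact ⟨hGM p hp.1, hp.2⟩⟩
  have hΓeq : ∀ p ∈ O, Γ =ᶠ[nhds p] graphMap g := fun p hp => by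
    filter_upwards [isOpen_ball.mem_nhds hp.1] with q hq using hΓs q hq
  have hn : d + 2 * (n - d) - 2 = 2 * n - d - 2 := by omega
  rw [hwedge]
  obtain ⟨F, hF, hlim⟩ := H.exists_extension (O := O) (φ := fun p => f (Γ p)) hd hm hg
    (half_pos hs0) (half_le_self hs0.le) ht0 hts (by linarith) hOopen inter_subset_left
    (fun p hp => (hball p (hsr hp.1)).2.le) ⟨hf.mono hOV, fun p hp u u' hu =>
      hfCR p (hOV hp) u u' (by rwa [(hΓeq p hp).fderiv_eq])⟩ (by
      rw [hn]
      refine measure_mono_null ?_ hK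
      rintro _ ⟨p, hp, rfl⟩
      by_contra hk
      exact hp.2 ⟨hp.1, hk⟩)
  refine ⟨F, hF, fun z hz hzK => ?_⟩
  have hzs : ‖baseL d (n - d) z‖ < s := lt_trans hz.2 (half_lt_self hs0)
  have hzG := (eq_graphMap_iff z).2 ((hMs z hzs).1 hz.1)
  have := hlim (baseL d (n - d) z) ⟨mem_ball_zero_iff.2 hzs, by rwa [mem_ofPred_eq, ← hzG]⟩ hz.2
  rwa [hΓs _ (mem_ball_zero_iff.2 hzs), ← hzG] at this
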